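/- For every p ∈ [1,2] there exists a constant C > 0, depending only on p, with the following property. Let ν be a Lévy measure supported in [−ε, ε] for some ε ∈ (0,1] with σ̄²(ε) := ∫_{|x|≤ε} x² ν(dx) ∈ (0, ∞), let t > 0, and let μ_t be the probability measure on ℝ whose characteristic function is u ↦ exp(t ∫ (e^{iux} − 1 − iux) ν(dx)) (the marginal at time t of the small-jump Lévy process with triplet (0,0,ν)). Then W_p(μ_t, N(0, t·σ̄²(ε))) ≤ C · min(√t · σ̄(ε), (∫_{|x|≤ε} |x|^{p+2} ν(dx) / σ̄²(ε))^{1/p}) ≤ C · min(√t · σ̄(ε), ε). For p = 1 this holds with the explicit bound min(2√t · σ̄(ε), ε/2). -/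

import Mathlib

open MeasureTheory ProbabilityTheory
open scoped ENNReal NNReal

/-- Wasserstein "distance" of order `p` with respect to a cost function `c`,
with values in `ℝ≥0∞`: the infimum over all couplings `π` of `μ` and `ν` of
`(∫ c(x,y)^p dπ)^(1/p)`. -/
noncomputable def wassersteinCost {E : Type*} [MeasurableSpace E]
    (c : E → E → ℝ) (p : ℝ) (μ ν : Measure E) : ℝ≥0∞ :=
  ⨅ π ∈ {π : Measure (E × E) |
      IsProbabilityMeasure π ∧ π.map Prod.fst = μ ∧ π.map Prod.snd = ν},
    (∫⁻ z, ENNReal.ofReal (c z.1 z.2) ^ p ∂π) ^ (1 / p)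

/-- Wasserstein distance of order `p` between measures on `ℝ` (usual metric). -/
noncomputable def wasserstein (p : ℝ) (μ ν : Measure ℝ) : ℝ≥0∞ :=
  wassersteinCost (fun x y => |x - y|) p μ ν

/-- Characteristic function of a measure on `ℝ`. -/
noncomputable def charFn (μ : Measure ℝ) (u : ℝ) : ℂ :=
  ∫ x, Complex.exp ((u * x : ℝ) * Complex.I) ∂μ

/-- Toscani–Fourier distance of order `s`, with values in `ℝ≥0∞`. -/
noncomputable def toscani (s : ℝ) (μ ν : Measure ℝ) : ℝ≥0∞ :=
  ⨆ u : {u : ℝ // u ≠ 0}, ENNReal.ofReal (‖charFn μ u.1 - charFn ν u.1‖ / |u.1| ^ s)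

/-- Total variation distance between two measures. -/
noncomputable def tvDist {α : Type*} [MeasurableSpace α] (μ ν : Measure α) : ℝ :=
  ⨆ A : {A : Set α // MeasurableSet A}, |(μ A.1).toReal - (ν A.1).toReal|

/-- Convolution of two measures on `ℝ`. -/
noncomputable def mconv (μ ν : Measure ℝ) : Measure ℝ :=
  (μ.prod ν).map (fun z => z.1 + z.2)

/-- The Poisson distribution with mean `lam`, as a measure on `ℕ`. -/
noncomputable def poissonNat (lam : ℝ) : Measure ℕ :=
  Measure.sum fun k : ℕ =>
    ENNReal.ofReal (Real.exp (-lam) * lam ^ k / (Nat.factorial k)) • Measure.dirac k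

/-- The Poisson distribution with mean `lam`, as a measure on `ℝ`. -/
noncomputable def poissonReal (lam : ℝ) : Measure ℝ :=
  Measure.sum fun k : ℕ =>
    ENNReal.ofReal (Real.exp (-lam) * lam ^ k / (Nat.factorial k)) • Measure.dirac (k : ℝ)

/-- `f'` is a weak derivative of `f` on `ℝ`. -/
def IsWeakDeriv (f f' : ℝ → ℝ) : Prop :=
  ∀ φ : ℝ → ℝ, ContDiff ℝ (⊤ : ℕ∞) φ → HasCompactSupport φ →
    ∫ x, f x * deriv φ x = -∫ x, f' x * φ x

/-- The integrand of the Lévy–Khintchine exponent with truncation `1`. -/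
noncomputable def lkIntegrand (u x : ℝ) : ℂ :=
  Complex.exp ((u * x : ℝ) * Complex.I) - 1 -
    (if |x| ≤ 1 then ((u * x : ℝ) : ℂ) * Complex.I else 0)

/-- The integrand of the Lévy–Khintchine exponent fully compensated (for small jumps). -/
noncomputable def lkIntegrandC (u x : ℝ) : ℂ :=
  Complex.exp ((u * x : ℝ) * Complex.I) - 1 - ((u * x : ℝ) : ℂ) * Complex.I

namespace SJ

/-- uniform law on the unit interval -/
noncomputable def unif : Measure ℝ := volume.restrict (Set.Ioo 0 1)

instance : IsProbabilityMeasure unif := ⟨by simp [unif]⟩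

/-- quantile function -/
noncomputable def qf (μ : Measure ℝ) (u : ℝ) : ℝ := sInf {x | u ≤ cdf μ x}

lemma qf_bdd (μ : Measure ℝ) [IsProbabilityMeasure μ] {u : ℝ} (hu : u ∈ Set.Ioo (0:ℝ) 1) :
    BddBelow {x | u ≤ cdf μ x} ∧ {x | u ≤ cdf μ x}.Nonempty := by
  constructor
  · have h := (tendsto_cdf_atBot μ).eventually (gt_mem_nhds hu.1)
    obtain ⟨a, ha⟩ := h.exists
    refine ⟨a, fun x hx => ?_⟩
    by_contra hlt
    push Not at hlt
    have := monotone_cdf μ hlt.le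
    simp only [Set.mem_ofPred_eq] at hx
    linarith
  · have h := (tendsto_cdf_atTop μ).eventually (lt_mem_nhds hu.2)
    obtain ⟨a, ha⟩ := h.exists
    exact ⟨a, ha.le⟩

lemma qf_le_iff (μ : Measure ℝ) [IsProbabilityMeasure μ] {u : ℝ} (hu : u ∈ Set.Ioo (0:ℝ) 1) (x : ℝ) :
    qf μ u ≤ x ↔ u ≤ cdf μ x := by
  obtain ⟨hb, hn⟩ := qf_bdd μ hu
  constructor
  · intro h
    have h1 : ∀ y, x < y → u ≤ cdf μ y := by
      intro y hy
      have : sInf {x | u ≤ cdf μ x} < y := lt_of_le_of_lt h hy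
      obtain ⟨z, hz, hzy⟩ := exists_lt_of_csInf_lt hn this
      exact le_trans hz (monotone_cdf μ hzy.le)
    have hc : ContinuousWithinAt (cdf μ) (Set.Ici x) x := (cdf μ).right_continuous x
    have hc' : Filter.Tendsto (cdf μ) (nhdsWithin x (Set.Ioi x)) (nhds (cdf μ x)) :=
      hc.mono_left (nhdsWithin_mono _ Set.Ioi_subset_Ici_self)
    refine ge_of_tendsto hc' ?_
    filter_upwards [self_mem_nhdsWithin] with y hy using h1 y hy
  · intro h
    exact csInf_le hb h

lemma qf_mono (μ : Measure ℝ) [IsProbabilityMeasure μ] : MonotoneOn (qf μ) (Set.Ioo 0 1) := by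
  intro u hu w hw huw
  rw [qf_le_iff μ hu]
  exact huw.trans ((qf_le_iff μ hw _).1 le_rfl)

lemma qf_aemeasurable (μ : Measure ℝ) [IsProbabilityMeasure μ] : AEMeasurable (qf μ) unif :=
  aemeasurable_restrict_of_monotoneOn measurableSet_Ioo (qf_mono μ)

lemma map_qf (μ : Measure ℝ) [IsProbabilityMeasure μ] : unif.map (qf μ) = μ := by
  have : IsProbabilityMeasure (unif.map (qf μ)) :=
    Measure.isProbabilityMeasure_map (qf_aemeasurable μ)
  apply Measure.ext_of_Iic
  intro x
  rw [Measure.map_apply_of_aemeasurable (qf_aemeasurable μ) measurableSet_Iic]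
  have hF0 := cdf_nonneg μ x
  have hF1 := cdf_le_one μ x
  have h1 : unif (qf μ ⁻¹' Set.Iic x) = unif (Set.Iic (cdf μ x)) := by
    apply measure_congr
    have : ∀ᵐ u ∂unif, u ∈ Set.Ioo (0:ℝ) 1 := ae_restrict_mem measurableSet_Ioo
    filter_upwards [this] with u hu
    exact propext (qf_le_iff μ hu x)
  rw [h1, unif, Measure.restrict_apply measurableSet_Iic, ← ofReal_cdf μ x]
  apply le_antisymm
  · calc volume (Set.Iic (cdf μ x) ∩ Set.Ioo 0 1) ≤ volume (Set.Ioc 0 (cdf μ x)) := by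
          apply measure_mono
          rintro u ⟨h, h'⟩
          exact ⟨h'.1, h⟩
      _ = _ := by simp
  · calc ENNReal.ofReal (cdf μ x) = volume (Set.Ioo 0 (cdf μ x)) := by simp
      _ ≤ _ := by
          apply measure_mono
          rintro u ⟨h, h'⟩
          exact ⟨h'.le, h, lt_of_lt_of_le h' hF1⟩

lemma wasserstein_le {Ω : Type*} [MeasurableSpace Ω] (P : Measure Ω) [IsProbabilityMeasure P]
    (X Y : Ω → ℝ) (hX : AEMeasurable X P) (hY : AEMeasurable Y P) (p : ℝ) :
    wasserstein p (P.map X) (P.map Y) ≤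
      (∫⁻ ω, ENNReal.ofReal |X ω - Y ω| ^ p ∂P) ^ (1 / p) := by
  unfold wasserstein wassersteinCost
  have hm : AEMeasurable (fun ω => (X ω, Y ω)) P := hX.prodMk hY
  refine (iInf₂_le (P.map (fun ω => (X ω, Y ω))) ?_).trans ?_
  · refine ⟨Measure.isProbabilityMeasure_map hm, ?_, ?_⟩
    · rw [AEMeasurable.map_map_of_aemeasurable measurable_fst.aemeasurable hm]; rfl
    · rw [AEMeasurable.map_map_of_aemeasurable measurable_snd.aemeasurable hm]; rfl
  · rw [lintegral_map' (by fun_prop) hm]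

/-- mixture of real version -/
lemma wasserstein_le_real {Ω : Type*} [MeasurableSpace Ω] (P : Measure Ω) [IsProbabilityMeasure P]
    (X Y : Ω → ℝ) (hX : AEMeasurable X P) (hY : AEMeasurable Y P) (p K : ℝ) (hp : 1 ≤ p) (hK : 0 ≤ K)
    (hintg : Integrable (fun ω => |X ω - Y ω| ^ p) P) (h : ∫ ω, |X ω - Y ω| ^ p ∂P ≤ K ^ p) :
    wasserstein p (P.map X) (P.map Y) ≤ ENNReal.ofReal K := by
  refine (wasserstein_le P X Y hX hY p).trans ?_
  have h0 : ∀ ω, ENNReal.ofReal |X ω - Y ω| ^ p = ENNReal.ofReal (|X ω - Y ω| ^ p) := fun ω =>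
    ENNReal.ofReal_rpow_of_nonneg (abs_nonneg _) (by linarith)
  simp_rw [h0]
  rw [← ofReal_integral_eq_lintegral_ofReal hintg (Filter.Eventually.of_forall fun ω => by positivity)]
  calc (ENNReal.ofReal (∫ ω, |X ω - Y ω| ^ p ∂P)) ^ (1 / p) ≤ (ENNReal.ofReal (K ^ p)) ^ (1 / p) := by
        gcongr
    _ = ENNReal.ofReal K := by
        rw [← ENNReal.ofReal_rpow_of_nonneg hK (by linarith), ← ENNReal.rpow_mul,
          mul_one_div_cancel (by linarith), ENNReal.rpow_one]

end SJ

namespace SJ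

/-- gap function of two monotone functions -/
noncomputable def cc (a b : ℝ → ℝ) (z : ℝ) : ℝ :=
  ⨆ u : Set.Ioo (0:ℝ) 1, max 0 (min (z - a u) (b u - z))

section gap
variable {a b : ℝ → ℝ}

lemma half_mem : (1/2 : ℝ) ∈ Set.Ioo (0:ℝ) 1 := by constructor <;> norm_num

lemma cc_term_le (ha : MonotoneOn a (Set.Ioo 0 1)) (hb : MonotoneOn b (Set.Ioo 0 1)) (z : ℝ) (u : Set.Ioo (0:ℝ) 1) :
    max 0 (min (z - a u) (b u - z)) ≤ |z| + (|a (1/2)| + |b (1/2)|) := by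
  have h1 := abs_nonneg (a (1/2))
  have h2 := abs_nonneg (b (1/2))
  have h3 := neg_abs_le (a (1/2))
  have h4 := le_abs_self (b (1/2))
  have h5 := le_abs_self z
  have h6 := neg_abs_le z
  apply max_le
  · positivity
  rcases le_total (u:ℝ) (1/2) with h | h
  · have := hb u.2 half_mem h
    exact (min_le_right _ _).trans (by linarith)
  · have := ha half_mem u.2 h
    exact (min_le_left _ _).trans (by linarith)

lemma cc_bdd (ha : MonotoneOn a (Set.Ioo 0 1)) (hb : MonotoneOn b (Set.Ioo 0 1)) (z : ℝ) : BddAbove (Set.range fun u : Set.Ioo (0:ℝ) 1 =>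
    max 0 (min (z - a u) (b u - z))) := by
  refine ⟨|z| + (|a (1/2)| + |b (1/2)|), ?_⟩
  rintro _ ⟨u, rfl⟩
  exact cc_term_le ha hb z u

lemma cc_nonneg (a b : ℝ → ℝ) (z : ℝ) : 0 ≤ cc a b z :=
  Real.iSup_nonneg fun _ => le_max_left _ _

instance : Nonempty (Set.Ioo (0:ℝ) 1) := ⟨⟨1/2, half_mem⟩⟩

lemma cc_growth (ha : MonotoneOn a (Set.Ioo 0 1)) (hb : MonotoneOn b (Set.Ioo 0 1)) (z : ℝ) : cc a b z ≤ |z| + (|a (1/2)| + |b (1/2)|) :=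
  ciSup_le fun u => cc_term_le ha hb z u

lemma cc_ge (ha : MonotoneOn a (Set.Ioo 0 1)) (hb : MonotoneOn b (Set.Ioo 0 1)) (z : ℝ) {u : ℝ} (hu : u ∈ Set.Ioo (0:ℝ) 1) : min (z - a u) (b u - z) ≤ cc a b z :=
  (le_max_right 0 _).trans (le_ciSup (cc_bdd ha hb z) ⟨u, hu⟩)

lemma cc_lip (ha : MonotoneOn a (Set.Ioo 0 1)) (hb : MonotoneOn b (Set.Ioo 0 1)) (z w : ℝ) : cc a b z ≤ cc a b w + |z - w| := by
  apply ciSup_le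
  intro u
  have h1 := le_ciSup (cc_bdd ha hb w) u
  have h1' : max 0 (min (w - a u) (b u - w)) ≤ cc a b w := h1
  have h2 := le_abs_self (z - w)
  have h3 := neg_abs_le (z - w)
  apply max_le
  · have := cc_nonneg a b w
    positivity
  · have h5 : min (z - a u) (b u - z) ≤ min (w - a u) (b u - w) + |z - w| := by
      rw [← min_add_add_right]
      apply min_le_min <;> linarith
    linarith [le_max_right 0 (min (w - a u) (b u - w))]

lemma cc_abs (ha : MonotoneOn a (Set.Ioo 0 1)) (hb : MonotoneOn b (Set.Ioo 0 1)) (z w : ℝ) : |cc a b z - cc a b w| ≤ |z - w| := by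
  rw [abs_le]
  have h1 := cc_lip ha hb z w
  have h2 := cc_lip ha hb w z
  rw [abs_sub_comm] at h2
  constructor <;> linarith

lemma cc_continuous (ha : MonotoneOn a (Set.Ioo 0 1)) (hb : MonotoneOn b (Set.Ioo 0 1)) : Continuous (cc a b) := by
  refine LipschitzWith.continuous (K := 1) (LipschitzWith.of_dist_le_mul fun z w => ?_)
  simpa [Real.dist_eq] using cc_abs ha hb z w

lemma cc_disj (ha : MonotoneOn a (Set.Ioo 0 1)) (hb : MonotoneOn b (Set.Ioo 0 1)) (z : ℝ) {u : ℝ} (hu : u ∈ Set.Ioo (0:ℝ) 1) (h1 : a u < z) (h2 : z < b u) :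
    cc b a z = 0 := by
  apply le_antisymm _ (cc_nonneg _ _ _)
  apply ciSup_le
  intro w
  apply max_le le_rfl
  rcases le_total u w with h | h
  · have := hb hu w.2 h
    exact (min_le_left _ _).trans (by linarith)
  · have := ha w.2 hu h
    exact (min_le_right _ _).trans (by linarith)

/-- derivative of the test function -/
noncomputable def zt (Λ : ℝ → ℝ) (a b : ℝ → ℝ) (z : ℝ) : ℝ := Λ (cc b a z) - Λ (cc a b z)

lemma zt_continuous (ha : MonotoneOn a (Set.Ioo 0 1)) (hb : MonotoneOn b (Set.Ioo 0 1)) {Λ : ℝ → ℝ} (hc : Continuous Λ) : Continuous (zt Λ a b) :=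
  (hc.comp (cc_continuous hb ha)).sub (hc.comp (cc_continuous ha hb))

lemma rio_aux (ha : MonotoneOn a (Set.Ioo 0 1)) (hb : MonotoneOn b (Set.Ioo 0 1)) {Λ : ℝ → ℝ} (hc : Continuous Λ) (hm : MonotoneOn Λ (Set.Ici 0)) (h0 : Λ 0 = 0) {u : ℝ}
    (hu : u ∈ Set.Ioo (0:ℝ) 1) (hab : a u ≤ b u) {s : ℝ} (hs : 0 ≤ s) :
    (|a u - b u| - 2 * s) * Λ s ≤ (∫ z in (0:ℝ)..a u, zt Λ a b z) - ∫ z in (0:ℝ)..b u, zt Λ a b z := by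
  have hci := zt_continuous ha hb hc
  have hii : ∀ x y, IntervalIntegrable (zt Λ a b) volume x y := fun x y => hci.intervalIntegrable x y
  have hLs : 0 ≤ Λ s := h0 ▸ hm (Set.mem_Ici.2 le_rfl) hs hs
  rw [intervalIntegral.integral_interval_sub_left (hii _ _) (hii _ _)]
  rw [intervalIntegral.integral_symm, ← intervalIntegral.integral_neg]
  have hpos : ∀ z ∈ Set.Ioo (a u) (b u), 0 ≤ - zt Λ a b z := by
    intro z hz
    rw [zt, cc_disj ha hb z hu hz.1 hz.2, h0]
    have : Λ 0 ≤ Λ (cc a b z) := hm (Set.mem_Ici.2 le_rfl) (cc_nonneg a b z) (cc_nonneg a b z)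
    rw [h0] at this
    linarith
  have hpos' : 0 ≤ ∫ z in (a u)..(b u), - zt Λ a b z := by
    apply intervalIntegral.integral_nonneg_of_ae_restrict hab
    rw [Filter.EventuallyLE, ← Measure.restrict_congr_set Ioo_ae_eq_Icc,
      ae_restrict_iff' measurableSet_Ioo]
    exact Filter.Eventually.of_forall hpos
  rw [abs_sub_comm, abs_of_nonneg (by linarith)]
  rcases le_or_gt (b u - a u) (2 * s) with h | h
  · exact (mul_nonpos_of_nonpos_of_nonneg (by linarith) hLs).trans hpos'
  · have h1 : ∫ z in (a u + s)..(b u - s), - zt Λ a b z ≤ ∫ z in (a u)..(b u), - zt Λ a b z := by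
      apply intervalIntegral.integral_mono_interval (by linarith) (by linarith) (by linarith)
      · rw [Filter.EventuallyLE, ← Measure.restrict_congr_set Ioo_ae_eq_Ioc,
          ae_restrict_iff' measurableSet_Ioo]
        exact Filter.Eventually.of_forall hpos
      · exact (hii _ _).neg
    refine le_trans ?_ h1
    have h2 : ∫ z in (a u + s)..(b u - s), Λ s = (b u - a u - 2 * s) * Λ s := by
      rw [intervalIntegral.integral_const, smul_eq_mul]; ring
    rw [← h2]
    apply intervalIntegral.integral_mono_on_of_le_Ioo (by linarith) (by simp) (hii _ _).neg
    intro z hz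
    have hz1 : a u < z := by linarith [hz.1]
    have hz2 : z < b u := by linarith [hz.2]
    change Λ s ≤ - zt Λ a b z
    rw [zt, cc_disj ha hb z hu hz1 hz2, h0]
    have h3 : s ≤ cc a b z := by
      refine le_trans (le_min ?_ ?_) (cc_ge ha hb z hu) <;> linarith [hz.1, hz.2]
    have := hm (Set.mem_Ici.2 hs) (cc_nonneg a b z) h3
    linarith

lemma zt_swap (Λ : ℝ → ℝ) (a b : ℝ → ℝ) (z : ℝ) : zt Λ b a z = - zt Λ a b z := by
  simp [zt]

lemma rio (ha : MonotoneOn a (Set.Ioo 0 1)) (hb : MonotoneOn b (Set.Ioo 0 1)) {Λ : ℝ → ℝ} (hc : Continuous Λ) (hm : MonotoneOn Λ (Set.Ici 0)) (h0 : Λ 0 = 0) {u : ℝ}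
    (hu : u ∈ Set.Ioo (0:ℝ) 1) {s : ℝ} (hs : 0 ≤ s) :
    (|a u - b u| - 2 * s) * Λ s ≤ (∫ z in (0:ℝ)..a u, zt Λ a b z) - ∫ z in (0:ℝ)..b u, zt Λ a b z := by
  rcases le_total (a u) (b u) with h | h
  · exact rio_aux ha hb hc hm h0 hu h hs
  · have := rio_aux hb ha hc hm h0 hu h hs
    simp_rw [zt_swap Λ a b, intervalIntegral.integral_neg] at this
    rw [abs_sub_comm]
    linarith

lemma rpow_holder {α : ℝ} (h0 : 0 < α) (h1 : α ≤ 1) {s t : ℝ} (hs : 0 ≤ s) (ht : 0 ≤ t) :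
    |s ^ α - t ^ α| ≤ |s - t| ^ α := by
  wlog h : t ≤ s generalizing s t
  · rw [abs_sub_comm, abs_sub_comm s t]
    exact this ht hs (le_of_not_ge h)
  have h2 : t ^ α ≤ s ^ α := Real.rpow_le_rpow ht h h0.le
  rw [abs_of_nonneg (by linarith), abs_of_nonneg (by linarith)]
  have := Real.rpow_add_le_add_rpow (sub_nonneg.2 h) ht h0.le h1
  rw [sub_add_cancel] at this
  linarith

lemma zt_holder (ha : MonotoneOn a (Set.Ioo 0 1)) (hb : MonotoneOn b (Set.Ioo 0 1)) {α : ℝ} (h0 : 0 < α) (h1 : α ≤ 1) (z w : ℝ) :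
    |zt (fun s => s ^ α) a b z - zt (fun s => s ^ α) a b w| ≤ 2 * |z - w| ^ α := by
  have e1 : |cc a b z ^ α - cc a b w ^ α| ≤ |z - w| ^ α :=
    (rpow_holder h0 h1 (cc_nonneg a b z) (cc_nonneg a b w)).trans
      (Real.rpow_le_rpow (abs_nonneg _) (cc_abs ha hb z w) h0.le)
  have e2 : |cc b a z ^ α - cc b a w ^ α| ≤ |z - w| ^ α :=
    (rpow_holder h0 h1 (cc_nonneg b a z) (cc_nonneg b a w)).trans
      (Real.rpow_le_rpow (abs_nonneg _) (cc_abs hb ha z w) h0.le)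
  unfold zt
  rw [abs_le] at *
  constructor <;> linarith [e1.1, e1.2, e2.1, e2.2]

lemma rio_p (ha : MonotoneOn a (Set.Ioo 0 1)) (hb : MonotoneOn b (Set.Ioo 0 1)) {p : ℝ} (h1 : 1 < p) (h2 : p ≤ 2) {u : ℝ} (hu : u ∈ Set.Ioo (0:ℝ) 1) :
    |a u - b u| ^ p ≤ 8 * ((∫ z in (0:ℝ)..a u, zt (fun s => s ^ (p-1)) a b z)
      - ∫ z in (0:ℝ)..b u, zt (fun s => s ^ (p-1)) a b z) := by
  have := rio ha hb (Λ := fun s => s ^ (p-1)) (Real.continuous_rpow_const (by linarith))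
    (fun x hx y hy hxy => Real.rpow_le_rpow hx hxy (by linarith))
    (Real.zero_rpow (by linarith)) hu (s := |a u - b u| / 4) (by positivity)
  have h3 : |a u - b u| ^ p ≤ 8 * ((|a u - b u| - 2 * (|a u - b u| / 4)) * (|a u - b u| / 4) ^ (p-1)) := by
    rw [Real.div_rpow (abs_nonneg _) (by norm_num)]
    have e : |a u - b u| ^ p = |a u - b u| * |a u - b u| ^ (p - 1) := by
      rcases eq_or_lt_of_le (abs_nonneg (a u - b u)) with h | h
      · rw [← h, Real.zero_rpow (by linarith), zero_mul]
      · nth_rw 2 [← Real.rpow_one |a u - b u|]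
        rw [← Real.rpow_add h]; congr 1; ring
    have h4 : (4:ℝ) ^ (p-1) ≤ 4 := by
      calc (4:ℝ) ^ (p-1) ≤ 4 ^ (1:ℝ) := Real.rpow_le_rpow_of_exponent_le (by norm_num) (by linarith)
        _ = 4 := by norm_num
    have h5 : (0:ℝ) < (4:ℝ) ^ (p-1) := by positivity
    rw [e]
    have h6 : |a u - b u| * |a u - b u| ^ (p - 1) * ((4:ℝ) ^ (p-1) / 4) ≤ |a u - b u| * |a u - b u| ^ (p - 1) * 1 := by
      apply mul_le_mul_of_nonneg_left
      · linarith
      · positivity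
    have h7 : |a u - b u| * |a u - b u| ^ (p - 1) ≤ |a u - b u| * |a u - b u| ^ (p - 1) * (4 / (4:ℝ) ^ (p-1)) := by
      apply le_mul_of_one_le_right
      · positivity
      · rw [le_div_iff₀ h5]; linarith
    refine h7.trans (le_of_eq ?_)
    field_simp
    ring
  linarith

lemma rio_one (ha : MonotoneOn a (Set.Ioo 0 1)) (hb : MonotoneOn b (Set.Ioo 0 1)) {η : ℝ} (hη : 0 < η) {u : ℝ} (hu : u ∈ Set.Ioo (0:ℝ) 1) :
    |a u - b u| - 2 * η ≤ ((∫ z in (0:ℝ)..a u, zt (fun s => min (s / η) 1) a b z)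
      - ∫ z in (0:ℝ)..b u, zt (fun s => min (s / η) 1) a b z) := by
  have := rio ha hb (Λ := fun s => min (s / η) 1) (by fun_prop)
    (fun x hx y hy hxy => min_le_min (by gcongr) le_rfl) (by simp) hu hη.le
  simpa [hη.ne'] using this

lemma zt_one_bdd {η : ℝ} (hη : 0 < η) (z : ℝ) : |zt (fun s => min (s / η) 1) a b z| ≤ 1 := by
  unfold zt
  have h1 := cc_nonneg a b z
  have h2 := cc_nonneg b a z
  have h3 : 0 ≤ min (cc a b z / η) 1 := le_min (by positivity) (by norm_num)
  have h4 : 0 ≤ min (cc b a z / η) 1 := le_min (by positivity) (by norm_num)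
  have h5 := min_le_right (cc a b z / η) 1
  have h6 := min_le_right (cc b a z / η) 1
  rw [abs_le]; constructor <;> linarith

end gap
end SJ

namespace SJ

/-- second order remainder of the complex exponential -/
noncomputable def e2 (x : ℝ) : ℂ := Complex.exp (x * Complex.I) - 1 - x * Complex.I

lemma norm_ee (x : ℝ) : ‖Complex.exp (x * Complex.I)‖ = 1 := Complex.norm_exp_ofReal_mul_I x

lemma norm_e1 (x : ℝ) : ‖Complex.exp (x * Complex.I) - 1‖ ≤ |x| := by
  have := @Real.norm_exp_I_mul_ofReal_sub_one_le x
  rwa [mul_comm] at this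

lemma hasDerivAt_ee (u y : ℝ) : HasDerivAt (fun u : ℝ => Complex.exp ((u * y : ℝ) * Complex.I))
    (y * Complex.I * Complex.exp ((u * y : ℝ) * Complex.I)) u := by
  have h1 : HasDerivAt (fun u : ℝ => ((u * y : ℝ) : ℂ) * Complex.I) (y * Complex.I) u := by
    have : HasDerivAt (fun u : ℝ => u * y) y u := by simpa using (hasDerivAt_id u).mul_const y
    exact this.ofReal_comp.mul_const _
  have := h1.cexp
  rwa [mul_comm] at this

lemma hasDerivAt_e2 (u y : ℝ) : HasDerivAt (fun u : ℝ => e2 (u * y))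
    (y * Complex.I * (Complex.exp ((u * y : ℝ) * Complex.I) - 1)) u := by
  have h1 : HasDerivAt (fun u : ℝ => ((u * y : ℝ) : ℂ) * Complex.I) (y * Complex.I) u := by
    have : HasDerivAt (fun u : ℝ => u * y) y u := by simpa using (hasDerivAt_id u).mul_const y
    exact this.ofReal_comp.mul_const _
  have := ((hasDerivAt_ee u y).sub_const 1).sub h1
  unfold e2
  convert! this using 1
  ring

lemma e2_continuous : Continuous e2 := by unfold e2; fun_prop

lemma norm_e2_le (x : ℝ) : ‖e2 x‖ ≤ x ^ 2 / 2 := by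
  have h := fun u => hasDerivAt_e2 u x
  have key : ∫ u in (0:ℝ)..1, (x * Complex.I * (Complex.exp ((u * x : ℝ) * Complex.I) - 1)) = e2 x := by
    rw [intervalIntegral.integral_eq_sub_of_hasDerivAt (fun u _ => h u)
      (Continuous.intervalIntegrable (by fun_prop) _ _)]
    simp [e2]
  rw [← key]
  have := intervalIntegral.norm_integral_le_of_norm_le (a := 0) (b := 1) (μ := volume)
    (f := fun u : ℝ => (x * Complex.I * (Complex.exp ((u * x : ℝ) * Complex.I) - 1)))
    (g := fun u => x ^ 2 * u) zero_le_one (Filter.Eventually.of_forall fun u hu => by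
      rw [norm_mul, norm_mul, Complex.norm_I, mul_one, Complex.norm_real, Real.norm_eq_abs]
      have h1 := norm_e1 (u * x)
      rw [abs_mul, abs_of_pos hu.1] at h1
      calc |x| * _ ≤ |x| * (u * |x|) := by gcongr
        _ = x ^ 2 * u := by rw [← sq_abs x]; ring)
    (Continuous.intervalIntegrable (by fun_prop) _ _)
  refine this.trans (le_of_eq ?_)
  rw [intervalIntegral.integral_const_mul, integral_id]
  ring

/-- `μ` is the law with characteristic exponent `v ∫ (e^{iuy}-1-iuy)/y² κ(dy)`. -/
structure IsSJ (κ μ : Measure ℝ) (v R : ℝ) : Prop where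
  pκ : IsProbabilityMeasure κ
  pμ : IsProbabilityMeasure μ
  hv : 0 < v
  supp : ∀ᵐ y ∂κ, |y| ≤ R
  nz : ∀ᵐ y ∂κ, y ≠ 0
  char : ∀ u : ℝ, charFun μ u = Complex.exp (v * ∫ y, e2 (u * y) / (y:ℂ) ^ 2 ∂κ)

/-- characteristic exponent without the factor `v` -/
noncomputable def psi (κ : Measure ℝ) (u : ℝ) : ℂ := ∫ y, e2 (u * y) / (y:ℂ) ^ 2 ∂κ

lemma norm_kk_le (u y : ℝ) : ‖e2 (u * y) / (y:ℂ) ^ 2‖ ≤ u ^ 2 / 2 := by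
  rcases eq_or_ne y 0 with rfl | hy
  · simp; positivity
  rw [norm_div, norm_pow, Complex.norm_real, Real.norm_eq_abs, sq_abs, div_le_iff₀ (by positivity)]
  calc _ ≤ _ := norm_e2_le _
    _ = _ := by ring

lemma kk_meas (u : ℝ) : Measurable (fun y : ℝ => e2 (u * y) / (y:ℂ) ^ 2) :=
  ((e2_continuous.comp (by fun_prop)).measurable).div (by fun_prop)

lemma kk_int (κ : Measure ℝ) [IsFiniteMeasure κ] (u : ℝ) : Integrable (fun y : ℝ => e2 (u * y) / (y:ℂ) ^ 2) κ :=
  Integrable.of_bound (kk_meas u).aestronglyMeasurable (u ^ 2 / 2)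
    (Filter.Eventually.of_forall fun y => norm_kk_le u y)

lemma norm_psi_le (κ : Measure ℝ) [IsProbabilityMeasure κ] (u : ℝ) : ‖psi κ u‖ ≤ u ^ 2 / 2 := by
  have := norm_integral_le_of_norm_le_const (μ := κ) (Filter.Eventually.of_forall fun y => norm_kk_le u y)
  simpa [psi] using this

lemma psi_hasDeriv (κ : Measure ℝ) [IsProbabilityMeasure κ] (u : ℝ) :
    HasDerivAt (psi κ) (∫ y : ℝ, Complex.I * (Complex.exp ((u * y : ℝ) * Complex.I) - 1) / y ∂κ) u := by
  have := (hasDerivAt_integral_of_dominated_loc_of_deriv_le (μ := κ)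
    (F := fun u y => e2 (u * y) / (y:ℂ) ^ 2)
    (F' := fun u y => Complex.I * (Complex.exp ((u * y : ℝ) * Complex.I) - 1) / y)
    (x₀ := u) (s := Metric.ball u 1) (bound := fun _ => |u| + 1) (Metric.ball_mem_nhds u one_pos)
    (Filter.Eventually.of_forall fun u => (kk_meas u).aestronglyMeasurable) (kk_int κ u) ?_ ?_ ?_ ?_).2
  · exact this
  · apply Measurable.aestronglyMeasurable
    fun_prop
  · refine Filter.Eventually.of_forall fun y w hw => ?_
    have hw' : |w| ≤ |u| + 1 := by
      rw [Metric.mem_ball, Real.dist_eq] at hw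
      have := abs_sub_abs_le_abs_sub w u
      linarith
    rcases eq_or_ne y 0 with rfl | hy
    · simp; positivity
    rw [norm_div, norm_mul, Complex.norm_I, one_mul, Complex.norm_real, Real.norm_eq_abs,
      div_le_iff₀ (by positivity)]
    calc _ ≤ |w * y| := norm_e1 _
      _ = |w| * |y| := abs_mul _ _
      _ ≤ _ := by gcongr
  · exact integrable_const _
  · refine Filter.Eventually.of_forall fun y w hw => ?_
    rcases eq_or_ne y 0 with rfl | hy
    · simp; exact hasDerivAt_const _ _
    convert! (hasDerivAt_e2 w y).div_const ((y:ℂ)^2) using 1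
    have : (y:ℂ) ≠ 0 := by exact_mod_cast hy
    field_simp

variable {κ μ : Measure ℝ} {v R : ℝ}

lemma IsSJ.char' (h : IsSJ κ μ v R) (u : ℝ) : charFun μ u = Complex.exp (v * psi κ u) := h.char u

lemma IsSJ.sq_lint (h : IsSJ κ μ v R) : ∫⁻ x, ENNReal.ofReal (x ^ 2) ∂μ ≤ ENNReal.ofReal v := by
  have := h.pκ
  have := h.pμ
  have := h.hv
  -- Fatou along u_n = 1/(n+1)
  let u : ℕ → ℝ := fun n => 1 / ((n:ℝ) + 1)
  have hu0 : Filter.Tendsto u Filter.atTop (nhds 0) := tendsto_one_div_add_atTop_nhds_zero_nat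
  have hup : ∀ n, 0 < u n := fun n => by positivity
  let f : ℕ → ℝ → ℝ := fun n x => 2 * (1 - Real.cos (u n * x)) / (u n) ^ 2
  have hfm : ∀ n, Measurable (fun x => ENNReal.ofReal (f n x)) := fun n => by
    apply Measurable.ennreal_ofReal
    fun_prop
  have hlim : ∀ x, Filter.Tendsto (fun n => ENNReal.ofReal (f n x)) Filter.atTop (nhds (ENNReal.ofReal (x ^ 2))) := by
    intro x
    apply ENNReal.tendsto_ofReal
    -- 2(1-cos(ux))/u² = (sin(ux/2)/(u/2))²
    have h1 : ∀ n, f n x = (x * Real.sinc (u n * x / 2)) ^ 2 := by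
      intro n
      have hn := (hup n).ne'
      rcases eq_or_ne x 0 with rfl | hx
      · simp [f]
      rw [Real.sinc_of_ne_zero (by positivity)]
      have : Real.cos (u n * x) = 1 - 2 * Real.sin (u n * x / 2) ^ 2 := by
        rw [← Real.cos_two_mul_eq_one_sub (u n * x / 2)]; congr 1; ring
      simp only [f]
      rw [this]
      field_simp
      ring
    simp_rw [h1]
    have h2 : Filter.Tendsto (fun n => (x * Real.sinc (u n * x / 2)) ^ 2) Filter.atTop
        (nhds ((x * Real.sinc (0 * x / 2)) ^ 2)) := by
      refine Filter.Tendsto.pow (Filter.Tendsto.const_mul _ ?_) 2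
      refine (Real.continuous_sinc.tendsto _).comp ?_
      exact (hu0.mul_const x).div_const 2
    simpa using h2
  have hval : ∀ n, ∫⁻ x, ENNReal.ofReal (f n x) ∂μ ≤ ENNReal.ofReal (2 * (Real.exp (v * (u n)^2 / 2) - 1) / (u n)^2) := by
    intro n
    have hintg : Integrable (f n) μ := by
      refine Integrable.of_bound (by fun_prop) (4 / (u n)^2) (Filter.Eventually.of_forall fun x => ?_)
      have h1 := Real.cos_le_one (u n * x)
      have h2 := Real.neg_one_le_cos (u n * x)
      have := hup n
      rw [Real.norm_eq_abs, abs_of_nonneg (by simp only [f]; apply div_nonneg <;> nlinarith)]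
      simp only [f]
      gcongr
      linarith
    rw [← ofReal_integral_eq_lintegral_ofReal hintg (Filter.Eventually.of_forall fun x => by
      have h1 := Real.cos_le_one (u n * x)
      simp only [f, Pi.zero_apply]; apply div_nonneg <;> nlinarith [hup n])]
    apply ENNReal.ofReal_le_ofReal
    have hcos : ∫ x, Real.cos (u n * x) ∂μ = (charFun μ (u n)).re := by
      rw [charFun_apply_real, ← RCLike.re_eq_complex_re, ← integral_re]
      · congr 1; ext x
        have : Complex.exp (u n * x * Complex.I) = Complex.exp ((u n * x : ℝ) * Complex.I) := by push_cast; rfl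
        rw [this, RCLike.re_eq_complex_re, Complex.exp_ofReal_mul_I_re]
      · refine Integrable.of_bound (by fun_prop) 1 (Filter.Eventually.of_forall fun x => ?_)
        have := norm_ee (u n * x)
        push_cast at this
        exact this.le
    have hci : Integrable (fun x => Real.cos (u n * x)) μ :=
      Integrable.of_bound (by fun_prop) 1 (Filter.Eventually.of_forall fun x => Real.abs_cos_le_one _)
    have e1 : ∫ x, f n x ∂μ = 2 * (1 - (charFun μ (u n)).re) / (u n)^2 := by
      simp only [f]
      rw [integral_div, integral_const_mul, integral_sub (integrable_const _) hci, hcos]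
      simp
    rw [e1]
    have h3 : 1 - (charFun μ (u n)).re ≤ Real.exp (v * (u n)^2/2) - 1 := by
      rw [h.char']
      have h4 : ‖Complex.exp (v * psi κ (u n)) - 1‖ ≤ Real.exp ‖v * psi κ (u n)‖ - 1 := by
        simpa using Complex.norm_exp_sub_sum_le_exp_norm_sub_sum (v * psi κ (u n)) 1
      have h5 := Complex.abs_re_le_norm (Complex.exp (v * psi κ (u n)) - 1)
      rw [Complex.sub_re, Complex.one_re] at h5
      have h6 : ‖v * psi κ (u n)‖ ≤ v * (u n)^2 / 2 := by
        rw [norm_mul, Complex.norm_real, Real.norm_eq_abs, abs_of_pos h.hv, mul_div_assoc]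
        gcongr
        exact norm_psi_le κ (u n)
      have h7 := Real.exp_le_exp.2 h6
      have h8 := (abs_le.1 h5).1
      linarith
    have := hup n
    gcongr
  have hlim2 : Filter.Tendsto (fun n => ENNReal.ofReal (2 * (Real.exp (v * (u n)^2 / 2) - 1) / (u n)^2))
      Filter.atTop (nhds (ENNReal.ofReal v)) := by
    apply ENNReal.tendsto_ofReal
    have hd : HasDerivAt Real.exp 1 0 := by simpa using Real.hasDerivAt_exp 0
    have hs := hd.tendsto_slope_zero
    have ht : Filter.Tendsto (fun n => v * (u n)^2 / 2) Filter.atTop (nhdsWithin 0 {0}ᶜ) := by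
      rw [tendsto_nhdsWithin_iff]
      constructor
      · have : Filter.Tendsto (fun n => v * (u n)^2 / 2) Filter.atTop (nhds (v * 0 ^ 2 / 2)) :=
          (((hu0.pow 2).const_mul v).div_const 2)
        simpa using this
      · refine Filter.Eventually.of_forall fun n => ?_
        have := hup n
        have : 0 < v * (u n)^2/2 := by positivity
        exact this.ne'
    have := (hs.comp ht).const_mul v
    rw [mul_one] at this
    refine this.congr fun n => ?_
    have := (hup n).ne'
    simp only [Function.comp, zero_add, smul_eq_mul, Real.exp_zero]
    field_simp
  calc ∫⁻ x, ENNReal.ofReal (x ^ 2) ∂μ = ∫⁻ x, Filter.liminf (fun n => ENNReal.ofReal (f n x)) Filter.atTop ∂μ := by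
        congr 1; ext x; exact (hlim x).liminf_eq.symm
    _ ≤ Filter.liminf (fun n => ∫⁻ x, ENNReal.ofReal (f n x) ∂μ) Filter.atTop := lintegral_liminf_le hfm
    _ ≤ Filter.liminf (fun n => ENNReal.ofReal (2 * (Real.exp (v * (u n)^2 / 2) - 1) / (u n)^2)) Filter.atTop :=
        Filter.liminf_le_liminf (Filter.Eventually.of_forall hval)
    _ = _ := hlim2.liminf_eq

lemma IsSJ.sq_int (h : IsSJ κ μ v R) : Integrable (fun x : ℝ => x ^ 2) μ := by
  refine ⟨by fun_prop, ?_⟩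
  rw [hasFiniteIntegral_iff_ofReal (Filter.Eventually.of_forall fun x => by positivity)]
  exact lt_of_le_of_lt h.sq_lint ENNReal.ofReal_lt_top

lemma IsSJ.sq_le (h : IsSJ κ μ v R) : ∫ x, x ^ 2 ∂μ ≤ v := by
  have := h.sq_lint
  rw [← ofReal_integral_eq_lintegral_ofReal h.sq_int (Filter.Eventually.of_forall fun x => by positivity)] at this
  exact (ENNReal.ofReal_le_ofReal_iff h.hv.le).1 this

lemma IsSJ.memLp (h : IsSJ κ μ v R) : MemLp id 2 μ :=
  (memLp_two_iff_integrable_sq aestronglyMeasurable_id).2 h.sq_int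

lemma IsSJ.int_id (h : IsSJ κ μ v R) : Integrable (fun x : ℝ => x) μ := by
  have := h.pμ
  exact (h.memLp.integrable (by norm_num))

end SJ

namespace SJ
variable {κ μ : Measure ℝ} {v R : ℝ}

/-- the kernel of the zero-bias density -/
noncomputable def zk (q : ℝ × ℝ) : ℝ :=
  if 0 ≤ q.2 ∧ q.2 < q.1 then q.1 else if q.1 ≤ q.2 ∧ q.2 < 0 then - q.1 else 0

lemma zk_meas : Measurable zk := by
  unfold zk
  refine Measurable.ite ?_ measurable_fst (Measurable.ite ?_ measurable_fst.neg measurable_const)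
  · exact (measurableSet_le measurable_const measurable_snd).inter (measurableSet_lt measurable_snd measurable_fst)
  · exact (measurableSet_le measurable_fst measurable_snd).inter (measurableSet_lt measurable_snd measurable_const)

lemma zk_nonneg (q : ℝ × ℝ) : 0 ≤ zk q := by
  unfold zk
  split_ifs with h1 h2
  · linarith [h1.1, h1.2]
  · linarith [h2.1, h2.2]
  · exact le_rfl

lemma zk_eq_pos {x : ℝ} (hx : 0 ≤ x) (G : ℝ → ℂ) : (fun z => (zk (x, z) : ℂ) * G z) =
    (Set.Ico 0 x).indicator (fun z => (x:ℂ) * G z) := by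
  ext z
  simp only [zk, Set.indicator, Set.mem_Ico]
  split_ifs with h1 h2
  · rfl
  · exfalso; linarith [h2.1, h2.2]
  · simp

lemma zk_eq_neg {x : ℝ} (hx : x < 0) (G : ℝ → ℂ) : (fun z => (zk (x, z) : ℂ) * G z) =
    (Set.Ico x 0).indicator (fun z => -(x:ℂ) * G z) := by
  ext z
  simp only [zk, Set.indicator, Set.mem_Ico]
  split_ifs with h1 h2
  all_goals first | (exfalso; linarith [h1.1, h1.2]) | (push_cast; rfl) | simp

lemma zk_integral (x : ℝ) (G : ℝ → ℂ) : ∫ z, (zk (x, z) : ℂ) * G z = x * ∫ z in (0:ℝ)..x, G z := by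
  rcases le_or_gt 0 x with hx | hx
  · rw [zk_eq_pos hx, integral_indicator measurableSet_Ico, integral_const_mul,
      intervalIntegral.integral_of_le hx, integral_Ico_eq_integral_Ioc]
  · rw [zk_eq_neg hx, integral_indicator measurableSet_Ico, integral_const_mul,
      intervalIntegral.integral_of_ge hx.le, integral_Ico_eq_integral_Ioc]
    ring

lemma zk_integrable (x : ℝ) : Integrable (fun z => zk (x, z)) := by
  rcases le_or_gt 0 x with hx | hx
  · have : (fun z => zk (x, z)) = (Set.Ico 0 x).indicator (fun _ => x) := by
      ext z
      have := congrFun (zk_eq_pos hx (fun _ => 1)) z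
      simp only [mul_one, Set.indicator] at this ⊢
      split_ifs at this ⊢ <;> exact_mod_cast this
    rw [this, integrable_indicator_iff measurableSet_Ico]
    exact integrableOn_const (by simp)
  · have : (fun z => zk (x, z)) = (Set.Ico x 0).indicator (fun _ => -x) := by
      ext z
      have := congrFun (zk_eq_neg hx (fun _ => 1)) z
      simp only [mul_one, Set.indicator] at this ⊢
      split_ifs at this ⊢ <;> exact_mod_cast this
    rw [this, integrable_indicator_iff measurableSet_Ico]
    exact integrableOn_const (by simp)

lemma zk_integral_one (x : ℝ) : ∫ z, zk (x, z) = x ^ 2 := by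
  have := zk_integral x (fun _ => 1)
  simp only [mul_one] at this
  rw [integral_complex_ofReal] at this
  simp at this
  have h2 : ((∫ z, zk (x, z) : ℝ) : ℂ) = ((x ^ 2 : ℝ) : ℂ) := by rw [this]; push_cast; ring
  exact_mod_cast h2

lemma IsSJ.zk_int (h : IsSJ κ μ v R) : Integrable zk (μ.prod volume) := by
  have := h.pμ
  rw [integrable_prod_iff zk_meas.aestronglyMeasurable]
  constructor
  · exact Filter.Eventually.of_forall fun x => zk_integrable x
  · have : (fun x => ∫ y, ‖zk (x, y)‖) = fun x => x ^ 2 := by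
      ext x
      rw [← zk_integral_one x]
      congr 1; ext y; rw [Real.norm_eq_abs, abs_of_nonneg (zk_nonneg _)]
    rw [this]
    exact h.sq_int

/-- zero bias measure (unnormalised) -/
noncomputable def zb (μ : Measure ℝ) : Measure ℝ :=
  ((μ.prod volume).withDensity (fun q => ENNReal.ofReal (zk q))).map Prod.snd

lemma IsSJ.zb_fin (h : IsSJ κ μ v R) : IsFiniteMeasure (zb μ) := by
  have : IsFiniteMeasure ((μ.prod volume).withDensity (fun q => ENNReal.ofReal (zk q))) :=
    isFiniteMeasure_withDensity_ofReal h.zk_int.2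
  unfold zb
  infer_instance

lemma IsSJ.zb_integral (h : IsSJ κ μ v R) (G : ℝ → ℂ) (hG : Measurable G) (K : ℝ) (hK : ∀ z, ‖G z‖ ≤ K) :
    ∫ z, G z ∂(zb μ) = ∫ x : ℝ, (x * ∫ z in (0:ℝ)..x, G z) ∂μ := by
  have := h.pμ
  unfold zb
  rw [integral_map measurable_snd.aemeasurable hG.aestronglyMeasurable,
    integral_withDensity_eq_integral_toReal_smul (by exact zk_meas.ennreal_ofReal) (by simp)]
  have e : ∀ q : ℝ × ℝ, (ENNReal.ofReal (zk q)).toReal • G q.2 = (zk q : ℂ) * G q.2 := by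
    intro q
    rw [ENNReal.toReal_ofReal (zk_nonneg q)]; simp
  simp_rw [e]
  rw [integral_prod]
  · congr 1; ext x
    exact zk_integral x G
  · have : Integrable (fun q => (zk q : ℂ)) (μ.prod volume) := h.zk_int.ofReal
    exact this.mul_bdd (c := K) (hG.comp measurable_snd).aestronglyMeasurable (Filter.Eventually.of_forall fun q => hK _)

/-- law of `X + U Y` -/
noncomputable def xi (κ μ : Measure ℝ) : Measure ℝ :=
  (μ.prod (unif.prod κ)).map (fun z => z.1 + z.2.1 * z.2.2)

lemma int_ee (ρ : Measure ℝ) [IsFiniteMeasure ρ] (u : ℝ) :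
    Integrable (fun x : ℝ => Complex.exp (u * x * Complex.I)) ρ := by
  refine Integrable.of_bound (by fun_prop) 1 (Filter.Eventually.of_forall fun x => ?_)
  have := norm_ee (u * x)
  push_cast at this
  exact this.le

lemma int_ee_unif {c : ℝ} (hc : c ≠ 0) :
    ∫ s, Complex.exp ((c * s : ℝ) * Complex.I) ∂unif = (Complex.exp (c * Complex.I) - 1) / (c * Complex.I) := by
  unfold unif
  rw [← integral_Ioc_eq_integral_Ioo, ← intervalIntegral.integral_of_le zero_le_one]
  have : ∀ s : ℝ, Complex.exp ((c * s : ℝ) * Complex.I) = Complex.exp ((c * Complex.I) * s) := by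
    intro s; congr 1; push_cast; ring
  simp_rw [this]
  have hcc : (c : ℂ) * Complex.I ≠ 0 := mul_ne_zero (by exact_mod_cast hc) Complex.I_ne_zero
  rw [integral_exp_mul_complex hcc]
  simp

lemma IsSJ.char_xi (h : IsSJ κ μ v R) {u : ℝ} (hu : u ≠ 0) : charFun (xi κ μ) u =
    charFun μ u * ∫ y : ℝ, (Complex.exp ((u * y : ℝ) * Complex.I) - 1) / (u * y * Complex.I) ∂κ := by
  have := h.pκ
  have := h.pμ
  rw [charFun_apply_real, xi, integral_map (by fun_prop) (by fun_prop)]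
  have e : ∀ z : ℝ × ℝ × ℝ, Complex.exp (u * ((z.1 + z.2.1 * z.2.2 : ℝ) : ℂ) * Complex.I) =
      Complex.exp (u * z.1 * Complex.I) * Complex.exp ((u * (z.2.1 * z.2.2) : ℝ) * Complex.I) := by
    intro z
    rw [← Complex.exp_add]
    congr 1; push_cast; ring
  simp_rw [e]
  rw [integral_prod_mul (f := fun x : ℝ => Complex.exp (u * x * Complex.I))
    (g := fun z : ℝ × ℝ => Complex.exp ((u * (z.1 * z.2) : ℝ) * Complex.I)), charFun_apply_real]
  congr 1
  rw [integral_prod_symm]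
  · apply integral_congr_ae
    filter_upwards [h.nz] with y hy
    have := int_ee_unif (c := u * y) (mul_ne_zero hu hy)
    push_cast at this ⊢
    rw [← this]
    congr 1; ext s; congr 1; ring
  · refine Integrable.of_bound (by fun_prop) 1 (Filter.Eventually.of_forall fun x => (norm_ee _).le)

lemma IsSJ.deriv_char (h : IsSJ κ μ v R) (u : ℝ) :
    ∫ x : ℝ, x * Complex.exp (u * x * Complex.I) ∂μ =
      v * (charFun μ u * ∫ y : ℝ, (Complex.exp ((u * y : ℝ) * Complex.I) - 1) / y ∂κ) := by
  have := h.pκ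
  have := h.pμ
  have hm : MemLp id ((1:ℕ) : ℝ≥0∞) μ := by
    simpa using h.memLp.mono_exponent (p := 1) (by norm_num)
  have h1 := iteratedDeriv_charFun (t := u) hm
  rw [iteratedDeriv_one] at h1
  have h2 : HasDerivAt (charFun μ) (Complex.exp (v * psi κ u) * (v * ∫ y : ℝ, Complex.I * (Complex.exp ((u * y : ℝ) * Complex.I) - 1) / y ∂κ)) u := by
    have : charFun μ = fun u => Complex.exp (v * psi κ u) := funext h.char'
    rw [this]
    exact ((psi_hasDeriv κ u).const_mul (v:ℂ)).cexp
  rw [h2.deriv, ← h.char'] at h1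
  have h3 : ∫ y : ℝ, Complex.I * (Complex.exp ((u * y : ℝ) * Complex.I) - 1) / y ∂κ =
      Complex.I * ∫ y : ℝ, (Complex.exp ((u * y : ℝ) * Complex.I) - 1) / y ∂κ := by
    rw [← integral_const_mul]
    congr 1; ext y; ring
  rw [h3] at h1
  simp only [pow_one] at h1
  apply mul_left_cancel₀ Complex.I_ne_zero
  rw [← h1]; ring

lemma IsSJ.mean (h : IsSJ κ μ v R) : ∫ x, x ∂μ = 0 := by
  have := h.deriv_char 0
  simp at this
  rw [integral_complex_ofReal] at this
  exact_mod_cast this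

lemma IsSJ.xi_prob (h : IsSJ κ μ v R) : IsProbabilityMeasure (xi κ μ) := by
  have := h.pκ
  have := h.pμ
  exact Measure.isProbabilityMeasure_map (by fun_prop)

lemma IsSJ.zb_eq (h : IsSJ κ μ v R) : zb μ = ENNReal.ofReal v • xi κ μ := by
  have := h.pκ
  have := h.pμ
  have := h.zb_fin
  have := h.xi_prob
  have : IsFiniteMeasure (ENNReal.ofReal v • xi κ μ) := Measure.smul_finite _ (by simp)
  apply Measure.ext_of_charFun
  have c1 : Continuous (charFun (zb μ)) := continuous_charFun
  have c2 : Continuous (charFun (ENNReal.ofReal v • xi κ μ)) := continuous_charFun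
  refine Continuous.ext_on (dense_compl_singleton (0:ℝ)) c1 c2 ?_
  intro u hu
  have hu : u ≠ 0 := hu
  have huc : (u:ℂ) ≠ 0 := by exact_mod_cast hu
  have e1 : charFun (zb μ) u = (∫ x : ℝ, x * Complex.exp (u * x * Complex.I) ∂μ) / (u * Complex.I) := by
    rw [charFun_apply_real, h.zb_integral _ (by fun_prop) 1 (fun z => by
      have := norm_ee (u * z)
      push_cast at this
      exact this.le)]
    have e : ∀ x : ℝ, (x:ℂ) * ∫ z in (0:ℝ)..x, Complex.exp (u * z * Complex.I) =
        (x * Complex.exp (u * x * Complex.I)) / (u * Complex.I) - x / (u * Complex.I) := by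
      intro x
      have : ∀ s : ℝ, Complex.exp (u * s * Complex.I) = Complex.exp ((u * Complex.I) * s) := by
        intro s; congr 1; ring
      simp_rw [this]
      rw [integral_exp_mul_complex (mul_ne_zero huc Complex.I_ne_zero)]
      simp
      ring
    simp_rw [e]
    have hi : Integrable (fun x : ℝ => (x:ℂ)) μ := h.int_id.ofReal
    rw [integral_sub, integral_div, integral_div, integral_complex_ofReal, h.mean]
    · simp
    · apply Integrable.div_const
      exact hi.mul_bdd (c := 1) (by fun_prop) (Filter.Eventually.of_forall fun x => by
        have := norm_ee (u * x)
        push_cast at this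
        exact this.le)
    · exact hi.div_const _
  have e2 : charFun (ENNReal.ofReal v • xi κ μ) u = v * charFun (xi κ μ) u := by
    rw [charFun_apply_real, integral_smul_measure, charFun_apply_real, ENNReal.toReal_ofReal h.hv.le]
    simp
  rw [e1, e2, h.deriv_char, h.char_xi hu]
  rw [mul_div_assoc, mul_div_assoc, ← integral_div]
  congr 3; ext y
  rw [div_div]
  congr 1; ring

/-- zero-bias identity -/
theorem IsSJ.zero_bias (h : IsSJ κ μ v R) (g g' : ℝ → ℝ) (hg : ∀ x, HasDerivAt g (g' x) x)
    (hc : Continuous g') (K : ℝ) (hK : ∀ x, |g' x| ≤ K) :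
    ∫ x, x * g x ∂μ = v * ∫ z, g' (z.1 + z.2.1 * z.2.2) ∂(μ.prod (unif.prod κ)) := by
  have := h.pκ
  have := h.pμ
  have h1 := h.zb_integral (fun z => (g' z : ℂ)) (by fun_prop) K (fun z => by simpa using hK z)
  rw [h.zb_eq, integral_smul_measure, ENNReal.toReal_ofReal h.hv.le, integral_complex_ofReal] at h1
  have e : ∀ x : ℝ, (x:ℂ) * ∫ z in (0:ℝ)..x, (g' z : ℂ) = ((x * g x - x * g 0 : ℝ) : ℂ) := by
    intro x
    rw [intervalIntegral.integral_ofReal, intervalIntegral.integral_eq_sub_of_hasDerivAt (fun y _ => hg y)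
      (hc.intervalIntegrable _ _)]
    push_cast; ring
  simp_rw [e] at h1
  rw [integral_complex_ofReal] at h1
  have h2 : v * ∫ z, g' z ∂(xi κ μ) = ∫ x, x * g x - x * g 0 ∂μ := by
    have : ((v * ∫ z, g' z ∂(xi κ μ) : ℝ) : ℂ) = ((∫ x, x * g x - x * g 0 ∂μ : ℝ):ℂ) := by
      rw [← h1]; push_cast; simp
    exact_mod_cast this
  have hgl : ∀ x, |g x| ≤ |g 0| + K * |x| := by
    intro x
    have := Convex.norm_image_sub_le_of_norm_hasDerivWithin_le (f := g) (f' := g') (C := K) (s := Set.univ)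
      (fun y _ => (hg y).hasDerivWithinAt) (fun y _ => hK y) convex_univ (Set.mem_univ 0) (Set.mem_univ x)
    simp only [Real.norm_eq_abs, sub_zero] at this
    have := abs_sub_abs_le_abs_sub (g x) (g 0)
    linarith
  have hgc : Continuous g := continuous_iff_continuousAt.2 fun x => (hg x).continuousAt
  have hi : Integrable (fun x => x * g x) μ := by
    refine Integrable.mono' ((h.int_id.abs.const_mul |g 0|).add (h.sq_int.const_mul K)) (by fun_prop) ?_
    refine Filter.Eventually.of_forall fun x => ?_
    rw [Real.norm_eq_abs, abs_mul]
    simp only [Pi.add_apply]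
    calc |x| * |g x| ≤ |x| * (|g 0| + K * |x|) := by gcongr; exact hgl x
      _ = _ := by rw [← sq_abs x]; ring
  rw [integral_sub hi (h.int_id.mul_const _), integral_mul_const, h.mean] at h2
  rw [xi, integral_map (by fun_prop) (by fun_prop)] at h2
  linarith

lemma IsSJ.sq_eq (h : IsSJ κ μ v R) : ∫ x, x ^ 2 ∂μ = v := by
  have := h.pκ
  have := h.pμ
  have := h.zero_bias (fun x => x) (fun _ => 1) (fun x => hasDerivAt_id x) continuous_const 1 (by simp)
  simp at this
  rw [← this]
  congr 1; ext x; ring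

end SJ

namespace SJ

/-- standard Gaussian -/
noncomputable abbrev gam : Measure ℝ := gaussianReal 0 1

lemma gint {h : ℝ → ℝ} (hm : AEStronglyMeasurable h gam) (K : ℝ) (n : ℕ) (hb : ∀ y, |h y| ≤ K * (1 + |y|) ^ n) :
    Integrable h gam := by
  have h2 : MemLp (id : ℝ → ℝ) (n : ℝ≥0∞) (gaussianReal 0 1) := memLp_id_gaussianReal' _ (by simp)
  have h3 : MemLp (fun y : ℝ => ‖y‖) (n : ℝ≥0∞) (gaussianReal 0 1) := h2.norm
  have h5 : MemLp (fun _ : ℝ => (1:ℝ)) (n : ℝ≥0∞) (gaussianReal 0 1) := memLp_const 1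
  have h1 : MemLp (fun y : ℝ => 1 + ‖y‖) (n : ℝ≥0∞) (gaussianReal 0 1) := h5.add h3
  have h4 := h1.integrable_norm_pow'
  refine Integrable.mono' (h4.const_mul K) hm (Filter.Eventually.of_forall fun y => ?_)
  rw [Real.norm_eq_abs (h y)]
  refine (hb y).trans (le_of_eq ?_)
  rw [Real.norm_eq_abs (1 + ‖y‖), Real.norm_eq_abs, abs_of_nonneg (show 0 ≤ 1 + |y| by positivity)]

lemma integrable_gam_iff {h : ℝ → ℝ} :
    Integrable h gam ↔ Integrable (fun y => gaussianPDFReal 0 1 y * h y) := by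
  rw [gam, gaussianReal_of_var_ne_zero _ one_ne_zero,
    integrable_withDensity_iff_integrable_smul' (measurable_gaussianPDF 0 1)
      (Filter.Eventually.of_forall fun x => gaussianPDF_lt_top)]
  simp [toReal_gaussianPDF]

lemma hasDerivAt_pdf (y : ℝ) : HasDerivAt (gaussianPDFReal 0 1) (- y * gaussianPDFReal 0 1 y) y := by
  rw [gaussianPDFReal_def]
  have h1 : HasDerivAt (fun x : ℝ => -(x - 0)^2 / (2 * ((1:ℝ≥0):ℝ))) (-y) y := by
    have := ((((hasDerivAt_id y).sub_const 0).pow 2).neg).div_const (2 * ((1:ℝ≥0):ℝ))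
    convert! this using 1
    simp
    ring
  have h2 := (h1.exp).const_mul ((√(2 * Real.pi * ((1:ℝ≥0):ℝ)))⁻¹)
  convert! h2 using 1
  ring

/-- Gaussian integration by parts -/
lemma gibp {h h' : ℝ → ℝ} (hd : ∀ y, HasDerivAt h (h' y) y) (i0 : Integrable h gam)
    (i1 : Integrable h' gam) (i2 : Integrable (fun y => y * h y) gam) :
    ∫ y, y * h y ∂gam = ∫ y, h' y ∂gam := by
  have j0 := integrable_gam_iff.1 i0
  have j1 := integrable_gam_iff.1 i1
  have j2 := integrable_gam_iff.1 i2
  have hder : ∀ y, HasDerivAt (fun y => gaussianPDFReal 0 1 y * h y)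
      (gaussianPDFReal 0 1 y * h' y - gaussianPDFReal 0 1 y * (y * h y)) y := by
    intro y
    convert! (hasDerivAt_pdf y).mul (hd y) using 1
    ring
  have := integral_eq_zero_of_hasDerivAt_of_integrable hder (j1.sub j2) j0
  rw [integral_sub j1 j2] at this
  rw [integral_gaussianReal_eq_integral_smul one_ne_zero, integral_gaussianReal_eq_integral_smul one_ne_zero]
  simp only [smul_eq_mul]
  linarith

lemma ode_aux {k φ : ℝ → ℝ} (hk : ∀ x, HasDerivAt k (x * k x + φ x) x) {c K : ℝ}
    (hφ : ∀ x, |φ x| ≤ c) (hK : ∀ x, |k x| ≤ K * (1 + |x|)) {x : ℝ} (hx : 0 < x) : x * k x ≤ c := by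
  have hc : 0 ≤ c := (abs_nonneg _).trans (hφ 0)
  let m : ℝ → ℝ := fun z => (k z - c / x) * Real.exp (- z ^ 2 / 2)
  have hm : ∀ z, HasDerivAt m ((φ z + z * (c / x)) * Real.exp (- z^2 / 2)) z := by
    intro z
    have h1 : HasDerivAt (fun z : ℝ => - z^2/2) (-z) z := by
      have := ((hasDerivAt_id z).pow 2).neg.div_const 2
      convert! this using 1
      simp
      ring
    convert! ((hk z).sub_const (c / x)).mul h1.exp using 1
    ring
  have hmono : MonotoneOn m (Set.Ici x) := by
    apply monotoneOn_of_deriv_nonneg (convex_Ici x)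
    · exact fun z _ => (hm z).continuousAt.continuousWithinAt
    · exact fun z _ => (hm z).differentiableAt.differentiableWithinAt
    · intro z hz
      rw [interior_Ici] at hz
      rw [(hm z).deriv]
      have h1 := (abs_le.1 (hφ z)).1
      have h2 : c ≤ z * (c / x) := by
        rw [mul_div_assoc', le_div_iff₀ hx]
        have : x < z := hz
        nlinarith
      apply mul_nonneg _ (Real.exp_pos _).le
      linarith
  have hlim : Filter.Tendsto m Filter.atTop (nhds 0) := by
    have hK0 : 0 ≤ K := by
      have := hK 0
      simp at this
      exact (abs_nonneg _).trans this
    have e1 : Filter.Tendsto (fun z : ℝ => z * Real.exp (-z)) Filter.atTop (nhds 0) := by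
      simpa using Real.tendsto_pow_mul_exp_neg_atTop_nhds_zero 1
    have e0 : Filter.Tendsto (fun z : ℝ => Real.exp (-z)) Filter.atTop (nhds 0) :=
      Real.tendsto_exp_neg_atTop_nhds_zero
    have e2 : Filter.Tendsto (fun z : ℝ => (K + c / x) * Real.exp (-z) + K * (z * Real.exp (-z)))
        Filter.atTop (nhds 0) := by
      simpa using (e0.const_mul (K + c/x)).add (e1.const_mul K)
    refine squeeze_zero_norm' ?_ e2
    filter_upwards [Filter.eventually_ge_atTop 2] with z hz
    rw [Real.norm_eq_abs, abs_mul, Real.abs_exp]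
    have h1 : |k z - c / x| ≤ (K + c / x) + K * z := by
      have h2 := abs_sub (k z) (c / x)
      have h3 := hK z
      rw [abs_of_nonneg (by linarith : (0:ℝ) ≤ z)] at h3
      rw [abs_of_nonneg (by positivity : 0 ≤ c / x)] at h2
      linarith
    have h4 : Real.exp (-z^2/2) ≤ Real.exp (-z) := by
      apply Real.exp_le_exp.2
      nlinarith
    calc _ ≤ ((K + c / x) + K * z) * Real.exp (-z) := by gcongr
      _ = _ := by ring
  have h0 : m x ≤ 0 := by
    refine ge_of_tendsto hlim ?_
    filter_upwards [Filter.eventually_ge_atTop x] with z hz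
    exact hmono (Set.mem_Ici.2 le_rfl) hz hz
  have h1 : k x - c / x ≤ 0 := by
    by_contra hcon
    push Not at hcon
    have : 0 < m x := mul_pos hcon (Real.exp_pos _)
    linarith
  have h2 : k x ≤ c / x := by linarith
  rw [le_div_iff₀ hx] at h2
  linarith

lemma ode_bound {k φ : ℝ → ℝ} (hk : ∀ x, HasDerivAt k (x * k x + φ x) x) {c K : ℝ}
    (hφ : ∀ x, |φ x| ≤ c) (hK : ∀ x, |k x| ≤ K * (1 + |x|)) (x : ℝ) : |x * k x| ≤ c := by
  have hc : 0 ≤ c := (abs_nonneg _).trans (hφ 0)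
  have main : ∀ {k φ : ℝ → ℝ}, (∀ x, HasDerivAt k (x * k x + φ x) x) → (∀ x, |φ x| ≤ c) →
      (∀ x, |k x| ≤ K * (1 + |x|)) → ∀ x, 0 < x → |x * k x| ≤ c := by
    intro k φ hk hφ hK x hx
    rw [abs_le]
    constructor
    · have := ode_aux (k := fun x => - k x) (φ := fun x => - φ x) (c := c) (K := K)
        (fun x => by convert! (hk x).neg using 1; ring) (fun x => by simpa using hφ x)
        (fun x => by simpa using hK x) hx
      linarith
    · exact ode_aux hk hφ hK hx
  rcases lt_trichotomy x 0 with h | h | h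
  · have := main (k := fun x => k (-x)) (φ := fun x => - φ (-x)) (fun x => by
      have h1 := (hk (-x)).comp x (hasDerivAt_neg x)
      convert! h1 using 1
      ring) (fun x => by simpa using hφ (-x)) (fun x => by simpa using hK (-x)) (-x) (by linarith)
    simpa using this
  · simp [h, hc]
  · exact main hk hφ hK x h

end SJ

namespace SJ

noncomputable def Th : Measure ℝ := volume.restrict (Set.Ioc 0 (Real.pi / 2))
instance : IsFiniteMeasure Th := by unfold Th; infer_instance

lemma Th_univ : Th.real Set.univ ≤ 2 := by
  unfold Th
  rw [Measure.real, Measure.restrict_apply_univ, Real.volume_Ioc, ENNReal.toReal_ofReal (by linarith [Real.pi_pos])]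
  linarith [Real.pi_lt_four]

noncomputable def P2 : Measure (ℝ × ℝ) := Th.prod gam
instance : IsFiniteMeasure P2 := by unfold P2; infer_instance

lemma P2_univ : P2.real Set.univ ≤ 2 := by
  unfold P2
  rw [Measure.real, ← Set.univ_prod_univ, Measure.prod_prod, measure_univ (μ := gam), mul_one]
  exact Th_univ

lemma P2_snd_int : Integrable (fun z : ℝ × ℝ => 1 + |z.2|) P2 := by
  have h : Integrable (fun y : ℝ => 1 + |y|) gam := gint (by fun_prop) 1 1 (fun y => by
    rw [abs_of_nonneg (by positivity)]; simp)
  exact h.comp_snd Th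

/-- point along the Ornstein-Uhlenbeck path -/
noncomputable def ou (x : ℝ) (z : ℝ × ℝ) : ℝ := x * Real.cos z.1 + z.2 * Real.sin z.1

lemma ou_le (x : ℝ) (z : ℝ × ℝ) : |ou x z| ≤ |x| + |z.2| := by
  unfold ou
  refine (abs_add_le _ _).trans ?_
  rw [abs_mul, abs_mul]
  have h1 := Real.abs_cos_le_one z.1
  have h2 := Real.abs_sin_le_one z.1
  nlinarith [abs_nonneg x, abs_nonneg z.2]

lemma ou_cont (x : ℝ) : Continuous (ou x) := by
  unfold ou; fun_prop

noncomputable def sg (F : ℝ → ℝ) (x : ℝ) : ℝ := -∫ z, Real.sin z.1 * F (ou x z) ∂P2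
noncomputable def sg1 (F' : ℝ → ℝ) (x : ℝ) : ℝ := -∫ z, Real.sin z.1 * Real.cos z.1 * F' (ou x z) ∂P2
noncomputable def sg2 (F F' : ℝ → ℝ) (x : ℝ) : ℝ := sg F x + x * sg1 F' x + F x

lemma lin_growth {F F' : ℝ → ℝ} (hF : ∀ x, HasDerivAt F (F' x) x) {K : ℝ} (hK : ∀ x, |F' x| ≤ K) (x : ℝ) :
    |F x| ≤ |F 0| + K * |x| := by
  have h := Convex.norm_image_sub_le_of_norm_hasDerivWithin_le (f := F) (f' := F') (C := K) (s := Set.univ)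
    (x := 0) (y := x) (fun z _ => (hF z).hasDerivWithinAt) (fun z _ => hK z) convex_univ trivial trivial
  simp only [Real.norm_eq_abs, sub_zero] at h
  have := abs_sub_abs_le_abs_sub (F x) (F 0)
  linarith

lemma sg_int {F : ℝ → ℝ} (hc : Continuous F) {A K : ℝ} (hg : ∀ x, |F x| ≤ A + K * |x|) (x : ℝ) :
    Integrable (fun z : ℝ × ℝ => Real.sin z.1 * F (ou x z)) P2 := by
  have hK : 0 ≤ K + A := by
    have h1 := (abs_nonneg _).trans (hg 1)
    simp at h1; linarith
  have hA : 0 ≤ A := by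
    have h1 := (abs_nonneg _).trans (hg 0)
    simp at h1; linarith
  have h2 := P2_snd_int.const_mul (A + |K| * (1 + |x|))
  have hm : Continuous (fun z : ℝ × ℝ => Real.sin z.1 * F (ou x z)) := by
    have := ou_cont x
    fun_prop
  refine h2.mono' hm.aestronglyMeasurable (Filter.Eventually.of_forall fun z => ?_)
  rw [Real.norm_eq_abs, abs_mul]
  have h3 := Real.abs_sin_le_one z.1
  have h4 := hg (ou x z)
  have h5 := ou_le x z
  have h6 : K * |ou x z| ≤ |K| * (|x| + |z.2|) :=
    (mul_le_mul_of_nonneg_right (le_abs_self K) (abs_nonneg _)).trans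
      (mul_le_mul_of_nonneg_left h5 (abs_nonneg _))
  have h7 : |Real.sin z.1| * |F (ou x z)| ≤ |F (ou x z)| := by
    nlinarith [abs_nonneg (F (ou x z))]
  have h8 : 0 ≤ |K| * (|x| * |z.2|) := by positivity
  have h9 : 0 ≤ A * |z.2| := by positivity
  nlinarith [abs_nonneg K]

lemma sg1_int {F' : ℝ → ℝ} (hc : Continuous F') {K : ℝ} (hg : ∀ x, |F' x| ≤ K) (x : ℝ) :
    Integrable (fun z : ℝ × ℝ => Real.sin z.1 * Real.cos z.1 * F' (ou x z)) P2 := by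
  have hm : Continuous (fun z : ℝ × ℝ => Real.sin z.1 * Real.cos z.1 * F' (ou x z)) := by
    have := ou_cont x
    fun_prop
  refine (integrable_const K).mono' hm.aestronglyMeasurable (Filter.Eventually.of_forall fun z => ?_)
  rw [Real.norm_eq_abs, abs_mul, abs_mul]
  have h1 := Real.abs_cos_le_one z.1
  have h2 := Real.abs_sin_le_one z.1
  have h3 := hg (ou x z)
  have : |Real.sin z.1| * |Real.cos z.1| ≤ 1 := by nlinarith [abs_nonneg (Real.cos z.1)]
  nlinarith [abs_nonneg (F' (ou x z))]

lemma sg1_bound {F' : ℝ → ℝ} {K : ℝ} (hg : ∀ x, |F' x| ≤ K) (x : ℝ) :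
    |sg1 F' x| ≤ 2 * K := by
  have hK : 0 ≤ K := (abs_nonneg _).trans (hg 0)
  unfold sg1
  rw [abs_neg, ← Real.norm_eq_abs]
  refine (norm_integral_le_of_norm_le_const (C := K) (Filter.Eventually.of_forall fun z => ?_)).trans ?_
  · rw [Real.norm_eq_abs, abs_mul, abs_mul]
    have h1 := Real.abs_cos_le_one z.1
    have h2 := Real.abs_sin_le_one z.1
    have h3 := hg (ou x z)
    have : |Real.sin z.1| * |Real.cos z.1| ≤ 1 := by nlinarith [abs_nonneg (Real.cos z.1)]
    nlinarith [abs_nonneg (F' (ou x z))]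
  · have := P2_univ
    nlinarith

lemma sg_bound {F : ℝ → ℝ} {K : ℝ} (hg : ∀ x, |F x| ≤ K) (x : ℝ) :
    |sg F x| ≤ 2 * K := by
  have hK : 0 ≤ K := (abs_nonneg _).trans (hg 0)
  unfold sg
  rw [abs_neg, ← Real.norm_eq_abs]
  refine (norm_integral_le_of_norm_le_const (C := K) (Filter.Eventually.of_forall fun z => ?_)).trans ?_
  · rw [Real.norm_eq_abs, abs_mul]
    have h2 := Real.abs_sin_le_one z.1
    have h3 := hg (ou x z)
    nlinarith [abs_nonneg (F (ou x z))]
  · have := P2_univ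
    nlinarith

lemma sg_hasDeriv {F F' : ℝ → ℝ} (hF : ∀ x, HasDerivAt F (F' x) x) (hc : Continuous F') {K : ℝ}
    (hK : ∀ x, |F' x| ≤ K) (x : ℝ) : HasDerivAt (sg F) (sg1 F' x) x := by
  have hFc : Continuous F := continuous_iff_continuousAt.2 fun x => (hF x).continuousAt
  have hcont : ∀ x, Continuous (fun z : ℝ × ℝ => Real.sin z.1 * F (ou x z)) := fun x => by
    have := ou_cont x
    fun_prop
  have := (hasDerivAt_integral_of_dominated_loc_of_deriv_le (μ := P2)
    (F := fun x z => Real.sin z.1 * F (ou x z))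
    (F' := fun x z => Real.sin z.1 * Real.cos z.1 * F' (ou x z)) (x₀ := x) (s := Set.univ)
    (bound := fun _ => K) Filter.univ_mem
    (Filter.Eventually.of_forall fun x => (hcont x).aestronglyMeasurable)
    (sg_int hFc (lin_growth hF hK) x) (sg1_int hc hK x).aestronglyMeasurable
    (Filter.Eventually.of_forall fun z x _ => by
      rw [Real.norm_eq_abs, abs_mul, abs_mul]
      have h1 := Real.abs_cos_le_one z.1
      have h2 := Real.abs_sin_le_one z.1
      have h3 := hK (ou x z)
      have : |Real.sin z.1| * |Real.cos z.1| ≤ 1 := by nlinarith [abs_nonneg (Real.cos z.1)]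
      nlinarith [abs_nonneg (F' (ou x z))])
    (integrable_const K)
    (Filter.Eventually.of_forall fun z x _ => by
      have h1 : HasDerivAt (fun x => ou x z) (Real.cos z.1) x := by
        unfold ou
        simpa using ((hasDerivAt_id x).mul_const (Real.cos z.1)).add_const (z.2 * Real.sin z.1)
      have h2 := ((hF (ou x z)).comp x h1).const_mul (Real.sin z.1)
      convert! h2 using 1
      ring)).2
  exact this.neg

end SJ

namespace SJ

lemma quad_growth {f F F' : ℝ → ℝ} (hf : ∀ x, HasDerivAt f (F x) x) (hF : ∀ x, HasDerivAt F (F' x) x) {K : ℝ}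
    (hK : ∀ x, |F' x| ≤ K) (x : ℝ) :
    |f x| ≤ |f 0| + (|F 0| + K * |x|) * |x| := by
  have h := Convex.norm_image_sub_le_of_norm_hasDerivWithin_le (f := f) (f' := F) (C := |F 0| + K * |x|)
    (s := Set.Icc (-|x|) |x|)
    (x := 0) (y := x) (fun z _ => (hf z).hasDerivWithinAt) (fun z hz => by
      refine (lin_growth hF hK z).trans ?_
      have : |z| ≤ |x| := abs_le.2 hz
      have hK0 := (abs_nonneg _).trans (hK 0)
      nlinarith) (convex_Icc _ _) (by simp) ⟨neg_abs_le x, le_abs_self x⟩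
  simp only [Real.norm_eq_abs, sub_zero] at h
  have := abs_sub_abs_le_abs_sub (f x) (f 0)
  linarith

lemma sg_ode {f F F' : ℝ → ℝ} (hf : ∀ x, HasDerivAt f (F x) x) (hF : ∀ x, HasDerivAt F (F' x) x)
    (hc : Continuous F') {K : ℝ} (hK : ∀ x, |F' x| ≤ K) (x : ℝ) :
    sg1 F' x - x * sg F x = f x - ∫ y, f y ∂gam := by
  have hK0 := (abs_nonneg _).trans (hK 0)
  have hFc : Continuous F := continuous_iff_continuousAt.2 fun x => (hF x).continuousAt
  have hfc : Continuous f := continuous_iff_continuousAt.2 fun x => (hf x).continuousAt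
  have hlin := lin_growth hF hK
  have hquad := quad_growth hf hF hK
  set B : ℝ := |f 0| + |F 0| + K with hB
  have hB0 : 0 ≤ B := by positivity
  have ouc : ∀ θ, Continuous fun y => ou x (θ, y) := fun θ => (ou_cont x).comp (by fun_prop)
  have hou : ∀ θ y, |ou x (θ, y)| ≤ |x| + |y| := fun θ y => ou_le x (θ, y)
  -- growth of composed functions
  have gF : ∀ θ y, |F (ou x (θ, y))| ≤ B * (1 + |x|) * (1 + |y|) := fun θ y => by
    refine (hlin _).trans ?_
    have h1 := hou θ y
    have h2 : K * |ou x (θ, y)| ≤ K * (|x| + |y|) := by gcongr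
    have h3 : |F 0| + K * (|x| + |y|) ≤ (|F 0| + K) * ((1 + |x|) * (1 + |y|)) := by
      have : 0 ≤ |x| * |y| := by positivity
      have h4 : 0 ≤ |F 0| := by positivity
      nlinarith [abs_nonneg x, abs_nonneg y, mul_nonneg h4 (abs_nonneg x), mul_nonneg h4 (abs_nonneg y),
        mul_nonneg h4 this, mul_nonneg hK0 this]
    have h5 : (|F 0| + K) * ((1 + |x|) * (1 + |y|)) ≤ B * ((1 + |x|) * (1 + |y|)) := by
      gcongr
      rw [hB]; linarith [abs_nonneg (f 0)]
    linarith
  have gf : ∀ θ y, |f (ou x (θ, y))| ≤ B * (1 + |x|)^2 * (1 + |y|)^2 := fun θ y => by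
    refine (hquad _).trans ?_
    have h1 := hou θ y
    set w := |ou x (θ, y)|
    have hw : 0 ≤ w := abs_nonneg _
    have h2 : 1 + w ≤ (1 + |x|) * (1 + |y|) := by nlinarith [mul_nonneg (abs_nonneg x) (abs_nonneg y)]
    have h3 : |f 0| + (|F 0| + K * w) * w ≤ B * (1 + w)^2 := by
      rw [hB]
      nlinarith [abs_nonneg (f 0), abs_nonneg (F 0), mul_nonneg (abs_nonneg (f 0)) hw,
        mul_nonneg (abs_nonneg (F 0)) hw, mul_nonneg hK0 hw, mul_nonneg (mul_nonneg (abs_nonneg (f 0)) hw) hw,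
        mul_nonneg (mul_nonneg (abs_nonneg (F 0)) hw) hw]
    calc _ ≤ B * (1 + w)^2 := h3
      _ ≤ B * ((1 + |x|) * (1 + |y|))^2 := by gcongr
      _ = _ := by ring
  have iF : ∀ θ, Integrable (fun y => F (ou x (θ, y))) gam := fun θ =>
    gint (hFc.comp (ouc θ)).aestronglyMeasurable _ 1 (fun y => by simpa using gF θ y)
  have if' : ∀ θ, Integrable (fun y => f (ou x (θ, y))) gam := fun θ =>
    gint (hfc.comp (ouc θ)).aestronglyMeasurable _ 2 (fun y => gf θ y)
  have iF' : ∀ θ, Integrable (fun y => F' (ou x (θ, y))) gam := fun θ =>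
    gint (hc.comp (ouc θ)).aestronglyMeasurable K 0 (fun y => by simpa using hK _)
  have iyF : ∀ θ, Integrable (fun y => y * F (ou x (θ, y))) gam := fun θ =>
    gint (continuous_id.mul (hFc.comp (ouc θ))).aestronglyMeasurable (B * (1 + |x|)) 2 (fun y => by
      rw [abs_mul]
      have := gF θ y
      have h2 : |y| ≤ 1 + |y| := by linarith
      calc _ ≤ (1 + |y|) * (B * (1 + |x|) * (1 + |y|)) := by gcongr
        _ = _ := by ring)
  let m : ℝ → ℝ := fun θ => ∫ y, f (ou x (θ, y)) ∂gam
  let m' : ℝ → ℝ := fun θ => ∫ y, F (ou x (θ, y)) * (-x * Real.sin θ + y * Real.cos θ) ∂gam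
  have hm : ∀ θ, HasDerivAt m (m' θ) θ := by
    intro θ
    refine (hasDerivAt_integral_of_dominated_loc_of_deriv_le (μ := gam)
      (F := fun θ y => f (ou x (θ, y)))
      (F' := fun θ y => F (ou x (θ, y)) * (-x * Real.sin θ + y * Real.cos θ)) (x₀ := θ) (s := Set.univ)
      (bound := fun y => B * (1 + |x|) ^ 2 * (1 + |y|) ^ 2) Filter.univ_mem
      (Filter.Eventually.of_forall fun θ => (if' θ).aestronglyMeasurable) (if' θ) ?_ ?_ ?_ ?_).2
    · exact ((hFc.comp (ouc θ)).mul (by fun_prop)).aestronglyMeasurable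
    · refine Filter.Eventually.of_forall fun y θ _ => ?_
      rw [Real.norm_eq_abs, abs_mul]
      have h1 : |-x * Real.sin θ + y * Real.cos θ| ≤ (1 + |x|) * (1 + |y|) := by
        refine (abs_add_le _ _).trans ?_
        rw [abs_mul, abs_mul, abs_neg]
        have h1 := Real.abs_cos_le_one θ
        have h2 := Real.abs_sin_le_one θ
        nlinarith [abs_nonneg x, abs_nonneg y, mul_nonneg (abs_nonneg x) (abs_nonneg y)]
      calc _ ≤ (B * (1 + |x|) * (1 + |y|)) * ((1 + |x|) * (1 + |y|)) := by
              gcongr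
              exact gF θ y
        _ = _ := by ring
    · refine gint (by fun_prop) (B * (1 + |x|)^2) 2 (fun y => ?_)
      rw [abs_of_nonneg (by positivity)]
    · refine Filter.Eventually.of_forall fun y θ _ => ?_
      have h1 : HasDerivAt (fun θ => ou x (θ, y)) (-x * Real.sin θ + y * Real.cos θ) θ := by
        unfold ou
        convert! ((Real.hasDerivAt_cos θ).const_mul x).add ((Real.hasDerivAt_sin θ).const_mul y) using 1
        ring
      exact (hf _).comp θ h1
  have hm'2 : ∀ θ, m' θ = x * (-(Real.sin θ * ∫ y, F (ou x (θ, y)) ∂gam)) +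
      Real.sin θ * Real.cos θ * ∫ y, F' (ou x (θ, y)) ∂gam := by
    intro θ
    have hib : ∫ y, y * F (ou x (θ, y)) ∂gam = ∫ y, F' (ou x (θ, y)) * Real.sin θ ∂gam := by
      apply gibp _ (iF θ) ((iF' θ).mul_const _) (iyF θ)
      intro y
      have h1 : HasDerivAt (fun y => ou x (θ, y)) (Real.sin θ) y := by
        unfold ou
        simpa using ((hasDerivAt_id y).mul_const (Real.sin θ)).const_add (x * Real.cos θ)
      exact (hF _).comp y h1
    have e1 : m' θ = ∫ y, ((-x * Real.sin θ) * F (ou x (θ, y)) + Real.cos θ * (y * F (ou x (θ, y)))) ∂gam := by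
      apply integral_congr_ae
      refine Filter.Eventually.of_forall fun y => ?_
      simp only
      ring
    rw [e1, integral_add ((iF θ).const_mul _) ((iyF θ).const_mul _), integral_const_mul, integral_const_mul, hib,
      integral_mul_const]
    ring
  have i1 : Integrable (fun z : ℝ × ℝ => Real.sin z.1 * F (ou x z)) (Th.prod gam) := sg_int hFc hlin x
  have i2 : Integrable (fun z : ℝ × ℝ => Real.sin z.1 * Real.cos z.1 * F' (ou x z)) (Th.prod gam) := sg1_int hc hK x
  have j1 := i1.integral_prod_left
  have j2 := i2.integral_prod_left
  simp only [integral_const_mul] at j1 j2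
  have hfun : m' = fun θ => x * (-(Real.sin θ * ∫ y, F (ou x (θ, y)) ∂gam)) +
      Real.sin θ * Real.cos θ * ∫ y, F' (ou x (θ, y)) ∂gam := funext hm'2
  have hmi : Integrable m' Th := by
    rw [hfun]
    exact (j1.neg.const_mul x).add j2
  have hpi : (0:ℝ) ≤ Real.pi / 2 := by positivity
  have ftc := intervalIntegral.integral_eq_sub_of_hasDerivAt (a := 0) (b := Real.pi / 2) (fun θ _ => hm θ)
    ((intervalIntegrable_iff_integrableOn_Ioc_of_le hpi).2 hmi)
  rw [intervalIntegral.integral_of_le hpi] at ftc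
  have hm0 : m 0 = f x := by simp [m, ou]
  have hm1 : m (Real.pi / 2) = ∫ y, f y ∂gam := by simp [m, ou]
  have e3 : ∫ θ in Set.Ioc 0 (Real.pi / 2), m' θ = x * sg F x - sg1 F' x := by
    have : ∫ θ in Set.Ioc 0 (Real.pi / 2), m' θ = ∫ θ, m' θ ∂Th := rfl
    have j1n : Integrable (fun θ => x * (-(Real.sin θ * ∫ y, F (ou x (θ, y)) ∂gam))) Th := j1.neg.const_mul x
    rw [this, hfun]
    simp only []
    rw [integral_add j1n j2, integral_const_mul, integral_neg]
    unfold sg sg1 P2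
    rw [integral_prod _ i1, integral_prod _ i2]
    simp only [integral_const_mul]
    ring
  rw [e3, hm0, hm1] at ftc
  linarith

/-- bundled smooth test function: `f' = F`, `F' = F1` bounded continuous -/
structure Tst (f F F1 : ℝ → ℝ) (K : ℝ) : Prop where
  d0 : ∀ x, HasDerivAt f (F x) x
  d1 : ∀ x, HasDerivAt F (F1 x) x
  c1 : Continuous F1
  b1 : ∀ x, |F1 x| ≤ K

variable {f F F1 : ℝ → ℝ} {K : ℝ}

lemma Tst.cF (h : Tst f F F1 K) : Continuous F := continuous_iff_continuousAt.2 fun x => (h.d1 x).continuousAt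
lemma Tst.cf (h : Tst f F F1 K) : Continuous f := continuous_iff_continuousAt.2 fun x => (h.d0 x).continuousAt
lemma Tst.K0 (h : Tst f F F1 K) : 0 ≤ K := (abs_nonneg _).trans (h.b1 0)

lemma Tst.dg (h : Tst f F F1 K) (x : ℝ) : HasDerivAt (sg F) (sg1 F1 x) x := sg_hasDeriv h.d1 h.c1 h.b1 x

lemma Tst.eq1 (h : Tst f F F1 K) : sg1 F1 = fun x => x * sg F x + (f x - ∫ y, f y ∂gam) := by
  funext x
  have := sg_ode h.d0 h.d1 h.c1 h.b1 x
  linarith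

lemma Tst.dg1 (h : Tst f F F1 K) (x : ℝ) : HasDerivAt (sg1 F1) (sg2 F F1 x) x := by
  rw [h.eq1]
  have := ((hasDerivAt_id x).mul (h.dg x)).add ((h.d0 x).sub_const (∫ y, f y ∂gam))
  convert! this using 1
  simp [sg2]

lemma Tst.dg2 (h : Tst f F F1 K) (x : ℝ) : HasDerivAt (sg2 F F1) (2 * sg1 F1 x + x * sg2 F F1 x + F1 x) x := by
  have := ((h.dg x).add ((hasDerivAt_id x).mul (h.dg1 x))).add (h.d1 x)
  convert! this using 1
  simp
  ring

lemma Tst.B1 (h : Tst f F F1 K) {K1 : ℝ} (hF : ∀ x, |F x| ≤ K1) (x : ℝ) : |sg2 F F1 x| ≤ 6 * K1 := by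
  have h1 := ode_bound (k := sg1 F1) (φ := fun x => sg F x + F x) (c := 3 * K1) (K := 2 * K)
    (fun x => by
      convert! h.dg1 x using 1
      simp [sg2]; ring)
    (fun x => by
      have := abs_add_le (sg F x) (F x)
      have h2 := sg_bound hF x
      have h3 := hF x
      linarith)
    (fun x => by
      have := sg1_bound h.b1 x
      have := h.K0
      nlinarith [abs_nonneg x]) x
  have h2 := sg_bound hF x
  have h3 := hF x
  unfold sg2
  have h4 := abs_add_le (sg F x + x * sg1 F1 x) (F x)
  have h5 := abs_add_le (sg F x) (x * sg1 F1 x)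
  linarith

lemma Tst.B2 (h : Tst f F F1 K) (x : ℝ) : |2 * sg1 F1 x + x * sg2 F F1 x + F1 x| ≤ 10 * K := by
  have hK := h.K0
  have gg := lin_growth h.dg (sg1_bound h.b1)
  have gF := lin_growth h.d1 h.b1
  have h1 := ode_bound (k := sg2 F F1) (φ := fun x => 2 * sg1 F1 x + F1 x) (c := 5 * K)
    (K := |sg F 0| + |F 0| + 5 * K)
    (fun x => by
      convert! h.dg2 x using 1
      ring)
    (fun x => by
      have h0 := abs_add_le (2 * sg1 F1 x) (F1 x)
      rw [abs_mul, abs_two] at h0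
      have h2 := sg1_bound h.b1 x
      have h3 := h.b1 x
      linarith)
    (fun x => by
      unfold sg2
      have h4 := abs_add_le (sg F x + x * sg1 F1 x) (F x)
      have h5 := abs_add_le (sg F x) (x * sg1 F1 x)
      rw [abs_mul] at h5
      have h6 := sg1_bound h.b1 x
      have h7 := gg x
      have h8 := gF x
      nlinarith [abs_nonneg x, abs_nonneg (sg F 0), abs_nonneg (F 0),
        mul_nonneg (abs_nonneg x) (abs_nonneg (sg F 0)), mul_nonneg (abs_nonneg x) (abs_nonneg (F 0)),
        mul_le_mul_of_nonneg_left h6 (abs_nonneg x)]) x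
  have h2 := sg1_bound h.b1 x
  have h3 := h.b1 x
  have h4 := abs_add_le (2 * sg1 F1 x + x * sg2 F F1 x) (F1 x)
  have h5 := abs_add_le (2 * sg1 F1 x) (x * sg2 F F1 x)
  rw [abs_mul 2, abs_two] at h5
  linarith

end SJ

namespace SJ

variable {f F F1 : ℝ → ℝ} {K : ℝ}

lemma sg2_add {F G F1 G1 : ℝ → ℝ} {f g : ℝ → ℝ} {K L : ℝ} (h : Tst f F F1 K) (k : Tst g G G1 L) (x : ℝ) :
    sg2 (fun x => F x + G x) (fun x => F1 x + G1 x) x = sg2 F F1 x + sg2 G G1 x := by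
  unfold sg2 sg sg1
  simp only [mul_add]
  rw [integral_add (sg_int h.cF (lin_growth h.d1 h.b1) x) (sg_int k.cF (lin_growth k.d1 k.b1) x),
    integral_add (sg1_int h.c1 h.b1 x) (sg1_int k.c1 k.b1 x)]
  ring

/-- Moving average of a test function -/
lemma avg_tst {f F : ℝ → ℝ} (hf : ∀ x, HasDerivAt f (F x) x) (hc : Continuous F) {g : ℝ → ℝ}
    (hg : ∀ x, HasDerivAt g (f x) x) {η : ℝ} {L : ℝ}
    (hL : ∀ x, |(F (x + η) - F x) / η| ≤ L) :
    Tst (fun x => (g (x + η) - g x) / η) (fun x => (f (x + η) - f x) / η) (fun x => (F (x + η) - F x) / η) L where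
  d0 := fun x => by
    have h1 : HasDerivAt (fun x => g (x + η)) (f (x + η)) x := by
      exact (hg (x + η)).comp_add_const x η
    exact (h1.sub (hg x)).div_const η
  d1 := fun x => by
    have h1 : HasDerivAt (fun x => f (x + η)) (F (x + η)) x := by
      exact (hf (x + η)).comp_add_const x η
    exact (h1.sub (hf x)).div_const η
  c1 := by fun_prop
  b1 := hL

/-- `|(f(x+η)-f(x))/η - F x| ≤ B` if `|F(y) - F(x)| ≤ B` near. -/
lemma avg_close {f F : ℝ → ℝ} (hf : ∀ x, HasDerivAt f (F x) x) {η : ℝ} (hη : 0 < η) {B : ℝ} (x : ℝ) (c : ℝ)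
    (hB : ∀ y, x ≤ y → y ≤ x + η → |F y - c| ≤ B) : |(f (x + η) - f x) / η - c| ≤ B := by
  have h := Convex.norm_image_sub_le_of_norm_hasDerivWithin_le (f := fun y => f y - c * y)
    (f' := fun y => F y - c) (C := B)
    (s := Set.Icc x (x + η))
    (x := x) (y := x + η) (fun z _ => by
      have := (hf z).sub ((hasDerivAt_id z).const_mul c)
      simp only [id, mul_one] at this
      exact this.hasDerivWithinAt) (fun z hz => hB z hz.1 hz.2) (convex_Icc _ _)
      (by simp [hη.le]) (by simp [hη.le])
  simp only [Real.norm_eq_abs] at h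
  have e : (f (x + η) - f x) / η - c = (f (x + η) - c * (x + η) - (f x - c * x)) / η := by
    field_simp
    ring
  rw [e, abs_div, abs_of_pos hη, div_le_iff₀ hη]
  have : |x + η - x| = η := by rw [add_sub_cancel_left, abs_of_pos hη]
  rwa [this] at h

lemma exists_prim {f : ℝ → ℝ} (hc : Continuous f) : ∃ g : ℝ → ℝ, ∀ x, HasDerivAt g (f x) x :=
  ⟨fun x => ∫ t in (0:ℝ)..x, f t, fun x => intervalIntegral.integral_hasDerivAt_right
    (hc.intervalIntegrable _ _) (hc.stronglyMeasurableAtFilter _ _) hc.continuousAt⟩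

lemma Tst.lip2 (h : Tst f F F1 K) (x y : ℝ) : |sg2 F F1 x - sg2 F F1 y| ≤ 10 * K * |x - y| := by
  have := Convex.norm_image_sub_le_of_norm_hasDerivWithin_le (f := sg2 F F1) (C := 10 * K) (s := Set.univ)
    (x := y) (y := x) (fun z _ => (h.dg2 z).hasDerivWithinAt) (fun z _ => h.B2 z) convex_univ trivial trivial
  simpa using this

lemma Tst.holder (h : Tst f F F1 K) {H α : ℝ} (hα : 0 < α)
    (hH : ∀ x y, |F x - F y| ≤ H * |x - y| ^ α) (x y : ℝ) :
    |sg2 F F1 x - sg2 F F1 y| ≤ 22 * H * |x - y| ^ α := by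
  rcases eq_or_ne x y with rfl | hne
  · simp [Real.zero_rpow hα.ne']
  set η := |x - y| with hηd
  have hη : 0 < η := abs_pos.2 (sub_ne_zero.2 hne)
  have hH0 : 0 ≤ H := by
    have := (abs_nonneg _).trans (hH 0 1)
    simpa using this
  obtain ⟨g, hg⟩ := exists_prim h.cf
  have hL : ∀ x, |(F (x + η) - F x) / η| ≤ H * η ^ (α - 1) := fun x => by
    rw [abs_div, abs_of_pos hη, div_le_iff₀ hη, mul_assoc, ← Real.rpow_add_one hη.ne']
    have := hH (x + η) x
    rw [add_sub_cancel_left, abs_of_pos hη] at this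
    simpa using this
  have t1 := avg_tst h.d0 h.cF hg hL
  have t0 : Tst (fun x => f x - (g (x + η) - g x) / η) (fun x => F x - (f (x + η) - f x) / η)
      (fun x => F1 x - (F (x + η) - F x) / η) (K + H * η ^ (α - 1)) :=
    { d0 := fun x => (h.d0 x).sub (t1.d0 x)
      d1 := fun x => (h.d1 x).sub (t1.d1 x)
      c1 := h.c1.sub t1.c1
      b1 := fun x => (abs_sub _ _).trans (add_le_add (h.b1 x) (hL x)) }
  have b0 : ∀ x, |F x - (f (x + η) - f x) / η| ≤ H * η ^ α := fun x => by
    rw [abs_sub_comm]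
    refine avg_close h.d0 hη x (F x) fun y hy1 hy2 => ?_
    refine (hH y x).trans ?_
    gcongr
    rw [abs_of_nonneg] <;> linarith
  have add := fun x => sg2_add t0 t1 x
  simp only [sub_add_cancel] at add
  have e : ∀ x, sg2 F F1 x = _ := add
  rw [e x, e y]
  have q0x := t0.B1 b0 x
  have q0y := t0.B1 b0 y
  have q1 := t1.lip2 x y
  rw [← hηd, mul_assoc, mul_assoc, ← Real.rpow_add_one hη.ne', sub_add_cancel] at q1
  rw [abs_le] at *
  constructor <;> linarith [q0x.1, q0x.2, q0y.1, q0y.2, q1.1, q1.2]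

/-- Stein identity for the small jump law (variance one) -/
lemma Tst.stein (h : Tst f F F1 K) {κ μ : Measure ℝ} {R : ℝ} (hs : IsSJ κ μ 1 R) :
    Integrable f μ ∧ Integrable (sg1 F1) μ ∧
    Integrable (fun z : ℝ × ℝ × ℝ => sg1 F1 (z.1 + z.2.1 * z.2.2)) (μ.prod (unif.prod κ)) ∧
    ∫ x, f x ∂μ - ∫ x, f x ∂gam = ∫ x, sg1 F1 x ∂μ -
      ∫ z, sg1 F1 (z.1 + z.2.1 * z.2.2) ∂(μ.prod (unif.prod κ)) := by
  have := hs.pμ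
  have := hs.pκ
  have hc1 : Continuous (sg1 F1) := continuous_iff_continuousAt.2 fun x => (h.dg1 x).continuousAt
  have hc0 : Continuous (sg F) := continuous_iff_continuousAt.2 fun x => (h.dg x).continuousAt
  have zb := hs.zero_bias (sg F) (sg1 F1) h.dg hc1 (2 * K) (sg1_bound h.b1)
  have i1 : Integrable (sg1 F1) μ := (integrable_const (2*K)).mono' hc1.aestronglyMeasurable
    (Filter.Eventually.of_forall fun x => sg1_bound h.b1 x)
  have gg := lin_growth h.dg (sg1_bound h.b1)
  have i0 : Integrable (fun x => x * sg F x) μ := by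
    refine ((hs.int_id.norm.const_mul (|sg F 0|)).add (hs.sq_int.const_mul (2 * K))).mono'
      (by fun_prop) (Filter.Eventually.of_forall fun x => ?_)
    have := gg x
    simp only [Real.norm_eq_abs, abs_mul, Pi.add_apply]
    have e : x ^ 2 = |x| * |x| := by rw [← sq, sq_abs]
    rw [e]
    nlinarith [abs_nonneg x]
  have e : f = fun x => (sg1 F1 x - x * sg F x) + ∫ y, f y ∂gam := by
    funext x
    rw [h.eq1]; ring
  refine ⟨?_, i1, ?_, ?_⟩
  · rw [e]
    exact (i1.sub i0).add (integrable_const _)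
  · exact (integrable_const (2*K)).mono' (Continuous.aestronglyMeasurable (by fun_prop))
      (Filter.Eventually.of_forall fun x => sg1_bound h.b1 _)
  · have e2 : ∫ x, f x ∂μ = ∫ x, ((sg1 F1 x - x * sg F x) + ∫ y, f y ∂gam) ∂μ := by
      conv_lhs => rw [e]
    have i10 : Integrable (fun x => sg1 F1 x - x * sg F x) μ := i1.sub i0
    rw [e2, integral_add i10 (integrable_const _), integral_sub i1 i0, zb, integral_const]
    simp

end SJ

namespace SJ

variable {f F F1 : ℝ → ℝ} {K : ℝ}

lemma gint' {h : ℝ → ℝ} (hm : Continuous h) (K : ℝ) (n : ℕ) (hb : ∀ y, |h y| ≤ K * (1 + |y|) ^ n) :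
    Integrable h gam := gint hm.aestronglyMeasurable K n hb

/-- The Hermite identity `E F(N)(N^2-1) = -3 E g''(N)`. -/
lemma Tst.hermite (h : Tst f F F1 K) :
    ∫ y, F y * (y ^ 2 - 1) ∂gam = -3 * ∫ y, sg2 F F1 y ∂gam := by
  have hK := h.K0
  have hc1 : Continuous (sg1 F1) := continuous_iff_continuousAt.2 fun x => (h.dg1 x).continuousAt
  have hc0 : Continuous (sg F) := continuous_iff_continuousAt.2 fun x => (h.dg x).continuousAt
  have hc2 : Continuous (sg2 F F1) := continuous_iff_continuousAt.2 fun x => (h.dg2 x).continuousAt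
  have g0 : ∀ x, |sg F x| ≤ (|sg F 0| + 2 * K) * (1 + |x|) ^ 1 := fun x => by
    refine (lin_growth h.dg (sg1_bound h.b1) x).trans ?_
    nlinarith [abs_nonneg x, abs_nonneg (sg F 0), mul_nonneg (abs_nonneg (sg F 0)) (abs_nonneg x)]
  have gF : ∀ x, |F x| ≤ (|F 0| + K) * (1 + |x|) ^ 1 := fun x => by
    refine (lin_growth h.d1 h.b1 x).trans ?_
    nlinarith [abs_nonneg x, abs_nonneg (F 0), mul_nonneg (abs_nonneg (F 0)) (abs_nonneg x)]
  have g1 : ∀ x, |sg1 F1 x| ≤ (2 * K) * (1 + |x|) ^ 0 := fun x => by simpa using sg1_bound h.b1 x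
  have g2 : ∀ x, |sg2 F F1 x| ≤ (|sg2 F F1 0| + 10 * K) * (1 + |x|) ^ 1 := fun x => by
    refine (lin_growth h.dg2 h.B2 x).trans ?_
    nlinarith [abs_nonneg x, abs_nonneg (sg2 F F1 0), mul_nonneg (abs_nonneg (sg2 F F1 0)) (abs_nonneg x)]
  have mulint : ∀ {u : ℝ → ℝ} {A : ℝ} {n : ℕ}, Continuous u → (∀ x, |u x| ≤ A * (1 + |x|) ^ n) →
      ∀ k : ℕ, Integrable (fun y => y ^ k * u y) gam := by
    intro u A n hu hb k
    refine gint' (by fun_prop) A (n + k) (fun y => ?_)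
    rw [abs_mul, abs_pow]
    have h1 : |y| ^ k ≤ (1 + |y|) ^ k := by gcongr; linarith
    calc _ ≤ (1 + |y|) ^ k * (A * (1 + |y|) ^ n) := by
          gcongr
          exact hb y
      _ = _ := by ring
  have i0 := fun k => mulint hc0 g0 k
  have i1 := fun k => mulint hc1 g1 k
  have i2 := fun k => mulint hc2 g2 k
  have iF := fun k => mulint h.cF gF k
  -- E[g''] = E[N g']
  have A1 : ∫ y, y ^ 1 * sg1 F1 y ∂gam = ∫ y, y ^ 0 * sg2 F F1 y ∂gam := by
    simpa using gibp h.dg1 (by simpa using i1 0) (by simpa using i2 0) (by simpa using i1 1)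
  -- E[N (N g)] = E[g + N g']
  have A2 : ∫ y, y ^ 2 * sg F y ∂gam = ∫ y, y ^ 0 * sg F y ∂gam + ∫ y, y ^ 1 * sg1 F1 y ∂gam := by
    rw [← integral_add (i0 0) (i1 1)]
    have := gibp (h := fun y => y ^ 1 * sg F y) (h' := fun y => y ^ 0 * sg F y + y ^ 1 * sg1 F1 y) (fun y => by
      have := (hasDerivAt_id y).mul (h.dg y)
      convert! this using 1
      · funext z; simp
      · simp) (i0 1) ((i0 0).add (i1 1)) (by convert! i0 2 using 2; ring)
    rw [← this]
    congr 1
    funext y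
    ring
  -- from the ODE:  F = g'' - g - x g'
  have eF : ∀ y, F y * (y ^ 2 - 1) = (y ^ 2 * sg2 F F1 y - y ^ 0 * sg2 F F1 y) - (y ^ 2 * sg F y - y ^ 0 * sg F y)
      - (y ^ 3 * sg1 F1 y - y ^ 1 * sg1 F1 y) := fun y => by
    unfold sg2; ring
  simp_rw [eF]
  have j1 : Integrable (fun y => y ^ 2 * sg2 F F1 y - y ^ 0 * sg2 F F1 y) gam := (i2 2).sub (i2 0)
  have j2 : Integrable (fun y => y ^ 2 * sg F y - y ^ 0 * sg F y) gam := (i0 2).sub (i0 0)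
  have j3 : Integrable (fun y => y ^ 3 * sg1 F1 y - y ^ 1 * sg1 F1 y) gam := (i1 3).sub (i1 1)
  have j4 : Integrable (fun y => y ^ 2 * sg2 F F1 y - y ^ 0 * sg2 F F1 y - (y ^ 2 * sg F y - y ^ 0 * sg F y)) gam := j1.sub j2
  rw [integral_sub j4 j3, integral_sub j1 j2, integral_sub (i2 2) (i2 0), integral_sub (i0 2) (i0 0),
    integral_sub (i1 3) (i1 1)]
  -- E[N (N^2 g')] = E[2 N g' + N^2 g'']
  have A3 : ∫ y, y ^ 3 * sg1 F1 y ∂gam = 2 * ∫ y, y ^ 1 * sg1 F1 y ∂gam + ∫ y, y ^ 2 * sg2 F F1 y ∂gam := by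
    rw [← integral_const_mul, ← integral_add ((i1 1).const_mul 2) (i2 2)]
    have := gibp (h := fun y => y ^ 2 * sg1 F1 y) (h' := fun y => 2 * (y ^ 1 * sg1 F1 y) + y ^ 2 * sg2 F F1 y)
      (fun y => by
      have := (hasDerivAt_pow 2 y).mul (h.dg1 y)
      convert! this using 1
      simp
      ring) (i1 2) (((i1 1).const_mul 2).add (i2 2)) (by convert! i1 3 using 2; ring)
    rw [← this]
    congr 1
    funext y
    ring
  simp only [pow_zero, one_mul] at *
  linarith

lemma Tst.gamInt (h : Tst f F F1 K) : Integrable f gam := by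
  have hK := h.K0
  refine gint' h.cf (|f 0| + |F 0| + K) 2 fun y => ?_
  refine (quad_growth h.d0 h.d1 h.b1 y).trans ?_
  nlinarith [abs_nonneg (f 0), abs_nonneg (F 0), mul_nonneg (abs_nonneg (f 0)) (abs_nonneg y),
        mul_nonneg (abs_nonneg (F 0)) (abs_nonneg y), mul_nonneg hK (abs_nonneg y),
        mul_nonneg (mul_nonneg (abs_nonneg (f 0)) (abs_nonneg y)) (abs_nonneg y),
        mul_nonneg (mul_nonneg (abs_nonneg (F 0)) (abs_nonneg y)) (abs_nonneg y)]

end SJ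

namespace SJ

variable {f F F1 : ℝ → ℝ} {K : ℝ} {κ μ : Measure ℝ} {v R : ℝ}

lemma IsSJ.kint (hs : IsSJ κ μ v R) {h : ℝ → ℝ} (hm : Continuous h) : Integrable h κ := by
  have := hs.pκ
  obtain ⟨C, hC⟩ := (isCompact_Icc (a := -R) (b := R)).exists_bound_of_continuousOn hm.continuousOn
  refine (integrable_const C).mono' hm.aestronglyMeasurable ?_
  filter_upwards [hs.supp] with y hy
  exact hC y (abs_le.1 hy)

lemma unif_mem : ∀ᵐ u ∂unif, u ∈ Set.Ioo (0:ℝ) 1 := by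
  unfold unif
  exact ae_restrict_mem measurableSet_Ioo

lemma unif_int_id : Integrable (fun u : ℝ => u) unif := by
  refine (integrable_const (1:ℝ)).mono' (by fun_prop) ?_
  filter_upwards [unif_mem] with u hu
  rw [Real.norm_eq_abs, abs_of_pos hu.1]
  exact hu.2.le

lemma unif_mean : ∫ u, u ∂unif = 1 / 2 := by
  unfold unif
  rw [← integral_Ioc_eq_integral_Ioo, ← intervalIntegral.integral_of_le zero_le_one, integral_id]
  norm_num

lemma IsSJ.prod_mem (hs : IsSJ κ μ v R) : ∀ᵐ z ∂(μ.prod (unif.prod κ)), z.2.1 ∈ Set.Ioo (0:ℝ) 1 := by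
  have := hs.pκ
  have := hs.pμ
  have h1 : ∀ᵐ w ∂(unif.prod κ), w.1 ∈ Set.Ioo (0:ℝ) 1 :=
    Measure.quasiMeasurePreserving_fst.ae unif_mem
  exact Measure.quasiMeasurePreserving_snd.ae h1

lemma IsSJ.int_prod_k (hs : IsSJ κ μ v R) {h : ℝ → ℝ} (hm : Continuous h) :
    Integrable (fun z : ℝ × ℝ × ℝ => h z.2.2) (μ.prod (unif.prod κ)) ∧
    ∫ z : ℝ × ℝ × ℝ, h z.2.2 ∂(μ.prod (unif.prod κ)) = ∫ y, h y ∂κ := by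
  have := hs.pκ
  have := hs.pμ
  refine ⟨((hs.kint hm).comp_snd unif).comp_snd μ, ?_⟩
  rw [integral_fun_snd (μ := μ) (ν := unif.prod κ) (fun w : ℝ × ℝ => h w.2), integral_fun_snd]
  simp

lemma IsSJ.int_prod_m (hs : IsSJ κ μ v R) {h : ℝ → ℝ} (hm : Integrable h μ) :
    Integrable (fun z : ℝ × ℝ × ℝ => h z.1) (μ.prod (unif.prod κ)) ∧
    ∫ z : ℝ × ℝ × ℝ, h z.1 ∂(μ.prod (unif.prod κ)) = ∫ y, h y ∂μ := by
  have := hs.pκ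
  have := hs.pμ
  refine ⟨hm.comp_fst _, ?_⟩
  rw [integral_fun_fst]
  simp

lemma Tst.stein_B1 (h : Tst f F F1 K) (hs : IsSJ κ μ 1 R) {K1 : ℝ} (hF : ∀ x, |F x| ≤ K1) :
    |∫ x, f x ∂μ - ∫ x, f x ∂gam| ≤ 6 * K1 * ∫ y, |y| ∂κ := by
  obtain ⟨i0, i1, i2, e⟩ := h.stein hs
  have hK1 := (abs_nonneg _).trans (hF 0)
  have m1 := hs.int_prod_m i1
  have k1 := hs.int_prod_k (h := fun y => |y|) (by fun_prop)
  rw [e, ← m1.2, ← integral_sub m1.1 i2, ← k1.2, ← integral_const_mul, ← Real.norm_eq_abs]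
  refine norm_integral_le_of_norm_le (k1.1.const_mul _) ?_
  filter_upwards [hs.prod_mem] with z hz
  have := Convex.norm_image_sub_le_of_norm_hasDerivWithin_le (f := sg1 F1) (C := 6 * K1) (s := Set.univ)
    (x := z.1 + z.2.1 * z.2.2) (y := z.1) (fun z _ => (h.dg1 z).hasDerivWithinAt) (fun z _ => h.B1 hF z)
    convex_univ trivial trivial
  refine this.trans ?_
  gcongr
  rw [sub_add_cancel_left, norm_neg, Real.norm_eq_abs, abs_mul, abs_of_pos hz.1]
  nlinarith [hz.2, abs_nonneg z.2.2]

lemma Tst.g2_int (h : Tst f F F1 K) (hs : IsSJ κ μ v R) : Integrable (sg2 F F1) μ := by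
  have := hs.pμ
  have hc2 : Continuous (sg2 F F1) := continuous_iff_continuousAt.2 fun x => (h.dg2 x).continuousAt
  refine ((integrable_const (|sg2 F F1 0|)).add (hs.int_id.norm.const_mul (10 * K))).mono' hc2.aestronglyMeasurable
    (Filter.Eventually.of_forall fun x => lin_growth h.dg2 h.B2 x)

lemma Tst.stein_holder (h : Tst f F F1 K) (hs : IsSJ κ μ 1 R) {H p : ℝ} (hp : 1 < p)
    (hH : ∀ x y, |F x - F y| ≤ H * |x - y| ^ (p - 1)) :
    |(∫ x, f x ∂μ - ∫ x, f x ∂gam) + (∫ y, y ∂κ) / 2 * ∫ x, sg2 F F1 x ∂μ| ≤ 22 * H * ∫ y, |y| ^ p ∂κ := by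
  obtain ⟨i0, i1, i2, e⟩ := h.stein hs
  have := hs.pκ
  have := hs.pμ
  have hH0 : 0 ≤ H := by
    have := (abs_nonneg _).trans (hH 0 1)
    simpa using this
  have m1 := hs.int_prod_m i1
  have k1 := hs.int_prod_k (h := fun y => |y| ^ p) (by
    exact continuous_abs.rpow_const (fun x => Or.inr (by linarith)))
  have iy : Integrable (fun y : ℝ => y) κ := hs.kint continuous_id
  have iuy : Integrable (fun w : ℝ × ℝ => w.1 * w.2) (unif.prod κ) := unif_int_id.mul_prod iy
  have i3 : Integrable (fun z : ℝ × ℝ × ℝ => sg2 F F1 z.1 * (z.2.1 * z.2.2)) (μ.prod (unif.prod κ)) :=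
    (h.g2_int hs).mul_prod iuy
  have e3 : ∫ z : ℝ × ℝ × ℝ, sg2 F F1 z.1 * (z.2.1 * z.2.2) ∂(μ.prod (unif.prod κ)) =
      (∫ y, y ∂κ) / 2 * ∫ x, sg2 F F1 x ∂μ := by
    rw [integral_prod_mul (μ := μ) (ν := unif.prod κ) (sg2 F F1) (fun w : ℝ × ℝ => w.1 * w.2),
      integral_prod_mul (μ := unif) (ν := κ) (fun u => u) (fun y => y), unif_mean]
    ring
  have i4 : Integrable (fun z : ℝ × ℝ × ℝ => sg1 F1 z.1 - sg1 F1 (z.1 + z.2.1 * z.2.2)) (μ.prod (unif.prod κ)) :=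
    m1.1.sub i2
  rw [e, ← e3, ← m1.2, ← integral_sub m1.1 i2, ← integral_add i4 i3, ← k1.2, ← integral_const_mul,
    ← Real.norm_eq_abs]
  refine norm_integral_le_of_norm_le (k1.1.const_mul _) ?_
  filter_upwards [hs.prod_mem] with z hz
  set x := z.1
  set w := z.2.1 * z.2.2 with hw
  have hwy : |w| ≤ |z.2.2| := by
    rw [hw, abs_mul, abs_of_pos hz.1]
    nlinarith [hz.2, abs_nonneg z.2.2]
  have := Convex.norm_image_sub_le_of_norm_hasDerivWithin_le (f := fun t => sg1 F1 t - sg2 F F1 x * t)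
    (f' := fun t => sg2 F F1 t - sg2 F F1 x)
    (C := 22 * H * |w| ^ (p - 1)) (s := Set.Icc (x - |w|) (x + |w|))
    (x := x + w) (y := x) (fun z _ => by
      have := (h.dg1 z).sub ((hasDerivAt_id z).const_mul (sg2 F F1 x))
      simp only [id, mul_one] at this
      exact this.hasDerivWithinAt) (fun z hz => by
        refine (h.holder (by linarith : 0 < p - 1) hH z x).trans ?_
        have hzw : |z - x| ≤ |w| := by
          rw [abs_le]
          constructor <;> linarith [hz.1, hz.2]
        have : |z - x| ^ (p - 1) ≤ |w| ^ (p - 1) := Real.rpow_le_rpow (abs_nonneg _) hzw (by linarith)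
        gcongr)
    (convex_Icc _ _) ⟨by linarith [neg_abs_le w], by linarith [le_abs_self w]⟩
    ⟨by linarith [abs_nonneg w], by linarith [abs_nonneg w]⟩
  have e5 : sg1 F1 x - sg1 F1 (x + w) + sg2 F F1 x * w =
    (sg1 F1 x - sg2 F F1 x * x) - (sg1 F1 (x + w) - sg2 F F1 x * (x + w)) := by ring
  rw [e5]
  refine this.trans ?_
  rw [sub_add_cancel_left, norm_neg, Real.norm_eq_abs, mul_assoc]
  gcongr
  rcases eq_or_ne w 0 with h0 | h0
  · rw [h0]; simp; positivity
  · rw [← Real.rpow_add_one (abs_pos.2 h0).ne', sub_add_cancel]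
    gcongr

end SJ

namespace SJ

variable {f F F1 : ℝ → ℝ} {K : ℝ} {κ μ : Measure ℝ} {v R : ℝ}

lemma qf_int (μ : Measure ℝ) [IsProbabilityMeasure μ] {h : ℝ → ℝ} (hi : Integrable h μ) :
    Integrable (fun u => h (qf μ u)) unif := by
  rw [← map_qf μ] at hi
  exact hi.comp_aemeasurable (qf_aemeasurable μ)

lemma qf_integral (μ : Measure ℝ) [IsProbabilityMeasure μ] {h : ℝ → ℝ} (hi : AEStronglyMeasurable h μ) :
    ∫ u, h (qf μ u) ∂unif = ∫ x, h x ∂μ := by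
  conv_rhs => rw [← map_qf μ]
  rw [integral_map (qf_aemeasurable μ)]
  rwa [map_qf μ]

lemma prim_hasDeriv {F : ℝ → ℝ} (hc : Continuous F) (x : ℝ) :
    HasDerivAt (fun x => ∫ t in (0:ℝ)..x, F t) (F x) x := intervalIntegral.integral_hasDerivAt_right
    (hc.intervalIntegrable _ _) (hc.stronglyMeasurableAtFilter _ _) hc.continuousAt

lemma gam_int_id : Integrable (fun y : ℝ => y) gam :=
  gint' continuous_id 1 1 (fun y => by simp)

lemma gam_int_pow (k : ℕ) : Integrable (fun y : ℝ => (1 + |y|) ^ k) gam :=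
  gint' (by fun_prop) 1 k (fun y => by rw [abs_of_nonneg (by positivity)]; simp)

/-- Order one bound -/
lemma w1_bound (hs : IsSJ κ μ 1 R) : ∫ u, |qf μ u - qf gam u| ∂unif ≤ 6 * ∫ y, |y| ∂κ := by
  have := hs.pκ
  have := hs.pμ
  set a := qf μ with ha_def
  set b := qf gam with hb_def
  have ha : MonotoneOn a (Set.Ioo 0 1) := qf_mono μ
  have hb : MonotoneOn b (Set.Ioo 0 1) := qf_mono gam
  have ia : Integrable a unif := qf_int μ hs.int_id
  have ib : Integrable b unif := qf_int gam gam_int_id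
  have iab : Integrable (fun u => |a u - b u|) unif := (ia.sub ib).abs
  have key : ∀ η : ℝ, 0 < η → ∫ u, |a u - b u| ∂unif ≤ 6 * ∫ y, |y| ∂κ + 4 * η := by
    intro η hη
    set F : ℝ → ℝ := zt (fun s => min (s / η) 1) a b with hF
    have hFc : Continuous F := zt_continuous ha hb (by fun_prop)
    have hFb : ∀ x, |F x| ≤ 1 := fun x => zt_one_bdd hη x
    set f : ℝ → ℝ := fun x => ∫ t in (0:ℝ)..x, F t with hf
    have hfd : ∀ x, HasDerivAt f (F x) x := prim_hasDeriv hFc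
    have hfc : Continuous f := continuous_iff_continuousAt.2 fun x => (hfd x).continuousAt
    obtain ⟨g, hg⟩ := exists_prim hfc
    have hL : ∀ x, |(F (x + η) - F x) / η| ≤ 2 / η := fun x => by
      rw [abs_div, abs_of_pos hη]
      gcongr
      have := abs_sub (F (x + η)) (F x)
      linarith [hFb x, hFb (x + η)]
    have t := avg_tst hfd hFc hg hL
    have tb : ∀ x, |(f (x + η) - f x) / η| ≤ 1 := fun x => by
      have := avg_close hfd hη (B := 1) x 0 (fun y _ _ => by simpa using hFb y)
      simpa using this
    have s1 := t.stein_B1 hs tb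
    have i1 := (t.stein hs).1
    have i2 := t.gamInt
    have close : ∀ x, |(g (x + η) - g x) / η - f x| ≤ η := fun x => by
      refine avg_close hg hη x (f x) fun y h1 h2 => ?_
      have := Convex.norm_image_sub_le_of_norm_hasDerivWithin_le (f := f) (C := 1) (s := Set.univ)
        (x := x) (y := y) (fun z _ => (hfd z).hasDerivWithinAt) (fun z _ => hFb z) convex_univ trivial trivial
      rw [Real.norm_eq_abs, Real.norm_eq_abs, abs_of_nonneg (by linarith : 0 ≤ y - x)] at this
      linarith
    have j1 := qf_int μ i1
    have j2 := qf_int gam i2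
    rw [← qf_integral μ i1.aestronglyMeasurable, ← qf_integral gam i2.aestronglyMeasurable,
      ← integral_sub j1 j2] at s1
    have s2 : ∫ u, |a u - b u| ∂unif ≤ ∫ u, (((g (a u + η) - g (a u)) / η - (g (b u + η) - g (b u)) / η) + 4 * η) ∂unif := by
      refine integral_mono_ae iab ((j1.sub j2).add (integrable_const _)) ?_
      filter_upwards [unif_mem] with u hu
      have r := rio_one ha hb hη hu
      have c1 := abs_le.1 (close (a u))
      have c2 := abs_le.1 (close (b u))
      change |a u - b u| - 2 * η ≤ f (a u) - f (b u) at r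
      linarith [c1.1, c2.2]
    have j3 : Integrable (fun u => ((g (a u + η) - g (a u)) / η - (g (b u + η) - g (b u)) / η)) unif := j1.sub j2
    rw [integral_add j3 (integrable_const _)] at s2
    have s3 := (abs_le.1 s1).2
    simp only [integral_const, probReal_univ, one_smul] at s2
    linarith
  refine le_of_forall_pos_le_add fun ε hε => ?_
  have := key (ε / 4) (by linarith)
  linarith

end SJ

namespace SJ

variable {f F F1 : ℝ → ℝ} {K : ℝ} {κ μ : Measure ℝ} {v R : ℝ}

lemma cont_rpow {p : ℝ} (hp : 0 ≤ p) : Continuous fun y : ℝ => |y| ^ p :=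
  continuous_abs.rpow_const (fun _ => Or.inr hp)

lemma rpow_le_sq {p : ℝ} (h0 : 0 ≤ p) (h2 : p ≤ 2) (z : ℝ) : |z| ^ p ≤ 1 + z ^ 2 := by
  rcases le_total |z| 1 with h | h
  · have := Real.rpow_le_one (abs_nonneg z) h h0
    nlinarith [sq_nonneg z]
  · have := Real.rpow_le_rpow_of_exponent_le h h2
    rw [Real.rpow_two, sq_abs] at this
    linarith

lemma IsSJ.jensen (hs : IsSJ κ μ v R) {p : ℝ} (hp : 1 ≤ p) : (∫ y, |y| ∂κ) ^ p ≤ ∫ y, |y| ^ p ∂κ := by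
  have := hs.pκ
  have := (convexOn_rpow hp).map_integral_le (μ := κ) (f := fun y => |y|)
    (Real.continuous_rpow_const (by linarith)).continuousOn isClosed_Ici
    (Filter.Eventually.of_forall fun y => abs_nonneg y) (hs.kint (by fun_prop))
    (hs.kint (cont_rpow (by linarith)))
  exact this

noncomputable def C6 : ℝ := ∫ y, (1 + |y|) ^ 6 ∂gam

lemma C6_nonneg : 0 ≤ C6 := integral_nonneg fun y => by positivity

noncomputable def TT (b x : ℝ) : ℝ := x + (b * (x ^ 2 - 1) + b ^ 2 * x ^ 3)

lemma TT_mono (b : ℝ) : Monotone (TT b) := by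
  intro x y hxy
  unfold TT
  have : 0 ≤ (y - x) * (1 + b * (x + y) + b ^ 2 * (x ^ 2 + x * y + y ^ 2)) := by
    apply mul_nonneg (by linarith)
    nlinarith [sq_nonneg (2 + b * (x + y)), sq_nonneg (b * (x - y)), sq_nonneg (b * (x + y))]
  nlinarith

lemma TT_sub_le {b : ℝ} (hb : |b| ≤ 1) (x : ℝ) : |TT b x - x| ≤ |b| * (1 + |x|) ^ 3 := by
  unfold TT
  rw [add_sub_cancel_left]
  refine (abs_add_le _ _).trans ?_
  rw [abs_mul, abs_mul, abs_pow, abs_pow]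
  have h1 : |x ^ 2 - 1| ≤ |x| ^ 2 + 1 := by
    rw [sq_abs]
    rw [abs_le]; constructor <;> nlinarith [sq_nonneg x]
  have h2 : |b| ^ 2 ≤ |b| := by nlinarith [abs_nonneg b]
  have h3 : 0 ≤ |x| := abs_nonneg x
  calc |b| * |x ^ 2 - 1| + |b| ^ 2 * |x| ^ 3 ≤ |b| * (|x| ^ 2 + 1) + |b| * |x| ^ 3 := by gcongr
    _ ≤ |b| * (1 + |x|) ^ 3 := by
      have : 0 ≤ |b| * (|x| * (2 * |x| + 3)) := by positivity
      nlinarith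

/-- Bound of the test function difference between the law and the skewed Gaussian -/
lemma Tst.core (h : Tst f F F1 K) (hs : IsSJ κ μ 1 R) {H p b : ℝ} (hp : 1 < p) (hp2 : p ≤ 2)
    (hH : ∀ x y, |F x - F y| ≤ H * |x - y| ^ (p - 1)) (hb : b = (∫ y, y ∂κ) / 6) (hb1 : |b| ≤ 1) :
    Integrable (fun y => f (TT b y)) gam ∧
    |∫ x, f x ∂μ - ∫ y, f (TT b y) ∂gam| ≤ (88 + 2 * C6) * H * ∫ y, |y| ^ p ∂κ := by
  have := hs.pκ
  have := hs.pμ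
  have hH0 : 0 ≤ H := by
    have := (abs_nonneg _).trans (hH 0 1)
    simpa using this
  set M := ∫ y, |y| ^ p ∂κ with hM
  set L := ∫ y, |y| ∂κ with hL
  set m := ∫ y, y ∂κ with hm
  have hM0 : 0 ≤ M := integral_nonneg fun y => by positivity
  have hL0 : 0 ≤ L := integral_nonneg fun y => by positivity
  have hmL : |m| ≤ L := abs_integral_le_integral_abs
  have hLM : L ^ p ≤ M := hs.jensen hp.le
  have hbM : |b| ^ p ≤ M := by
    refine (Real.rpow_le_rpow (abs_nonneg _) ?_ (by linarith)).trans hLM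
    rw [hb, abs_div, abs_of_pos (by norm_num : (0:ℝ) < 6)]
    linarith [abs_nonneg m]
  -- (i)
  have q1 := h.stein_holder hs hp hH
  -- (ii)
  have hc2 : Continuous (sg2 F F1) := continuous_iff_continuousAt.2 fun x => (h.dg2 x).continuousAt
  have g2g : Integrable (sg2 F F1) gam := by
    refine gint' hc2 (|sg2 F F1 0| + 10 * K) 1 fun x => ?_
    refine (lin_growth h.dg2 h.B2 x).trans ?_
    have := h.K0
    nlinarith [abs_nonneg x, abs_nonneg (sg2 F F1 0), mul_nonneg (abs_nonneg (sg2 F F1 0)) (abs_nonneg x)]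
  have q2 : |∫ x, sg2 F F1 x ∂μ - ∫ x, sg2 F F1 x ∂gam| ≤ 22 * H * (6 * L) ^ (p - 1) := by
    have ia : Integrable (qf μ) unif := qf_int μ hs.int_id
    have ib : Integrable (qf gam) unif := qf_int gam gam_int_id
    have iab : Integrable (fun u => |qf μ u - qf gam u|) unif := (ia.sub ib).abs
    have ipa : Integrable (fun u => |qf μ u - qf gam u| ^ (p - 1)) unif := by
      refine ((integrable_const (1:ℝ)).add iab).mono' ?_ ?_
      · exact ((cont_rpow (by linarith : 0 ≤ p - 1)).comp_aestronglyMeasurable (ia.sub ib).aestronglyMeasurable)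
      · refine Filter.Eventually.of_forall fun u => ?_
        rw [Real.norm_eq_abs, abs_of_nonneg (by positivity)]
        simp only [Pi.add_apply]
        rcases le_total |qf μ u - qf gam u| 1 with h | h
        · have := Real.rpow_le_one (abs_nonneg _) h (by linarith : 0 ≤ p - 1)
          linarith [abs_nonneg (qf μ u - qf gam u)]
        · have := Real.rpow_le_rpow_of_exponent_le h (by linarith : p - 1 ≤ 1)
          rw [Real.rpow_one] at this
          linarith
    have j1 := qf_int μ (h.g2_int hs)
    have j2 := qf_int gam g2g
    rw [← qf_integral μ hc2.aestronglyMeasurable, ← qf_integral gam hc2.aestronglyMeasurable,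
      ← integral_sub j1 j2, ← Real.norm_eq_abs]
    refine (norm_integral_le_of_norm_le (ipa.const_mul (22 * H)) (Filter.Eventually.of_forall fun u =>
      h.holder (by linarith : 0 < p - 1) hH _ _)).trans ?_
    rw [integral_const_mul]
    gcongr
    have jj := (Real.concaveOn_rpow (by linarith : 0 ≤ p - 1) (by linarith)).le_map_integral (μ := unif)
      (f := fun u => |qf μ u - qf gam u|)
      (Real.continuous_rpow_const (by linarith)).continuousOn isClosed_Ici
      (Filter.Eventually.of_forall fun y => Set.mem_Ici.2 (abs_nonneg _)) iab ipa
    refine jj.trans ?_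
    exact Real.rpow_le_rpow (integral_nonneg fun u => abs_nonneg _) (w1_bound hs) (by linarith)
  have q3 : |m / 2 * (∫ x, sg2 F F1 x ∂μ - ∫ x, sg2 F F1 x ∂gam)| ≤ 66 * H * M := by
    rw [abs_mul, abs_div, abs_two]
    have h6 : (6:ℝ) ^ (p - 1) ≤ 6 := by
      have := Real.rpow_le_rpow_of_exponent_le (by norm_num : (1:ℝ) ≤ 6) (by linarith : p - 1 ≤ 1)
      simpa using this
    have h7 : L ^ (p - 1) * L = L ^ p := by
      rcases hL0.eq_or_lt with h0 | h0
      · rw [← h0, Real.zero_rpow (by linarith), Real.zero_rpow (by linarith)]; ring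
      · rw [← Real.rpow_add_one h0.ne', sub_add_cancel]
    rw [Real.mul_rpow (by norm_num) hL0] at q2
    have hLp : 0 ≤ L ^ (p - 1) := by positivity
    calc _ ≤ L / 2 * (22 * H * (6 ^ (p - 1) * L ^ (p - 1))) := by gcongr
      _ ≤ L / 2 * (22 * H * (6 * L ^ (p - 1))) := by gcongr
      _ = 66 * H * (L ^ (p - 1) * L) := by ring
      _ ≤ _ := by rw [h7]; gcongr
  -- (iii)
  have q4 := h.hermite
  -- (iv)
  let E : ℝ → ℝ := fun y => f (TT b y) - f y - b * (F y * (y ^ 2 - 1)) - b ^ 2 * F 0 * y ^ 3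
  have hcf := h.cf
  have hcF := h.cF
  have hEc : Continuous E := by
    have : Continuous (TT b) := by unfold TT; fun_prop
    fun_prop
  have hEb : ∀ y, |E y| ≤ 2 * H * |b| ^ p * (1 + |y|) ^ 6 := by
    intro y
    set w := TT b y - y with hw
    have e1 := Convex.norm_image_sub_le_of_norm_hasDerivWithin_le (f := fun t => f t - F y * t)
      (f' := fun t => F t - F y)
      (C := H * |w| ^ (p - 1)) (s := Set.Icc (y - |w|) (y + |w|))
      (x := y) (y := TT b y) (fun z _ => by
        have := (h.d0 z).sub ((hasDerivAt_id z).const_mul (F y))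
        simp only [id, mul_one] at this
        exact this.hasDerivWithinAt) (fun z hz => by
          refine (hH z y).trans ?_
          have hzw : |z - y| ≤ |w| := by
            rw [abs_le]
            constructor <;> linarith [hz.1, hz.2]
          have : |z - y| ^ (p - 1) ≤ |w| ^ (p - 1) := Real.rpow_le_rpow (abs_nonneg _) hzw (by linarith)
          gcongr)
      (convex_Icc _ _) ⟨by linarith [abs_nonneg w], by linarith [abs_nonneg w]⟩
      ⟨by linarith [neg_abs_le w], by linarith [le_abs_self w]⟩
    rw [Real.norm_eq_abs, Real.norm_eq_abs, ← hw, mul_assoc] at e1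
    have e2 : |w| ^ (p - 1) * |w| = |w| ^ p := by
      rcases eq_or_ne w 0 with h0 | h0
      · rw [h0, abs_zero, Real.zero_rpow (by linarith), Real.zero_rpow (by linarith)]; ring
      · rw [← Real.rpow_add_one (abs_pos.2 h0).ne', sub_add_cancel]
    rw [e2] at e1
    have hy1 : (1:ℝ) ≤ 1 + |y| := by linarith [abs_nonneg y]
    have e3 : |w| ^ p ≤ |b| ^ p * (1 + |y|) ^ 6 := by
      calc |w| ^ p ≤ (|b| * (1 + |y|) ^ 3) ^ p := Real.rpow_le_rpow (abs_nonneg _) (TT_sub_le hb1 y) (by linarith)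
        _ = |b| ^ p * ((1 + |y|) ^ 3) ^ p := Real.mul_rpow (abs_nonneg _) (by positivity)
        _ ≤ |b| ^ p * ((1 + |y|) ^ 3) ^ (2:ℝ) := by
            gcongr
            exact one_le_pow₀ hy1
        _ = _ := by rw [Real.rpow_two]; ring
    have e4 : |b ^ 2 * ((F y - F 0) * y ^ 3)| ≤ H * |b| ^ p * (1 + |y|) ^ 6 := by
      rw [abs_mul, abs_mul, abs_pow, abs_pow]
      have h1 := hH y 0
      rw [sub_zero] at h1
      have h2 : |b| ^ 2 ≤ |b| ^ p := by
        rw [← Real.rpow_two]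
        rcases (abs_nonneg b).eq_or_lt with h0 | h0
        · rw [← h0, Real.zero_rpow (by norm_num), Real.zero_rpow (by linarith)]
        · exact Real.rpow_le_rpow_of_exponent_ge h0 hb1 hp2
      have h3 : |y| ^ (p - 1) ≤ 1 + |y| := by
        rcases le_total |y| 1 with h | h
        · have := Real.rpow_le_one (abs_nonneg _) h (by linarith : 0 ≤ p - 1)
          linarith [abs_nonneg y]
        · have := Real.rpow_le_rpow_of_exponent_le h (by linarith : p - 1 ≤ 1)
          rw [Real.rpow_one] at this
          linarith
      have h4 : |y| ^ 3 ≤ (1 + |y|) ^ 3 := by gcongr; linarith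
      calc _ ≤ |b| ^ p * ((H * (1 + |y|)) * (1 + |y|) ^ 3) := by
            gcongr
            exact h1.trans (by gcongr)
        _ = H * |b| ^ p * (1 + |y|) ^ 4 := by ring
        _ ≤ _ := by
          gcongr
          norm_num
    have e5 : E y = (f (TT b y) - F y * TT b y - (f y - F y * y)) + b ^ 2 * ((F y - F 0) * y ^ 3) := by
      simp only [E, TT]; ring
    rw [e5]
    refine (abs_add_le _ _).trans ?_
    have e6 : H * |w| ^ p ≤ H * (|b| ^ p * (1 + |y|) ^ 6) := by gcongr
    linarith
  have iE : Integrable E gam := gint' hEc _ 6 hEb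
  have if0 := h.gamInt
  have iFy : Integrable (fun y => F y * (y ^ 2 - 1)) gam := by
    refine gint' (by fun_prop) (|F 0| + K) 3 fun y => ?_
    rw [abs_mul]
    have h1 := lin_growth h.d1 h.b1 y
    have hK := h.K0
    have h2 : |F y| ≤ (|F 0| + K) * (1 + |y|) := by
      nlinarith [abs_nonneg y, abs_nonneg (F 0), mul_nonneg (abs_nonneg (F 0)) (abs_nonneg y)]
    have h3 : |y ^ 2 - 1| ≤ (1 + |y|) ^ 2 := by
      have : (1 + |y|) ^ 2 = 1 + 2 * |y| + y ^ 2 := by rw [add_sq, sq_abs]; ring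
      rw [this, abs_le]; constructor <;> nlinarith [sq_nonneg y, abs_nonneg y]
    calc _ ≤ ((|F 0| + K) * (1 + |y|)) * (1 + |y|) ^ 2 := by gcongr
      _ = _ := by ring
  have powint : ∀ k : ℕ, Integrable (fun y : ℝ => y ^ k) gam := fun k => by
    refine gint' (by fun_prop) 1 k fun y => ?_
    rw [abs_pow, one_mul]
    gcongr; linarith
  have i3 : Integrable (fun y : ℝ => y ^ 3) gam := powint 3
  have z3 : ∫ y, y ^ 3 ∂gam = 0 := by
    have := gibp (h := fun y => y ^ 2) (h' := fun y => 2 * y) (fun y => by simpa using hasDerivAt_pow 2 y)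
      (powint 2) (gam_int_id.const_mul 2) (by convert! powint 3 using 2; ring)
    have e : ∫ y, y ^ 3 ∂gam = ∫ y, y * y ^ 2 ∂gam := by congr 1; funext y; ring
    rw [e, this, integral_const_mul]
    have : ∫ y, y ∂gam = 0 := by simp [gam]
    rw [this, mul_zero]
  have efT : (fun y => f (TT b y)) = fun y => E y + (f y + (b * (F y * (y ^ 2 - 1)) + b ^ 2 * F 0 * y ^ 3)) := by
    funext y; simp only [E]; ring
  have i5 : Integrable (fun y => b * (F y * (y ^ 2 - 1)) + b ^ 2 * F 0 * y ^ 3) gam :=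
    (iFy.const_mul b).add (i3.const_mul _)
  have i6 : Integrable (fun y => f y + (b * (F y * (y ^ 2 - 1)) + b ^ 2 * F 0 * y ^ 3)) gam := if0.add i5
  refine ⟨by rw [efT]; exact iE.add i6, ?_⟩
  have tot : ∫ y, f (TT b y) ∂gam = ∫ y, E y ∂gam + (∫ y, f y ∂gam + b * ∫ y, F y * (y ^ 2 - 1) ∂gam) := by
    rw [efT, integral_add iE i6, integral_add if0 i5, integral_add (iFy.const_mul b) (i3.const_mul _),
      integral_const_mul, integral_const_mul, z3]
    ring
  have q5 : |∫ y, E y ∂gam| ≤ 2 * H * M * C6 := by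
    rw [← Real.norm_eq_abs]
    refine (norm_integral_le_of_norm_le ((gam_int_pow 6).const_mul (2 * H * |b| ^ p))
      (Filter.Eventually.of_forall fun u => hEb u)).trans ?_
    rw [integral_const_mul]
    change 2 * H * |b| ^ p * C6 ≤ _
    have := C6_nonneg
    gcongr
  rw [tot, q4]
  have e : ∫ x, f x ∂μ - (∫ y, E y ∂gam + (∫ y, f y ∂gam + b * (-3 * ∫ y, sg2 F F1 y ∂gam))) =
    ((∫ x, f x ∂μ - ∫ x, f x ∂gam) + m / 2 * ∫ x, sg2 F F1 x ∂μ)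
      - m / 2 * (∫ x, sg2 F F1 x ∂μ - ∫ x, sg2 F F1 x ∂gam) - ∫ y, E y ∂gam := by
    rw [hb]; ring
  rw [e]
  have r1 := abs_sub (((∫ x, f x ∂μ - ∫ x, f x ∂gam) + m / 2 * ∫ x, sg2 F F1 x ∂μ)
      - m / 2 * (∫ x, sg2 F F1 x ∂μ - ∫ x, sg2 F F1 x ∂gam)) (∫ y, E y ∂gam)
  have r2 := abs_sub ((∫ x, f x ∂μ - ∫ x, f x ∂gam) + m / 2 * ∫ x, sg2 F F1 x ∂μ)
      (m / 2 * (∫ x, sg2 F F1 x ∂μ - ∫ x, sg2 F F1 x ∂gam))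
  nlinarith

end SJ

namespace SJ

variable {f F F1 : ℝ → ℝ} {K : ℝ} {κ μ : Measure ℝ} {v R : ℝ}

lemma rpow_add_le {p x y : ℝ} (hp : 1 ≤ p) (hp2 : p ≤ 2) (hx : 0 ≤ x) (hy : 0 ≤ y) :
    (x + y) ^ p ≤ 4 * (x ^ p + y ^ p) := by
  have h4 : (2:ℝ) ^ p ≤ 4 := by
    have := Real.rpow_le_rpow_of_exponent_le (by norm_num : (1:ℝ) ≤ 2) hp2
    norm_num at this
    exact this
  have hp0 : 0 ≤ p := by linarith
  have key : ∀ a b : ℝ, 0 ≤ a → a ≤ b → (a + b) ^ p ≤ 4 * (a ^ p + b ^ p) := by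
    intro a b ha hab
    have hb := ha.trans hab
    calc (a + b) ^ p ≤ (2 * b) ^ p := Real.rpow_le_rpow (by linarith) (by linarith) hp0
      _ = 2 ^ p * b ^ p := Real.mul_rpow (by norm_num) hb
      _ ≤ 4 * b ^ p := by gcongr
      _ ≤ _ := by
        have : 0 ≤ a ^ p := by positivity
        linarith
  rcases le_total x y with h | h
  · exact key x y hx h
  · have := key y x hy h
    rw [add_comm y x, add_comm (y ^ p)] at this
    exact this

lemma gam_sq : ∫ y, y ^ 2 ∂gam = 1 := by
  have powint : ∀ k : ℕ, Integrable (fun y : ℝ => y ^ k) gam := fun k => by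
    refine gint' (by fun_prop) 1 k fun y => ?_
    rw [abs_pow, one_mul]
    gcongr; linarith
  have := gibp (h := fun y => y) (h' := fun _ => 1) (fun y => hasDerivAt_id y)
      (by simpa using powint 1) (integrable_const _) (by convert! powint 2 using 2; ring)
  have e : ∫ y, y ^ 2 ∂gam = ∫ y, y * y ∂gam := by congr 1; funext y; ring
  rw [e, this]; simp

lemma gam_int_sq : Integrable (fun y : ℝ => y ^ 2) gam :=
  gint' (by fun_prop) 1 2 fun y => by
    rw [abs_pow, one_mul]
    gcongr; linarith

lemma aint_p {a b : ℝ → ℝ} (ma : AEStronglyMeasurable a unif) (mb : AEStronglyMeasurable b unif)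
    (ia : Integrable (fun u => a u ^ 2) unif) (ib : Integrable (fun u => b u ^ 2) unif)
    {p : ℝ} (h0 : 0 ≤ p) (h2 : p ≤ 2) : Integrable (fun u => |a u - b u| ^ p) unif := by
  refine ((integrable_const (1:ℝ)).add ((ia.const_mul 2).add (ib.const_mul 2))).mono' ?_ ?_
  · exact (cont_rpow h0).comp_aestronglyMeasurable (ma.sub mb)
  · refine Filter.Eventually.of_forall fun u => ?_
    rw [Real.norm_eq_abs, abs_of_nonneg (by positivity)]
    simp only [Pi.add_apply]
    refine (rpow_le_sq h0 h2 _).trans ?_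
    nlinarith [sq_nonneg (a u + b u)]

lemma avg_holder {f F : ℝ → ℝ} (hf : ∀ x, HasDerivAt f (F x) x) {H α : ℝ}
    (hH : ∀ x y, |F x - F y| ≤ H * |x - y| ^ α) {η : ℝ} (hη : 0 < η) (x y : ℝ) :
    |(f (x + η) - f x) / η - (f (y + η) - f y) / η| ≤ H * |x - y| ^ α := by
  have := avg_close (f := fun z => f z - f (z + (y - x))) (F := fun z => F z - F (z + (y - x)))
    (fun z => (hf z).sub ((hf (z + (y - x))).comp_add_const z (y - x))) hη (B := H * |x - y| ^ α) x 0 (fun z _ _ => by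
      have := hH z (z + (y - x))
      have e : z - (z + (y - x)) = x - y := by ring
      rw [e] at this
      simpa using this)
  have e : (f (x + η) - f (x + η + (y - x)) - (f x - f (x + (y - x)))) / η - 0 =
      (f (x + η) - f x) / η - (f (y + η) - f y) / η := by
    have e1 : x + η + (y - x) = y + η := by ring
    have e2 : x + (y - x) = y := by ring
    rw [e1, e2]; ring
  rw [← e]; exact this

/-- The order `p` bound in normalised form -/
lemma wp_bound {p : ℝ} (hp : 1 < p) (hp2 : p ≤ 2) (hs : IsSJ κ μ 1 R) :
    ∫ u, |qf μ u - qf gam u| ^ p ∂unif ≤ (4 * (16 * (88 + 2 * C6) + C6) + 5) * ∫ y, |y| ^ p ∂κ := by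
  have := hs.pκ
  have := hs.pμ
  have hp0 : 0 ≤ p := by linarith
  have hC6 := C6_nonneg
  set M := ∫ y, |y| ^ p ∂κ with hM
  have hM0 : 0 ≤ M := integral_nonneg fun y => by positivity
  have hLM : (∫ y, |y| ∂κ) ^ p ≤ M := hs.jensen hp.le
  have hmL : |∫ y, y ∂κ| ≤ ∫ y, |y| ∂κ := abs_integral_le_integral_abs
  set b0 := (∫ y, y ∂κ) / 6 with hb0
  have hbL : |b0| ≤ ∫ y, |y| ∂κ := by
    rw [hb0, abs_div, abs_of_pos (by norm_num : (0:ℝ) < 6)]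
    linarith [abs_nonneg (∫ y, y ∂κ)]
  have hbM : |b0| ^ p ≤ M := (Real.rpow_le_rpow (abs_nonneg _) hbL hp0).trans hLM
  set a := qf μ with ha_def
  set n := qf gam with hn_def
  have ma : AEStronglyMeasurable a unif := (qf_aemeasurable μ).aestronglyMeasurable
  have mn : AEStronglyMeasurable n unif := (qf_aemeasurable gam).aestronglyMeasurable
  have ia2 : Integrable (fun u => a u ^ 2) unif := qf_int μ hs.sq_int
  have in2 : Integrable (fun u => n u ^ 2) unif := qf_int gam gam_int_sq
  have ian := aint_p ma mn ia2 in2 hp0 hp2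
  rcases lt_or_ge 1 |b0| with hbig | hb1
  · have hM1 : 1 ≤ M := le_trans (Real.one_le_rpow hbig.le hp0) hbM
    have h5 : ∫ u, |a u - n u| ^ p ∂unif ≤ 5 := by
      have : ∫ u, |a u - n u| ^ p ∂unif ≤ ∫ u, (1 + (2 * a u ^ 2 + 2 * n u ^ 2)) ∂unif := by
        refine integral_mono ian ((integrable_const (1:ℝ)).add ((ia2.const_mul 2).add (in2.const_mul 2))) fun u => ?_
        refine (rpow_le_sq hp0 hp2 _).trans ?_
        nlinarith [sq_nonneg (a u + n u)]
      refine this.trans (le_of_eq ?_)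
      have j : Integrable (fun u => 2 * a u ^ 2 + 2 * n u ^ 2) unif := (ia2.const_mul 2).add (in2.const_mul 2)
      rw [integral_add (integrable_const _) j, integral_add (ia2.const_mul 2) (in2.const_mul 2), integral_const_mul,
        integral_const_mul, qf_integral μ (h := fun x => x ^ 2) (by fun_prop),
        qf_integral gam (h := fun x => x ^ 2) (by fun_prop), hs.sq_eq, gam_sq]
      simp
      norm_num
    nlinarith
  set b : ℝ → ℝ := fun u => TT b0 (n u) with hb_def
  have hTc : Continuous (TT b0) := by unfold TT; fun_prop
  have ha : MonotoneOn a (Set.Ioo 0 1) := qf_mono μ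
  have hb : MonotoneOn b (Set.Ioo 0 1) := fun x hx y hy hxy => TT_mono b0 (qf_mono gam hx hy hxy)
  have mb : AEStronglyMeasurable b unif := hTc.comp_aestronglyMeasurable mn
  have hTb : ∀ y, |TT b0 y| ≤ 2 * (1 + |y|) ^ 3 := fun y => by
    have h1 := TT_sub_le hb1 y
    have h2 := abs_sub_abs_le_abs_sub (TT b0 y) y
    have h4 : (0:ℝ) ≤ (1 + |y|) ^ 3 := by positivity
    have h5 : |b0| * (1 + |y|) ^ 3 ≤ (1 + |y|) ^ 3 := by nlinarith
    have h6 : |y| ≤ (1 + |y|) ^ 3 := by nlinarith [abs_nonneg y, pow_nonneg (abs_nonneg y) 3, pow_nonneg (abs_nonneg y) 2]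
    linarith
  have iT2 : Integrable (fun y => TT b0 y ^ 2) gam := gint' (by fun_prop) 4 6 fun y => by
    rw [abs_pow]
    calc |TT b0 y| ^ 2 ≤ (2 * (1 + |y|) ^ 3) ^ 2 := by gcongr; exact hTb y
      _ = _ := by ring
  have ib2 : Integrable (fun u => b u ^ 2) unif := qf_int gam iT2
  have iab := aint_p ma mb ia2 ib2 hp0 hp2
  have ibn := aint_p mb mn ib2 in2 hp0 hp2
  -- the Rio test function
  set F : ℝ → ℝ := zt (fun s => s ^ (p - 1)) a b with hF
  have hFH : ∀ x y, |F x - F y| ≤ 2 * |x - y| ^ (p - 1) := fun x y =>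
    zt_holder ha hb (by linarith) (by linarith) x y
  have hFc : Continuous F := zt_continuous ha hb (Real.continuous_rpow_const (by linarith))
  set f : ℝ → ℝ := fun x => ∫ t in (0:ℝ)..x, F t with hf
  have hfd : ∀ x, HasDerivAt f (F x) x := prim_hasDeriv hFc
  have hfc : Continuous f := continuous_iff_continuousAt.2 fun x => (hfd x).continuousAt
  obtain ⟨g, hg⟩ := exists_prim hfc
  let q : ℝ → ℝ := fun x => |F 0| + 4 + 2 * |x|
  have iqa : Integrable (fun u => q (a u)) unif :=
    qf_int μ (h := q) (((integrable_const _).add (hs.int_id.abs.const_mul 2)))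
  have iqb : Integrable (fun u => q (b u)) unif := by
    have : Integrable b unif := by
      refine qf_int gam (h := TT b0) (gint' hTc 2 3 hTb)
    exact (integrable_const _).add (this.abs.const_mul 2)
  set Q := ∫ u, q (a u) ∂unif + ∫ u, q (b u) ∂unif with hQ
  have rp1 : ∀ x : ℝ, |x| ^ (p - 1) ≤ 1 + |x| := fun x => by
    rcases le_total |x| 1 with h | h
    · have := Real.rpow_le_one (abs_nonneg _) h (by linarith : 0 ≤ p - 1)
      linarith [abs_nonneg x]
    · have := Real.rpow_le_rpow_of_exponent_le h (by linarith : p - 1 ≤ 1)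
      rw [Real.rpow_one] at this
      linarith
  have key : ∀ η : ℝ, 0 < η → η ≤ 1 → ∫ u, |a u - b u| ^ p ∂unif ≤ 16 * (88 + 2 * C6) * M + 8 * (η * Q) := by
    intro η hη hη1
    have hL : ∀ x, |(F (x + η) - F x) / η| ≤ 2 * η ^ (p - 1) / η := fun x => by
      rw [abs_div, abs_of_pos hη]
      gcongr
      have := hFH (x + η) x
      rwa [add_sub_cancel_left, abs_of_pos hη] at this
    have t := avg_tst hfd hFc hg hL
    have tH := avg_holder hfd hFH hη
    obtain ⟨i2, s1⟩ := t.core hs hp hp2 tH hb0 hb1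
    have i1 := (t.stein hs).1
    have close : ∀ x, |(g (x + η) - g x) / η - f x| ≤ η * q x := fun x => by
      refine avg_close hg hη x (f x) fun y h1 h2 => ?_
      have hFx : |F x| ≤ |F 0| + 2 * (1 + |x|) := by
        have h3 := hFH x 0
        rw [sub_zero] at h3
        have h4 := abs_sub_abs_le_abs_sub (F x) (F 0)
        linarith [rp1 x]
      have := Convex.norm_image_sub_le_of_norm_hasDerivWithin_le (f := f) (C := q x) (s := Set.Icc x (x + η))
        (x := x) (y := y) (fun z _ => (hfd z).hasDerivWithinAt) (fun z hz => by
          have h3 := hFH z x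
          have h4 := abs_sub_abs_le_abs_sub (F z) (F x)
          have h5 : |z - x| ^ (p - 1) ≤ 1 := by
            apply Real.rpow_le_one (abs_nonneg _) _ (by linarith)
            rw [abs_of_nonneg (by linarith [hz.1])]
            linarith [hz.2]
          rw [Real.norm_eq_abs]
          simp only [q]
          linarith) (convex_Icc _ _) (by simp [hη.le]) ⟨h1, h2⟩
      rw [Real.norm_eq_abs, Real.norm_eq_abs, abs_of_nonneg (by linarith : 0 ≤ y - x)] at this
      refine this.trans ?_
      rw [mul_comm]
      have hq : 0 ≤ q x := by simp only [q]; positivity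
      have : y - x ≤ η := by linarith
      gcongr
    have j1 := qf_int μ i1
    have j2 := qf_int gam i2
    rw [← qf_integral μ i1.aestronglyMeasurable, ← qf_integral gam i2.aestronglyMeasurable,
      ← integral_sub j1 j2] at s1
    have j3 : Integrable (fun u => ((g (a u + η) - g (a u)) / η - (g (b u + η) - g (b u)) / η)) unif := j1.sub j2
    have j4 : Integrable (fun u => η * (q (a u) + q (b u))) unif := (iqa.add iqb).const_mul η
    have s2 : ∫ u, |a u - b u| ^ p ∂unif ≤
        ∫ u, 8 * (((g (a u + η) - g (a u)) / η - (g (b u + η) - g (b u)) / η) + η * (q (a u) + q (b u))) ∂unif := by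
      refine integral_mono_ae iab ((j3.add j4).const_mul 8) ?_
      filter_upwards [unif_mem] with u hu
      have r := rio_p ha hb hp hp2 hu
      have c1 := abs_le.1 (close (a u))
      have c2 := abs_le.1 (close (b u))
      change |a u - b u| ^ p ≤ 8 * (f (a u) - f (b u)) at r
      linarith [c1.1, c2.2]
    rw [integral_const_mul, integral_add j3 j4, integral_const_mul, integral_add iqa iqb] at s2
    have s3 := (abs_le.1 s1).2
    change ∫ u, ((g (a u + η) - g (a u)) / η - (g (b u + η) - g (b u)) / η) ∂unif ≤ _ at s3
    nlinarith
  have hQ0 : 0 ≤ Q := by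
    have h1 : 0 ≤ ∫ u, q (a u) ∂unif := integral_nonneg fun u => by simp only [q]; positivity
    have h2 : 0 ≤ ∫ u, q (b u) ∂unif := integral_nonneg fun u => by simp only [q]; positivity
    linarith
  have s4 : ∫ u, |a u - b u| ^ p ∂unif ≤ 16 * (88 + 2 * C6) * M := by
    refine le_of_forall_pos_le_add fun ε hε => ?_
    have hpos : 0 < ε / (8 * (Q + 1)) := by positivity
    refine (key (min 1 (ε / (8 * (Q + 1)))) (lt_min one_pos hpos) (min_le_left _ _)).trans ?_
    have h1 : min 1 (ε / (8 * (Q + 1))) * Q ≤ ε / (8 * (Q + 1)) * (Q + 1) := by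
      apply mul_le_mul (min_le_right _ _) (by linarith) hQ0 hpos.le
    have h2 : ε / (8 * (Q + 1)) * (Q + 1) = ε / 8 := by field_simp
    linarith
  have s5 : ∫ u, |b u - n u| ^ p ∂unif ≤ M * C6 := by
    have i6 : Integrable (fun u => |b0| ^ p * (1 + |n u|) ^ 6) unif :=
      (qf_int gam (gam_int_pow 6)).const_mul _
    refine (integral_mono ibn i6 fun u => ?_).trans ?_
    · set y := n u
      have hy1 : (1:ℝ) ≤ 1 + |y| := by linarith [abs_nonneg y]
      calc |TT b0 y - y| ^ p ≤ (|b0| * (1 + |y|) ^ 3) ^ p := Real.rpow_le_rpow (abs_nonneg _) (TT_sub_le hb1 y) hp0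
        _ = |b0| ^ p * ((1 + |y|) ^ 3) ^ p := Real.mul_rpow (abs_nonneg _) (by positivity)
        _ ≤ |b0| ^ p * ((1 + |y|) ^ 3) ^ (2:ℝ) := by
            gcongr
            exact one_le_pow₀ hy1
        _ = _ := by rw [Real.rpow_two]; ring
    · rw [integral_const_mul, qf_integral gam (h := fun y => (1 + |y|) ^ 6) (by fun_prop)]
      change |b0| ^ p * C6 ≤ _
      gcongr
  have s6 : ∫ u, |a u - n u| ^ p ∂unif ≤ ∫ u, 4 * (|a u - b u| ^ p + |b u - n u| ^ p) ∂unif := by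
    refine integral_mono ian ((iab.add ibn).const_mul 4) fun u => ?_
    refine le_trans ?_ (rpow_add_le hp.le hp2 (abs_nonneg _) (abs_nonneg _))
    exact Real.rpow_le_rpow (abs_nonneg _) (abs_sub_le _ _ _) hp0
  rw [integral_const_mul, integral_add iab ibn] at s6
  nlinarith

end SJ

namespace SJ

/-- normalised jump measure -/
noncomputable def kap (ν : Measure ℝ) (s2 : ℝ) : Measure ℝ :=
  ν.withDensity (fun x => ENNReal.ofReal (x ^ 2 / s2))

lemma kap_meas (s2 : ℝ) : Measurable (fun x : ℝ => ENNReal.ofReal (x ^ 2 / s2)) := by fun_prop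

lemma sq_integrable {ν : Measure ℝ} (hf : ∫⁻ x, ENNReal.ofReal (x ^ 2) ∂ν ≠ ⊤) :
    Integrable (fun x : ℝ => x ^ 2) ν := by
  refine ⟨by fun_prop, ?_⟩
  rw [hasFiniteIntegral_iff_ofReal (Filter.Eventually.of_forall fun x => sq_nonneg x)]
  exact lt_top_iff_ne_top.2 hf

lemma kap_integral {E : Type*} [NormedAddCommGroup E] [NormedSpace ℝ E] (ν : Measure ℝ) {s2 : ℝ} (hs : 0 < s2) (g : ℝ → E) :
    ∫ x, g x ∂(kap ν s2) = ∫ x, (x ^ 2 / s2) • g x ∂ν := by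
  unfold kap
  rw [integral_withDensity_eq_integral_toReal_smul (kap_meas s2)
    (Filter.Eventually.of_forall fun x => ENNReal.ofReal_lt_top)]
  refine integral_congr_ae (Filter.Eventually.of_forall fun x => ?_)
  simp only
  rw [ENNReal.toReal_ofReal (by positivity)]

lemma kap_prob {ν : Measure ℝ} {s2 : ℝ} (hf : ∫⁻ x, ENNReal.ofReal (x ^ 2) ∂ν ≠ ⊤)
    (hs : s2 = ∫ x, x ^ 2 ∂ν) (hs0 : 0 < s2) : IsProbabilityMeasure (kap ν s2) := by
  constructor
  unfold kap
  rw [withDensity_apply _ MeasurableSet.univ, Measure.restrict_univ,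
    ← ofReal_integral_eq_lintegral_ofReal ((sq_integrable hf).div_const s2)
      (Filter.Eventually.of_forall fun x => by positivity), integral_div, ← hs, div_self hs0.ne']
  simp

lemma isSJ_of {ν μt : Measure ℝ} {ε t s2 c : ℝ} (hc : 0 < c) (ht : 0 < t)
    (h0 : ν {0} = 0) (he : ν {x : ℝ | ε < |x|} = 0)
    (hf : ∫⁻ x, ENNReal.ofReal (x ^ 2) ∂ν ≠ ⊤) (hs : s2 = ∫ x, x ^ 2 ∂ν) (hs0 : 0 < s2)
    (hp : IsProbabilityMeasure μt)
    (hch : ∀ u : ℝ, charFn μt u = Complex.exp ((t : ℂ) * ∫ x, lkIntegrandC u x ∂ν)) :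
    IsSJ ((kap ν s2).map (c * ·)) (μt.map (c * ·)) (t * s2 * c ^ 2) (c * ε) := by
  have hk := kap_prob hf hs hs0
  have hmc : Measurable (fun x : ℝ => c * x) := by fun_prop
  have hac : kap ν s2 ≪ ν := withDensity_absolutelyContinuous _ _
  refine ⟨Measure.isProbabilityMeasure_map hmc.aemeasurable,
    Measure.isProbabilityMeasure_map hmc.aemeasurable, by positivity, ?_, ?_, ?_⟩
  · rw [ae_map_iff hmc.aemeasurable (measurableSet_le (by fun_prop) (by fun_prop))]
    have : ∀ᵐ x ∂ν, ¬ (ε < |x|) := by rw [ae_iff]; simpa using he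
    filter_upwards [hac.ae_le this] with x hx
    rw [abs_mul, abs_of_pos hc]
    exact mul_le_mul_of_nonneg_left (not_lt.1 hx) hc.le
  · have hm : MeasurableSet {y : ℝ | y ≠ 0} := (measurableSet_singleton (0:ℝ)).compl
    rw [ae_map_iff hmc.aemeasurable hm]
    have : ∀ᵐ x ∂ν, x ≠ 0 := by rw [ae_iff]; simpa using h0
    filter_upwards [hac.ae_le this] with x hx
    exact mul_ne_zero hc.ne' hx
  · intro u
    rw [charFun_map_mul]
    have h1 : charFun μt (c * u) = charFn μt (c * u) := by
      rw [charFun_apply_real]; unfold charFn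
      refine integral_congr_ae (Filter.Eventually.of_forall fun x => ?_)
      simp only; push_cast; ring_nf
    rw [h1, hch]
    congr 1
    rw [integral_map hmc.aemeasurable (kk_meas u).aestronglyMeasurable, kap_integral ν hs0,
      ← integral_const_mul, ← integral_const_mul]
    refine integral_congr_ae (Filter.Eventually.of_forall fun x => ?_)
    simp only
    have hcc : (c : ℂ) ≠ 0 := by exact_mod_cast hc.ne'
    have hss : (s2 : ℂ) ≠ 0 := by exact_mod_cast hs0.ne'
    rcases eq_or_ne x 0 with rfl | hx
    · simp [lkIntegrandC]
    · have hxx : (x : ℂ) ≠ 0 := by exact_mod_cast hx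
      have : lkIntegrandC (c * u) x = e2 (u * (c * x)) := by
        unfold lkIntegrandC e2
        rw [show c * u * x = u * (c * x) by ring]
      rw [this, Complex.real_smul]
      push_cast
      field_simp

lemma map_scale {μ : Measure ℝ} {c : ℝ} (hc : c ≠ 0) :
    (μ.map (c * ·)).map (c⁻¹ * ·) = μ := by
  rw [Measure.map_map (by fun_prop) (by fun_prop)]
  convert! Measure.map_id using 2
  funext x; simp [hc]

lemma gam_scale {c : ℝ} (hc : 0 < c) : gam.map (c * ·) = gaussianReal 0 (Real.toNNReal (c ^ 2)) := by
  unfold gam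
  rw [gaussianReal_map_const_mul]
  congr 1
  · simp
  · ext; simp [sq_nonneg]

end SJ

namespace SJ

lemma scale_W {κ μ : Measure ℝ} {R : ℝ} (hs : IsSJ κ μ 1 R) {s p K : ℝ} (h : 0 < s) (hp : 1 ≤ p) (hp2 : p ≤ 2) (hK : 0 ≤ K)
    (hb : ∫ u, |qf μ u - qf gam u| ^ p ∂unif ≤ K ^ p) :
    wasserstein p (μ.map (s * ·)) (gaussianReal 0 (Real.toNNReal (s ^ 2))) ≤ ENNReal.ofReal (s * K) := by
  have := hs.pμ
  have hPu : IsProbabilityMeasure unif := ⟨by simp [unif]⟩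
  rw [← gam_scale h]
  have e1 : μ.map (s * ·) = unif.map (fun u => s * qf μ u) := by
    conv_lhs => rw [← map_qf μ]
    rw [AEMeasurable.map_map_of_aemeasurable (by fun_prop) (qf_aemeasurable μ)]; rfl
  have e2 : gam.map (s * ·) = unif.map (fun u => s * qf gam u) := by
    conv_lhs => rw [← map_qf gam]
    rw [AEMeasurable.map_map_of_aemeasurable (by fun_prop) (qf_aemeasurable gam)]; rfl
  have hi := aint_p (qf_aemeasurable μ).aestronglyMeasurable (qf_aemeasurable gam).aestronglyMeasurable
    (qf_int μ hs.sq_int) (qf_int gam gam_int_sq) (p := p) (by linarith) hp2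
  have hfe : (fun u => |s * qf μ u - s * qf gam u| ^ p) = fun u => s ^ p * |qf μ u - qf gam u| ^ p := by
    funext u
    rw [← mul_sub, abs_mul, abs_of_pos h, Real.mul_rpow h.le (abs_nonneg _)]
  rw [e1, e2]
  refine wasserstein_le_real unif _ _ ((qf_aemeasurable μ).const_mul s) ((qf_aemeasurable gam).const_mul s) p _ hp
    (by positivity) ?_ ?_
  · rw [hfe]; exact hi.const_mul _
  · rw [hfe, integral_const_mul, Real.mul_rpow h.le hK]
    gcongr

lemma triv_bound {κ μ : Measure ℝ} {R : ℝ} (hs : IsSJ κ μ 1 R) {p : ℝ} (hp : 1 ≤ p) (hp2 : p ≤ 2) :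
    ∫ u, |qf μ u - qf gam u| ^ p ∂unif ≤ (2:ℝ) ^ p := by
  have := hs.pμ
  have hPu : IsProbabilityMeasure unif := ⟨by simp [unif]⟩
  have i1 := qf_int μ hs.sq_int
  have i2 := qf_int gam gam_int_sq
  have hi := aint_p (qf_aemeasurable μ).aestronglyMeasurable (qf_aemeasurable gam).aestronglyMeasurable
    i1 i2 (p := p) (by linarith) hp2
  have hpt : ∀ u, |qf μ u - qf gam u| ^ p ≤ 2 ^ p * ((1 - p / 2) + p / 4 * (qf μ u ^ 2 + qf gam u ^ 2)) := by
    intro u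
    set d := qf μ u - qf gam u with hd
    have h1 : |d| ^ p = 2 ^ p * ((d / 2) ^ 2) ^ (p / 2) := by
      have h2 : ((d / 2) ^ 2) ^ (p / 2) = (|d| / 2) ^ p := by
        rw [show (d / 2) ^ 2 = (|d| / 2) ^ (2:ℝ) by rw [Real.rpow_two, div_pow, div_pow, sq_abs],
          ← Real.rpow_mul (by positivity)]
        congr 1; ring
      rw [h2, ← Real.mul_rpow (by norm_num) (by positivity)]
      congr 1; ring
    rw [h1]
    gcongr
    have h2 := rpow_one_add_le_one_add_mul_self (s := (d / 2) ^ 2 - 1) (by nlinarith [sq_nonneg (d / 2)])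
      (p := p / 2) (by linarith) (by linarith)
    rw [add_sub_cancel] at h2
    refine h2.trans ?_
    have h3 : d ^ 2 ≤ 2 * (qf μ u ^ 2 + qf gam u ^ 2) := by rw [hd]; nlinarith [sq_nonneg (qf μ u + qf gam u)]
    nlinarith
  refine (integral_mono hi (((integrable_const (1 - p / 2)).add ((i1.add i2).const_mul (p / 4))).const_mul _) hpt).trans ?_
  have e : ∫ u, (1 - p / 2) + p / 4 * (qf μ u ^ 2 + qf gam u ^ 2) ∂unif = 1 := by
    have e0 : Integrable (fun u => p / 4 * (qf μ u ^ 2 + qf gam u ^ 2)) unif := (i1.add i2).const_mul (p / 4)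
    rw [integral_add (integrable_const _) e0, integral_const_mul, integral_add i1 i2,
      qf_integral μ (h := fun x => x ^ 2) (by fun_prop), qf_integral gam (h := fun x => x ^ 2) (by fun_prop), hs.sq_eq, gam_sq]
    simp
    ring
  have e3 : (∫ u, (2:ℝ) ^ p * ((1 - p / 2) + p / 4 * (qf μ u ^ 2 + qf gam u ^ 2)) ∂unif) = 2 ^ p := by
    rw [integral_const_mul, e, mul_one]
  exact e3.le

/-- the constant of the general bound -/
noncomputable def Kc : ℝ := 4 * (16 * (88 + 2 * C6) + C6) + 6

lemma Kc_ge : 6 ≤ Kc := by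
  have := C6_nonneg
  unfold Kc; nlinarith

lemma gen_bound {κ μ : Measure ℝ} {R : ℝ} (hs : IsSJ κ μ 1 R) {p : ℝ} (hp : 1 ≤ p) (hp2 : p ≤ 2) :
    ∫ u, |qf μ u - qf gam u| ^ p ∂unif ≤ Kc * ∫ y, |y| ^ p ∂κ := by
  have h0 : 0 ≤ ∫ y, |y| ^ p ∂κ := integral_nonneg fun y => by positivity
  rcases hp.eq_or_lt with rfl | hp
  · have := w1_bound hs
    simp only [Real.rpow_one] at *
    nlinarith [Kc_ge]
  · refine (wp_bound hp hp2 hs).trans ?_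
    gcongr
    unfold Kc; linarith

lemma general {p : ℝ} (hp1 : 1 ≤ p) (hp2 : p ≤ 2) {ν μt : Measure ℝ} {ε t s2 : ℝ} (hε : 0 < ε) (ht : 0 < t)
    (h0 : ν {0} = 0) (he : ν {x : ℝ | ε < |x|} = 0)
    (hf : ∫⁻ x, ENNReal.ofReal (x ^ 2) ∂ν ≠ ⊤) (hs : s2 = ∫ x, x ^ 2 ∂ν) (hs0 : 0 < s2)
    (hp : IsProbabilityMeasure μt)
    (hch : ∀ u : ℝ, charFn μt u = Complex.exp ((t : ℂ) * ∫ x, lkIntegrandC u x ∂ν)) :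
    wasserstein p μt (gaussianReal 0 (Real.toNNReal (t * s2))) ≤ ENNReal.ofReal (2 * (Real.sqrt t * Real.sqrt s2)) ∧
    wasserstein p μt (gaussianReal 0 (Real.toNNReal (t * s2)))
      ≤ ENNReal.ofReal (Kc ^ (1 / p) * ((∫ x, |x| ^ (p + 2) ∂ν) / s2) ^ (1 / p)) ∧
    ((∫ x, |x| ^ (p + 2) ∂ν) / s2) ^ (1 / p) ≤ ε := by
  have hp0 : 0 < p := by linarith
  set s := Real.sqrt t * Real.sqrt s2 with hsd
  have hspos : 0 < s := mul_pos (Real.sqrt_pos.2 ht) (Real.sqrt_pos.2 hs0)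
  have hs2 : s ^ 2 = t * s2 := by rw [hsd, mul_pow, Real.sq_sqrt ht.le, Real.sq_sqrt hs0.le]
  have hJ := isSJ_of (c := s⁻¹) (inv_pos.2 hspos) ht h0 he hf hs hs0 hp hch
  have hv : t * s2 * s⁻¹ ^ 2 = 1 := by rw [← hs2]; field_simp
  rw [hv] at hJ
  have hmap : (μt.map (s⁻¹ * ·)).map (s * ·) = μt := by
    have := map_scale (μ := μt) (inv_ne_zero hspos.ne')
    rwa [inv_inv] at this
  have hnn : 0 ≤ ∫ x, |x| ^ (p + 2) ∂ν := integral_nonneg fun y => by positivity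
  have hKc := Kc_ge
  have hpw : ∀ x : ℝ, x ^ 2 / s2 * |x| ^ p = |x| ^ (p + 2) / s2 := by
    intro x
    rcases eq_or_ne x 0 with rfl | hx
    · simp [Real.zero_rpow (show p + 2 ≠ 0 by linarith)]
    · rw [Real.rpow_add (abs_pos.2 hx), show |x| ^ (2:ℝ) = x ^ 2 by rw [Real.rpow_two, sq_abs]]; ring
  have hmom : ∫ x, |x| ^ p ∂(kap ν s2) = (∫ x, |x| ^ (p + 2) ∂ν) / s2 := by
    rw [kap_integral ν hs0, ← integral_div]
    refine integral_congr_ae (Filter.Eventually.of_forall fun x => ?_)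
    simp only [smul_eq_mul]; exact hpw x
  refine ⟨?_, ?_, ?_⟩
  · have := scale_W hJ hspos hp1 hp2 (by norm_num : (0:ℝ) ≤ 2) (triv_bound hJ hp1 hp2)
    rwa [hmap, hs2, mul_comm s 2] at this
  · have hg := gen_bound hJ hp1 hp2
    have hk : ∫ y, |y| ^ p ∂((kap ν s2).map (s⁻¹ * ·)) = s⁻¹ ^ p * ((∫ x, |x| ^ (p + 2) ∂ν) / s2) := by
      rw [integral_map (by fun_prop) (by fun_prop (disch := exact hp0.le)), ← hmom, ← integral_const_mul]
      refine integral_congr_ae (Filter.Eventually.of_forall fun x => ?_)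
      simp only
      rw [abs_mul, Real.mul_rpow (abs_nonneg _) (abs_nonneg _), abs_of_pos (inv_pos.2 hspos)]
    rw [hk] at hg
    set M := (∫ x, |x| ^ (p + 2) ∂ν) / s2 with hM
    have hM0 : 0 ≤ M := by positivity
    have := scale_W hJ hspos hp1 hp2 (K := Kc ^ (1 / p) * (s⁻¹ * M ^ (1 / p))) (by positivity) (hg.trans (le_of_eq ?_))
    · rw [hmap, hs2] at this
      refine this.trans (le_of_eq ?_)
      congr 1
      field_simp
    · rw [Real.mul_rpow (by positivity) (by positivity), Real.mul_rpow (by positivity) (by positivity),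
        ← Real.rpow_mul (by positivity), ← Real.rpow_mul (by positivity), one_div_mul_cancel hp0.ne',
        Real.rpow_one, Real.rpow_one]
  · have hle : (∫ x, |x| ^ (p + 2) ∂ν) / s2 ≤ ε ^ p := by
      have hk := kap_prob hf hs hs0
      rw [← hmom]
      have hac : kap ν s2 ≪ ν := withDensity_absolutelyContinuous _ _
      have hb : ∀ᵐ x ∂(kap ν s2), ‖|x| ^ p‖ ≤ ε ^ p := by
        have : ∀ᵐ x ∂ν, ¬ (ε < |x|) := by rw [ae_iff]; simpa using he
        filter_upwards [hac.ae_le this] with x hx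
        rw [Real.norm_of_nonneg (by positivity)]
        exact Real.rpow_le_rpow (abs_nonneg _) (not_lt.1 hx) hp0.le
      have := norm_integral_le_of_norm_le_const hb
      rw [probReal_univ, mul_one] at this
      exact (le_abs_self _).trans this
    calc _ ≤ (ε ^ p) ^ (1 / p) := Real.rpow_le_rpow (by positivity) hle (by positivity)
      _ = ε := by rw [← Real.rpow_mul hε.le, mul_one_div_cancel hp0.ne', Real.rpow_one]

/-- assembling, given the explicit order one bound -/
lemma assemble (hhalf : ∀ (κ μ : Measure ℝ) (τ : ℝ), 0 < τ → IsSJ κ μ 1 τ → ∫ u, |qf μ u - qf gam u| ∂unif ≤ τ / 2)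
    (p : ℝ) (hp1 : 1 ≤ p) (hp2 : p ≤ 2) :
    ∃ C > (0 : ℝ), ∀ (ν : Measure ℝ) (ε t : ℝ), 0 < ε → ε ≤ 1 → 0 < t →
      ν {0} = 0 → ν {x : ℝ | ε < |x|} = 0 →
      (∫⁻ x, ENNReal.ofReal (x ^ 2) ∂ν ≠ ⊤) →
      ∀ s2 : ℝ, s2 = ∫ x, x ^ 2 ∂ν → 0 < s2 →
      ∀ μt : Measure ℝ, IsProbabilityMeasure μt →
      (∀ u : ℝ, charFn μt u = Complex.exp ((t : ℂ) * ∫ x, lkIntegrandC u x ∂ν)) →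
      ((wasserstein p μt (gaussianReal 0 (Real.toNNReal (t * s2)))
          ≤ ENNReal.ofReal (C * min (Real.sqrt t * Real.sqrt s2)
              (((∫ x, |x| ^ (p + 2) ∂ν) / s2) ^ (1 / p)))
        ∧ wasserstein p μt (gaussianReal 0 (Real.toNNReal (t * s2)))
            ≤ ENNReal.ofReal (C * min (Real.sqrt t * Real.sqrt s2) ε))
      ∧ (p = 1 → wasserstein 1 μt (gaussianReal 0 (Real.toNNReal (t * s2)))
            ≤ ENNReal.ofReal (min (2 * Real.sqrt t * Real.sqrt s2) (ε / 2)))) := by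
  have hKc := Kc_ge
  refine ⟨max 2 (Kc ^ (1 / p)), lt_of_lt_of_le (by norm_num) (le_max_left _ _), ?_⟩
  intro ν ε t hε _ ht h0 he hf s2 hs hs0 μt hp hch
  obtain ⟨b1, b2, b3⟩ := general hp1 hp2 hε ht h0 he hf hs hs0 hp hch
  have hx0 : 0 ≤ Real.sqrt t * Real.sqrt s2 := by positivity
  have hnn : 0 ≤ ∫ x, |x| ^ (p + 2) ∂ν := integral_nonneg fun y => by positivity
  have hm0 : 0 ≤ ((∫ x, |x| ^ (p + 2) ∂ν) / s2) ^ (1 / p) := by positivity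
  have main : wasserstein p μt (gaussianReal 0 (Real.toNNReal (t * s2)))
          ≤ ENNReal.ofReal (max 2 (Kc ^ (1 / p)) * min (Real.sqrt t * Real.sqrt s2)
              (((∫ x, |x| ^ (p + 2) ∂ν) / s2) ^ (1 / p))) := by
    rcases min_cases (Real.sqrt t * Real.sqrt s2) (((∫ x, |x| ^ (p + 2) ∂ν) / s2) ^ (1 / p)) with h | h
    · rw [h.1]
      exact b1.trans (ENNReal.ofReal_le_ofReal (mul_le_mul_of_nonneg_right (le_max_left _ _) hx0))
    · rw [h.1]
      exact b2.trans (ENNReal.ofReal_le_ofReal (mul_le_mul_of_nonneg_right (le_max_right _ _) hm0))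
  refine ⟨⟨main, main.trans (ENNReal.ofReal_le_ofReal ?_)⟩, ?_⟩
  · gcongr
  · intro hp1'
    subst hp1'
    rcases min_cases (2 * Real.sqrt t * Real.sqrt s2) (ε / 2) with h | h
    · rw [h.1, mul_assoc]; exact b1
    · rw [h.1]
      set s := Real.sqrt t * Real.sqrt s2 with hsd
      have hspos : 0 < s := mul_pos (Real.sqrt_pos.2 ht) (Real.sqrt_pos.2 hs0)
      have hs2 : s ^ 2 = t * s2 := by rw [hsd, mul_pow, Real.sq_sqrt ht.le, Real.sq_sqrt hs0.le]
      have hJ := isSJ_of (c := s⁻¹) (inv_pos.2 hspos) ht h0 he hf hs hs0 hp hch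
      have hv : t * s2 * s⁻¹ ^ 2 = 1 := by rw [← hs2]; field_simp
      rw [hv] at hJ
      have hmap : (μt.map (s⁻¹ * ·)).map (s * ·) = μt := by
        have := map_scale (μ := μt) (inv_ne_zero hspos.ne')
        rwa [inv_inv] at this
      have hh := hhalf _ _ (s⁻¹ * ε) (by positivity) hJ
      have := scale_W hJ hspos le_rfl hp2 (K := s⁻¹ * ε / 2) (by positivity) (by simpa using hh)
      rw [hmap, hs2] at this
      refine this.trans (le_of_eq ?_)
      congr 1
      field_simp

end SJ

namespace SJ

/-- difference of two half-line indicators -/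
noncomputable def stp (q : ℝ × ℝ) (x : ℝ) : ℝ :=
  (if q.1 ≤ x then 1 else 0) - (if q.2 ≤ x then 1 else 0)

lemma stp_meas : Measurable (fun z : (ℝ × ℝ) × ℝ => stp z.1 z.2) := by
  unfold stp
  refine Measurable.sub ?_ ?_
  · exact Measurable.ite (measurableSet_le (by fun_prop) (by fun_prop)) measurable_const measurable_const
  · exact Measurable.ite (measurableSet_le (by fun_prop) (by fun_prop)) measurable_const measurable_const

lemma stp_pos {a b : ℝ} (h : a ≤ b) : stp (a, b) = (Set.Ico a b).indicator 1 := by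
  funext x
  unfold stp
  simp only [Set.indicator, Set.mem_Ico, Pi.one_apply]
  split_ifs <;> first | (exfalso; grind) | norm_num

lemma stp_neg {a b : ℝ} (h : b ≤ a) : stp (a, b) = fun x => - (Set.Ico b a).indicator 1 x := by
  funext x
  unfold stp
  simp only [Set.indicator, Set.mem_Ico, Pi.one_apply]
  split_ifs <;> first | (exfalso; grind) | norm_num

lemma stp_int (a b : ℝ) (F : ℝ → ℂ) : ∫ x, (stp (a, b) x : ℂ) * F x = ∫ x in a..b, F x := by
  rcases le_total a b with h | h
  · rw [stp_pos h, intervalIntegral.integral_of_le h, integral_Ioc_eq_integral_Ioo, ← integral_Ico_eq_integral_Ioo,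
      ← integral_indicator measurableSet_Ico]
    congr 1; funext x
    by_cases hx : x ∈ Set.Ico a b <;> simp [Set.indicator, hx]
  · rw [stp_neg h, intervalIntegral.integral_of_ge h, integral_Ioc_eq_integral_Ioo, ← integral_Ico_eq_integral_Ioo,
      ← integral_indicator measurableSet_Ico, ← integral_neg]
    congr 1; funext x
    by_cases hx : x ∈ Set.Ico b a <;> simp [Set.indicator, hx]

lemma stp_abs (a b x : ℝ) : |stp (a, b) x| = (Set.Ico (min a b) (max a b)).indicator 1 x := by
  rcases le_total a b with h | h
  · rw [stp_pos h, min_eq_left h, max_eq_right h]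
    by_cases hx : x ∈ Set.Ico a b <;> simp [Set.indicator, hx]
  · rw [stp_neg h, min_eq_right h, max_eq_left h]
    by_cases hx : x ∈ Set.Ico b a <;> simp [Set.indicator, hx]

lemma stp_integrable (a b : ℝ) : Integrable (stp (a, b)) := by
  refine (integrable_norm_iff ?_).mp ?_
  · exact (stp_meas.comp (measurable_const.prodMk measurable_id)).aestronglyMeasurable
  · have : (fun x => ‖stp (a, b) x‖) = (Set.Ico (min a b) (max a b)).indicator 1 := by
      funext x; exact stp_abs a b x
    rw [this]
    exact (integrable_indicator_iff measurableSet_Ico).mpr (integrableOn_const (by simp))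

lemma stp_int_abs (a b : ℝ) : ∫ x, ‖stp (a, b) x‖ = |b - a| := by
  have : (fun x => ‖stp (a, b) x‖) = (Set.Ico (min a b) (max a b)).indicator 1 := by
    funext x; exact stp_abs a b x
  rw [this, integral_indicator_one measurableSet_Ico]
  simp [Measure.real]
  rcases le_total a b with h | h
  · rw [max_eq_right h, min_eq_left h, abs_of_nonneg (by linarith)]
  · rw [max_eq_left h, min_eq_right h, abs_of_nonpos (by linarith)]; ring

noncomputable def Dc (μ : Measure ℝ) (x : ℝ) : ℝ := cdf μ x - cdf gam x

lemma Dc_meas (μ : Measure ℝ) : Measurable (Dc μ) :=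
  (cdf μ).mono.measurable.sub (cdf gam).mono.measurable

lemma Dc_abs_le (μ : Measure ℝ) (x : ℝ) : |Dc μ x| ≤ 1 := by
  unfold Dc
  rw [abs_le]
  constructor <;> linarith [cdf_nonneg μ x, cdf_le_one μ x, cdf_nonneg gam x, cdf_le_one gam x]

lemma stp_prod_int {μ : Measure ℝ} [IsProbabilityMeasure μ] (hi : Integrable (fun x : ℝ => x) μ) :
    Integrable (fun z : (ℝ × ℝ) × ℝ => stp z.1 z.2) ((μ.prod gam).prod volume) := by
  rw [integrable_prod_iff stp_meas.aestronglyMeasurable]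
  refine ⟨Filter.Eventually.of_forall fun q => stp_integrable q.1 q.2, ?_⟩
  have : (fun q : ℝ × ℝ => ∫ x, ‖stp q x‖) = fun q => |q.2 - q.1| := by
    funext q; exact stp_int_abs q.1 q.2
  rw [this]
  have h1 : Integrable (fun q : ℝ × ℝ => q.1) (μ.prod gam) := hi.comp_fst gam
  have h2 : Integrable (fun q : ℝ × ℝ => q.2) (μ.prod gam) := gam_int_id.comp_snd μ
  exact (h2.sub h1).abs

lemma Dc_repr (μ : Measure ℝ) [IsProbabilityMeasure μ] (x : ℝ) : ∫ q, stp q x ∂(μ.prod gam) = Dc μ x := by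
  have hI : ∀ (ρ : Measure ℝ) [IsProbabilityMeasure ρ], (∫ a, (if a ≤ x then (1:ℝ) else 0) ∂ρ) = cdf ρ x := by
    intro ρ _
    rw [cdf_eq_real]
    have : (fun a : ℝ => if a ≤ x then (1:ℝ) else 0) = (Set.Iic x).indicator 1 := by
      funext a; simp [Set.indicator]
    rw [this, integral_indicator_one measurableSet_Iic]
  have hb : ∀ (ρ : Measure ℝ) [IsProbabilityMeasure ρ], Integrable (fun a : ℝ => if a ≤ x then (1:ℝ) else 0) ρ := by
    intro ρ _
    refine Integrable.of_bound (C := 1) ?_ (Filter.Eventually.of_forall fun a => ?_)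
    · exact (Measurable.ite (measurableSet_le measurable_id measurable_const) measurable_const measurable_const).aestronglyMeasurable
    · split_ifs <;> simp
  have h1 : Integrable (fun q : ℝ × ℝ => if q.1 ≤ x then (1:ℝ) else 0) (μ.prod gam) := (hb μ).comp_fst gam
  have h2 : Integrable (fun q : ℝ × ℝ => if q.2 ≤ x then (1:ℝ) else 0) (μ.prod gam) := (hb gam).comp_snd μ
  unfold stp Dc
  rw [integral_sub h1 h2, ← hI μ, ← hI gam]
  congr 1
  · have := integral_fun_fst (μ := μ) (ν := gam) (fun a : ℝ => if a ≤ x then (1:ℝ) else 0)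
    simpa using this
  · have := integral_fun_snd (μ := μ) (ν := gam) (fun a : ℝ => if a ≤ x then (1:ℝ) else 0)
    simpa using this

lemma Dc_int {μ : Measure ℝ} [IsProbabilityMeasure μ] (hi : Integrable (fun x : ℝ => x) μ) : Integrable (Dc μ) := by
  have := (stp_prod_int hi).integral_prod_right
  simpa only [Dc_repr] using this

lemma ee_interval {w : ℝ} (hw : w ≠ 0) (a b : ℝ) :
    ∫ x in a..b, Complex.exp ((w * x : ℝ) * Complex.I) =
      (Complex.exp ((w * b : ℝ) * Complex.I) - Complex.exp ((w * a : ℝ) * Complex.I)) / (w * Complex.I) := by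
  have hc : (w : ℂ) * Complex.I ≠ 0 := by simp [hw]
  have := integral_exp_mul_complex (a := a) (b := b) hc
  rw [show (fun x : ℝ => Complex.exp ((w * x : ℝ) * Complex.I)) = fun x : ℝ => Complex.exp (w * Complex.I * x) by
    funext x; congr 1; push_cast; ring, this]
  congr 3 <;> (push_cast; ring)

lemma Dc_fourier {μ : Measure ℝ} [IsProbabilityMeasure μ] (hi : Integrable (fun x : ℝ => x) μ) {w : ℝ} (hw : w ≠ 0) :
    ∫ x, (Dc μ x : ℂ) * Complex.exp ((w * x : ℝ) * Complex.I) = (charFun gam w - charFun μ w) / (w * Complex.I) := by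
  have hI := stp_prod_int hi
  have hF : Integrable (fun z : (ℝ × ℝ) × ℝ => (stp z.1 z.2 : ℂ) * Complex.exp ((w * z.2 : ℝ) * Complex.I))
      ((μ.prod gam).prod volume) := by
    refine hI.ofReal.mul_bdd (c := 1) ?_ ?_
    · exact Continuous.aestronglyMeasurable (by fun_prop)
    · exact Filter.Eventually.of_forall fun z => (norm_ee _).le
  have e1 : ∀ x, (Dc μ x : ℂ) * Complex.exp ((w * x : ℝ) * Complex.I) =
      ∫ q, (stp q x : ℂ) * Complex.exp ((w * x : ℝ) * Complex.I) ∂(μ.prod gam) := by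
    intro x
    rw [integral_mul_const, ← Dc_repr μ x, integral_complex_ofReal]
  simp_rw [e1]
  rw [← integral_integral_swap hF]
  have e2 : ∀ q : ℝ × ℝ, ∫ x, (stp q x : ℂ) * Complex.exp ((w * x : ℝ) * Complex.I) =
      (Complex.exp ((w * q.2 : ℝ) * Complex.I) - Complex.exp ((w * q.1 : ℝ) * Complex.I)) / (w * Complex.I) := by
    intro q
    rw [← ee_interval hw, ← stp_int]
  simp_rw [e2]
  rw [integral_div]
  congr 1
  have h1 : Integrable (fun q : ℝ × ℝ => Complex.exp ((w * q.1 : ℝ) * Complex.I)) (μ.prod gam) :=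
    by simpa only [Complex.ofReal_mul] using (int_ee μ w).comp_fst gam
  have h2 : Integrable (fun q : ℝ × ℝ => Complex.exp ((w * q.2 : ℝ) * Complex.I)) (μ.prod gam) :=
    by simpa only [Complex.ofReal_mul] using (int_ee gam w).comp_snd μ
  rw [integral_sub h2 h1]
  congr 1
  · have := integral_fun_snd (μ := μ) (ν := gam) (fun a : ℝ => Complex.exp ((w * a : ℝ) * Complex.I))
    rw [this]
    simp [charFun_apply_real]
  · have := integral_fun_fst (μ := μ) (ν := gam) (fun a : ℝ => Complex.exp ((w * a : ℝ) * Complex.I))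
    rw [this]
    simp [charFun_apply_real]

end SJ

namespace SJ

/-- Fourier integral -/
noncomputable def dhat (D : ℝ → ℝ) (w : ℝ) : ℂ := ∫ x, (D x : ℂ) * Complex.exp ((w * x : ℝ) * Complex.I)

lemma dhat_cont {D : ℝ → ℝ} (hi : Integrable D) : Continuous (dhat D) := by
  unfold dhat
  refine continuous_of_dominated (bound := fun x => |D x|) ?_ ?_ hi.abs ?_
  · intro w
    exact hi.ofReal.aestronglyMeasurable.mul (Continuous.aestronglyMeasurable (by fun_prop))
  · intro w
    refine Filter.Eventually.of_forall fun x => ?_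
    rw [norm_mul, norm_ee, mul_one, Complex.norm_real, Real.norm_eq_abs]
  · refine Filter.Eventually.of_forall fun x => by fun_prop

lemma dhat_bdd {D : ℝ → ℝ} (w : ℝ) : ‖dhat D w‖ ≤ ∫ x, |D x| := by
  refine (norm_integral_le_integral_norm _).trans (le_of_eq ?_)
  congr 1; funext x
  rw [norm_mul, norm_ee, mul_one, Complex.norm_real, Real.norm_eq_abs]

lemma dhat_sq {D : ℝ → ℝ} (w : ℝ) : ((‖dhat D w‖ ^ 2 : ℝ) : ℂ) =
    ∫ p : ℝ × ℝ, (D p.1 * D p.2 : ℝ) * Complex.exp ((w * (p.1 - p.2) : ℝ) * Complex.I) ∂(volume.prod volume) := by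
  have h1 : ((‖dhat D w‖ ^ 2 : ℝ) : ℂ) = dhat D w * (starRingEnd ℂ) (dhat D w) := by
    rw [Complex.mul_conj, Complex.normSq_eq_norm_sq]
  rw [h1]
  unfold dhat
  rw [← integral_conj, ← integral_prod_mul]
  congr 1; funext p
  rw [map_mul, Complex.conj_ofReal, ← Complex.exp_conj, map_mul, Complex.conj_I, Complex.conj_ofReal]
  rw [show ((w * (p.1 - p.2) : ℝ) : ℂ) * Complex.I = (w * p.1 : ℝ) * Complex.I + (w * p.2 : ℝ) * -Complex.I by
    push_cast; ring, Complex.exp_add]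
  push_cast; ring

lemma gn_int {D : ℝ → ℝ} (hi : Integrable D) (v : ℝ≥0) :
    ((∫ w, ‖dhat D w‖ ^ 2 ∂(gaussianReal 0 v) : ℝ) : ℂ) =
    ∫ p : ℝ × ℝ, ((D p.1 * D p.2 * Real.exp (-(v * (p.1 - p.2) ^ 2 / 2)) : ℝ) : ℂ) ∂(volume.prod volume) := by
  rw [← integral_complex_ofReal]
  simp_rw [dhat_sq]
  have hP : Integrable (fun p : ℝ × ℝ => D p.1 * D p.2) (volume.prod volume) := hi.mul_prod hi
  have hF : Integrable (fun z : ℝ × (ℝ × ℝ) => ((D z.2.1 * D z.2.2 : ℝ) : ℂ) *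
      Complex.exp ((z.1 * (z.2.1 - z.2.2) : ℝ) * Complex.I)) ((gaussianReal 0 v).prod (volume.prod volume)) := by
    refine Integrable.mul_bdd (c := 1) ?_ ?_ ?_
    · exact (hP.comp_snd (gaussianReal 0 v)).ofReal
    · exact Continuous.aestronglyMeasurable (by fun_prop)
    · exact Filter.Eventually.of_forall fun z => (norm_ee _).le
  rw [integral_integral_swap hF]
  congr 1; funext p
  rw [integral_const_mul]
  have := charFun_gaussianReal (μ := 0) (v := v) (p.1 - p.2)
  rw [charFun_apply_real] at this
  have e : ∫ w : ℝ, Complex.exp ((w * (p.1 - p.2) : ℝ) * Complex.I) ∂(gaussianReal 0 v) =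
      ∫ w : ℝ, Complex.exp ((p.1 - p.2 : ℝ) * w * Complex.I) ∂(gaussianReal 0 v) := by
    congr 1; funext w; congr 1; push_cast; ring
  rw [e, this]
  push_cast
  congr 2; ring_nf

lemma gn_int' {D : ℝ → ℝ} (hi : Integrable D) (v : ℝ≥0) :
    ∫ w, ‖dhat D w‖ ^ 2 ∂(gaussianReal 0 v) =
    ∫ x, D x * ∫ y, D y * Real.exp (-(v * (x - y) ^ 2 / 2)) := by
  have h := gn_int hi v
  rw [integral_complex_ofReal] at h
  have h' := Complex.ofReal_injective h
  rw [h']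
  have hP : Integrable (fun p : ℝ × ℝ => D p.1 * D p.2) (volume.prod volume) := hi.mul_prod hi
  have hE : Integrable (fun p : ℝ × ℝ => D p.1 * D p.2 * Real.exp (-(v * (p.1 - p.2) ^ 2 / 2))) (volume.prod volume) := by
    refine hP.mul_bdd (c := 1) (Continuous.aestronglyMeasurable (by fun_prop)) ?_
    refine Filter.Eventually.of_forall fun p => ?_
    rw [Real.norm_eq_abs, abs_of_pos (Real.exp_pos _)]
    exact Real.exp_le_one_iff.mpr (by have := v.2; have : 0 ≤ (v:ℝ) * (p.1 - p.2) ^ 2 := by positivity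
                                      linarith)
  rw [integral_prod _ hE]
  congr 1; funext x
  rw [← integral_const_mul]
  congr 1; funext y; ring

lemma inner_sub (D : ℝ → ℝ) {n : ℝ} (hn : 0 < n) (x : ℝ) :
    ∫ y, D y * Real.exp (-(n ^ 2 * (x - y) ^ 2 / 2)) = Real.sqrt (2 * Real.pi) / n * ∫ z, D (x + z / n) ∂gam := by
  have h1 : ∫ z, D (x + z / n) ∂gam = ∫ z, gaussianPDFReal 0 1 z * D (x + z / n) := by
    have := integral_gaussianReal_eq_integral_smul (μ := 0) (v := 1) (by norm_num) (f := fun z => D (x + z / n))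
    simpa [smul_eq_mul] using this
  have h2 := integral_add_left_eq_self (μ := volume) (fun y => D y * Real.exp (-(n ^ 2 * (x - y) ^ 2 / 2))) x
  have h3 := Measure.integral_comp_mul_left (fun t => D (x + t) * Real.exp (-(n ^ 2 * (x - (x + t)) ^ 2 / 2))) (n⁻¹)
  rw [← h2, h1]
  simp only [inv_inv, smul_eq_mul, abs_of_pos hn] at h3
  have h4 : (fun z => gaussianPDFReal 0 1 z * D (x + z / n)) = fun z => (Real.sqrt (2 * Real.pi))⁻¹ *
      (D (x + n⁻¹ * z) * Real.exp (-(n ^ 2 * (x - (x + n⁻¹ * z)) ^ 2 / 2))) := by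
    funext z
    simp only [gaussianPDFReal]
    rw [show n⁻¹ * z = z / n by ring, show -(n ^ 2 * (x - (x + z / n)) ^ 2 / 2) = -(z - 0) ^ 2 / (2 * 1) by
      field_simp; ring]
    simp only [NNReal.coe_one, mul_one]
    ring
  rw [h4, integral_const_mul, h3]
  have : Real.sqrt (2 * Real.pi) ≠ 0 := by positivity
  field_simp

lemma planch {D : ℝ → ℝ} (hm : Measurable D) (hi : Integrable D) (hb : ∀ x, |D x| ≤ 1)
    (hc : ∀ᵐ x, ContinuousAt D x) :
    ∫⁻ x, ENNReal.ofReal (D x ^ 2) ≤ ENNReal.ofReal (1 / (2 * Real.pi)) * ∫⁻ w, ENNReal.ofReal (‖dhat D w‖ ^ 2) := by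
  have hsq : Integrable (fun x => D x ^ 2) := by
    have : Integrable (fun x => D x * D x) := hi.mul_bdd (c := 1) hm.aestronglyMeasurable (Filter.Eventually.of_forall hb)
    simpa only [sq] using this
  rw [← ofReal_integral_eq_lintegral_ofReal hsq (Filter.Eventually.of_forall fun x => sq_nonneg _)]
  set K : ℕ → ℝ := fun n => ∫ p : ℝ × ℝ, D p.1 * D (p.1 + p.2 / ((n:ℝ) + 1)) ∂(volume.prod gam) with hK
  have hKm : ∀ n : ℕ, Measurable (fun p : ℝ × ℝ => D p.1 * D (p.1 + p.2 / ((n:ℝ) + 1))) := fun n =>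
    (hm.comp measurable_fst).mul (hm.comp (by fun_prop))
  have hdom : Integrable (fun p : ℝ × ℝ => |D p.1|) (volume.prod gam) := hi.abs.comp_fst gam
  have hbd : ∀ (n : ℕ) (p : ℝ × ℝ), ‖D p.1 * D (p.1 + p.2 / ((n:ℝ) + 1))‖ ≤ |D p.1| := by
    intro n p
    rw [norm_mul, Real.norm_eq_abs, Real.norm_eq_abs]
    exact mul_le_of_le_one_right (abs_nonneg _) (hb _)
  have hlim : Filter.Tendsto K Filter.atTop (nhds (∫ p : ℝ × ℝ, D p.1 ^ 2 ∂(volume.prod gam))) := by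
    refine tendsto_integral_of_dominated_convergence (fun p => |D p.1|) (fun n => (hKm n).aestronglyMeasurable) hdom
      (fun n => Filter.Eventually.of_forall (hbd n)) ?_
    have h0 : ∀ᵐ p : ℝ × ℝ ∂(volume.prod gam), ContinuousAt D p.1 := Measure.quasiMeasurePreserving_fst.ae hc
    filter_upwards [h0] with p hp
    rw [sq]
    refine Filter.Tendsto.const_mul _ (hp.tendsto.comp ?_)
    have h1 : Filter.Tendsto (fun n : ℕ => p.2 / ((n:ℝ) + 1)) Filter.atTop (nhds 0) :=
      tendsto_const_nhds.div_atTop (Filter.tendsto_atTop_add_const_right _ _ tendsto_natCast_atTop_atTop)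
    simpa using h1.const_add p.1
  have hI : ∫ p : ℝ × ℝ, D p.1 ^ 2 ∂(volume.prod gam) = ∫ x, D x ^ 2 := by
    have := integral_fun_fst (μ := volume) (ν := gam) (fun x : ℝ => D x ^ 2)
    simpa using this
  rw [hI] at hlim
  refine le_of_tendsto (ENNReal.tendsto_ofReal hlim) (Filter.Eventually.of_forall fun n => ?_)
  set m : ℝ := (n:ℝ) + 1 with hmdef
  have hm0 : 0 < m := by positivity
  set v : ℝ≥0 := ⟨m ^ 2, by positivity⟩ with hv
  have hKn : K n = m / Real.sqrt (2 * Real.pi) * ∫ w, ‖dhat D w‖ ^ 2 ∂(gaussianReal 0 v) := by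
    rw [gn_int' hi v]
    have : ∀ x, (∫ y, D y * Real.exp (-(v * (x - y) ^ 2 / 2))) = Real.sqrt (2 * Real.pi) / m * ∫ z, D (x + z / m) ∂gam :=
      fun x => inner_sub D hm0 x
    simp_rw [this]
    rw [hK]
    simp only
    rw [integral_prod _ (Integrable.mono' hdom (hKm n).aestronglyMeasurable (Filter.Eventually.of_forall (hbd n))),
      ← integral_const_mul]
    congr 1; funext x
    simp only
    rw [integral_const_mul]
    have : Real.sqrt (2 * Real.pi) ≠ 0 := by positivity
    set J := ∫ z, D (x + z / ((n:ℝ) + 1)) ∂gam with hJ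
    field_simp
  have hdi : Integrable (fun w => ‖dhat D w‖ ^ 2) (gaussianReal 0 v) := by
    refine Integrable.of_bound (C := (∫ x, |D x|) ^ 2) ?_ (Filter.Eventually.of_forall fun w => ?_)
    · exact ((dhat_cont hi).norm.pow 2).aestronglyMeasurable
    · rw [Real.norm_eq_abs, abs_of_nonneg (by positivity)]
      exact pow_le_pow_left₀ (norm_nonneg _) (dhat_bdd w) 2
  have hdm : Measurable (fun w => ENNReal.ofReal (‖dhat D w‖ ^ 2)) :=
    (((dhat_cont hi).norm.pow 2).measurable : Measurable (fun w => ‖dhat D w‖ ^ 2)).ennreal_ofReal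
  rw [hKn, ENNReal.ofReal_mul (by positivity), ofReal_integral_eq_lintegral_ofReal hdi
    (Filter.Eventually.of_forall fun w => by positivity), gaussianReal_of_var_ne_zero _ (by
      intro h; have h2 : m ^ 2 = 0 := congrArg NNReal.toReal h
      exact absurd h2 (by positivity))]
  rw [lintegral_withDensity_eq_lintegral_mul _ (measurable_gaussianPDF 0 v)
    hdm]
  have hle : ∀ w, (gaussianPDF 0 v * fun w => ENNReal.ofReal (‖dhat D w‖ ^ 2)) w ≤
      ENNReal.ofReal ((Real.sqrt (2 * Real.pi) * m)⁻¹) * ENNReal.ofReal (‖dhat D w‖ ^ 2) := by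
    intro w
    simp only [Pi.mul_apply]
    gcongr
    rw [gaussianPDF]
    apply ENNReal.ofReal_le_ofReal
    rw [gaussianPDFReal]
    have e : Real.sqrt (2 * Real.pi * v) = Real.sqrt (2 * Real.pi) * m := by
      rw [show (v:ℝ) = m ^ 2 from rfl, Real.sqrt_mul (by positivity), Real.sqrt_sq hm0.le]
    rw [e]
    refine mul_le_of_le_one_right (by positivity) (Real.exp_le_one_iff.mpr ?_)
    rw [neg_div]
    have : 0 ≤ (w - 0) ^ 2 / (2 * (v:ℝ)) := by have := v.2; positivity
    linarith
  refine (mul_le_mul_right (lintegral_mono hle) _).trans ?_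
  rw [lintegral_const_mul _ hdm, ← mul_assoc,
    ← ENNReal.ofReal_mul (by positivity)]
  gcongr
  have : Real.sqrt (2 * Real.pi) * Real.sqrt (2 * Real.pi) = 2 * Real.pi := Real.mul_self_sqrt (by positivity)
  have h' : Real.sqrt (2 * Real.pi) ≠ 0 := by positivity
  apply le_of_eq
  rw [show m / Real.sqrt (2 * Real.pi) * (Real.sqrt (2 * Real.pi) * m)⁻¹ =
    1 / (Real.sqrt (2 * Real.pi) * Real.sqrt (2 * Real.pi)) by field_simp, this]

lemma Dc_planch {μ : Measure ℝ} [IsProbabilityMeasure μ] (hi : Integrable (fun x : ℝ => x) μ) :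
    ∫⁻ x, ENNReal.ofReal (Dc μ x ^ 2) ≤ ENNReal.ofReal (1 / (2 * Real.pi)) *
      ∫⁻ w, ENNReal.ofReal (‖charFun μ w - charFun gam w‖ ^ 2 / w ^ 2) := by
  have hc : ∀ᵐ x, ContinuousAt (Dc μ) x := by
    have h1 : ∀ᵐ x : ℝ, ContinuousAt (cdf μ) x := by
      rw [ae_iff]; exact ((cdf μ).mono.countable_not_continuousAt).measure_zero _
    have h2 : ∀ᵐ x : ℝ, ContinuousAt (cdf gam) x := by
      rw [ae_iff]; exact ((cdf gam).mono.countable_not_continuousAt).measure_zero _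
    filter_upwards [h1, h2] with x a b
    exact a.sub b
  refine (planch (Dc_meas μ) (Dc_int hi) (Dc_abs_le μ) hc).trans ?_
  refine mul_le_mul_right (lintegral_mono_ae ?_) _
  have h0 : ∀ᵐ w : ℝ, w ≠ 0 := by simp [ae_iff]
  filter_upwards [h0] with w hw
  apply ENNReal.ofReal_le_ofReal
  unfold dhat
  rw [Dc_fourier hi hw, norm_div, norm_mul, Complex.norm_I, mul_one, Complex.norm_real, Real.norm_eq_abs,
    div_pow, sq_abs, norm_sub_rev]

end SJ

namespace SJ

lemma stp_lint (a b : ℝ) : ∫⁻ x, ENNReal.ofReal |stp (a, b) x| = ENNReal.ofReal |a - b| := by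
  have := stp_int_abs a b
  rw [abs_sub_comm, ← this, ofReal_integral_eq_lintegral_ofReal (stp_integrable a b).norm
    (Filter.Eventually.of_forall fun _ => norm_nonneg _)]
  rfl

lemma lint_swap {π : Measure (ℝ × ℝ)} [IsProbabilityMeasure π] (S : Set ℝ) :
    ∫⁻ q, (∫⁻ x in S, ENNReal.ofReal |stp q x|) ∂π = ∫⁻ x in S, (∫⁻ q, ENNReal.ofReal |stp q x| ∂π) := by
  refine lintegral_lintegral_swap ?_
  exact (stp_meas.abs.ennreal_ofReal).aemeasurable

lemma qf_pair_abs (μ : Measure ℝ) [IsProbabilityMeasure μ] (x : ℝ) :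
    ∫⁻ u, ENNReal.ofReal |stp (qf μ u, qf gam u) x| ∂unif ≤ ENNReal.ofReal |Dc μ x| := by
  have h1 : ∀ᵐ u ∂unif, ENNReal.ofReal |stp (qf μ u, qf gam u) x| =
      (Set.Ioc (min (cdf μ x) (cdf gam x)) (max (cdf μ x) (cdf gam x))).indicator 1 u := by
    filter_upwards [unif_mem] with u hu
    unfold stp
    simp only [qf_le_iff μ hu, qf_le_iff gam hu]
    simp only [Set.indicator, Set.mem_Ioc, Pi.one_apply, min_lt_iff, le_max_iff]
    split_ifs <;> first | (exfalso; grind) | norm_num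
  rw [lintegral_congr_ae h1, lintegral_indicator_one measurableSet_Ioc]
  refine (Measure.restrict_apply_le _ _).trans ?_
  rw [Real.volume_Ioc]
  apply ENNReal.ofReal_le_ofReal
  unfold Dc
  rw [max_sub_min_eq_abs, abs_sub_comm]

lemma w1_le_D (μ : Measure ℝ) [IsProbabilityMeasure μ] :
    ∫⁻ u, ENNReal.ofReal |qf μ u - qf gam u| ∂unif ≤ ∫⁻ x, ENNReal.ofReal |Dc μ x| := by
  have hPu : IsProbabilityMeasure unif := ⟨by simp [unif]⟩
  have hm : AEMeasurable (fun u => (qf μ u, qf gam u)) unif := (qf_aemeasurable μ).prodMk (qf_aemeasurable gam)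
  set π := unif.map (fun u => (qf μ u, qf gam u)) with hπ
  have : IsProbabilityMeasure π := Measure.isProbabilityMeasure_map hm
  have h := lint_swap (π := π) Set.univ
  simp only [Measure.restrict_univ] at h
  have e1 : ∀ q : ℝ × ℝ, ∫⁻ x, ENNReal.ofReal |stp q x| = ENNReal.ofReal |q.1 - q.2| := fun q => stp_lint q.1 q.2
  simp_rw [e1] at h
  rw [hπ, lintegral_map' (by fun_prop) hm] at h
  simp only at h
  rw [h]
  refine lintegral_mono fun x => ?_
  rw [lintegral_map' ?_ hm]
  · exact qf_pair_abs μ x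
  · exact ((stp_meas.comp (measurable_id.prodMk measurable_const)).abs.ennreal_ofReal).aemeasurable

/-- set outside `[-A, A]` -/
def outA (A : ℝ) : Set ℝ := {x | A < |x|}

lemma outA_meas (A : ℝ) : MeasurableSet (outA A) := measurableSet_lt measurable_const measurable_id.abs

lemma stp_out {A : ℝ} (hA : 0 < A) (a : ℝ) :
    ∫⁻ x in outA A, ENNReal.ofReal |stp (a, 0) x| = ENNReal.ofReal (|a| - A) := by
  have h1 : (fun x => ENNReal.ofReal |stp (a, 0) x|) = (Set.Ico (min a 0) (max a 0)).indicator 1 := by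
    funext x; rw [stp_abs]
    by_cases hx : x ∈ Set.Ico (min a 0) (max a 0) <;> simp [Set.indicator, hx]
  rw [h1, lintegral_indicator_one measurableSet_Ico, Measure.restrict_apply measurableSet_Ico]
  rcases le_total 0 a with h | h
  · rw [min_eq_right h, max_eq_left h, abs_of_nonneg h, ← Real.volume_Ioo]
    congr 1; ext x
    simp only [outA, Set.mem_inter_iff, Set.mem_Ico, Set.mem_ofPred_eq, Set.mem_Ioo]
    constructor
    · rintro ⟨⟨h1, h2⟩, h3⟩; rw [abs_of_nonneg h1] at h3; exact ⟨h3, h2⟩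
    · rintro ⟨h1, h2⟩; exact ⟨⟨by linarith, h2⟩, by rw [abs_of_nonneg (by linarith)]; exact h1⟩
  · rw [min_eq_left h, max_eq_right h, abs_of_nonpos h, show -a - A = -A - a by ring, ← Real.volume_Ico]
    congr 1; ext x
    simp only [outA, Set.mem_inter_iff, Set.mem_Ico, Set.mem_ofPred_eq]
    constructor
    · rintro ⟨⟨h1, h2⟩, h3⟩; rw [abs_of_neg h2] at h3; exact ⟨h1, by linarith⟩
    · rintro ⟨h1, h2⟩; exact ⟨⟨h1, by linarith⟩, by rw [abs_of_neg (by linarith)]; linarith⟩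

lemma cdf_step (ρ : Measure ℝ) [IsProbabilityMeasure ρ] (x : ℝ) :
    ENNReal.ofReal |cdf ρ x - (if 0 ≤ x then 1 else 0)| ≤ ∫⁻ a, ENNReal.ofReal |stp (a, 0) x| ∂ρ := by
  have hm : Measurable (fun a : ℝ => if a ≤ x then (1:ℝ) else 0) :=
    Measurable.ite (measurableSet_le measurable_id measurable_const) measurable_const measurable_const
  have hb : Integrable (fun a : ℝ => if a ≤ x then (1:ℝ) else 0) ρ := by
    refine Integrable.of_bound (C := 1) hm.aestronglyMeasurable (Filter.Eventually.of_forall fun a => ?_)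
    split_ifs <;> simp
  have e : cdf ρ x - (if 0 ≤ x then 1 else 0) = ∫ a, stp (a, 0) x ∂ρ := by
    show _ = ∫ a, ((if a ≤ x then (1:ℝ) else 0) - (if (0:ℝ) ≤ x then (1:ℝ) else 0)) ∂ρ
    rw [integral_sub hb (integrable_const (if (0:ℝ) ≤ x then (1:ℝ) else 0)), cdf_eq_real]
    have : (fun a : ℝ => if a ≤ x then (1:ℝ) else 0) = (Set.Iic x).indicator 1 := by
      funext a; simp [Set.indicator]
    rw [this, integral_indicator_one measurableSet_Iic]
    simp
  rw [e]
  have hi : Integrable (fun a => stp (a, 0) x) ρ := by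
    exact hb.sub (integrable_const (if (0:ℝ) ≤ x then (1:ℝ) else 0))
  rw [← ofReal_integral_eq_lintegral_ofReal hi.abs (Filter.Eventually.of_forall fun _ => abs_nonneg _)]
  exact ENNReal.ofReal_le_ofReal (abs_integral_le_integral_abs)

lemma tail_le (μ : Measure ℝ) [IsProbabilityMeasure μ] {A : ℝ} (hA : 0 < A) :
    ∫⁻ x in outA A, ENNReal.ofReal |Dc μ x| ≤
      ∫⁻ a, ENNReal.ofReal (|a| - A) ∂μ + ∫⁻ a, ENNReal.ofReal (|a| - A) ∂gam := by
  have hone : ∀ (ρ : Measure ℝ) [IsProbabilityMeasure ρ],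
      ∫⁻ x in outA A, (∫⁻ a, ENNReal.ofReal |stp (a, 0) x| ∂ρ) = ∫⁻ a, ENNReal.ofReal (|a| - A) ∂ρ := by
    intro ρ _
    rw [← lintegral_congr (fun a => stp_out hA a)]
    refine lintegral_lintegral_swap ?_
    exact ((stp_meas.comp ((measurable_snd.prodMk measurable_const).prodMk measurable_fst)).abs.ennreal_ofReal).aemeasurable
  rw [← hone μ, ← hone gam, ← lintegral_add_left']
  · refine lintegral_mono fun x => ?_
    refine le_trans ?_ (add_le_add (cdf_step μ x) (cdf_step gam x))
    rw [← ENNReal.ofReal_add (abs_nonneg _) (abs_nonneg _)]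
    apply ENNReal.ofReal_le_ofReal
    unfold Dc
    have := abs_sub (cdf μ x - (if 0 ≤ x then 1 else 0)) (cdf gam x - (if 0 ≤ x then 1 else 0))
    rwa [sub_sub_sub_cancel_right] at this
  · refine Measurable.aemeasurable ?_
    refine Measurable.lintegral_prod_left' (f := fun z : ℝ × ℝ => ENNReal.ofReal |stp (z.1, 0) z.2|) ?_
    exact (stp_meas.comp ((measurable_fst.prodMk measurable_const).prodMk measurable_snd)).abs.ennreal_ofReal

/-- combination of the central part (via Plancherel) and the tail. -/
lemma w1_combine {μ : Measure ℝ} [IsProbabilityMeasure μ] (hi : Integrable (fun x : ℝ => x) μ)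
    {A s d T : ℝ} (hA : 0 < A) (hd : 0 < d) (hT : 0 ≤ T) (hs : 0 ≤ s)
    (hS : ∫⁻ w, ENNReal.ofReal (‖charFun μ w - charFun gam w‖ ^ 2 / w ^ 2) ≤ ENNReal.ofReal (2 * s))
    (hsd : 2 * A * s ≤ Real.pi * d ^ 2)
    (htail : ∫⁻ x in outA A, ENNReal.ofReal |Dc μ x| ≤ ENNReal.ofReal T) :
    ∫⁻ u, ENNReal.ofReal |qf μ u - qf gam u| ∂unif ≤ ENNReal.ofReal (d + T) := by
  refine (w1_le_D μ).trans ?_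
  rw [← lintegral_add_compl _ (outA_meas A), add_comm, ENNReal.ofReal_add hd.le hT]
  refine add_le_add ?_ htail
  have hP : ∫⁻ x, ENNReal.ofReal (Dc μ x ^ 2) ≤ ENNReal.ofReal (s / Real.pi) := by
    refine (Dc_planch hi).trans ((mul_le_mul_right hS _).trans (le_of_eq ?_))
    rw [← ENNReal.ofReal_mul (by positivity)]
    congr 1; field_simp
  have hpt : ∀ x, ENNReal.ofReal |Dc μ x| ≤ ENNReal.ofReal (d / (4 * A)) + ENNReal.ofReal (A / d) * ENNReal.ofReal (Dc μ x ^ 2) := by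
    intro x
    rw [← ENNReal.ofReal_mul (by positivity), ← ENNReal.ofReal_add (by positivity) (by positivity)]
    apply ENNReal.ofReal_le_ofReal
    rw [← sq_abs (Dc μ x)]
    set t := |Dc μ x|
    have : d / (4 * A) + A / d * t ^ 2 - t = (d - 2 * A * t) ^ 2 / (4 * A * d) := by field_simp; ring
    have h2 : 0 ≤ (d - 2 * A * t) ^ 2 / (4 * A * d) := by positivity
    linarith
  have hvol : volume (outA A)ᶜ ≤ ENNReal.ofReal (2 * A) := by
    have : (outA A)ᶜ = Set.Icc (-A) A := by
      ext x; simp [outA, abs_le]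
    rw [this, Real.volume_Icc]; apply le_of_eq; congr 1; ring
  calc ∫⁻ x in (outA A)ᶜ, ENNReal.ofReal |Dc μ x|
      ≤ ∫⁻ x in (outA A)ᶜ, ENNReal.ofReal (d / (4 * A)) + ENNReal.ofReal (A / d) * ENNReal.ofReal (Dc μ x ^ 2) :=
        lintegral_mono hpt
    _ = ENNReal.ofReal (d / (4 * A)) * volume (outA A)ᶜ +
        ENNReal.ofReal (A / d) * ∫⁻ x in (outA A)ᶜ, ENNReal.ofReal (Dc μ x ^ 2) := by
        rw [lintegral_add_left measurable_const, lintegral_const, lintegral_const_mul _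
          (((Dc_meas μ).pow_const 2).ennreal_ofReal), Measure.restrict_apply_univ]
    _ ≤ ENNReal.ofReal (d / (4 * A)) * ENNReal.ofReal (2 * A) + ENNReal.ofReal (A / d) * ENNReal.ofReal (s / Real.pi) := by
        gcongr
        exact (setLIntegral_le_lintegral _ _).trans hP
    _ ≤ ENNReal.ofReal d := by
        rw [← ENNReal.ofReal_mul (by positivity), ← ENNReal.ofReal_mul (by positivity),
          ← ENNReal.ofReal_add (by positivity) (by positivity)]
        apply ENNReal.ofReal_le_ofReal
        have h1 : d / (4 * A) * (2 * A) = d / 2 := by field_simp; norm_num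
        have h2 : A / d * (s / Real.pi) ≤ d / 2 := by
          rw [div_mul_div_comm, div_le_div_iff₀ (by positivity) (by norm_num)]
          nlinarith
        linarith

end SJ

namespace SJ

lemma lint_even {f : ℝ → ℝ≥0∞} (he : ∀ x, f (-x) = f x) :
    ∫⁻ x, f x = 2 * ∫⁻ x in Set.Ioi 0, f x := by
  rw [← lintegral_add_compl f (measurableSet_Ioi (a := (0:ℝ))), two_mul]
  congr 1
  have h1 : (Set.Ioi (0:ℝ))ᶜ = Set.Iic 0 := by ext; simp
  rw [h1, setLIntegral_congr (f := f) (Iio_ae_eq_Iic (a := (0:ℝ))).symm]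
  have h2 : MeasurePreserving (fun x : ℝ => -x) volume volume := Measure.measurePreserving_neg _
  have h3 := h2.setLIntegral_comp_preimage_emb (MeasurableEquiv.neg ℝ).measurableEmbedding f (Set.Ioi 0)
  have h4 : (fun x : ℝ => -x) ⁻¹' Set.Ioi 0 = Set.Iio 0 := by ext; simp
  rw [h4] at h3
  rw [← h3]
  simp [he]

lemma lint_Ioi {F F' : ℝ → ℝ} {a L : ℝ} (hc : ContinuousWithinAt F (Set.Ici a) a)
    (hd : ∀ x ∈ Set.Ioi a, HasDerivAt F (F' x) x) (hp : ∀ x ∈ Set.Ioi a, 0 ≤ F' x)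
    (hL : Filter.Tendsto F Filter.atTop (nhds L)) :
    ∫⁻ x in Set.Ioi a, ENNReal.ofReal (F' x) = ENNReal.ofReal (L - F a) := by
  rw [← integral_Ioi_of_hasDerivAt_of_nonneg hc hd hp hL,
    ofReal_integral_eq_lintegral_ofReal (integrableOn_Ioi_deriv_of_nonneg hc hd hp hL)]
  exact (ae_restrict_iff' measurableSet_Ioi).2 (Filter.Eventually.of_forall fun x hx => hp x hx)

variable {κ μ : Measure ℝ} {v R : ℝ}

lemma unif_sq : ∫ u, u ^ 2 ∂unif = 1 / 3 := by
  unfold unif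
  rw [← integral_Ioc_eq_integral_Ioo, ← intervalIntegral.integral_of_le (by norm_num)]
  rw [integral_pow]; norm_num

lemma IsSJ.prod_supp (hs : IsSJ κ μ v R) : ∀ᵐ z ∂(unif.prod κ), z.1 ∈ Set.Ioo (0:ℝ) 1 ∧ |z.2| ≤ R := by
  have := hs.pκ
  have h1 : ∀ᵐ z ∂(unif.prod κ), z.1 ∈ Set.Ioo (0:ℝ) 1 :=
    Measure.quasiMeasurePreserving_fst.ae unif_mem
  have h2 : ∀ᵐ z ∂(unif.prod κ), |z.2| ≤ R :=
    Measure.quasiMeasurePreserving_snd.ae hs.supp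
  filter_upwards [h1, h2] with z h1 h2 using ⟨h1, h2⟩

lemma IsSJ.R_nonneg (hs : IsSJ κ μ v R) : 0 ≤ R := by
  have := hs.pκ
  obtain ⟨y, hy⟩ := hs.supp.exists
  exact (abs_nonneg y).trans hy

lemma IsSJ.m2 (hs : IsSJ κ μ 1 R) : ∫⁻ z, ENNReal.ofReal ((z.1 + z.2.1 * z.2.2) ^ 2) ∂(μ.prod (unif.prod κ)) ≤
    ENNReal.ofReal (1 + R ^ 2 / 3) := by
  have := hs.pκ
  have := hs.pμ
  rw [lintegral_prod_symm _ (by fun_prop)]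
  have h1 : ∀ᵐ q ∂(unif.prod κ), ∫⁻ x, ENNReal.ofReal ((x + q.1 * q.2) ^ 2) ∂μ ≤ ENNReal.ofReal (1 + q.1 ^ 2 * R ^ 2) := by
    filter_upwards [hs.prod_supp] with q hq
    have hi : Integrable (fun x : ℝ => (x + q.1 * q.2) ^ 2) μ := by
      have := ((hs.sq_int.add (hs.int_id.const_mul (2 * (q.1 * q.2)))).add (integrable_const ((q.1 * q.2) ^ 2)))
      refine this.congr (Filter.Eventually.of_forall fun x => ?_)
      simp only [Pi.add_apply]; ring
    rw [← ofReal_integral_eq_lintegral_ofReal hi (Filter.Eventually.of_forall fun x => sq_nonneg _)]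
    apply ENNReal.ofReal_le_ofReal
    have e : ∫ x, (x + q.1 * q.2) ^ 2 ∂μ = 1 + (q.1 * q.2) ^ 2 := by
      have e1 : ∀ x : ℝ, (x + q.1 * q.2) ^ 2 = (x ^ 2 + 2 * (q.1 * q.2) * x) + (q.1 * q.2) ^ 2 := fun x => by ring
      simp_rw [e1]
      have hi3 : Integrable (fun x : ℝ => x ^ 2 + 2 * (q.1 * q.2) * x) μ := hs.sq_int.add (hs.int_id.const_mul (2 * (q.1 * q.2)))
      rw [integral_add hi3 (integrable_const ((q.1 * q.2) ^ 2)),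
        integral_add hs.sq_int (hs.int_id.const_mul (2 * (q.1 * q.2))), integral_const_mul, hs.mean, hs.sq_eq]
      simp
    rw [e, mul_pow]
    have h3 : q.2 ^ 2 ≤ R ^ 2 := by rw [← sq_abs]; exact pow_le_pow_left₀ (abs_nonneg _) hq.2 2
    have := mul_le_mul_of_nonneg_left h3 (sq_nonneg q.1)
    linarith
  refine (lintegral_mono_ae h1).trans ?_
  rw [lintegral_prod _ (by fun_prop)]
  simp only [lintegral_const, measure_univ, mul_one]
  have hi : Integrable (fun u : ℝ => 1 + u ^ 2 * R ^ 2) unif := by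
    refine Integrable.of_bound (C := 1 + R ^ 2) (by fun_prop) ?_
    filter_upwards [unif_mem] with u hu
    have : u ^ 2 ≤ 1 := pow_le_one₀ hu.1.le hu.2.le
    rw [Real.norm_of_nonneg (by positivity)]
    nlinarith [sq_nonneg R]
  rw [← ofReal_integral_eq_lintegral_ofReal hi (Filter.Eventually.of_forall fun x => by positivity)]
  apply ENNReal.ofReal_le_ofReal
  have hi2 : Integrable (fun u : ℝ => u ^ 2 * R ^ 2) unif := by
    refine (hi.sub (integrable_const 1)).congr (Filter.Eventually.of_forall fun x => ?_)
    simp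
  rw [integral_add (integrable_const (1:ℝ)) hi2, integral_mul_const, unif_sq]
  simp; linarith

/-- fourth moment bound -/
lemma IsSJ.m4 (hs : IsSJ κ μ 1 R) : ∫⁻ x, ENNReal.ofReal (x ^ 4) ∂μ ≤ ENNReal.ofReal (3 + R ^ 2) := by
  have := hs.pκ
  have := hs.pμ
  have hstep : ∀ n : ℕ, ∫⁻ x, ENNReal.ofReal (x ^ 4 / (1 + (1 / ((n:ℝ) + 1)) * x ^ 2)) ∂μ ≤ ENNReal.ofReal (3 + R ^ 2) := by
    intro n
    set δ : ℝ := 1 / ((n:ℝ) + 1) with hδ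
    have hδ0 : 0 < δ := by positivity
    have hpos : ∀ x : ℝ, 0 < 1 + δ * x ^ 2 := fun x => by positivity
    set g : ℝ → ℝ := fun x => x ^ 3 / (1 + δ * x ^ 2)
    set g' : ℝ → ℝ := fun x => (3 * x ^ 2 + δ * x ^ 4) / (1 + δ * x ^ 2) ^ 2
    have hd : ∀ x, HasDerivAt g (g' x) x := by
      intro x
      have := ((hasDerivAt_pow 3 x).div (((hasDerivAt_pow 2 x).const_mul δ).const_add 1) (hpos x).ne')
      convert! this using 1
      simp only [g']; congr 1; push_cast; ring
    have hc : Continuous g' := by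
      refine Continuous.div (by fun_prop) (by fun_prop) fun x => (pow_pos (hpos x) 2).ne'
    have hg3 : ∀ x, g' x ≤ 3 * x ^ 2 := by
      intro x
      simp only [g']
      rw [div_le_iff₀ (pow_pos (hpos x) 2)]
      have : 0 ≤ δ * x ^ 4 := by positivity
      have : 0 ≤ δ ^ 2 * x ^ 6 := by positivity
      nlinarith
    have hg0 : ∀ x, 0 ≤ g' x := fun x => by simp only [g']; positivity
    have hK : ∀ x, |g' x| ≤ 3 / δ := by
      intro x
      rw [abs_of_nonneg (hg0 x)]
      simp only [g']
      rw [div_le_div_iff₀ (pow_pos (hpos x) 2) hδ0]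
      have : 0 ≤ δ * x ^ 2 := by positivity
      have : 0 ≤ δ ^ 2 * x ^ 4 := by positivity
      nlinarith
    have hz := hs.zero_bias g g' hd hc _ hK
    have hig : Integrable (fun x => x * g x) μ := by
      refine (hs.sq_int.const_mul (1 / δ)).mono' ?_ (Filter.Eventually.of_forall fun x => ?_)
      · refine Continuous.aestronglyMeasurable ?_
        exact continuous_id.mul (Continuous.div (by fun_prop) (by fun_prop) fun x => (hpos x).ne')
      · have e : x * g x = x ^ 4 / (1 + δ * x ^ 2) := by simp only [g]; ring
        rw [e, Real.norm_of_nonneg (by positivity), div_le_iff₀ (hpos x)]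
        field_simp
        nlinarith [sq_nonneg x]
    have e : ∀ x : ℝ, x ^ 4 / (1 + δ * x ^ 2) = x * g x := fun x => by simp only [g]; ring
    simp_rw [e]
    rw [← ofReal_integral_eq_lintegral_ofReal hig (Filter.Eventually.of_forall fun x => by
      show 0 ≤ x * g x
      rw [← e]; positivity), hz, one_mul]
    rw [ofReal_integral_eq_lintegral_ofReal (Integrable.of_bound (C := 3 / δ) (by fun_prop)
      (Filter.Eventually.of_forall fun z => hK _)) (Filter.Eventually.of_forall fun z => hg0 _)]
    calc _ ≤ ∫⁻ z, ENNReal.ofReal 3 * ENNReal.ofReal ((z.1 + z.2.1 * z.2.2) ^ 2) ∂(μ.prod (unif.prod κ)) := by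
          refine lintegral_mono fun z => ?_
          rw [← ENNReal.ofReal_mul (by norm_num)]
          exact ENNReal.ofReal_le_ofReal (hg3 _)
      _ ≤ ENNReal.ofReal 3 * ENNReal.ofReal (1 + R ^ 2 / 3) := by
          rw [lintegral_const_mul _ (by fun_prop)]
          exact mul_le_mul_right hs.m2 _
      _ ≤ _ := by
          rw [← ENNReal.ofReal_mul (by norm_num)]
          apply ENNReal.ofReal_le_ofReal; linarith
  have hlim : ∀ x : ℝ, Filter.Tendsto (fun n : ℕ => ENNReal.ofReal (x ^ 4 / (1 + (1 / ((n:ℝ) + 1)) * x ^ 2))) Filter.atTop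
      (nhds (ENNReal.ofReal (x ^ 4))) := by
    intro x
    apply ENNReal.tendsto_ofReal
    have h0 := tendsto_one_div_add_atTop_nhds_zero_nat (𝕜 := ℝ)
    have := (tendsto_const_nhds (x := x ^ 4)).div ((h0.mul_const (x ^ 2)).const_add 1) (by simp)
    refine Filter.Tendsto.congr (fun n => ?_) (by simpa using this)
    simp
  calc ∫⁻ x, ENNReal.ofReal (x ^ 4) ∂μ = ∫⁻ x, Filter.liminf (fun n : ℕ => ENNReal.ofReal (x ^ 4 / (1 + (1 / ((n:ℝ) + 1)) * x ^ 2))) Filter.atTop ∂μ :=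
        lintegral_congr fun x => ((hlim x).liminf_eq).symm
    _ ≤ _ := lintegral_liminf_le fun n => by fun_prop
    _ ≤ _ := by
        refine Filter.liminf_le_of_frequently_le' (Filter.Frequently.of_forall fun n => hstep n)

lemma IsSJ.mtail (hs : IsSJ κ μ 1 R) {A : ℝ} (hA : 0 < A) :
    ∫⁻ a, ENNReal.ofReal (|a| - A) ∂μ ≤ ENNReal.ofReal (27 / (256 * A ^ 3) * (3 + R ^ 2)) := by
  calc ∫⁻ a, ENNReal.ofReal (|a| - A) ∂μ ≤ ∫⁻ a, ENNReal.ofReal (27 / (256 * A ^ 3)) * ENNReal.ofReal (a ^ 4) ∂μ := by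
        refine lintegral_mono fun a => ?_
        rw [← ENNReal.ofReal_mul (by positivity)]
        apply ENNReal.ofReal_le_ofReal
        rw [div_mul_eq_mul_div, le_div_iff₀ (by positivity)]
        have e : a ^ 4 = |a| ^ 4 := by rw [← abs_pow, abs_of_nonneg (by positivity)]
        rw [e]
        set t := |a|
        have : 27 * t ^ 4 - (t - A) * (256 * A ^ 3) = (3 * t - 4 * A) ^ 2 * (3 * t ^ 2 + 8 * t * A + 16 * A ^ 2) := by ring
        have ht : 0 ≤ t := abs_nonneg a
        have h2 : 0 ≤ (3 * t - 4 * A) ^ 2 * (3 * t ^ 2 + 8 * t * A + 16 * A ^ 2) := by positivity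
        linarith
    _ ≤ _ := by
        rw [lintegral_const_mul _ (by fun_prop), ENNReal.ofReal_mul (by positivity)]
        exact mul_le_mul_right hs.m4 _

lemma pdf_eq (y : ℝ) : gaussianPDFReal 0 1 y = (√(2 * Real.pi))⁻¹ * Real.exp (-y ^ 2 / 2) := by
  simp [gaussianPDFReal]

lemma pdf_le (y : ℝ) : gaussianPDFReal 0 1 y ≤ 399 / 1000 * Real.exp (-y ^ 2 / 2) := by
  rw [pdf_eq]
  refine mul_le_mul_of_nonneg_right ?_ (Real.exp_nonneg _)
  rw [inv_le_comm₀ (by positivity) (by norm_num)]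
  apply Real.le_sqrt_of_sq_le
  have := Real.pi_gt_d4
  norm_num; linarith

lemma gtail_one {A : ℝ} (hA : 0 < A) :
    ∫⁻ y in Set.Ioi A, ENNReal.ofReal ((y - A) * gaussianPDFReal 0 1 y) ≤ ENNReal.ofReal (gaussianPDFReal 0 1 A / (1 + A ^ 2)) := by
  set φ := gaussianPDFReal 0 1 with hφ
  have hφp : ∀ y, 0 < φ y := fun y => gaussianPDFReal_pos 0 1 y (by norm_num)
  set F : ℝ → ℝ := fun y => -(φ y * (1 - A * y / (1 + y ^ 2))) with hF
  have hp : ∀ y : ℝ, 0 < 1 + y ^ 2 := fun y => by positivity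
  have hd : ∀ y, HasDerivAt F (φ y * (y - A + 2 * A / (1 + y ^ 2) ^ 2)) y := by
    intro y
    have h1 := ((hasDerivAt_pow 2 y).const_add 1)
    have h2 := (((hasDerivAt_id y).const_mul A).div h1 (hp y).ne')
    have h3 := ((hasDerivAt_pdf y).mul (h2.const_sub 1)).neg
    refine (h3.congr_deriv ?_)
    simp only [id, ← hφ, Pi.div_apply]
    have := (hp y).ne'
    field_simp
    push_cast
    ring
  have hlim : Filter.Tendsto F Filter.atTop (nhds 0) := by
    have hφ0 : Filter.Tendsto φ Filter.atTop (nhds 0) := by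
      have e : φ = fun y => (√(2 * Real.pi))⁻¹ * Real.exp (-y ^ 2 / 2) := funext pdf_eq
      rw [e]
      have : Filter.Tendsto (fun y : ℝ => -y ^ 2 / 2) Filter.atTop Filter.atBot := by
        have := (Filter.tendsto_pow_atTop (α := ℝ) (n := 2) (by norm_num)).atTop_div_const (r := 2) (by norm_num)
        refine (Filter.tendsto_neg_atTop_atBot.comp this).congr fun y => ?_
        simp; ring
      simpa using (Real.tendsto_exp_atBot.comp this).const_mul (√(2 * Real.pi))⁻¹
    rw [tendsto_zero_iff_abs_tendsto_zero]
    refine squeeze_zero (g := fun y => φ y * (1 + A)) (fun y => abs_nonneg _) (fun y => ?_) (by simpa using hφ0.mul_const (1 + A))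
    simp only [Function.comp_apply, hF]
    rw [abs_neg, abs_mul, abs_of_pos (hφp y)]
    refine mul_le_mul_of_nonneg_left ?_ (hφp y).le
    have h1 : |A * y / (1 + y ^ 2)| ≤ A := by
      rw [abs_div, abs_mul, abs_of_pos hA, abs_of_pos (hp y), div_le_iff₀ (hp y)]
      refine mul_le_mul_of_nonneg_left ?_ hA.le
      rw [← sq_abs]
      nlinarith [sq_nonneg (|y| - 1), abs_nonneg y]
    calc _ ≤ |(1:ℝ)| + |A * y / (1 + y ^ 2)| := abs_sub _ _
      _ ≤ _ := by simpa using h1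
  have h := lint_Ioi (a := A) (hd A).continuousAt.continuousWithinAt (fun y _ => hd y) (fun y hy => by
    have : 0 < y - A := sub_pos.2 hy
    have := hφp y
    positivity) hlim
  have e : 0 - F A = φ A / (1 + A ^ 2) := by
    simp only [hF]
    have := (hp A).ne'
    field_simp
    ring
  rw [e] at h
  rw [← h]
  refine lintegral_mono fun y => ENNReal.ofReal_le_ofReal ?_
  rw [mul_comm]
  refine mul_le_mul_of_nonneg_left ?_ (hφp y).le
  have : 0 ≤ 2 * A / (1 + y ^ 2) ^ 2 := by positivity
  linarith

lemma gam_lint {f : ℝ → ℝ≥0∞} (hf : Measurable f) :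
    ∫⁻ y, f y ∂gam = ∫⁻ y, ENNReal.ofReal (gaussianPDFReal 0 1 y) * f y := by
  show ∫⁻ y, f y ∂(gaussianReal 0 1) = _
  rw [gaussianReal_of_var_ne_zero _ one_ne_zero]
  rw [lintegral_withDensity_eq_lintegral_mul _ (measurable_gaussianPDF 0 1) hf]
  rfl

lemma gtail {A : ℝ} (hA : 0 < A) :
    ∫⁻ a, ENNReal.ofReal (|a| - A) ∂gam ≤ ENNReal.ofReal (2 * (399 / 1000 * Real.exp (-A ^ 2 / 2) / (1 + A ^ 2))) := by
  rw [gam_lint (by fun_prop), lint_even (fun x => by simp [pdf_eq]), ENNReal.ofReal_mul (by norm_num)]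
  have h2 : ENNReal.ofReal 2 = 2 := by norm_num
  rw [h2]
  refine mul_le_mul_right ?_ _
  refine le_trans ?_ ((gtail_one hA).trans (ENNReal.ofReal_le_ofReal
    (div_le_div_of_nonneg_right (pdf_le A) (by positivity))))
  rw [← lintegral_indicator measurableSet_Ioi, ← lintegral_indicator measurableSet_Ioi]
  refine lintegral_mono fun y => ?_
  by_cases hy : A < y
  · have hy0 : 0 < y := hA.trans hy
    simp only [Set.indicator, Set.mem_Ioi, hy, hy0, if_true]
    rw [abs_of_pos hy0, ← ENNReal.ofReal_mul (gaussianPDFReal_nonneg 0 1 y), mul_comm]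
  · by_cases hy0 : 0 < y
    · simp only [Set.indicator, Set.mem_Ioi, hy, hy0, if_true, if_false]
      rw [abs_of_pos hy0, ENNReal.ofReal_of_nonpos (p := y - A) (by linarith)]
      simp
    · simp [Set.indicator, hy0]

end SJ

namespace SJ

lemma nonneg_of_der {F F' : ℝ → ℝ} (h0 : F 0 = 0) (hd : ∀ x, HasDerivAt F (F' x) x)
    (hp : ∀ x, 0 ≤ x → 0 ≤ F' x) {x : ℝ} (hx : 0 ≤ x) : 0 ≤ F x := by
  have hm : MonotoneOn F (Set.Ici 0) := by
    refine monotoneOn_of_deriv_nonneg (convex_Ici 0) (fun x _ => (hd x).continuousAt.continuousWithinAt)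
      (fun x _ => (hd x).differentiableAt.differentiableWithinAt) fun x hx => ?_
    rw [(hd x).deriv]
    rw [interior_Ici] at hx
    exact hp x (le_of_lt hx)
  have := hm (Set.self_mem_Ici) hx hx
  rwa [h0] at this

lemma sin_ub1 {x : ℝ} (hx : 0 ≤ x) : Real.sin x ≤ x := Real.sin_le hx

lemma cos_lb2 {x : ℝ} (_hx : 0 ≤ x) : 1 - x ^ 2 / 2 ≤ Real.cos x := Real.one_sub_sq_div_two_le_cos

lemma sin_lb3 {x : ℝ} (hx : 0 ≤ x) : x - x ^ 3 / 6 ≤ Real.sin x := by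
  have := nonneg_of_der (F := fun x => Real.sin x - (x - x ^ 3 / 6)) (F' := fun x => Real.cos x - (1 - x ^ 2 / 2)) (by simp)
    (fun x => by
      refine ((Real.hasDerivAt_sin x).sub ((hasDerivAt_id x).sub ((hasDerivAt_pow 3 x).div_const 6))).congr_deriv ?_
      push_cast; ring) (fun x hx => by linarith [cos_lb2 hx]) hx
  linarith

lemma cos_ub4 {x : ℝ} (hx : 0 ≤ x) : Real.cos x ≤ 1 - x ^ 2 / 2 + x ^ 4 / 24 := by
  have := nonneg_of_der (F := fun x => 1 - x ^ 2 / 2 + x ^ 4 / 24 - Real.cos x) (F' := fun x => Real.sin x - (x - x ^ 3 / 6)) (by simp)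
    (fun x => by
      refine (((((hasDerivAt_pow 2 x).div_const 2).const_sub 1).add ((hasDerivAt_pow 4 x).div_const 24)).sub (Real.hasDerivAt_cos x)).congr_deriv ?_
      push_cast; ring) (fun x hx => by linarith [sin_lb3 hx]) hx
  linarith

lemma sin_ub5 {x : ℝ} (hx : 0 ≤ x) : Real.sin x ≤ x - x ^ 3 / 6 + x ^ 5 / 120 := by
  have := nonneg_of_der (F := fun x => x - x ^ 3 / 6 + x ^ 5 / 120 - Real.sin x) (F' := fun x => 1 - x ^ 2 / 2 + x ^ 4 / 24 - Real.cos x) (by simp)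
    (fun x => by
      refine ((((hasDerivAt_id x).sub ((hasDerivAt_pow 3 x).div_const 6)).add ((hasDerivAt_pow 5 x).div_const 120)).sub (Real.hasDerivAt_sin x)).congr_deriv ?_
      push_cast; ring) (fun x hx => by linarith [cos_ub4 hx]) hx
  linarith

lemma cos_lb6 {x : ℝ} (hx : 0 ≤ x) : 1 - x ^ 2 / 2 + x ^ 4 / 24 - x ^ 6 / 720 ≤ Real.cos x := by
  have := nonneg_of_der (F := fun x => Real.cos x - (1 - x ^ 2 / 2 + x ^ 4 / 24 - x ^ 6 / 720))
    (F' := fun x => x - x ^ 3 / 6 + x ^ 5 / 120 - Real.sin x) (by simp)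
    (fun x => by
      refine ((Real.hasDerivAt_cos x).sub (((((hasDerivAt_pow 2 x).div_const 2).const_sub 1).add ((hasDerivAt_pow 4 x).div_const 24)).sub ((hasDerivAt_pow 6 x).div_const 720))).congr_deriv ?_
      push_cast; ring) (fun x hx => by linarith [sin_ub5 hx]) hx
  linarith

lemma sin_lb7 {x : ℝ} (hx : 0 ≤ x) : x - x ^ 3 / 6 + x ^ 5 / 120 - x ^ 7 / 5040 ≤ Real.sin x := by
  have := nonneg_of_der (F := fun x => Real.sin x - (x - x ^ 3 / 6 + x ^ 5 / 120 - x ^ 7 / 5040))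
    (F' := fun x => Real.cos x - (1 - x ^ 2 / 2 + x ^ 4 / 24 - x ^ 6 / 720)) (by simp)
    (fun x => by
      refine ((Real.hasDerivAt_sin x).sub ((((hasDerivAt_id x).sub ((hasDerivAt_pow 3 x).div_const 6)).add ((hasDerivAt_pow 5 x).div_const 120)).sub ((hasDerivAt_pow 7 x).div_const 5040))).congr_deriv ?_
      push_cast; ring) (fun x hx => by linarith [cos_lb6 hx]) hx
  linarith

/-- Taylor minorant of sinc, as a function of the square -/
noncomputable def Tp (u : ℝ) : ℝ := max 0 (1 - u / 6 + u ^ 2 / 120 - u ^ 3 / 5040)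

lemma Tp_nonneg (u : ℝ) : 0 ≤ Tp u := le_max_left _ _

lemma Tp_anti : Antitone Tp := by
  intro a b hab
  unfold Tp
  refine max_le_max le_rfl ?_
  have h1 : (b - a) * (1 / 6 - (a + b) / 120 + (a ^ 2 + a * b + b ^ 2) / 5040) =
    (1 - a / 6 + a ^ 2 / 120 - a ^ 3 / 5040) - (1 - b / 6 + b ^ 2 / 120 - b ^ 3 / 5040) := by ring
  have h2 : 0 ≤ 1 / 6 - (a + b) / 120 + (a ^ 2 + a * b + b ^ 2) / 5040 := by
    nlinarith [sq_nonneg (a - b), sq_nonneg (a + b - 28)]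
  have := mul_nonneg (sub_nonneg.2 hab) h2
  linarith

lemma Tp_le_one {u : ℝ} (hu : 0 ≤ u) : Tp u ≤ 1 := by
  have := Tp_anti hu
  simpa [Tp] using this

lemma Tp_sin {x : ℝ} (hx : 0 ≤ x) : x * Tp (x ^ 2) ≤ |Real.sin x| := by
  unfold Tp
  rcases le_total 0 (1 - x ^ 2 / 6 + (x ^ 2) ^ 2 / 120 - (x ^ 2) ^ 3 / 5040) with h | h
  · rw [max_eq_right h]
    refine le_trans (le_of_eq ?_) ((sin_lb7 hx).trans (le_abs_self _)); ring
  · rw [max_eq_left h]; simp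

noncomputable def rho (θ : ℝ) : ℝ := Tp (θ ^ 2 / 4) ^ 2 / 2

lemma rho_nonneg (θ : ℝ) : 0 ≤ rho θ := by unfold rho; positivity
lemma rho_le_half (θ : ℝ) : rho θ ≤ 1 / 2 := by
  unfold rho
  have h1 := Tp_le_one (u := θ ^ 2 / 4) (by positivity)
  have h2 := Tp_nonneg (θ ^ 2 / 4)
  have : Tp (θ ^ 2 / 4) ^ 2 ≤ 1 := pow_le_one₀ h2 h1
  linarith
lemma rho_anti {a b : ℝ} (ha : 0 ≤ a) (hab : a ≤ b) : rho b ≤ rho a := by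
  unfold rho
  have h2 := Tp_nonneg (b ^ 2 / 4)
  have : Tp (b ^ 2 / 4) ≤ Tp (a ^ 2 / 4) := Tp_anti (by gcongr)
  have := pow_le_pow_left₀ h2 this 2
  linarith

lemma one_sub_cos_sq (s : ℝ) : 1 - Real.cos s = 2 * Real.sin (s / 2) ^ 2 := by
  have := Real.cos_two_mul (s / 2)
  have h2 := Real.sin_sq_add_cos_sq (s / 2)
  rw [show 2 * (s / 2) = s by ring] at this
  linarith

lemma rho_cos (s : ℝ) : s ^ 2 * rho s ≤ 1 - Real.cos s := by
  have h := Tp_sin (abs_nonneg (s / 2))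
  rw [one_sub_cos_sq, sq_abs] at *
  have h3 := pow_le_pow_left₀ (mul_nonneg (abs_nonneg _) (Tp_nonneg _)) h 2
  rw [mul_pow, sq_abs, sq_abs] at h3
  have e : |Real.sin (|s / 2|)| ^ 2 = Real.sin (s / 2) ^ 2 := by
    rw [sq_abs]
    rcases abs_choice (s / 2) with h | h <;> rw [h] <;> simp
  unfold rho
  have e2 : (s / 2) ^ 2 = s ^ 2 / 4 := by ring
  rw [e2] at h3
  rw [← sq_abs, ← e, sq_abs] 
  rw [sq_abs] at *
  linarith

lemma rr_lb {w τ y : ℝ} (hw : 0 ≤ w) (hy : y ≠ 0) (hyt : |y| ≤ τ) :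
    w ^ 2 * rho (w * τ) ≤ (1 - Real.cos (w * y)) / y ^ 2 := by
  rw [le_div_iff₀ (by positivity)]
  have h1 := rho_cos (w * |y|)
  have e : Real.cos (w * |y|) = Real.cos (w * y) := by
    rcases abs_choice y with h | h <;> rw [h] <;> simp
  rw [e, mul_pow, sq_abs] at h1
  have h2 : rho (w * τ) ≤ rho (w * |y|) := rho_anti (by positivity) (by gcongr)
  have := mul_le_mul_of_nonneg_left h2 (by positivity : 0 ≤ w ^ 2 * y ^ 2)
  linarith

lemma rr_ub (w y : ℝ) : (1 - Real.cos (w * y)) / y ^ 2 ≤ w ^ 2 / 2 := by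
  rcases eq_or_ne y 0 with rfl | hy
  · simp; positivity
  rw [div_le_iff₀ (by positivity)]
  have := Real.one_sub_sq_div_two_le_cos (x := w * y)
  nlinarith

lemma sin_gap {s : ℝ} (hs : 0 ≤ s) : s - Real.sin s ≤ s ^ 2 / 3 := by
  have hpi1 := Real.pi_gt_d4
  have hpi2 := Real.pi_lt_d4
  rcases le_total s 2 with h | h
  · have := sin_lb3 hs
    nlinarith [mul_nonneg (sq_nonneg s) (sub_nonneg.2 h)]
  rcases le_total s Real.pi with h2 | h2
  · have h3 := sin_lb3 (sub_nonneg.2 h2)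
    rw [Real.sin_pi_sub] at h3
    obtain ⟨t, ht⟩ : ∃ t, t = Real.pi - s := ⟨_, rfl⟩
    rw [← ht] at h3
    have ht0 : 0 ≤ t := by linarith
    have ht1 : t ≤ 1.15 := by linarith
    have hs2 : s = Real.pi - t := by linarith
    have : t ^ 3 ≤ 2 * t ^ 2 := by nlinarith [sq_nonneg t]
    have e : s ^ 2 = Real.pi ^ 2 - 2 * (Real.pi * t) + t ^ 2 := by rw [hs2]; ring
    have h5 : Real.pi * t ≤ 3.1416 * t := mul_le_mul_of_nonneg_right hpi2.le ht0
    have h6 : 9.869 ≤ Real.pi ^ 2 := by nlinarith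
    rw [e]
    linarith
  · have h3 := Real.sin_le (sub_nonneg.2 h2)
    rw [Real.sin_sub_pi] at h3
    nlinarith [sq_nonneg (s - 3)]

lemma sin_gap' (s : ℝ) {m : ℝ} (hm : |s| ≤ m) : |Real.sin s - s| ≤ s ^ 2 * min (m / 6) (1 / 3) := by
  have key : ∀ s : ℝ, 0 ≤ s → s ≤ m → |Real.sin s - s| ≤ s ^ 2 * min (m / 6) (1 / 3) := by
    intro s hs hsm
    rw [abs_sub_comm, abs_of_nonneg (sub_nonneg.2 (Real.sin_le hs))]
    rcases le_total (m / 6) (1 / 3) with h | h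
    · rw [min_eq_left h]
      have := sin_lb3 hs
      nlinarith [mul_nonneg (sq_nonneg s) (sub_nonneg.2 hsm)]
    · rw [min_eq_right h]
      have := sin_gap hs
      linarith
  rcases abs_cases s with ⟨h, h'⟩ | ⟨h, h'⟩
  · exact key s h' (h ▸ hm)
  · have := key (-s) (by linarith) (h ▸ hm)
    rw [Real.sin_neg, ← abs_neg] at this
    simpa [neg_add_eq_sub] using this

end SJ

namespace SJ
variable {κ μ : Measure ℝ} {v R τ : ℝ}

/-- real part of the (negated) exponent -/
noncomputable def rr (κ : Measure ℝ) (w : ℝ) : ℝ := ∫ y, (1 - Real.cos (w * y)) / y ^ 2 ∂κ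

lemma rr_nonneg_pt (w y : ℝ) : 0 ≤ (1 - Real.cos (w * y)) / y ^ 2 :=
  div_nonneg (sub_nonneg.2 (Real.cos_le_one _)) (sq_nonneg _)

lemma rr_int (κ : Measure ℝ) [IsProbabilityMeasure κ] (w : ℝ) : Integrable (fun y => (1 - Real.cos (w * y)) / y ^ 2) κ :=
  Integrable.of_bound (C := w ^ 2 / 2) (Measurable.aestronglyMeasurable (by fun_prop))
    (Filter.Eventually.of_forall fun y => by
      rw [Real.norm_of_nonneg (rr_nonneg_pt w y)]; exact rr_ub w y)

lemma kk_re (w y : ℝ) : (e2 (w * y) / (y:ℂ) ^ 2).re = -((1 - Real.cos (w * y)) / y ^ 2) := by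
  rw [← Complex.ofReal_pow, Complex.div_ofReal_re]
  unfold e2
  have : ((w * y : ℝ) : ℂ) * Complex.I = ((w * y : ℝ) : ℂ) * Complex.I := rfl
  simp only [Complex.sub_re, Complex.exp_ofReal_mul_I_re, Complex.one_re, Complex.mul_re, Complex.ofReal_re,
    Complex.I_re, Complex.I_im, Complex.ofReal_im]
  ring

lemma kk_im (w y : ℝ) : (e2 (w * y) / (y:ℂ) ^ 2).im = (Real.sin (w * y) - w * y) / y ^ 2 := by
  rw [← Complex.ofReal_pow, Complex.div_ofReal_im]
  unfold e2
  simp only [Complex.sub_im, Complex.exp_ofReal_mul_I_im, Complex.one_im, Complex.mul_im, Complex.ofReal_re,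
    Complex.I_re, Complex.I_im, Complex.ofReal_im]
  ring

lemma psi_re (κ : Measure ℝ) [IsProbabilityMeasure κ] (w : ℝ) : (psi κ w).re = - rr κ w := by
  unfold psi rr
  have h : (∫ y, e2 (w * y) / (y:ℂ) ^ 2 ∂κ).re = ∫ y, (e2 (w * y) / (y:ℂ) ^ 2).re ∂κ :=
    (Complex.reCLM.integral_comp_comm (kk_int κ w)).symm
  rw [h, ← integral_neg]
  simp_rw [kk_re]

lemma psi_im (κ : Measure ℝ) [IsProbabilityMeasure κ] (w : ℝ) : (psi κ w).im = ∫ y, (Real.sin (w * y) - w * y) / y ^ 2 ∂κ := by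
  unfold psi
  have h : (∫ y, e2 (w * y) / (y:ℂ) ^ 2 ∂κ).im = ∫ y, (e2 (w * y) / (y:ℂ) ^ 2).im ∂κ :=
    (Complex.imCLM.integral_comp_comm (kk_int κ w)).symm
  rw [h]
  simp_rw [kk_im]

lemma IsSJ.rr_le (hs : IsSJ κ μ v τ) (w : ℝ) : rr κ w ≤ w ^ 2 / 2 := by
  have := hs.pκ
  have := integral_mono (rr_int κ w) (integrable_const (w ^ 2 / 2)) (fun y => rr_ub w y)
  simpa [rr] using this

lemma IsSJ.rr_ge (hs : IsSJ κ μ v τ) {w : ℝ} (hw : 0 ≤ w) : w ^ 2 * rho (w * τ) ≤ rr κ w := by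
  have := hs.pκ
  have h : ∀ᵐ y ∂κ, w ^ 2 * rho (w * τ) ≤ (1 - Real.cos (w * y)) / y ^ 2 := by
    filter_upwards [hs.supp, hs.nz] with y h1 h2 using rr_lb hw h2 h1
  have := integral_mono_ae (integrable_const (w ^ 2 * rho (w * τ))) (rr_int κ w) h
  simpa [rr] using this

lemma IsSJ.im_le (hs : IsSJ κ μ v τ) {w : ℝ} (hw : 0 ≤ w) : |(psi κ w).im| ≤ w ^ 2 * min (w * τ / 6) (1 / 3) := by
  have := hs.pκ
  rw [psi_im]
  have h : ∀ᵐ y ∂κ, ‖(Real.sin (w * y) - w * y) / y ^ 2‖ ≤ w ^ 2 * min (w * τ / 6) (1 / 3) := by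
    filter_upwards [hs.supp, hs.nz] with y h1 h2
    rw [Real.norm_eq_abs, abs_div, abs_of_pos (by positivity : 0 < y ^ 2), div_le_iff₀ (by positivity)]
    refine (sin_gap' (w * y) (m := w * τ) ?_).trans (le_of_eq (by ring))
    rw [abs_mul, abs_of_nonneg hw]; gcongr
  have := norm_integral_le_of_norm_le_const h
  simpa using this

lemma gam_char (w : ℝ) : charFun gam w = ((Real.exp (-w ^ 2 / 2) : ℝ) : ℂ) := by
  show charFun (gaussianReal 0 1) w = _
  rw [charFun_gaussianReal]
  push_cast
  congr 1
  simp; ring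

lemma dist_polar (r β g : ℝ) : ‖Complex.exp (-r + β * Complex.I) - (g : ℂ)‖ ^ 2 =
    (Real.exp (-r) - g) ^ 2 + 2 * Real.exp (-r) * g * (1 - Real.cos β) := by
  have e : Complex.exp (-r + β * Complex.I) = ((Real.exp (-r) * Real.cos β : ℝ) : ℂ) + ((Real.exp (-r) * Real.sin β : ℝ) : ℂ) * Complex.I := by
    rw [Complex.exp_add, ← Complex.ofReal_neg, ← Complex.ofReal_exp, Complex.exp_mul_I]
    push_cast; ring
  rw [e, ← Complex.normSq_eq_norm_sq, Complex.normSq_apply]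
  simp only [Complex.sub_re, Complex.add_re, Complex.mul_re, Complex.sub_im, Complex.add_im, Complex.mul_im,
    Complex.ofReal_re, Complex.ofReal_im, Complex.I_re, Complex.I_im]
  have := Real.sin_sq_add_cos_sq β
  linear_combination Real.exp (-r) ^ 2 * this

lemma IsSJ.dist_eq (hs : IsSJ κ μ 1 τ) (w : ℝ) : ‖charFun μ w - charFun gam w‖ ^ 2 =
    (Real.exp (-rr κ w) - Real.exp (-w ^ 2 / 2)) ^ 2
      + 2 * Real.exp (-rr κ w) * Real.exp (-w ^ 2 / 2) * (1 - Real.cos (psi κ w).im) := by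
  have := hs.pκ
  rw [← dist_polar, hs.char', gam_char]
  congr 4
  rw [← Complex.re_add_im (psi κ w), psi_re]
  simp

/-- low frequency part -/
noncomputable def lowf (τ w : ℝ) : ℝ := (Real.exp (-(w ^ 2 * rho (w * τ))) * min (w * (1 / 2 - rho (w * τ))) (1 / w)) ^ 2
/-- cross part -/
noncomputable def crf (τ w : ℝ) : ℝ :=
  Real.exp (-(w ^ 2 * rho (w * τ))) * Real.exp (-w ^ 2 / 2) * (w * min (w * τ / 6) (1 / 3)) ^ 2

lemma IsSJ.low_le (hs : IsSJ κ μ 1 τ) {w : ℝ} (hw : 0 < w) :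
    (Real.exp (-rr κ w) - Real.exp (-w ^ 2 / 2)) ^ 2 / w ^ 2 ≤ lowf τ w := by
  have h1 := hs.rr_ge hw.le
  have h2 := hs.rr_le w
  unfold lowf
  rw [← div_pow]
  have h0 : 0 ≤ Real.exp (-rr κ w) - Real.exp (-w ^ 2 / 2) := by
    rw [sub_nonneg, Real.exp_le_exp]; linarith
  refine pow_le_pow_left₀ (div_nonneg h0 hw.le) ?_ 2
  have hE : Real.exp (-rr κ w) - Real.exp (-w ^ 2 / 2) ≤ Real.exp (-(w ^ 2 * rho (w * τ))) *
      min (w ^ 2 * (1 / 2 - rho (w * τ))) 1 := by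
    have e : Real.exp (-w ^ 2 / 2) = Real.exp (-rr κ w) * Real.exp (-(w ^ 2 / 2 - rr κ w)) := by
      rw [← Real.exp_add]; congr 1; ring
    rw [e, show Real.exp (-rr κ w) - Real.exp (-rr κ w) * Real.exp (-(w ^ 2 / 2 - rr κ w))
      = Real.exp (-rr κ w) * (1 - Real.exp (-(w ^ 2 / 2 - rr κ w))) by ring]
    have h3 := Real.add_one_le_exp (-(w ^ 2 / 2 - rr κ w))
    have h4 : Real.exp (-(w ^ 2 / 2 - rr κ w)) ≤ 1 := Real.exp_le_one_iff.2 (by linarith)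
    have h5 := Real.exp_pos (-(w ^ 2 / 2 - rr κ w))
    refine mul_le_mul (Real.exp_le_exp.2 (by linarith)) (le_min ?_ ?_) (by linarith) (Real.exp_nonneg _)
    · nlinarith
    · linarith
  rw [div_le_iff₀ hw]
  refine hE.trans (le_of_eq ?_)
  rw [mul_assoc]
  congr 1
  rw [min_mul_of_nonneg _ _ hw.le]
  congr 1
  · ring
  · field_simp

lemma one_sub_cos_le (β : ℝ) : 2 * (1 - Real.cos β) ≤ β ^ 2 := by
  have := Real.one_sub_sq_div_two_le_cos (x := β)
  linarith

lemma IsSJ.cross_le (hs : IsSJ κ μ 1 τ) {w : ℝ} (hw : 0 < w) :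
    2 * Real.exp (-rr κ w) * Real.exp (-w ^ 2 / 2) * (1 - Real.cos (psi κ w).im) / w ^ 2 ≤ crf τ w := by
  have h1 := hs.rr_ge hw.le
  have h3 := hs.im_le hw.le
  unfold crf
  rw [div_le_iff₀ (by positivity)]
  have h4 : (psi κ w).im ^ 2 ≤ (w ^ 2 * min (w * τ / 6) (1 / 3)) ^ 2 := by
    rw [← sq_abs]; exact pow_le_pow_left₀ (abs_nonneg _) h3 2
  have h5 := one_sub_cos_le (psi κ w).im
  calc _ = Real.exp (-rr κ w) * Real.exp (-w ^ 2 / 2) * (2 * (1 - Real.cos (psi κ w).im)) := by ring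
    _ ≤ Real.exp (-(w ^ 2 * rho (w * τ))) * Real.exp (-w ^ 2 / 2) * (w ^ 2 * min (w * τ / 6) (1 / 3)) ^ 2 := by
      refine mul_le_mul ?_ (h5.trans h4) ?_ (by positivity)
      · refine mul_le_mul_of_nonneg_right (Real.exp_le_exp.2 (by linarith)) (Real.exp_nonneg _)
      · have := Real.cos_le_one (psi κ w).im
        linarith
    _ = _ := by ring

lemma cross_le4 {r w β : ℝ} (hr : 0 ≤ r) (hw : 0 < w) :
    2 * Real.exp (-r) * Real.exp (-w ^ 2 / 2) * (1 - Real.cos β) / w ^ 2 ≤ 4 * Real.exp (-w ^ 2 / 2) / w ^ 2 := by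
  refine div_le_div_of_nonneg_right ?_ (by positivity)
  have h1 := Real.neg_one_le_cos β
  have h2 := Real.cos_le_one β
  have h3 : Real.exp (-r) ≤ 1 := Real.exp_le_one_iff.2 (by linarith)
  have h4 := Real.exp_pos (-w ^ 2 / 2)
  have h5 := Real.exp_pos (-r)
  have : Real.exp (-r) * (1 - Real.cos β) ≤ 1 * 2 := mul_le_mul h3 (by linarith) (by linarith) (by norm_num)
  nlinarith

lemma IsSJ.rr_nonneg (_hs : IsSJ κ μ v τ) (w : ℝ) : 0 ≤ rr κ w := integral_nonneg fun y => rr_nonneg_pt w y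

/-- Jensen -/
lemma IsSJ.jensenF (hs : IsSJ κ μ v τ) (w : ℝ) :
    ENNReal.ofReal (Real.exp (-rr κ w) ^ 2 / w ^ 2) ≤
      ∫⁻ y, ENNReal.ofReal (Real.exp (-2 * ((1 - Real.cos (w * y)) / y ^ 2)) / w ^ 2) ∂κ := by
  have := hs.pκ
  have hb : Integrable (fun y => Real.exp (-2 * ((1 - Real.cos (w * y)) / y ^ 2))) κ := by
    refine Integrable.of_bound (C := 1) (Measurable.aestronglyMeasurable (by fun_prop)) (Filter.Eventually.of_forall fun y => ?_)
    rw [Real.norm_of_nonneg (Real.exp_nonneg _), Real.exp_le_one_iff]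
    have := rr_nonneg_pt w y
    linarith
  rw [← ofReal_integral_eq_lintegral_ofReal (hb.div_const _) (Filter.Eventually.of_forall fun y => by positivity)]
  apply ENNReal.ofReal_le_ofReal
  rw [integral_div]
  refine div_le_div_of_nonneg_right ?_ (sq_nonneg w)
  have hj := convexOn_exp.map_integral_le (μ := κ) (f := fun y => -2 * ((1 - Real.cos (w * y)) / y ^ 2))
    Real.continuous_exp.continuousOn isClosed_univ (by simp) ((rr_int κ w).const_mul (-2)) hb
  refine le_trans (le_of_eq ?_) hj
  rw [integral_const_mul, ← Real.exp_nat_mul]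
  congr 1
  simp [rr]

lemma IsSJ.charSym (hs : IsSJ κ μ 1 τ) (w : ℝ) : ‖charFun μ (-w) - charFun gam (-w)‖ ^ 2 = ‖charFun μ w - charFun gam w‖ ^ 2 := by
  have := hs.pκ
  rw [hs.dist_eq, hs.dist_eq]
  have e1 : rr κ (-w) = rr κ w := by simp [rr]
  have e2 : (psi κ (-w)).im = -(psi κ w).im := by
    rw [psi_im, psi_im, ← integral_neg]
    congr 1; funext y; simp; ring
  rw [e1, e2]; simp

/-- integral at high frequencies for a fixed jump size -/
noncomputable def HH (W y : ℝ) : ℝ≥0∞ := ∫⁻ w in Set.Ioi W, ENNReal.ofReal (Real.exp (-2 * ((1 - Real.cos (w * y)) / y ^ 2)) / w ^ 2)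

/-- decomposition of the L2 integral -/
lemma IsSJ.S0 (hs : IsSJ κ μ 1 τ) {W V : ℝ} (hW : 0 < W) (hV : 0 < V) {H : ℝ≥0∞} (hH : ∀ᵐ y ∂κ, HH W y ≤ H) :
    ∫⁻ w in Set.Ioi 0, ENNReal.ofReal (‖charFun μ w - charFun gam w‖ ^ 2 / w ^ 2) ≤
      (∫⁻ w in Set.Ioc 0 W, ENNReal.ofReal (lowf τ w)) + H + (∫⁻ w in Set.Ioc 0 V, ENNReal.ofReal (crf τ w))
       + (∫⁻ w in Set.Ioi V, ENNReal.ofReal (4 * Real.exp (-w ^ 2 / 2) / w ^ 2)) := by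
  have := hs.pκ
  have hpsim : Measurable (fun w => (psi κ w).im) := by
    have : Measurable (psi κ) := by
      have h : StronglyMeasurable (fun w => ∫ y, e2 (w * y) / (y:ℂ) ^ 2 ∂κ) := by
        refine StronglyMeasurable.integral_prod_right (f := fun w y : ℝ => e2 (w * y) / (y:ℂ) ^ 2) ?_
        apply Measurable.stronglyMeasurable
        unfold e2; fun_prop
      exact h.measurable
    exact Complex.measurable_im.comp this
  have hrrm : Measurable (rr κ) := by
    have h : StronglyMeasurable (fun w => ∫ y, (1 - Real.cos (w * y)) / y ^ 2 ∂κ) := by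
      refine StronglyMeasurable.integral_prod_right (f := fun w y : ℝ => (1 - Real.cos (w * y)) / y ^ 2) ?_
      apply Measurable.stronglyMeasurable
      fun_prop
    exact h.measurable
  set a : ℝ → ℝ := fun w => (Real.exp (-rr κ w) - Real.exp (-w ^ 2 / 2)) ^ 2 / w ^ 2 with ha
  set b : ℝ → ℝ := fun w => 2 * Real.exp (-rr κ w) * Real.exp (-w ^ 2 / 2) * (1 - Real.cos (psi κ w).im) / w ^ 2 with hb
  have ham : Measurable a := by fun_prop
  have hbm : Measurable b := by fun_prop
  have e : ∀ w, ENNReal.ofReal (‖charFun μ w - charFun gam w‖ ^ 2 / w ^ 2) ≤ ENNReal.ofReal (a w) + ENNReal.ofReal (b w) := by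
    intro w
    rw [hs.dist_eq, add_div]
    exact ENNReal.ofReal_add_le
  refine (lintegral_mono e).trans ?_
  rw [lintegral_add_left ham.ennreal_ofReal, add_assoc]
  have split : ∀ (X : ℝ) (_ : 0 < X) (f : ℝ → ℝ≥0∞), ∫⁻ w in Set.Ioi 0, f w = (∫⁻ w in Set.Ioc 0 X, f w) + (∫⁻ w in Set.Ioi X, f w) := by
    intro X hX f
    rw [← Set.Ioc_union_Ioi_eq_Ioi hX.le, lintegral_union measurableSet_Ioi]
    exact Set.Ioc_disjoint_Ioi le_rfl
  refine add_le_add ?_ ?_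
  · rw [split W hW]
    refine add_le_add ?_ ?_
    · refine setLIntegral_mono' measurableSet_Ioc fun w hw => ENNReal.ofReal_le_ofReal (hs.low_le hw.1)
    · calc ∫⁻ w in Set.Ioi W, ENNReal.ofReal (a w)
          ≤ ∫⁻ w in Set.Ioi W, ∫⁻ y, ENNReal.ofReal (Real.exp (-2 * ((1 - Real.cos (w * y)) / y ^ 2)) / w ^ 2) ∂κ := by
            refine lintegral_mono fun w => le_trans (ENNReal.ofReal_le_ofReal ?_) (hs.jensenF w)
            refine div_le_div_of_nonneg_right ?_ (sq_nonneg w)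
            have h2 := hs.rr_le w
            have h0 : 0 ≤ Real.exp (-rr κ w) - Real.exp (-w ^ 2 / 2) := by
              rw [sub_nonneg, Real.exp_le_exp]; linarith
            refine pow_le_pow_left₀ h0 ?_ 2
            have := Real.exp_pos (-w ^ 2 / 2)
            linarith
        _ = ∫⁻ y, HH W y ∂κ := by
            unfold HH
            refine lintegral_lintegral_swap ?_
            exact Measurable.aemeasurable (by fun_prop)
        _ ≤ ∫⁻ _, H ∂κ := lintegral_mono_ae hH
        _ = H := by simp
  · rw [split V hV]
    refine add_le_add ?_ ?_
    · refine setLIntegral_mono' measurableSet_Ioc fun w hw => ENNReal.ofReal_le_ofReal (hs.cross_le hw.1)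
    · refine setLIntegral_mono' measurableSet_Ioi fun w hw => ENNReal.ofReal_le_ofReal ?_
      exact cross_le4 (hs.rr_nonneg w) (hV.trans hw)

lemma IsSJ.S0_full (hs : IsSJ κ μ 1 τ) {s : ℝ}
    (h : ∫⁻ w in Set.Ioi 0, ENNReal.ofReal (‖charFun μ w - charFun gam w‖ ^ 2 / w ^ 2) ≤ ENNReal.ofReal s) :
    ∫⁻ w, ENNReal.ofReal (‖charFun μ w - charFun gam w‖ ^ 2 / w ^ 2) ≤ ENNReal.ofReal (2 * s) := by
  rw [lint_even (fun w => by rw [hs.charSym, neg_sq]), ENNReal.ofReal_mul (by norm_num)]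
  have h2 : ENNReal.ofReal 2 = 2 := by norm_num
  rw [h2]
  exact mul_le_mul_right h _

end SJ

namespace SJ

lemma cell_fold (F : ℝ → ℝ≥0∞) (hF : Measurable F) (a : ℝ) :
    ∫⁻ θ in Set.Ioc (a - Real.pi) (a + Real.pi), F θ = ∫⁻ x in Set.Ioc 0 Real.pi, (F (a + x) + F (a - x)) := by
  have hpi := Real.pi_pos
  have h1 : Set.Ioc (a - Real.pi) (a + Real.pi) = Set.Ioc (a - Real.pi) a ∪ Set.Ioc a (a + Real.pi) :=
    (Set.Ioc_union_Ioc_eq_Ioc (by linarith) (by linarith)).symm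
  rw [h1, lintegral_union measurableSet_Ioc (Set.Ioc_disjoint_Ioc_of_le le_rfl),
    lintegral_add_left (by fun_prop), add_comm]
  congr 1
  · rw [← lintegral_indicator measurableSet_Ioc, ← lintegral_indicator measurableSet_Ioc,
      ← lintegral_add_left_eq_self _ a]
    congr 1; funext x
    simp only [Set.indicator, Set.mem_Ioc]
    congr 1
    simp only [eq_iff_iff]; constructor <;> rintro ⟨h, h'⟩ <;> constructor <;> linarith
  · rw [setLIntegral_congr (Ico_ae_eq_Ioc (a := (0:ℝ)) (b := Real.pi)).symm, ← lintegral_indicator measurableSet_Ioc,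
      ← lintegral_indicator measurableSet_Ico, ← lintegral_sub_left_eq_self _ a]
    congr 1; funext x
    simp only [Set.indicator, Set.mem_Ioc, Set.mem_Ico]
    congr 1
    simp only [eq_iff_iff]; constructor <;> rintro ⟨h, h'⟩ <;> constructor <;> linarith

lemma term_bd {a x : ℝ} (ha : 0 < a) (hx : 0 ≤ x) (hxa : 2 * x ≤ a) :
    1 / (a + x) ^ 2 + 1 / (a - x) ^ 2 ≤ 2 / a ^ 2 + 88 / 9 * x ^ 2 / a ^ 4 := by
  obtain ⟨q, rfl⟩ : ∃ q, x = a * q := ⟨x / a, by field_simp⟩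
  have hq : 0 ≤ q := by by_contra h; push Not at h; nlinarith
  have hq2 : q ≤ 1 / 2 := by by_contra h; push Not at h; nlinarith
  have e1 : 1 / (a + a * q) ^ 2 + 1 / (a - a * q) ^ 2 = (2 * (1 + q ^ 2) / (1 - q ^ 2) ^ 2) / a ^ 2 := by
    have h1 : (1 - q ^ 2) ≠ 0 := by nlinarith
    have h2 : 1 + q ≠ 0 := by linarith
    have h3 : 1 - q ≠ 0 := by linarith
    rw [show a + a * q = a * (1 + q) by ring, show a - a * q = a * (1 - q) by ring,
      show 1 - q ^ 2 = (1 + q) * (1 - q) by ring]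
    field_simp
    ring
  have e2 : 2 / a ^ 2 + 88 / 9 * (a * q) ^ 2 / a ^ 4 = (2 + 88 / 9 * q ^ 2) / a ^ 2 := by field_simp
  rw [e1, e2]
  refine div_le_div_of_nonneg_right ?_ (by positivity)
  have h1 : 0 < 1 - q ^ 2 := by nlinarith
  rw [div_le_iff₀ (by positivity)]
  set t := q ^ 2 with ht
  have ht0 : 0 ≤ t := sq_nonneg q
  have ht1 : t ≤ 1 / 4 := by nlinarith
  have : (2 + 88 / 9 * t) * (1 - t) ^ 2 - 2 * (1 + t) = 2 * (t / 9) * (1 - 4 * t) * (17 - 11 * t) := by ring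
  have : 0 ≤ 2 * (t / 9) * (1 - 4 * t) * (17 - 11 * t) :=
    mul_nonneg (mul_nonneg (by positivity) (by linarith)) (by linarith)
  linarith

lemma lat_sum (x : ℝ) : HasSum (fun k : ℕ => 2 / (2 * Real.pi * ((k:ℝ) + 1)) ^ 2 + 88 / 9 * x ^ 2 / (2 * Real.pi * ((k:ℝ) + 1)) ^ 4)
    (1 / 12 + 11 * x ^ 2 / 1620) := by
  have hpi := Real.pi_pos
  have z2 := (hasSum_nat_add_iff' 1).2 hasSum_zeta_two
  have z4 := (hasSum_nat_add_iff' 1).2 hasSum_zeta_four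
  simp at z2 z4
  have h := (z2.mul_left (2 / (2 * Real.pi) ^ 2)).add (z4.mul_left (88 / 9 * x ^ 2 / (2 * Real.pi) ^ 4))
  convert! h using 1
  · funext k
    have : (k:ℝ) + 1 ≠ 0 := by positivity
    field_simp
  · field_simp
    ring

/-- the weight -/
noncomputable def wt (x : ℝ) : ℝ := 1 / 12 + 11 * x ^ 2 / 1620

lemma hi_lattice {c : ℝ} :
    ∫⁻ θ in Set.Ioi Real.pi, ENNReal.ofReal (Real.exp (-(c * (1 - Real.cos θ))) / θ ^ 2) ≤
      ∫⁻ x in Set.Ioc 0 Real.pi, ENNReal.ofReal (Real.exp (-(c * (1 - Real.cos x))) * wt x) := by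
  have hpi := Real.pi_pos
  set F : ℝ → ℝ≥0∞ := fun θ => ENNReal.ofReal (Real.exp (-(c * (1 - Real.cos θ))) / θ ^ 2) with hF
  have hFm : Measurable F := by fun_prop
  set f : ℕ → ℝ := fun k => 2 * Real.pi * k + Real.pi with hf
  have hmono : Monotone f := by
    intro a b hab
    simp only [hf]
    have : (a:ℝ) ≤ b := by exact_mod_cast hab
    nlinarith
  have hU : ⋃ a, Set.Ioc (f a) (f (Order.succ a)) = Set.Ioi (f ⊥) := by
    refine iUnion_Ioc_map_succ_eq_Ioi (fun a => hmono bot_le) ?_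
    rintro ⟨M, hM⟩
    obtain ⟨n, hn⟩ := exists_nat_gt (M / (2 * Real.pi))
    have h2 := hM ⟨n, rfl⟩
    rw [div_lt_iff₀ (by positivity)] at hn
    simp only [hf] at h2
    nlinarith
  have h0 : f ⊥ = Real.pi := by simp [hf]
  rw [h0] at hU
  rw [← hU, lintegral_iUnion (fun _ => measurableSet_Ioc) hmono.pairwise_disjoint_on_Ioc_succ]
  have h1 : ∀ k : ℕ, ∫⁻ θ in Set.Ioc (f k) (f (Order.succ k)), F θ =
      ∫⁻ x in Set.Ioc 0 Real.pi, (F (2 * Real.pi * ((k:ℝ) + 1) + x) + F (2 * Real.pi * ((k:ℝ) + 1) - x)) := by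
    intro k
    rw [← cell_fold F hFm]
    congr 2
    simp only [hf, Nat.succ_eq_succ]
    push_cast
    congr 1 <;> ring
  rw [tsum_congr h1, ← lintegral_tsum (fun k => by fun_prop)]
  refine setLIntegral_mono' measurableSet_Ioc fun x hx => ?_
  set E := Real.exp (-(c * (1 - Real.cos x))) with hE
  have hE0 : 0 < E := Real.exp_pos _
  have hs := (lat_sum x).mul_left E
  rw [show E * wt x = E * (1 / 12 + 11 * x ^ 2 / 1620) from rfl, ← hs.tsum_eq,
    ENNReal.ofReal_tsum_of_nonneg (fun k => by positivity) hs.summable]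
  refine ENNReal.tsum_le_tsum fun k => ?_
  set a := 2 * Real.pi * ((k:ℝ) + 1) with ha
  have ha0 : 0 < a := by positivity
  have c1 : Real.cos (a + x) = Real.cos x := by
    have := Real.cos_add_nat_mul_two_pi x (k + 1)
    rw [← this]; congr 1; push_cast; rw [ha]; ring
  have c2 : Real.cos (a - x) = Real.cos x := by
    have := Real.cos_nat_mul_two_pi_sub x (k + 1)
    rw [← this]; congr 1; push_cast; rw [ha]; ring
  simp only [hF, c1, c2, ← hE]
  rw [← ENNReal.ofReal_add (by positivity) (by positivity)]
  apply ENNReal.ofReal_le_ofReal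
  have h2 : 2 * x ≤ a := by
    have : 2 * Real.pi * 1 ≤ a := by
      rw [ha]; refine mul_le_mul_of_nonneg_left ?_ (by positivity)
      have : (0:ℝ) ≤ k := by positivity
      linarith
    linarith [hx.2]
  have h3 := mul_le_mul_of_nonneg_left (term_bd ha0 hx.1.le h2) hE0.le
  refine le_trans (le_of_eq ?_) h3
  ring

/-- high-frequency majorant -/
noncomputable def hv (y : ℝ) : ℝ≥0∞ := ENNReal.ofReal y *
  ∫⁻ x in Set.Ioc 0 Real.pi, ENNReal.ofReal (Real.exp (-(2 / y ^ 2 * (1 - Real.cos x))) * wt x)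

lemma wt_nonneg (x : ℝ) : 0 ≤ wt x := by unfold wt; positivity

lemma hv_mono' {y τ : ℝ} (hy : 0 < y) (hyt : y ≤ τ) :
    ∫⁻ x in Set.Ioc 0 Real.pi, ENNReal.ofReal (Real.exp (-(2 / y ^ 2 * (1 - Real.cos x))) * wt x) ≤
    ∫⁻ x in Set.Ioc 0 Real.pi, ENNReal.ofReal (Real.exp (-(2 / τ ^ 2 * (1 - Real.cos x))) * wt x) := by
  refine lintegral_mono fun x => ENNReal.ofReal_le_ofReal (mul_le_mul_of_nonneg_right (Real.exp_le_exp.2 ?_) (wt_nonneg x))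
  have h1 : 0 ≤ 1 - Real.cos x := sub_nonneg.2 (Real.cos_le_one x)
  have h2 : 2 / τ ^ 2 ≤ 2 / y ^ 2 := by gcongr
  nlinarith [mul_le_mul_of_nonneg_right h2 h1]

lemma hv_mono {y τ : ℝ} (hy : 0 < y) (hyt : y ≤ τ) : hv y ≤ hv τ :=
  mul_le_mul' (ENNReal.ofReal_le_ofReal hyt) (hv_mono' hy hyt)

lemma hv_mono9 {y τ : ℝ} (hy : 0 < y) (hyt : y ≤ 9 / 10 * τ) : hv y ≤ ENNReal.ofReal (9 / 10) * hv τ := by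
  unfold hv
  rw [← mul_assoc, ← ENNReal.ofReal_mul (by norm_num)]
  exact mul_le_mul' (ENNReal.ofReal_le_ofReal hyt) (hv_mono' hy (by linarith))

lemma hh_high {y : ℝ} (hy : 0 < y) : HH (Real.pi / y) y ≤ hv y := by
  have hpi := Real.pi_pos
  unfold HH hv
  refine le_trans (le_of_eq ?_) (mul_le_mul_right (hi_lattice (c := 2 / y ^ 2)) (ENNReal.ofReal y))
  have him : Set.image (fun x => y * x) (Set.Ioi (Real.pi / y)) = Set.Ioi Real.pi := by
    rw [Set.image_mul_left_Ioi hy]; congr 1; field_simp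
  have h := lintegral_image_eq_lintegral_deriv_mul_of_monotoneOn (s := Set.Ioi (Real.pi / y)) (f := fun x => y * x) (f' := fun _ => y)
    measurableSet_Ioi (fun x _ => by simpa using ((hasDerivAt_id x).const_mul y).hasDerivWithinAt)
    (fun a _ b _ hab => mul_le_mul_of_nonneg_left hab hy.le)
    (fun θ => ENNReal.ofReal (Real.exp (-(2 / y ^ 2 * (1 - Real.cos θ))) / θ ^ 2))
  rw [him] at h
  rw [h, ← lintegral_const_mul _ (by fun_prop)]
  refine setLIntegral_congr_fun measurableSet_Ioi fun w hw => ?_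
  have hw0 : 0 < w := lt_trans (by positivity) hw
  rw [← ENNReal.ofReal_mul hy.le, ← ENNReal.ofReal_mul hy.le]
  congr 1
  rw [show -2 * ((1 - Real.cos (w * y)) / y ^ 2) = -(2 / y ^ 2 * (1 - Real.cos (y * w))) by rw [mul_comm w y]; ring]
  field_simp

lemma cos_quad {s : ℝ} (h0 : 0 ≤ s) (h1 : s ≤ Real.pi) : 2 * s ^ 2 / Real.pi ^ 2 ≤ 1 - Real.cos s := by
  have hpi := Real.pi_pos
  have h := Real.mul_le_sin (x := s / 2) (by linarith) (by linarith)
  rw [one_sub_cos_sq]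
  have h2 := pow_le_pow_left₀ (by positivity) h 2
  have e : (2 / Real.pi * (s / 2)) ^ 2 = s ^ 2 / Real.pi ^ 2 := by field_simp
  rw [e] at h2
  rw [mul_div_assoc]; linarith

lemma hh_split {W y : ℝ} (hW : 0 < W) (hy : 0 < y) (hWy : W ≤ Real.pi / y) :
    HH W y ≤ (∫⁻ w in Set.Ioc W (Real.pi / y), ENNReal.ofReal (Real.exp (-(4 / Real.pi ^ 2 * w ^ 2)) / w ^ 2)) + hv y := by
  have hpi := Real.pi_pos
  unfold HH
  rw [← Set.Ioc_union_Ioi_eq_Ioi hWy, lintegral_union measurableSet_Ioi (Set.Ioc_disjoint_Ioi le_rfl)]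
  refine add_le_add ?_ (hh_high hy)
  refine setLIntegral_mono' measurableSet_Ioc fun w hw => ENNReal.ofReal_le_ofReal ?_
  refine div_le_div_of_nonneg_right (Real.exp_le_exp.2 ?_) (sq_nonneg w)
  have hw0 : 0 < w := hW.trans hw.1
  have h2 : w * y ≤ Real.pi := by
    have := hw.2
    rwa [le_div_iff₀ hy] at this
  have h3 := cos_quad (by positivity) h2
  have h4 := div_le_div_of_nonneg_right h3 (sq_nonneg y)
  have e : 2 * (w * y) ^ 2 / Real.pi ^ 2 / y ^ 2 = 2 / Real.pi ^ 2 * w ^ 2 := by field_simp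
  rw [e] at h4
  have e3 : 4 / Real.pi ^ 2 * w ^ 2 = 2 * (2 / Real.pi ^ 2 * w ^ 2) := by ring
  linarith

lemma exp_neg_sq_tendsto {c : ℝ} (hc : 0 < c) : Filter.Tendsto (fun w : ℝ => Real.exp (-(c * w ^ 2))) Filter.atTop (nhds 0) := by
  have := (Filter.tendsto_pow_atTop (α := ℝ) (n := 2) (by norm_num)).const_mul_atTop hc
  exact Real.tendsto_exp_atBot.comp (Filter.tendsto_neg_atTop_atBot.comp this)

/-- tail of the Gaussian over the square -/
lemma ex_bd {c W : ℝ} (hc : 0 < c) (hW : 0 < W) :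
    ∫⁻ w in Set.Ioi W, ENNReal.ofReal (Real.exp (-(c * w ^ 2)) / w ^ 2) ≤
      ENNReal.ofReal (Real.exp (-(c * W ^ 2)) / (W * (1 + 2 * c * W ^ 2))) := by
  set F : ℝ → ℝ := fun w => -(Real.exp (-(c * w ^ 2)) / (w * (1 + 2 * c * w ^ 2))) with hF
  set F' : ℝ → ℝ := fun w => Real.exp (-(c * w ^ 2)) * (1 + 8 * (c * w ^ 2) + 4 * (c * w ^ 2) ^ 2) / (w * (1 + 2 * c * w ^ 2)) ^ 2
  have hd : ∀ w, 0 < w → HasDerivAt F (F' w) w := by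
    intro w hw
    have h1 : HasDerivAt (fun w : ℝ => Real.exp (-(c * w ^ 2))) (Real.exp (-(c * w ^ 2)) * (-(c * (2 * w)))) w := by
      have := (((hasDerivAt_pow 2 w).const_mul c).neg).exp
      simpa using this
    have h2 : HasDerivAt (fun w : ℝ => w * (1 + 2 * c * w ^ 2)) (1 + 6 * c * w ^ 2) w := by
      have := (hasDerivAt_id w).mul (((hasDerivAt_pow 2 w).const_mul (2 * c)).const_add 1)
      refine this.congr_deriv ?_
      simp; ring
    have h3 := (h1.div h2 (by positivity)).neg
    refine h3.congr_deriv ?_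
    simp only [F']
    field_simp
    ring
  have hlim : Filter.Tendsto F Filter.atTop (nhds 0) := by
    rw [tendsto_zero_iff_abs_tendsto_zero]
    refine squeeze_zero' (Filter.Eventually.of_forall fun w => abs_nonneg _) ?_ (exp_neg_sq_tendsto hc)
    filter_upwards [Filter.eventually_ge_atTop 1] with w hw
    simp only [Function.comp_apply, hF]
    rw [abs_neg, abs_of_nonneg (by positivity)]
    apply div_le_self (Real.exp_nonneg _)
    have : 0 ≤ 2 * c * w ^ 2 := by positivity
    nlinarith
  have h := lint_Ioi (a := W) (hd W hW).continuousAt.continuousWithinAt (fun y hy => hd y (hW.trans hy)) (fun y hy => by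
    have : 0 < y := hW.trans hy
    simp only [F']; positivity) hlim
  rw [zero_sub, show -F W = Real.exp (-(c * W ^ 2)) / (W * (1 + 2 * c * W ^ 2)) by simp [hF]] at h
  rw [← h]
  refine setLIntegral_mono' measurableSet_Ioi fun w hw => ENNReal.ofReal_le_ofReal ?_
  have hw0 : 0 < w := hW.trans hw
  simp only [F']
  rw [mul_pow w (1 + 2 * c * w ^ 2) 2, mul_comm (w ^ 2), ← div_div]
  refine div_le_div_of_nonneg_right ?_ (by positivity)
  rw [le_div_iff₀ (by positivity)]
  refine mul_le_mul_of_nonneg_left ?_ (Real.exp_nonneg _)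
  have : 0 ≤ c * w ^ 2 := by positivity
  nlinarith

lemma HH_neg (W y : ℝ) : HH W (-y) = HH W y := by simp [HH]

lemma HH_abs (W y : ℝ) : HH W |y| = HH W y := by
  rcases abs_choice y with h | h
  · rw [h]
  · rw [h, HH_neg]

end SJ

namespace SJ

lemma exp10 {x : ℝ} (hx : 10 ≤ x) : Real.exp (-x) ≤ 1 / 20589 := by
  rw [Real.exp_neg, ← one_div]
  refine one_div_le_one_div_of_le (by norm_num) ?_
  have h1 : Real.exp 10 ≤ Real.exp x := Real.exp_le_exp.2 hx
  have h2 : Real.exp 10 = Real.exp 1 ^ 10 := by rw [← Real.exp_nat_mul]; norm_num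
  have h3 : (2.7:ℝ) ^ 10 ≤ Real.exp 1 ^ 10 := pow_le_pow_left₀ (by norm_num) (by have := Real.exp_one_gt_d9; linarith) _
  rw [h2] at h1
  refine le_trans ?_ (h3.trans h1)
  norm_num

lemma exp12 {x : ℝ} (hx : 12 ≤ x) : Real.exp (-x) ≤ 1 / 150000 := by
  rw [Real.exp_neg, ← one_div]
  refine one_div_le_one_div_of_le (by norm_num) ?_
  have h1 : Real.exp 12 ≤ Real.exp x := Real.exp_le_exp.2 hx
  have h2 : Real.exp 12 = Real.exp 1 ^ 12 := by rw [← Real.exp_nat_mul]; norm_num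
  have h3 : (2.7:ℝ) ^ 12 ≤ Real.exp 1 ^ 12 := pow_le_pow_left₀ (by norm_num) (by have := Real.exp_one_gt_d9; linarith) _
  rw [h2] at h1
  refine le_trans ?_ (h3.trans h1)
  norm_num

lemma cross_tail5 : (∫⁻ w in Set.Ioi (5:ℝ), ENNReal.ofReal (4 * Real.exp (-w ^ 2 / 2) / w ^ 2)) ≤ ENNReal.ofReal (4 / 10000000) := by
  have h := ex_bd (c := 1 / 2) (W := 5) (by norm_num) (by norm_num)
  have e : ∀ w : ℝ, ENNReal.ofReal (4 * Real.exp (-w ^ 2 / 2) / w ^ 2) = ENNReal.ofReal 4 * ENNReal.ofReal (Real.exp (-(1 / 2 * w ^ 2)) / w ^ 2) := by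
    intro w
    rw [← ENNReal.ofReal_mul (by norm_num), mul_div_assoc]
    congr 4; ring
  simp_rw [e]
  rw [lintegral_const_mul _ (by fun_prop)]
  refine (mul_le_mul_right h _).trans ?_
  rw [← ENNReal.ofReal_mul (by norm_num)]
  refine ENNReal.ofReal_le_ofReal ?_
  have := exp12 (x := 1 / 2 * 5 ^ 2) (by norm_num)
  norm_num at this ⊢
  linarith

lemma ex5 : Real.exp (-(4 / Real.pi ^ 2 * 5 ^ 2)) / (5 * (1 + 2 * (4 / Real.pi ^ 2) * 5 ^ 2)) ≤ 5 / 10000000 := by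
  have h1 := Real.pi_lt_d2
  have h0 := Real.pi_gt_d2
  have h2 : (0.403:ℝ) ≤ 4 / Real.pi ^ 2 := by
    rw [le_div_iff₀ (by positivity)]; nlinarith
  have := exp10 (x := 4 / Real.pi ^ 2 * 5 ^ 2) (by linarith)
  rw [div_le_iff₀ (by positivity)]
  nlinarith

lemma H_small (hs : IsSJ κ μ 1 τ) (h1 : τ ≤ 62 / 100) :
    ∀ᵐ y ∂κ, HH 5 y ≤ hv τ + ENNReal.ofReal (5 / 10000000) := by
  filter_upwards [hs.supp, hs.nz] with y hy hy0
  rw [← HH_abs]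
  have hp := abs_pos.2 hy0
  have hpi := Real.pi_gt_d2
  have hW : 5 ≤ Real.pi / |y| := by
    rw [le_div_iff₀ hp]; linarith
  refine (hh_split (by norm_num) hp hW).trans ?_
  rw [add_comm]
  refine add_le_add (hv_mono hp hy) ?_
  refine (lintegral_mono_set Set.Ioc_subset_Ioi_self).trans ((ex_bd (by positivity) (by norm_num)).trans (ENNReal.ofReal_le_ofReal ex5))

lemma H_big (hs : IsSJ κ μ 1 τ) (h0 : 0 < τ) :
    ∀ᵐ y ∂κ, HH (Real.pi / τ) y ≤ max (hv τ + ENNReal.ofReal (393 / 10000 * τ * Real.exp (-(39 / 10 / τ ^ 2))))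
      (ENNReal.ofReal (9 / 10) * hv τ + ENNReal.ofReal (Real.exp (-(4 / τ ^ 2)) * (τ ^ 3 * (3184 / 10000) / (τ ^ 2 + 8)))) := by
  filter_upwards [hs.supp, hs.nz] with y hy hy0
  rw [← HH_abs]
  have hp := abs_pos.2 hy0
  have hpi := Real.pi_gt_d2
  have hW : Real.pi / τ ≤ Real.pi / |y| := div_le_div_of_nonneg_left (by linarith) hp hy
  have hs := hh_split (by positivity) hp hW
  have e4 : 4 / Real.pi ^ 2 * (Real.pi / τ) ^ 2 = 4 / τ ^ 2 := by field_simp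
  refine hs.trans ?_
  rw [add_comm]
  by_cases hc : 9 / 10 * τ ≤ |y|
  · refine le_trans ?_ (le_max_left _ _)
    refine add_le_add (hv_mono hp hy) ?_
    have h2 : ∫⁻ w in Set.Ioc (Real.pi / τ) (Real.pi / |y|), ENNReal.ofReal (Real.exp (-(4 / Real.pi ^ 2 * w ^ 2)) / w ^ 2) ≤
      ∫⁻ w in Set.Ioc (Real.pi / τ) (Real.pi / |y|), ENNReal.ofReal (Real.exp (-(4 / τ ^ 2)) / (Real.pi / τ) ^ 2) := by
      refine setLIntegral_mono' measurableSet_Ioc fun w hw => ENNReal.ofReal_le_ofReal ?_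
      have hw2 : (Real.pi / τ) ^ 2 ≤ w ^ 2 := pow_le_pow_left₀ (by positivity) hw.1.le 2
      refine div_le_div₀ (Real.exp_nonneg _) (Real.exp_le_exp.2 ?_) (by positivity) hw2
      rw [← e4]
      exact neg_le_neg (mul_le_mul_of_nonneg_left hw2 (by positivity))
    refine h2.trans ?_
    rw [setLIntegral_const, Real.volume_Ioc, ← ENNReal.ofReal_mul (by positivity)]
    refine ENNReal.ofReal_le_ofReal ?_
    have h3 : Real.pi / |y| - Real.pi / τ ≤ Real.pi / τ * (1 / 9) := by
      have : Real.pi / |y| ≤ Real.pi / (9 / 10 * τ) := div_le_div_of_nonneg_left (by linarith) (by positivity) hc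
      refine (sub_le_sub_right this _).trans (le_of_eq ?_)
      field_simp; norm_num
    refine (mul_le_mul_of_nonneg_left h3 (by positivity)).trans ?_
    have e5 : Real.exp (-(4 / τ ^ 2)) / (Real.pi / τ) ^ 2 * (Real.pi / τ * (1 / 9)) = Real.exp (-(4 / τ ^ 2)) * (τ * (1 / (9 * Real.pi))) := by
      field_simp
    rw [e5, mul_comm (393 / 10000 * τ)]
    refine mul_le_mul (Real.exp_le_exp.2 ?_) ?_ (by positivity) (Real.exp_nonneg _)
    · gcongr; norm_num
    · rw [mul_comm]
      refine mul_le_mul_of_nonneg_right ?_ h0.le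
      rw [div_le_iff₀ (by positivity)]; linarith
  · refine le_trans ?_ (le_max_right _ _)
    push Not at hc
    refine add_le_add (hv_mono9 hp hc.le) ?_
    refine (lintegral_mono_set Set.Ioc_subset_Ioi_self).trans ((ex_bd (by positivity) (by positivity)).trans (ENNReal.ofReal_le_ofReal ?_))
    rw [mul_assoc 2, e4, div_eq_mul_inv]
    refine mul_le_mul_of_nonneg_left ?_ (Real.exp_nonneg _)
    have e6 : (Real.pi / τ * (1 + 2 * (4 / τ ^ 2)))⁻¹ = τ ^ 3 * (1 / Real.pi) / (τ ^ 2 + 8) := by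
      field_simp; norm_num
    rw [e6]
    have h7 : 1 / Real.pi ≤ 3184 / 10000 := by
      rw [div_le_iff₀ (by positivity)]
      have := Real.pi_gt_d4
      linarith
    exact div_le_div_of_nonneg_right (mul_le_mul_of_nonneg_left h7 (by positivity)) (by positivity)

/-- Upper Riemann sums -/
lemma riem {F : ℝ → ℝ≥0∞} {h : ℝ} (hh : 0 < h) {c : ℕ → ℝ} (hc : ∀ j, 0 ≤ c j) (n : ℕ)
    (hF : ∀ j < n, ∀ w, j * h < w → w ≤ (j + 1) * h → F w ≤ ENNReal.ofReal (c j)) :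
    ∫⁻ w in Set.Ioc 0 (n * h), F w ≤ ENNReal.ofReal (h * ∑ j ∈ Finset.range n, c j) := by
  induction n with
  | zero => simp
  | succ n ih =>
    have e : Set.Ioc (0:ℝ) ((n + 1 : ℕ) * h) = Set.Ioc 0 (n * h) ∪ Set.Ioc (n * h) ((n + 1 : ℕ) * h) := by
      rw [Set.Ioc_union_Ioc_eq_Ioc (by positivity)]
      push_cast; nlinarith
    rw [e, lintegral_union measurableSet_Ioc (by
      rw [Set.disjoint_left]; intro x hx hy; exact absurd hx.2 (not_le.2 hy.1))]
    rw [Finset.sum_range_succ, mul_add, ENNReal.ofReal_add (mul_nonneg hh.le (Finset.sum_nonneg fun j _ => hc j)) (mul_nonneg hh.le (hc n))]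
    refine add_le_add (ih fun j hj => hF j (by omega)) ?_
    have : ∫⁻ w in Set.Ioc (n * h) ((n + 1 : ℕ) * h), F w ≤ ∫⁻ w in Set.Ioc (n * h) ((n + 1 : ℕ) * h), ENNReal.ofReal (c n) := by
      refine setLIntegral_mono' measurableSet_Ioc fun w hw => hF n (by omega) w hw.1 ?_
      have := hw.2
      push_cast at this; exact this
    refine this.trans ?_
    rw [setLIntegral_const, Real.volume_Ioc, ← ENNReal.ofReal_mul (hc n)]
    refine le_of_eq (congrArg _ ?_)
    push_cast; ring

end SJ

namespace SJ

/-- fixed point scale -/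
def qq : ℕ := 281474976710656
/-- fixed point lower bound for Tp (p / q) -/
def tl (p q : ℕ) : ℕ := qq * (5040 * q ^ 3 + 42 * p ^ 2 * q - (840 * p * q ^ 2 + p ^ 3)) / (5040 * q ^ 3)
/-- rounded up product -/
def mq (a b : ℕ) : ℕ := a * b / qq + 1
/-- rounded up square -/
def sqq (a : ℕ) : ℕ := a ^ 2 / qq + 1
/-- start of the exponential -/
def exl (y : ℕ) : ℕ := qq + y ^ 2 / (2 * qq) + 1 - y
/-- upper bound for exp (-E) -/
def exf (E : ℕ) : ℕ := sqq (sqq (sqq (sqq (sqq (sqq (sqq (sqq (sqq (exl (E / 512))))))))))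
/-- recursive sum -/
def sumN (f : ℕ → ℕ) : ℕ → ℕ
  | 0 => 0
  | n + 1 => sumN f n + f n
/-- minimum with boolean test -/
def minN (a b : ℕ) : ℕ := bif Nat.ble a b then a else b
/-- bound for the gap factor -/
def mj (j r : ℕ) : ℕ := bif Nat.beq j 0 then (j + 1) * (qq / 2 - r) / 50 + 1 else minN ((j + 1) * (qq / 2 - r) / 50 + 1) (50 * qq / j + 1)
/-- bound for the phase factor -/
def bj (N j : ℕ) : ℕ := qq * ((j + 1) * minN ((j + 1) * N) 100000) / 15000000 + 1
/-- cell value, low part -/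
def cLow (N j r f : ℕ) : ℕ := bif Nat.blt (j * N) 157080 then sqq (mq f (mj j r)) else 0
/-- cell value, cross part -/
def cCr (N j f : ℕ) : ℕ := mq (mq f (exf (j ^ 2 * qq / 5000))) (sqq (bj N j))
/-- cell value given rho and the exponential -/
def cellC (N j r f : ℕ) : ℕ := cLow N j r f + cCr N j f
/-- cell value given rho -/
def cellB (N j r : ℕ) : ℕ := cellC N j r (exf (j ^ 2 * r / 2500))
/-- cell value -/
def cell (N j : ℕ) : ℕ := cellB N j ((tl (((j + 1) * N) ^ 2) 10000000000) ^ 2 / (2 * qq))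
/-- high cell value -/
def hcell (N i : ℕ) : ℕ := mq (exf (i ^ 2 * ((tl (i ^ 2) 25600) ^ 2 / qq) * 1000000 / (6400 * N ^ 2)))
  (qq / 12 + 1 + (qq * 11 * (i + 1) ^ 2 / (1620 * 6400) + 1))

/-- a is an upper bound for x in fixed point -/
def Ub (a : ℕ) (x : ℝ) : Prop := x * qq ≤ a
/-- a is a lower bound for x in fixed point -/
def Lb (a : ℕ) (x : ℝ) : Prop := (a : ℝ) ≤ x * qq

lemma qq_pos : (0 : ℝ) < qq := by norm_num [qq]

lemma ub_div {n d : ℕ} {x : ℝ} (hd : 0 < d) (h : x * qq ≤ (n : ℝ) / d) : Ub (n / d + 1) x := by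
  have h1 : n < d * (n / d + 1) := Nat.lt_mul_div_succ n hd
  have h2 : (n : ℝ) < d * ((n / d + 1 : ℕ) : ℝ) := by exact_mod_cast h1
  unfold Ub
  refine h.trans ?_
  have hd' : (0 : ℝ) < d := by exact_mod_cast hd
  rw [div_le_iff₀ hd']
  linarith

lemma lb_div {n d : ℕ} {x : ℝ} (h : (n : ℝ) / d ≤ x * qq) : Lb (n / d) x :=
  le_trans Nat.cast_div_le h

lemma ub_mono {x y : ℝ} (h : Ub a y) (hxy : x ≤ y) : Ub a x :=
  le_trans (mul_le_mul_of_nonneg_right hxy qq_pos.le) h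

lemma ub_add {x y : ℝ} (h : Ub a x) (h' : Ub b y) : Ub (a + b) (x + y) := by
  unfold Ub at *; push_cast; linarith

lemma ub_mq {x y : ℝ} (h : Ub a x) (h' : Ub b y) (hx : 0 ≤ x) (hy : 0 ≤ y) : Ub (mq a b) (x * y) := by
  unfold mq
  refine ub_div (by norm_num [qq]) ?_
  rw [le_div_iff₀ qq_pos]
  push_cast
  have := mul_le_mul h h' (mul_nonneg hy qq_pos.le) (Nat.cast_nonneg a)
  linarith

lemma ub_sqq {x : ℝ} (h : Ub a x) (hx : 0 ≤ x) : Ub (sqq a) (x ^ 2) := by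
  have := ub_mq h h hx hx
  rw [mq, ← pow_two, ← pow_two] at this
  exact this

lemma ub_exl {y : ℕ} {z : ℝ} (h : Lb y z) : Ub (exl y) (Real.exp (-z)) := by
  set u : ℝ := (y : ℝ) / qq with hu
  have hq := qq_pos
  have hu0 : 0 ≤ u := by positivity
  have h1 : u ≤ z := by rw [hu, div_le_iff₀ hq]; exact h
  have h2 : Real.exp (-z) ≤ Real.exp (-u) := Real.exp_le_exp.2 (by linarith)
  have h3 : Real.exp (-u) ≤ 1 - u + u ^ 2 / 2 := by
    have h := Real.quadratic_le_exp_of_nonneg hu0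
    rw [Real.exp_neg]
    rw [inv_le_iff_one_le_mul₀ (Real.exp_pos u)]
    have hp : 0 ≤ 1 - u + u ^ 2 / 2 := by nlinarith [sq_nonneg (u - 1)]
    have := mul_le_mul_of_nonneg_left h hp
    nlinarith [sq_nonneg (u ^ 2)]
  have h4 : Ub (y ^ 2 / (2 * qq) + 1) (u ^ 2 / 2) := by
    refine ub_div (by norm_num [qq]) (le_of_eq ?_)
    rw [hu]; push_cast; field_simp
  unfold Ub at h4 ⊢
  have h5 : ((qq + y ^ 2 / (2 * qq) + 1 : ℕ) : ℝ) - y ≤ (exl y : ℕ) := by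
    unfold exl
    have : qq + y ^ 2 / (2 * qq) + 1 ≤ (qq + y ^ 2 / (2 * qq) + 1 - y) + y := by omega
    have h' : ((qq + y ^ 2 / (2 * qq) + 1 : ℕ) : ℝ) ≤ ((qq + y ^ 2 / (2 * qq) + 1 - y : ℕ) : ℝ) + y := by exact_mod_cast this
    linarith
  refine le_trans ?_ h5
  have h6 : u * qq = y := by rw [hu]; field_simp
  have h7 := mul_le_mul_of_nonneg_right (h2.trans h3) hq.le
  refine h7.trans ?_
  have e : ((qq + y ^ 2 / (2 * qq) + 1 : ℕ) : ℝ) = qq + ((y ^ 2 / (2 * qq) + 1 : ℕ) : ℝ) := by push_cast; ring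
  rw [e]
  nlinarith

lemma lb_div' {d : ℕ} {x : ℝ} (h : Lb n x) : Lb (n / d) (x / d) := by
  refine lb_div ?_
  unfold Lb at h
  rw [div_mul_eq_mul_div]
  exact div_le_div_of_nonneg_right h (Nat.cast_nonneg d)

lemma ub_exf {z : ℝ} (h : Lb E z) : Ub (exf E) (Real.exp (-z)) := by
  have h1 := ub_exl (lb_div' (d := 512) h)
  have h2 := ub_sqq (ub_sqq (ub_sqq (ub_sqq (ub_sqq (ub_sqq (ub_sqq (ub_sqq (ub_sqq h1 (Real.exp_nonneg _)) (by positivity)) (by positivity)) (by positivity)) (by positivity)) (by positivity)) (by positivity)) (by positivity)) (by positivity)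
  have e : ((((((((Real.exp (-(z / (512:ℕ))) ^ 2) ^ 2) ^ 2) ^ 2) ^ 2) ^ 2) ^ 2) ^ 2) ^ 2 = Real.exp (-z) := by
    simp only [← pow_mul]
    rw [← Real.exp_nat_mul]
    congr 1; push_cast; ring
  rw [e] at h2
  exact h2

lemma lb_tl {p q : ℕ} (hq : 0 < q) : Lb (tl p q) (Tp (p / q)) := by
  unfold tl
  refine lb_div ?_
  have hq' : (0 : ℝ) < q := by exact_mod_cast hq
  have hQ := qq_pos
  push_cast
  rw [mul_div_assoc, mul_comm]
  refine mul_le_mul_of_nonneg_right ?_ hQ.le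
  rw [div_le_iff₀ (by positivity)]
  unfold Tp
  set a := 5040 * q ^ 3 + 42 * p ^ 2 * q with ha
  set b := 840 * p * q ^ 2 + p ^ 3 with hb
  rcases le_total a b with h | h
  · rw [Nat.sub_eq_zero_of_le h]
    simp only [Nat.cast_zero]
    exact mul_nonneg (le_max_left _ _) (by positivity)
  · rw [Nat.cast_sub h]
    refine le_trans (le_of_eq ?_) (mul_le_mul_of_nonneg_right (le_max_right _ _) (by positivity))
    rw [ha, hb]
    push_cast
    field_simp
    ring

lemma lb_sq {t : ℕ} {x : ℝ} (h : Lb t x) : Lb (t ^ 2 / qq) (x ^ 2) := by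
  refine lb_div ?_
  rw [div_le_iff₀ qq_pos]
  have := pow_le_pow_left₀ (Nat.cast_nonneg t) h 2
  push_cast
  linarith [mul_pow x (qq:ℝ) 2]

lemma lb_sq2 {t : ℕ} {x : ℝ} (h : Lb t x) : Lb (t ^ 2 / (2 * qq)) (x ^ 2 / 2) := by
  have hq := qq_pos
  refine lb_div ?_
  have := pow_le_pow_left₀ (Nat.cast_nonneg t) h 2
  push_cast
  rw [div_le_iff₀ (by positivity)]
  linarith [mul_pow x (qq:ℝ) 2]

lemma lb_rho (N j : ℕ) : Lb ((tl (((j + 1) * N) ^ 2) 10000000000) ^ 2 / (2 * qq)) (rho (((j:ℝ) + 1) / 50 * (N / 1000))) := by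
  have h := lb_sq2 (lb_tl (p := ((j + 1) * N) ^ 2) (q := 10000000000) (by norm_num))
  unfold rho
  convert! h using 4
  push_cast; ring

lemma minN_eq (a b : ℕ) : minN a b = min a b := by
  unfold minN
  by_cases h : a ≤ b
  · rw [Nat.ble_eq_true_of_le h, cond_true, min_eq_left h]
  · have : Nat.ble a b = false := by
      rw [Bool.eq_false_iff]; intro h'; exact h (Nat.le_of_ble_eq_true h')
    rw [this, cond_false, min_eq_right (by omega)]

lemma ub_min {x y : ℝ} (h : Ub a x) (h' : Ub b y) : Ub (minN a b) (min x y) := by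
  rw [minN_eq]
  rcases le_total a b with hh | hh
  · rw [min_eq_left hh]; exact ub_mono h (min_le_left _ _)
  · rw [min_eq_right hh]; exact ub_mono h' (min_le_right _ _)

lemma ub_gap {r j : ℕ} {ρ w : ℝ} (h : Lb r ρ) (hw0 : 0 ≤ w) (hw : w ≤ (j + 1 : ℝ) / 50) (hρ : ρ ≤ 1 / 2) :
    Ub ((j + 1) * (qq / 2 - r) / 50 + 1) (w * (1 / 2 - ρ)) := by
  refine ub_div (by norm_num) ?_
  have h1 : qq / 2 ≤ (qq / 2 - r) + r := by omega
  have h2 : ((qq / 2 : ℕ) : ℝ) ≤ ((qq / 2 - r : ℕ) : ℝ) + r := by exact_mod_cast h1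
  have h3 : ((qq / 2 : ℕ) : ℝ) = qq / 2 := by norm_num [qq]
  unfold Lb at h
  have h4 : (1 / 2 - ρ) * qq ≤ ((qq / 2 - r : ℕ) : ℝ) := by linarith
  push_cast
  calc w * (1 / 2 - ρ) * qq = w * ((1 / 2 - ρ) * qq) := by ring
    _ ≤ (j + 1 : ℝ) / 50 * ((qq / 2 - r : ℕ) : ℝ) := mul_le_mul hw h4 (mul_nonneg (by linarith) qq_pos.le) (by positivity)
    _ = _ := by ring

lemma ub_mj {r j : ℕ} {ρ w : ℝ} (h : Lb r ρ) (hw0 : 0 < w) (hw1 : (j:ℝ) / 50 < w) (hw : w ≤ (j + 1 : ℝ) / 50) (hρ : ρ ≤ 1 / 2) :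
    Ub (mj j r) (min (w * (1 / 2 - ρ)) (1 / w)) := by
  unfold mj
  by_cases hj : j = 0
  · subst hj
    have := ub_gap (j := 0) h hw0.le hw hρ
    simp only [Nat.beq_eq, cond_true, Nat.beq]
    exact ub_mono this (min_le_left _ _)
  · have : Nat.beq j 0 = false := by
      cases j with
      | zero => exact absurd rfl hj
      | succ n => rfl
    rw [this, cond_false]
    refine ub_min (ub_gap h hw0.le hw hρ) ?_
    have hj0 : (0:ℝ) < j := by exact_mod_cast Nat.pos_of_ne_zero hj
    refine ub_div (Nat.pos_of_ne_zero hj) ?_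
    push_cast
    rw [mul_div_right_comm]
    refine mul_le_mul_of_nonneg_right ?_ qq_pos.le
    rw [div_le_div_iff₀ hw0 hj0]
    linarith

lemma ub_bj {N j : ℕ} {w : ℝ} (hw0 : 0 < w) (hw : w ≤ (j + 1 : ℝ) / 50) :
    Ub (bj N j) (w * min (w * (N / 1000 : ℝ) / 6) (1 / 3)) := by
  unfold bj
  refine ub_div (by norm_num) ?_
  push_cast
  rw [minN_eq, Nat.cast_min]
  push_cast
  have h1 : min (w * (N / 1000 : ℝ) / 6) (1 / 3) ≤ min (((j:ℝ) + 1) * N) 100000 / 300000 := by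
    rw [le_div_iff₀ (by norm_num), min_mul_of_nonneg _ _ (by norm_num)]
    refine min_le_min ?_ (by norm_num)
    have : w * (N:ℝ) ≤ (j + 1 : ℝ) / 50 * N := mul_le_mul_of_nonneg_right hw (Nat.cast_nonneg N)
    linarith
  have h2 := mul_le_mul hw h1 (by positivity) (by positivity)
  have h3 := mul_le_mul_of_nonneg_right h2 qq_pos.le
  refine h3.trans (le_of_eq ?_)
  ring

lemma lb_e1 {r j : ℕ} {ρ w : ℝ} (h : Lb r ρ) (hw1 : (j:ℝ) / 50 < w) (hρ : 0 ≤ ρ) : Lb (j ^ 2 * r / 2500) (w ^ 2 * ρ) := by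
  refine lb_div ?_
  unfold Lb at h
  push_cast
  have h2 := pow_le_pow_left₀ (by positivity) hw1.le 2
  have h3 := mul_le_mul h2 h (by positivity) (by positivity)
  have : w ^ 2 * (ρ * qq) = w ^ 2 * ρ * qq := by ring
  rw [← this]
  refine le_trans (le_of_eq ?_) h3
  ring

lemma lb_e2 {j : ℕ} {w : ℝ} (hw1 : (j:ℝ) / 50 < w) : Lb (j ^ 2 * qq / 5000) (w ^ 2 / 2) := by
  refine lb_div ?_
  push_cast
  have h2 := pow_le_pow_left₀ (by positivity) hw1.le 2
  have h3 := mul_le_mul_of_nonneg_right h2 qq_pos.le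
  have e : ((j:ℝ) / 50) ^ 2 * qq = 2 * ((j:ℝ) ^ 2 * qq / 5000) := by ring
  linarith

lemma ub_cell {N j : ℕ} {w : ℝ} (hw1 : (j:ℝ) / 50 < w) (hw : w ≤ (j + 1 : ℝ) / 50) :
    Ub (cell N j) ((if (j * N) < 157080 then lowf (N / 1000) w else 0) + crf (N / 1000) w) := by
  have hw0 : 0 < w := lt_of_le_of_lt (by positivity) hw1
  have hr0 := lb_rho N j
  have ha : rho (((j:ℝ) + 1) / 50 * (N / 1000)) ≤ rho (w * (N / 1000)) :=
    rho_anti (by positivity) (mul_le_mul_of_nonneg_right hw (by positivity))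
  have hr : Lb ((tl (((j + 1) * N) ^ 2) 10000000000) ^ 2 / (2 * qq)) (rho (w * (N / 1000))) :=
    le_trans hr0 (mul_le_mul_of_nonneg_right ha qq_pos.le)
  unfold cell
  generalize (tl (((j + 1) * N) ^ 2) 10000000000) ^ 2 / (2 * qq) = r at hr
  unfold cellB
  have hf := ub_exf (lb_e1 hr hw1 (rho_nonneg _))
  generalize exf (j ^ 2 * r / 2500) = f at hf
  unfold cellC
  have hh := rho_le_half (w * (N / 1000 : ℝ))
  refine ub_add ?_ ?_
  · unfold cLow
    by_cases hc : j * N < 157080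
    · have hb : Nat.blt (j * N) 157080 = true := by simpa [Nat.blt] using hc
      rw [hb, cond_true, if_pos hc]
      have hm : 0 ≤ min (w * (1 / 2 - rho (w * (N / 1000 : ℝ)))) (1 / w) := le_min (mul_nonneg hw0.le (by linarith)) (by positivity)
      exact ub_sqq (ub_mq hf (ub_mj hr hw0 hw1 hw hh) (Real.exp_nonneg _) hm) (mul_nonneg (Real.exp_nonneg _) hm)
    · rw [if_neg hc]
      unfold Ub; rw [zero_mul]; positivity
  · unfold cCr crf
    have hg := ub_exf (lb_e2 hw1)
    rw [neg_div]
    exact ub_mq (ub_mq hf hg (Real.exp_nonneg _) (Real.exp_nonneg _)) (ub_sqq (ub_bj hw0 hw) (by positivity)) (by positivity) (by positivity)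

lemma ub_hcell {N i : ℕ} {x : ℝ} (hN : 0 < N) (hx1 : (i:ℝ) / 80 < x) (hx : x ≤ (i + 1 : ℝ) / 80) (hxp : x ≤ Real.pi) :
    Ub (hcell N i) (Real.exp (-(2 / (N / 1000 : ℝ) ^ 2 * (1 - Real.cos x))) * wt x) := by
  have hx0 : 0 < x := lt_of_le_of_lt (by positivity) hx1
  have hN' : (0:ℝ) < N := by exact_mod_cast hN
  have hq := qq_pos
  unfold hcell
  refine ub_mq (ub_exf ?_) ?_ (Real.exp_nonneg _) (wt_nonneg x)
  · refine lb_div ?_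
    have ht := lb_sq (lb_tl (p := i ^ 2) (q := 25600) (by norm_num))
    have hc : Real.cos x ≤ Real.cos ((i:ℝ) / 80) := Real.cos_le_cos_of_nonneg_of_le_pi (by positivity) hxp hx1.le
    have h1 := rho_cos ((i:ℝ) / 80)
    unfold rho at h1
    have e : ((i:ℝ) / 80) ^ 2 / 4 = ((i ^ 2 : ℕ) : ℝ) / ((25600 : ℕ) : ℝ) := by push_cast; ring
    rw [e] at h1
    unfold Lb at ht
    generalize (tl (i ^ 2) 25600) ^ 2 / qq = T at ht ⊢
    push_cast at h1 ht ⊢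
    generalize Tp ((i:ℝ) ^ 2 / 25600) = P at h1 ht
    rw [div_le_iff₀ (by positivity)]
    have h2 : (i:ℝ) ^ 2 * T ≤ (i:ℝ) ^ 2 * (P ^ 2 * qq) := mul_le_mul_of_nonneg_left ht (by positivity)
    have h3 : (i:ℝ) ^ 2 * P ^ 2 ≤ 12800 * (1 - Real.cos x) := by nlinarith
    have h4 := mul_le_mul_of_nonneg_right h3 hq.le
    have e2 : 2 / ((N:ℝ) / 1000) ^ 2 * (1 - Real.cos x) * qq * (6400 * N ^ 2) = 12800 * (1 - Real.cos x) * qq * 1000000 := by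
      field_simp; ring
    rw [e2]
    nlinarith
  · unfold wt
    refine ub_add ?_ ?_
    · refine ub_div (by norm_num) ?_
      apply le_of_eq; push_cast; ring
    · refine ub_div (by norm_num) ?_
      push_cast
      have h2 := pow_le_pow_left₀ hx0.le hx 2
      have h3 := mul_le_mul_of_nonneg_right h2 hq.le
      have e : ((i + 1 : ℝ) / 80) ^ 2 * qq = qq * 11 * (i + 1) ^ 2 / (1620 * 6400) * (1620 / 11) := by ring
      rw [e] at h3
      linarith

lemma sumN_eq (f : ℕ → ℕ) (n : ℕ) : sumN f n = ∑ j ∈ Finset.range n, f j := by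
  induction n with
  | zero => rfl
  | succ n ih => rw [sumN, Finset.sum_range_succ, ih]

end SJ

namespace SJ

/-- low and cross part -/
def loN (N : ℕ) : ℕ := sumN (cell N) 250 / 50 + 1
/-- high part -/
def hiN (N : ℕ) : ℕ := N * sumN (hcell N) 252 / 80000 + 1
/-- first extra term -/
def e1N (N : ℕ) : ℕ := mq (393 * N * qq / 10000000 + 1) (exf (3900000 * qq / N ^ 2))
/-- second extra term -/
def e2N (N : ℕ) : ℕ := mq (exf (4000000 * qq / N ^ 2)) (qq * N ^ 3 * 3184 / (10000000 * (N ^ 2 + 8000000)) + 1)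
/-- S for large tau -/
def sBig (N : ℕ) : ℕ := loN N + max (hiN N + e1N N) (9 * hiN N / 10 + 1 + e2N N) + qq / 1000000
/-- S for small tau -/
def sSmall (N : ℕ) : ℕ := loN N + hiN N + qq / 1000000
/-- tail bound -/
def tailN (N A : ℕ) : ℕ := qq * (216000 * (3000000 + N ^ 2)) / (256000000 * A ^ 3) + 1 +
  (exf (A ^ 2 * qq / 800) * 319200 / (1000 * (400 + A ^ 2)) + 1)
/-- check of one step -/
def okN (S N N2 A : ℕ) : Bool := Nat.ble (2 * A * S * 31831 * qq / 2000000 + qq) ((N2 * qq / 2000 - tailN N A) ^ 2)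

lemma Ub.ofReal (h : Ub a x) : ENNReal.ofReal x ≤ ENNReal.ofReal (a / qq) := by
  refine ENNReal.ofReal_le_ofReal ?_
  rw [le_div_iff₀ qq_pos]; exact h

lemma ub_self (a : ℕ) : Ub a (a / qq) := by
  unfold Ub; rw [div_mul_cancel₀ _ qq_pos.ne']

lemma lo_bd {N : ℕ} (hN : 0 < N) {W : ℝ} (hW5 : W ≤ 5) (hWp : W ≤ Real.pi / (N / 1000)) :
    (∫⁻ w in Set.Ioc 0 W, ENNReal.ofReal (lowf (N / 1000) w)) + (∫⁻ w in Set.Ioc 0 5, ENNReal.ofReal (crf (N / 1000) w)) ≤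
      ENNReal.ofReal (loN N / qq) := by
  have hN' : (0:ℝ) < N := by exact_mod_cast hN
  have hq := qq_pos
  have h1 : (∫⁻ w in Set.Ioc 0 W, ENNReal.ofReal (lowf (N / 1000) w)) =
      ∫⁻ w in Set.Ioc 0 5, (Set.Ioc 0 W).indicator (fun w => ENNReal.ofReal (lowf (N / 1000) w)) w := by
    rw [lintegral_indicator measurableSet_Ioc, Measure.restrict_restrict measurableSet_Ioc,
      Set.inter_eq_left.2 (Set.Ioc_subset_Ioc_right hW5)]
  have hcm : Measurable (fun w => ENNReal.ofReal (crf (N / 1000) w)) := by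
    unfold crf rho Tp; fun_prop
  rw [h1, ← lintegral_add_right _ hcm]
  have e5 : (5:ℝ) = (250 : ℕ) * (1 / 50) := by norm_num
  rw [e5]
  refine (riem (h := 1 / 50) (by norm_num) (c := fun j => (cell N j : ℝ) / qq) (fun j => by positivity) 250 ?_).trans ?_
  · intro j _ w hw1 hw2
    have hw1' : (j:ℝ) / 50 < w := by linarith
    have hw2' : w ≤ ((j:ℝ) + 1) / 50 := by linarith
    refine le_trans ?_ (ub_cell (N := N) hw1' hw2').ofReal
    have hw0 : 0 < w := lt_of_le_of_lt (by positivity) hw1'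
    have hl : 0 ≤ lowf (N / 1000) w := by unfold lowf; positivity
    have hc : 0 ≤ crf (N / 1000) w := by unfold crf; positivity
    by_cases hj : j * N < 157080
    · rw [if_pos hj, ENNReal.ofReal_add hl hc]
      refine add_le_add_left (Set.indicator_le_self _ _ w) _
    · rw [if_neg hj, zero_add, Set.indicator_of_notMem, zero_add]
      intro hm
      apply hj
      have h3 := hm.2.trans hWp
      rw [le_div_iff₀ (by positivity)] at h3
      have h4 := mul_lt_mul_of_pos_right hw1' hN'
      have h5 := Real.pi_lt_d6
      have : (j:ℝ) * N < 157080 := by linarith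
      exact_mod_cast this
  · have hu : Ub (loN N) (1 / 50 * ∑ j ∈ Finset.range 250, (cell N j : ℝ) / qq) := by
      unfold loN
      refine ub_div (by norm_num) (le_of_eq ?_)
      rw [← Finset.sum_div, sumN_eq]
      push_cast; field_simp
    exact hu.ofReal

lemma hv_bd {N : ℕ} (hN : 0 < N) : hv (N / 1000) ≤ ENNReal.ofReal (hiN N / qq) := by
  have hN' : (0:ℝ) < N := by exact_mod_cast hN
  have hq := qq_pos
  have hpi := Real.pi_lt_d2
  unfold hv
  have h1 : ∫⁻ x in Set.Ioc 0 Real.pi, ENNReal.ofReal (Real.exp (-(2 / (N / 1000 : ℝ) ^ 2 * (1 - Real.cos x))) * wt x) =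
      ∫⁻ x in Set.Ioc (0:ℝ) (((252:ℕ):ℝ) * (1 / 80)), (Set.Ioc 0 Real.pi).indicator (fun x => ENNReal.ofReal (Real.exp (-(2 / (N / 1000 : ℝ) ^ 2 * (1 - Real.cos x))) * wt x)) x := by
    rw [lintegral_indicator measurableSet_Ioc, Measure.restrict_restrict measurableSet_Ioc,
      Set.inter_eq_left.2 (Set.Ioc_subset_Ioc_right (by norm_num; linarith))]
  rw [h1]
  have h2 := riem (F := (Set.Ioc 0 Real.pi).indicator (fun x => ENNReal.ofReal (Real.exp (-(2 / (N / 1000 : ℝ) ^ 2 * (1 - Real.cos x))) * wt x)))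
    (h := 1 / 80) (by norm_num) (c := fun j => (hcell N j : ℝ) / qq) (fun j => by positivity) 252 (by
    intro j _ w hw1 hw2
    have hw1' : (j:ℝ) / 80 < w := by linarith
    have hw2' : w ≤ ((j:ℝ) + 1) / 80 := by linarith
    by_cases hm : w ∈ Set.Ioc 0 Real.pi
    · rw [Set.indicator_of_mem hm]
      exact (ub_hcell hN hw1' hw2' hm.2).ofReal
    · rw [Set.indicator_of_notMem hm]; exact zero_le)
  refine (mul_le_mul_right h2 _).trans ?_
  rw [← ENNReal.ofReal_mul (by positivity)]
  refine Ub.ofReal ?_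
  unfold hiN
  refine ub_div (by norm_num) (le_of_eq ?_)
  rw [← Finset.sum_div, sumN_eq]
  push_cast; field_simp; ring

lemma e1_bd {N : ℕ} (hN : 0 < N) : Ub (e1N N) (393 / 10000 * (N / 1000) * Real.exp (-(39 / 10 / (N / 1000 : ℝ) ^ 2))) := by
  have hN' : (0:ℝ) < N := by exact_mod_cast hN
  unfold e1N
  refine ub_mq (ub_div (by norm_num) (le_of_eq ?_)) (ub_exf (lb_div (le_of_eq ?_))) (by positivity) (by positivity)
  · push_cast; ring
  · push_cast; field_simp; ring

lemma e2_bd {N : ℕ} (hN : 0 < N) : Ub (e2N N) (Real.exp (-(4 / (N / 1000 : ℝ) ^ 2)) * ((N / 1000 : ℝ) ^ 3 * (3184 / 10000) / ((N / 1000 : ℝ) ^ 2 + 8))) := by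
  have hN' : (0:ℝ) < N := by exact_mod_cast hN
  unfold e2N
  refine ub_mq (ub_exf (lb_div (le_of_eq ?_))) (ub_div (by positivity) (le_of_eq ?_)) (by positivity) (by positivity)
  · push_cast; field_simp; ring
  · push_cast; field_simp; ring

lemma c6 : ENNReal.ofReal (5 / 10000000) + ENNReal.ofReal (4 / 10000000) ≤ ENNReal.ofReal ((qq / 1000000 : ℕ) / qq) := by
  rw [← ENNReal.ofReal_add (by norm_num) (by norm_num)]
  refine ENNReal.ofReal_le_ofReal ?_
  norm_num [qq]

lemma ofq_add (a b : ℕ) : ENNReal.ofReal ((a + b : ℕ) / qq) = ENNReal.ofReal (a / qq) + ENNReal.ofReal (b / qq) := by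
  have hq := qq_pos
  rw [← ENNReal.ofReal_add (by positivity) (by positivity)]
  push_cast; rw [add_div]

lemma S_small {N : ℕ} (hN : 0 < N) (hN2 : N ≤ 620) (hs : IsSJ κ μ 1 (N / 1000)) :
    ∫⁻ w in Set.Ioi 0, ENNReal.ofReal (‖charFun μ w - charFun gam w‖ ^ 2 / w ^ 2) ≤ ENNReal.ofReal (sSmall N / qq) := by
  have hN' : (0:ℝ) < N := by exact_mod_cast hN
  have hNr : (N:ℝ) ≤ 620 := by exact_mod_cast hN2
  have hpi := Real.pi_gt_d2
  have h := hs.S0 (W := 5) (V := 5) (by norm_num) (by norm_num) (H_small hs (by linarith))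
  refine h.trans ?_
  have hlo := lo_bd hN (W := 5) le_rfl (by rw [le_div_iff₀ (by positivity)]; linarith)
  have hv := hv_bd hN
  unfold sSmall
  rw [ofq_add, ofq_add]
  calc _ = ((∫⁻ w in Set.Ioc 0 5, ENNReal.ofReal (lowf (N / 1000) w)) + (∫⁻ w in Set.Ioc 0 5, ENNReal.ofReal (crf (N / 1000) w)))
        + SJ.hv (N / 1000) + (ENNReal.ofReal (5 / 10000000) + (∫⁻ w in Set.Ioi (5:ℝ), ENNReal.ofReal (4 * Real.exp (-w ^ 2 / 2) / w ^ 2))) := by ring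
    _ ≤ _ := add_le_add (add_le_add hlo hv) ((add_le_add_right cross_tail5 _).trans c6)

lemma S_big {N : ℕ} (hN2 : 635 ≤ N) (hs : IsSJ κ μ 1 (N / 1000)) :
    ∫⁻ w in Set.Ioi 0, ENNReal.ofReal (‖charFun μ w - charFun gam w‖ ^ 2 / w ^ 2) ≤ ENNReal.ofReal (sBig N / qq) := by
  have hN : 0 < N := by omega
  have hN' : (0:ℝ) < N := by exact_mod_cast hN
  have hNr : (635:ℝ) ≤ N := by exact_mod_cast hN2
  have hpi := Real.pi_lt_d2
  have hp0 := Real.pi_pos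
  have hq := qq_pos
  have h := hs.S0 (W := Real.pi / (N / 1000)) (V := 5) (by positivity) (by norm_num) (H_big hs (by positivity))
  refine h.trans ?_
  have hlo := lo_bd hN (W := Real.pi / (N / 1000)) (by rw [div_le_iff₀ (by positivity)]; linarith) le_rfl
  have hv := hv_bd hN
  have hv9 : ENNReal.ofReal (9 / 10) * SJ.hv (N / 1000) ≤ ENNReal.ofReal ((9 * hiN N / 10 + 1 : ℕ) / qq) := by
    refine (mul_le_mul_right hv _).trans ?_
    rw [← ENNReal.ofReal_mul (by norm_num)]
    refine Ub.ofReal (ub_div (by norm_num) (le_of_eq ?_))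
    push_cast; field_simp
  unfold sBig
  rw [ofq_add, ofq_add]
  have hmax : max (SJ.hv (N / 1000) + ENNReal.ofReal (393 / 10000 * (N / 1000) * Real.exp (-(39 / 10 / (N / 1000 : ℝ) ^ 2))))
      (ENNReal.ofReal (9 / 10) * SJ.hv (N / 1000) + ENNReal.ofReal (Real.exp (-(4 / (N / 1000 : ℝ) ^ 2)) * ((N / 1000 : ℝ) ^ 3 * (3184 / 10000) / ((N / 1000 : ℝ) ^ 2 + 8)))) ≤
      ENNReal.ofReal ((max (hiN N + e1N N) (9 * hiN N / 10 + 1 + e2N N) : ℕ) / qq) := by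
    refine max_le ?_ ?_
    · refine le_trans (add_le_add hv (e1_bd hN).ofReal) ?_
      rw [← ofq_add]
      refine ENNReal.ofReal_le_ofReal (div_le_div_of_nonneg_right ?_ hq.le)
      exact_mod_cast le_max_left _ _
    · refine le_trans (add_le_add hv9 (e2_bd hN).ofReal) ?_
      rw [← ofq_add]
      refine ENNReal.ofReal_le_ofReal (div_le_div_of_nonneg_right ?_ hq.le)
      exact_mod_cast le_max_right _ _
  generalize max (SJ.hv (N / 1000) + _) _ = M at hmax ⊢
  calc _ = ((∫⁻ w in Set.Ioc 0 (Real.pi / (N / 1000)), ENNReal.ofReal (lowf (N / 1000) w)) + (∫⁻ w in Set.Ioc 0 5, ENNReal.ofReal (crf (N / 1000) w)))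
        + M + ((∫⁻ w in Set.Ioi (5:ℝ), ENNReal.ofReal (4 * Real.exp (-w ^ 2 / 2) / w ^ 2))) := by ring
    _ ≤ _ := add_le_add (add_le_add hlo hmax) (cross_tail5.trans (le_trans le_add_self c6))

lemma tail_bd {N A : ℕ} (hA : 0 < A) (hs : IsSJ κ μ 1 (N / 1000)) :
    ∫⁻ x in outA (A / 20), ENNReal.ofReal |Dc μ x| ≤ ENNReal.ofReal (tailN N A / qq) := by
  have := hs.pμ
  have hA' : (0:ℝ) < A := by exact_mod_cast hA
  have hq := qq_pos
  refine (tail_le μ (by positivity)).trans ?_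
  unfold tailN
  rw [ofq_add]
  refine add_le_add ?_ ?_
  · refine (hs.mtail (by positivity)).trans ?_
    refine (ub_div (by positivity) (le_of_eq ?_)).ofReal
    push_cast; field_simp; ring
  · refine (gtail (by positivity)).trans ?_
    refine (ub_div (by positivity) ?_).ofReal
    have he : Ub (exf (A ^ 2 * qq / 800)) (Real.exp (-(((A:ℝ) / 20) ^ 2 / 2))) := ub_exf (lb_div (le_of_eq (by push_cast; ring)))
    unfold Ub at he
    rw [neg_div]
    push_cast
    have h1 := mul_le_mul_of_nonneg_right he (show (0:ℝ) ≤ 319200 / (1000 * (400 + (A:ℝ) ^ 2)) by positivity)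
    refine le_trans (le_of_eq ?_) (h1.trans (le_of_eq ?_))
    · field_simp; ring
    · ring

lemma step_ok {N N2 A S : ℕ} (hA : 0 < A) (hs : IsSJ κ μ 1 (N / 1000))
    (hS : ∫⁻ w in Set.Ioi 0, ENNReal.ofReal (‖charFun μ w - charFun gam w‖ ^ 2 / w ^ 2) ≤ ENNReal.ofReal (S / qq))
    (hok : okN S N N2 A = true) : ∫ u, |qf μ u - qf gam u| ∂unif ≤ (N2 : ℝ) / 2000 := by
  have := hs.pμ
  have hq := qq_pos
  have hA' : (0:ℝ) < A := by exact_mod_cast hA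
  unfold okN at hok
  have h1 := Nat.le_of_ble_eq_true hok
  set d := N2 * qq / 2000 - tailN N A with hd
  have hd0 : 0 < d := by
    rcases Nat.eq_zero_or_pos d with h | h
    · rw [h] at h1
      simp [qq] at h1
    · exact h
  have h2 : d + tailN N A ≤ N2 * qq / 2000 := by omega
  have h3 : ((d:ℝ) + tailN N A) ≤ N2 * qq / 2000 := by
    have : ((d + tailN N A : ℕ) : ℝ) ≤ ((N2 * qq / 2000 : ℕ) : ℝ) := by exact_mod_cast h2
    have h' : ((N2 * qq / 2000 : ℕ) : ℝ) ≤ ((N2 * qq : ℕ) : ℝ) / ((2000 : ℕ) : ℝ) := Nat.cast_div_le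
    push_cast at this h'
    linarith
  have h4 : (2 * A * S * 31831 * qq / 2000000 : ℝ) ≤ d ^ 2 := by
    have h5 : (2 * A * S * 31831 * qq / 2000000 + 1) ≤ d ^ 2 := le_trans (by unfold qq; omega) h1
    have h6 : 2 * A * S * 31831 * qq < 2000000 * (2 * A * S * 31831 * qq / 2000000 + 1) := Nat.lt_mul_div_succ _ (by norm_num)
    have h7 : 2 * A * S * 31831 * qq ≤ 2000000 * d ^ 2 := h6.le.trans (Nat.mul_le_mul_left _ h5)
    have h8 : (2 * A * S * 31831 * qq : ℝ) ≤ 2000000 * d ^ 2 := by exact_mod_cast h7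
    linarith
  have hd' : (0:ℝ) < d := by exact_mod_cast hd0
  have hmain := w1_combine (μ := μ) hs.int_id (A := A / 20) (d := d / qq) (T := tailN N A / qq) (s := S / qq) (by positivity) (by positivity)
    (by positivity) (by positivity) (hs.S0_full hS) (by
      have hpi : 1 ≤ 31831 / 100000 * Real.pi := by have := Real.pi_gt_d6; linarith
      have e : 2 * ((A:ℝ) / 20) * (S / qq) = (2 * A * S * qq / 20) / qq ^ 2 := by field_simp
      rw [e, div_pow, ← mul_div_assoc]
      refine div_le_div_of_nonneg_right ?_ (by positivity)
      have h9 := mul_le_mul_of_nonneg_left h4 Real.pi_pos.le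
      refine le_trans ?_ h9
      have h10 := mul_le_mul_of_nonneg_left hpi (show (0:ℝ) ≤ 2 * A * S * qq / 20 by positivity)
      linarith) (tail_bd hA hs)
  rw [integral_eq_lintegral_of_nonneg_ae (f := fun u => |qf μ u - qf gam u|) (Filter.Eventually.of_forall fun u => abs_nonneg _)
    (((qf_aemeasurable μ).sub (qf_aemeasurable gam)).abs.aestronglyMeasurable)]
  refine ENNReal.toReal_le_of_le_ofReal (by positivity) (hmain.trans (ENNReal.ofReal_le_ofReal ?_))
  rw [← add_div, div_le_iff₀ hq]
  linarith

lemma IsSJ.enlarge (hs : IsSJ κ μ v R) (h : R ≤ R') : IsSJ κ μ v R' :=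
  ⟨hs.pκ, hs.pμ, hs.hv, hs.supp.mono fun _ hy => hy.trans h, hs.nz, hs.char⟩

lemma big_step {N N2 A : ℕ} (hN : 635 ≤ N) (hA : 0 < A) (hok : okN (sBig N) N N2 A = true) (κ μ : Measure ℝ) (τ : ℝ)
    (hs : IsSJ κ μ 1 τ) (h1 : (N2:ℝ) / 1000 ≤ τ) (h2 : τ ≤ (N:ℝ) / 1000) : ∫ u, |qf μ u - qf gam u| ∂unif ≤ τ / 2 := by
  have hs' := hs.enlarge h2
  refine (step_ok hA hs' (S_big hN hs') hok).trans (by linarith)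

lemma small_step {N N2 A : ℕ} (hN : 0 < N) (hN2 : N ≤ 620) (hA : 0 < A) (hok : okN (sSmall N) N N2 A = true) (κ μ : Measure ℝ) (τ : ℝ)
    (hs : IsSJ κ μ 1 τ) (h1 : (N2:ℝ) / 1000 ≤ τ) (h2 : τ ≤ (N:ℝ) / 1000) : ∫ u, |qf μ u - qf gam u| ∂unif ≤ τ / 2 := by
  have hs' := hs.enlarge h2
  refine (step_ok hA hs' (S_small hN hN2 hs') hok).trans (by linarith)

end SJ

namespace SJ

/-- recursive check of the chain, large tau -/
def chainB : ℕ → List (ℕ × ℕ) → Bool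
  | _, [] => true
  | N, (N2, A) :: l => (Nat.ble 635 N && Nat.ble 1 A && okN (sBig N) N N2 A) && chainB N2 l

/-- recursive check of the chain, small tau -/
def chainS : ℕ → List (ℕ × ℕ) → Bool
  | _, [] => true
  | N, (N2, A) :: l => (Nat.ble 1 N && Nat.ble N 620 && Nat.ble 1 A && okN (sSmall N) N N2 A) && chainS N2 l

/-- last element of the chain -/
def chainE : ℕ → List (ℕ × ℕ) → ℕ
  | N, [] => N
  | _, (N2, _) :: l => chainE N2 l

lemma chainB_ok (l : List (ℕ × ℕ)) (N : ℕ) (h : chainB N l = true) (κ μ : Measure ℝ) (τ : ℝ)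
    (hs : IsSJ κ μ 1 τ) (h1 : (chainE N l : ℝ) / 1000 ≤ τ) (h2 : τ ≤ (N:ℝ) / 1000) (hne : (chainE N l : ℝ) / 1000 < τ) :
    ∫ u, |qf μ u - qf gam u| ∂unif ≤ τ / 2 := by
  induction l generalizing N with
  | nil => exact absurd h2 (not_le.2 hne)
  | cons a l ih =>
    obtain ⟨N2, A⟩ := a
    simp only [chainB, Bool.and_eq_true] at h
    simp only [chainE] at h1 hne
    rcases le_total ((N2:ℝ) / 1000) τ with hc | hc
    · exact big_step (Nat.le_of_ble_eq_true h.1.1.1) (Nat.le_of_ble_eq_true h.1.1.2) h.1.2 κ μ τ hs hc h2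
    · exact ih N2 h.2 h1 hc hne

lemma chainS_ok (l : List (ℕ × ℕ)) (N : ℕ) (h : chainS N l = true) (κ μ : Measure ℝ) (τ : ℝ)
    (hs : IsSJ κ μ 1 τ) (h1 : (chainE N l : ℝ) / 1000 ≤ τ) (h2 : τ ≤ (N:ℝ) / 1000) (hne : (chainE N l : ℝ) / 1000 < τ) :
    ∫ u, |qf μ u - qf gam u| ∂unif ≤ τ / 2 := by
  induction l generalizing N with
  | nil => exact absurd h2 (not_le.2 hne)
  | cons a l ih =>
    obtain ⟨N2, A⟩ := a
    simp only [chainS, Bool.and_eq_true] at h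
    simp only [chainE] at h1 hne
    rcases le_total ((N2:ℝ) / 1000) τ with hc | hc
    · exact small_step (Nat.le_of_ble_eq_true h.1.1.1.1) (Nat.le_of_ble_eq_true h.1.1.1.2) (Nat.le_of_ble_eq_true h.1.1.2) h.1.2 κ μ τ hs hc h2
    · exact ih N2 h.2 h1 hc hne

set_option maxRecDepth 100000 in
lemma chk0 : chainB 4000 [(3614, 41), (3310, 40), (3064, 40), (2860, 39), (2686, 39), (2536, 39)] = true := by decide +kernel

set_option maxRecDepth 100000 in
lemma chk1 : chainB 2536 [(2403, 39), (2286, 39), (2180, 39), (2085, 39), (1997, 39), (1914, 39)] = true := by decide +kernel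

set_option maxRecDepth 100000 in
lemma chk2 : chainB 1914 [(1838, 39), (1771, 39), (1713, 39), (1662, 40), (1617, 40), (1576, 40)] = true := by decide +kernel

set_option maxRecDepth 100000 in
lemma chk3 : chainB 1576 [(1536, 40), (1499, 40), (1461, 40), (1424, 40), (1387, 40), (1349, 40)] = true := by decide +kernel

set_option maxRecDepth 100000 in
lemma chk4 : chainB 1349 [(1309, 40), (1266, 41), (1221, 41), (1172, 41), (1119, 41), (1061, 42)] = true := by decide +kernel

set_option maxRecDepth 100000 in
lemma chk5 : chainB 1061 [(997, 43), (928, 43), (855, 44), (780, 44), (706, 45), (635, 47)] = true := by decide +kernel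

set_option maxRecDepth 100000 in
lemma chk6 : chainB 635 [(570, 48)] = true := by decide +kernel

set_option maxRecDepth 100000 in
lemma chk7 : chainS 570 [(513, 48), (463, 50), (421, 50), (385, 51), (355, 51), (329, 54)] = true := by decide +kernel

set_option maxRecDepth 100000 in
lemma chk8 : chainS 329 [(308, 53), (290, 54), (275, 54), (262, 55), (251, 56)] = true := by decide +kernel

lemma mid_range (κ μ : Measure ℝ) (τ : ℝ) (hs : IsSJ κ μ 1 τ) (h1 : 251 / 1000 < τ) (h2 : τ ≤ 4) :
    ∫ u, |qf μ u - qf gam u| ∂unif ≤ τ / 2 := by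
  rcases lt_or_ge (2536 / 1000 : ℝ) τ with h | h0
  · exact chainB_ok _ _ chk0 κ μ τ hs (by simp [chainE]; linarith) (by norm_num; linarith) (by simp [chainE]; linarith)
  rcases lt_or_ge (1914 / 1000 : ℝ) τ with h | h1
  · exact chainB_ok _ _ chk1 κ μ τ hs (by simp [chainE]; linarith) (by norm_num; linarith) (by simp [chainE]; linarith)
  rcases lt_or_ge (1576 / 1000 : ℝ) τ with h | h2
  · exact chainB_ok _ _ chk2 κ μ τ hs (by simp [chainE]; linarith) (by norm_num; linarith) (by simp [chainE]; linarith)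
  rcases lt_or_ge (1349 / 1000 : ℝ) τ with h | h3
  · exact chainB_ok _ _ chk3 κ μ τ hs (by simp [chainE]; linarith) (by norm_num; linarith) (by simp [chainE]; linarith)
  rcases lt_or_ge (1061 / 1000 : ℝ) τ with h | h4
  · exact chainB_ok _ _ chk4 κ μ τ hs (by simp [chainE]; linarith) (by norm_num; linarith) (by simp [chainE]; linarith)
  rcases lt_or_ge (635 / 1000 : ℝ) τ with h | h5
  · exact chainB_ok _ _ chk5 κ μ τ hs (by simp [chainE]; linarith) (by norm_num; linarith) (by simp [chainE]; linarith)
  rcases lt_or_ge (570 / 1000 : ℝ) τ with h | h6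
  · exact chainB_ok _ _ chk6 κ μ τ hs (by simp [chainE]; linarith) (by norm_num; linarith) (by simp [chainE]; linarith)
  rcases lt_or_ge (329 / 1000 : ℝ) τ with h | h7
  · exact chainS_ok _ _ chk7 κ μ τ hs (by simp [chainE]; linarith) (by norm_num; linarith) (by simp [chainE]; linarith)
  rcases lt_or_ge (251 / 1000 : ℝ) τ with h | h8
  · exact chainS_ok _ _ chk8 κ μ τ hs (by simp [chainE]; linarith) (by norm_num; linarith) (by simp [chainE]; linarith)
  linarith

end SJ

namespace SJ

/-- standard normal density -/
noncomputable def ph (w : ℝ) : ℝ := gaussianPDFReal 0 1 w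
/-- standard normal upper tail -/
noncomputable def Qg (w : ℝ) : ℝ := 1 - cdf gam w

lemma ph_pos (w : ℝ) : 0 < ph w := gaussianPDFReal_pos 0 1 w (by norm_num)
lemma ph_neg (w : ℝ) : ph (-w) = ph w := by simp [ph, pdf_eq]
lemma ph_der (w : ℝ) : HasDerivAt ph (-w * ph w) w := hasDerivAt_pdf w
lemma ph_cont : Continuous ph := continuous_iff_continuousAt.2 fun w => (ph_der w).continuousAt
lemma ph_tend : Filter.Tendsto ph Filter.atTop (nhds 0) := by
  have := (exp_neg_sq_tendsto (c := 1/2) (by norm_num)).const_mul ((√(2 * Real.pi))⁻¹)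
  rw [mul_zero] at this
  refine this.congr fun w => ?_
  rw [ph, pdf_eq]; congr 2; ring

lemma Qg_nonneg (w : ℝ) : 0 ≤ Qg w := sub_nonneg.2 (cdf_le_one gam w)
lemma Qg_le (w : ℝ) : Qg w ≤ 1 := by have := cdf_nonneg gam w; unfold Qg; linarith

lemma cdf_gam_diff (a b : ℝ) : cdf gam b - cdf gam a = ∫ y in a..b, ph y := by
  have hi : Integrable ph := integrable_gaussianPDFReal 0 1
  have e : ∀ x, cdf gam x = ∫ y in Set.Iic x, ph y := by
    intro x
    rw [cdf_eq_real, Measure.real, gaussianReal_apply_eq_integral 0 one_ne_zero, ENNReal.toReal_ofReal]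
    · rfl
    · exact integral_nonneg fun y => (ph_pos y).le
  rw [e, e, intervalIntegral.integral_Iic_sub_Iic hi.integrableOn hi.integrableOn]

lemma Qg_der (w : ℝ) : HasDerivAt Qg (-ph w) w := by
  have h1 : HasDerivAt (fun x => ∫ y in (0:ℝ)..x, ph y) (ph w) w :=
    intervalIntegral.integral_hasDerivAt_right (ph_cont.intervalIntegrable _ _)
      (ph_cont.stronglyMeasurableAtFilter _ _) ph_cont.continuousAt
  have h2 := h1.const_sub (1 - cdf gam 0)
  refine h2.congr_of_eventuallyEq (Filter.Eventually.of_forall fun x => ?_)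
  show Qg x = 1 - cdf gam 0 - ∫ y in (0:ℝ)..x, ph y
  rw [← cdf_gam_diff, Qg]; ring

lemma Qg_cont : Continuous Qg := continuous_iff_continuousAt.2 fun w => (Qg_der w).continuousAt

lemma Qg_tend : Filter.Tendsto Qg Filter.atTop (nhds 0) := by
  have := (tendsto_cdf_atTop gam).const_sub 1
  rwa [sub_self] at this

lemma Qg_neg (w : ℝ) : Qg (-w) = 1 - Qg w := by
  unfold Qg
  have hm : (gaussianReal 0 1).map (fun x : ℝ => -x) = gaussianReal 0 1 := by
    rw [gaussianReal_map_neg, neg_zero]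
  have : NullSingletonClass (gaussianReal 0 1) := nullSingletonClass_gaussianReal one_ne_zero
  have h1 : cdf gam (-w) = gam.real (Set.Ioi w) := by
    rw [cdf_eq_real, Measure.real, Measure.real]
    congr 1
    show (gaussianReal 0 1) _ = (gaussianReal 0 1) _
    conv_lhs => rw [← hm]
    rw [Measure.map_apply (by fun_prop) measurableSet_Iic]
    have : (fun x : ℝ => -x) ⁻¹' (Set.Iic (-w)) = Set.Ici w := by ext; simp
    rw [this]
    exact measure_congr Ioi_ae_eq_Ici.symm
  have h2 : gam.real (Set.Ioi w) = 1 - cdf gam w := by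
    rw [cdf_eq_real, ← Set.compl_Iic, probReal_compl_eq_one_sub measurableSet_Iic]
  rw [h1, h2]

lemma mills_lb (w : ℝ) : w * ph w ≤ (1 + w ^ 2) * Qg w := by
  set R : ℝ → ℝ := fun w => Qg w - w * ph w / (1 + w ^ 2) with hR
  have hp : ∀ y : ℝ, 0 < 1 + y ^ 2 := fun y => by positivity
  have hd : ∀ y, HasDerivAt R (-(2 * ph y / (1 + y ^ 2) ^ 2)) y := by
    intro y
    have h1 := ((hasDerivAt_id y).mul (ph_der y)).div (((hasDerivAt_id y).pow 2).const_add 1) (hp y).ne'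
    have h2 := (Qg_der y).sub h1
    refine (h2.congr_deriv ?_)
    simp only [id, Pi.mul_apply, Pi.pow_apply]
    have := (hp y).ne'
    field_simp
    push_cast
    ring
  have ha : Antitone R := antitone_of_hasDerivAt_nonpos hd fun y => by
    have := ph_pos y
    have : 0 ≤ 2 * ph y / (1 + y ^ 2) ^ 2 := by positivity
    simpa using this
  have ht : Filter.Tendsto R Filter.atTop (nhds 0) := by
    have h1 : Filter.Tendsto (fun w => w * ph w / (1 + w ^ 2)) Filter.atTop (nhds 0) := by
      refine squeeze_zero' (g := ph) ?_ ?_ ph_tend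
      · filter_upwards [Filter.eventually_ge_atTop 0] with y hy
        have := ph_pos y
        positivity
      · refine Filter.Eventually.of_forall fun y => ?_
        rw [div_le_iff₀ (hp y)]
        nlinarith [ph_pos y, sq_nonneg (y - 1), sq_nonneg y]
    simpa using Qg_tend.sub h1
  have h := ha.le_of_tendsto ht w
  simp only [hR] at h
  have h2 : w * ph w / (1 + w ^ 2) ≤ Qg w := by linarith
  rw [div_le_iff₀ (hp w)] at h2
  linarith

lemma mills_ub {w : ℝ} (hw : 0 ≤ w) : w * Qg w ≤ ph w := by
  have h1 : ∫⁻ x in Set.Ioi w, ENNReal.ofReal (ph x) = ENNReal.ofReal (0 - (- Qg w)) :=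
    lint_Ioi (F := fun y => - Qg y) Qg_cont.neg.continuousAt.continuousWithinAt
      (fun x _ => (Qg_der x).neg.congr_deriv (by ring)) (fun x _ => (ph_pos x).le) (by simpa using Qg_tend.neg)
  have h2 : ∫⁻ x in Set.Ioi w, ENNReal.ofReal (x * ph x) = ENNReal.ofReal (0 - (- ph w)) :=
    lint_Ioi (F := fun y => - ph y) ph_cont.neg.continuousAt.continuousWithinAt
      (fun x _ => (ph_der x).neg.congr_deriv (by ring)) (fun x hx => mul_nonneg (hw.trans (le_of_lt hx)) (ph_pos x).le) (by simpa using ph_tend.neg)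
  have h3 : ENNReal.ofReal w * ∫⁻ x in Set.Ioi w, ENNReal.ofReal (ph x) ≤ ∫⁻ x in Set.Ioi w, ENNReal.ofReal (x * ph x) := by
    rw [← lintegral_const_mul' _ _ (by simp)]
    refine setLIntegral_mono' measurableSet_Ioi fun x hx => ?_
    rw [← ENNReal.ofReal_mul hw]
    exact ENNReal.ofReal_le_ofReal (mul_le_mul_of_nonneg_right (le_of_lt hx) (ph_pos x).le)
  rw [h1, h2, ← ENNReal.ofReal_mul hw, ENNReal.ofReal_le_ofReal_iff (by have := ph_pos w; linarith)] at h3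
  linarith

/-- integrated tail -/
noncomputable def Jg (a : ℝ) : ℝ := ph a - a * Qg a

lemma Jg_lint (a : ℝ) : ∫⁻ x in Set.Ioi a, ENNReal.ofReal (Qg x) = ENNReal.ofReal (Jg a) := by
  have hd : ∀ x, HasDerivAt (fun y => - Jg y) (Qg x) x := by
    intro x
    have := ((ph_der x).sub ((hasDerivAt_id x).mul (Qg_der x))).neg
    refine this.congr_deriv ?_
    simp only [id]
    ring
  have ht : Filter.Tendsto (fun y => - Jg y) Filter.atTop (nhds 0) := by
    have : Filter.Tendsto Jg Filter.atTop (nhds 0) := by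
      refine squeeze_zero' (g := ph) ?_ ?_ ph_tend
      · filter_upwards [Filter.eventually_ge_atTop 0] with y hy
        have := mills_ub hy
        unfold Jg; linarith
      · filter_upwards [Filter.eventually_ge_atTop 0] with y hy
        have := mul_nonneg hy (Qg_nonneg y)
        unfold Jg; linarith
    simpa using this.neg
  rw [lint_Ioi (F := fun y => - Jg y) (hd a).continuousAt.continuousWithinAt (fun x _ => hd x) (fun x _ => Qg_nonneg x) ht]
  congr 1; ring

lemma Jg_lint' (b : ℝ) : ∫⁻ x in Set.Iio b, ENNReal.ofReal (1 - Qg x) = ENNReal.ofReal (Jg (-b)) := by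
  rw [← Jg_lint]
  have h := (Measure.measurePreserving_neg (volume : Measure ℝ)).setLIntegral_comp_preimage
    (measurableSet_Ioi (a := -b)) (f := fun x => ENNReal.ofReal (Qg x)) Qg_cont.measurable.ennreal_ofReal
  rw [← h]
  have : (Neg.neg : ℝ → ℝ) ⁻¹' (Set.Ioi (-b)) = Set.Iio b := by ext; simp
  rw [this]
  simp_rw [Qg_neg]

lemma Jg_le (A : ℝ) (hA : 0 ≤ A) : Jg A ≤ ph A / (1 + A ^ 2) := by
  rw [le_div_iff₀ (by positivity)]
  have := mills_lb A
  unfold Jg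
  nlinarith

lemma Jg_nonneg (a : ℝ) : 0 ≤ Jg a := by
  rcases le_total 0 a with h | h
  · have := mills_ub h; unfold Jg; linarith
  · have := mul_nonneg (neg_nonneg.2 h) (Qg_nonneg a)
    have := ph_pos a
    unfold Jg; nlinarith

/-- Mills ratio -/
noncomputable def Mi (w : ℝ) : ℝ := Qg w / ph w
/-- derivative of `w * Mi w` -/
noncomputable def Li (w : ℝ) : ℝ := (1 + w ^ 2) * Mi w - w

lemma Mi_der (w : ℝ) : HasDerivAt Mi (w * Mi w - 1) w := by
  have := (Qg_der w).div (ph_der w) (ph_pos w).ne'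
  refine this.congr_deriv ?_
  have := (ph_pos w).ne'
  unfold Mi; field_simp; ring
lemma Mi_cont : Continuous Mi := continuous_iff_continuousAt.2 fun w => (Mi_der w).continuousAt
lemma Li_cont : Continuous Li := by have := Mi_cont; unfold Li; fun_prop
lemma Mi_nonneg (w : ℝ) : 0 ≤ Mi w := div_nonneg (Qg_nonneg w) (ph_pos w).le
lemma Li_nonneg (w : ℝ) : 0 ≤ Li w := by
  have := mills_lb w
  unfold Li Mi
  rw [sub_nonneg, ← mul_div_assoc, le_div_iff₀ (ph_pos w)]
  exact this
lemma wMi_le {w : ℝ} (hw : 0 ≤ w) : w * Mi w ≤ 1 := by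
  unfold Mi
  rw [← mul_div_assoc, div_le_one (ph_pos w)]
  exact mills_ub hw

lemma wMi_der (w : ℝ) : HasDerivAt (fun w => w * Mi w) (Li w) w := by
  refine ((hasDerivAt_id w).mul (Mi_der w)).congr_deriv ?_
  unfold Li; simp only [id]; ring
lemma wMin_der (w : ℝ) : HasDerivAt (fun w => w * Mi (-w)) (Li (-w)) w := by
  have h1 : HasDerivAt (fun w => Mi (-w)) (-(-w * Mi (-w) - 1)) w := by
    exact ((Mi_der (-w)).comp w (hasDerivAt_neg w)).congr_deriv (by ring)
  refine ((hasDerivAt_id w).mul h1).congr_deriv ?_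
  unfold Li; simp only [id]; ring

lemma LJ (w : ℝ) : Li (-w) * Jg w + Li w * Jg (-w) = 1 := by
  have := (ph_pos w).ne'
  unfold Li Jg Mi
  rw [Qg_neg, ph_neg]
  field_simp
  ring

lemma LL (w : ℝ) : Li (-w) + Li w = (1 + w ^ 2) / ph w := by
  have := (ph_pos w).ne'
  unfold Li Mi
  rw [Qg_neg, ph_neg]
  field_simp
  ring

end SJ

namespace SJ

noncomputable def fst (x w : ℝ) : ℝ := if w ≤ x then Mi (-w) * Qg x else Mi w * (1 - Qg x)
noncomputable def kst (x w : ℝ) : ℝ := if w ≤ x then w * Mi (-w) * Qg x else w * Mi w * (1 - Qg x)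
noncomputable def Kst (x w : ℝ) : ℝ := if w ≤ x then Li (-w) * Qg x else Li w * (1 - Qg x)
noncomputable def dst (x w : ℝ) : ℝ := kst x w + ((if w ≤ x then 1 else 0) - (1 - Qg x))

lemma kst_eq (x w : ℝ) : kst x w = w * fst x w := by
  unfold kst fst; split_ifs <;> ring

lemma Kst_meas : Measurable (fun z : ℝ × ℝ => Kst z.1 z.2) := by
  unfold Kst
  have := Li_cont.measurable
  have := Qg_cont.measurable
  exact Measurable.ite (measurableSet_le (by fun_prop) (by fun_prop)) (by fun_prop) (by fun_prop)

lemma kst_meas (x : ℝ) : Measurable (kst x) := by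
  unfold kst
  have := Mi_cont.measurable
  exact Measurable.ite (measurableSet_le (by fun_prop) (by fun_prop)) (by fun_prop) (by fun_prop)

lemma dst_meas (x : ℝ) : Measurable (dst x) := by
  unfold dst
  refine (kst_meas x).add (Measurable.sub ?_ measurable_const)
  exact Measurable.ite (measurableSet_le (by fun_prop) (by fun_prop)) (by fun_prop) (by fun_prop)

lemma one_sub_Qg (x : ℝ) : 0 ≤ 1 - Qg x := sub_nonneg.2 (Qg_le x)

/-- the two branches agree at the junction -/
lemma k_junc (x : ℝ) : x * Mi (-x) * Qg x = x * Mi x * (1 - Qg x) := by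
  unfold Mi; rw [Qg_neg, ph_neg]; ring

lemma f_junc (x : ℝ) : Mi (-x) * Qg x = Mi x * (1 - Qg x) := by
  unfold Mi; rw [Qg_neg, ph_neg]; ring

lemma piece {F F' : ℝ → ℝ} (hd : ∀ w, HasDerivAt F (F' w) w) (hc : Continuous F') (hp : ∀ w, 0 ≤ F' w) {a b : ℝ} (hab : a ≤ b) :
    ∫⁻ w in Set.Ico a b, ENNReal.ofReal (F' w) = ENNReal.ofReal (F b - F a) := by
  rw [← intervalIntegral.integral_eq_sub_of_hasDerivAt (fun w _ => hd w) (hc.intervalIntegrable a b),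
    intervalIntegral.integral_of_le hab, ofReal_integral_eq_lintegral_ofReal
    ((hc.intervalIntegrable a b).1) (Filter.Eventually.of_forall hp)]
  exact setLIntegral_congr Ico_ae_eq_Ioc

lemma kst_diff (x : ℝ) {a b : ℝ} (hab : a ≤ b) :
    kst x a ≤ kst x b ∧ ENNReal.ofReal (kst x b - kst x a) ≤ ∫⁻ w in Set.Ico a b, ENNReal.ofReal (Kst x w) := by
  have hQ := Qg_nonneg x
  have hP := one_sub_Qg x
  have pL : ∀ {a b : ℝ}, a ≤ b → b ≤ x → kst x a ≤ kst x b ∧ ∫⁻ w in Set.Ico a b, ENNReal.ofReal (Kst x w) = ENNReal.ofReal (kst x b - kst x a) := by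
    intro a b hab hb
    have ea : kst x a = a * Mi (-a) * Qg x := by rw [kst, if_pos (hab.trans hb)]
    have eb : kst x b = b * Mi (-b) * Qg x := by rw [kst, if_pos hb]
    rw [ea, eb]
    constructor
    · refine mul_le_mul_of_nonneg_right ?_ hQ
      exact monotone_of_hasDerivAt_nonneg (f := fun w => w * Mi (-w)) wMin_der (fun w => Li_nonneg _) hab
    · rw [← piece (F := fun w => w * Mi (-w) * Qg x) (F' := fun w => Li (-w) * Qg x) (fun w => (wMin_der w).mul_const _)
        (by have := Li_cont; fun_prop) (fun w => mul_nonneg (Li_nonneg _) hQ) hab]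
      refine setLIntegral_congr_fun measurableSet_Ico fun w hw => ?_
      show ENNReal.ofReal (Kst x w) = _
      rw [Kst, if_pos (hw.2.le.trans hb)]
  have pR : ∀ {a b : ℝ}, a ≤ b → x ≤ a → kst x a ≤ kst x b ∧ ∫⁻ w in Set.Ico a b, ENNReal.ofReal (Kst x w) = ENNReal.ofReal (kst x b - kst x a) := by
    intro a b hab ha
    have e : ∀ c, x ≤ c → kst x c = c * Mi c * (1 - Qg x) := by
      intro c hc
      rcases hc.eq_or_lt with h | h
      · rw [kst, if_pos h.ge, ← h, k_junc]
      · rw [kst, if_neg (not_le.2 h)]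
    rw [e a ha, e b (ha.trans hab)]
    constructor
    · refine mul_le_mul_of_nonneg_right ?_ hP
      exact monotone_of_hasDerivAt_nonneg (f := fun w => w * Mi w) wMi_der (fun w => Li_nonneg _) hab
    · rw [← piece (F := fun w => w * Mi w * (1 - Qg x)) (F' := fun w => Li w * (1 - Qg x)) (fun w => (wMi_der w).mul_const _)
        (by have := Li_cont; fun_prop) (fun w => mul_nonneg (Li_nonneg _) hP) hab]
      rw [setLIntegral_congr (Ioo_ae_eq_Ico (a := a) (b := b)).symm, setLIntegral_congr (Ioo_ae_eq_Ico (a := a) (b := b)).symm]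
      refine setLIntegral_congr_fun measurableSet_Ioo fun w hw => ?_
      show ENNReal.ofReal (Kst x w) = _
      rw [Kst, if_neg (not_le.2 (ha.trans_lt hw.1))]
  rcases le_total b x with hb | hb
  · exact ⟨(pL hab hb).1, (pL hab hb).2.ge⟩
  rcases le_total x a with ha | ha
  · exact ⟨(pR hab ha).1, (pR hab ha).2.ge⟩
  have h1 := pL ha le_rfl
  have h2 := pR hb le_rfl
  refine ⟨h1.1.trans h2.1, ?_⟩
  rw [← Set.Ico_union_Ico_eq_Ico ha hb, lintegral_union measurableSet_Ico (by
    rw [Set.disjoint_left]; intro z hz hz2; exact absurd hz.2 (not_lt.2 hz2.1)), h1.2, h2.2,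
    ← ENNReal.ofReal_add (by linarith [h1.1]) (by linarith [h2.1])]
  apply ENNReal.ofReal_le_ofReal; linarith

lemma kst_abs (x w : ℝ) : |kst x w| ≤ 1 := by
  rw [abs_le]
  constructor
  · have h := (kst_diff x (a := min w (min x 0)) (b := w) (min_le_left _ _)).1
    refine le_trans ?_ h
    set c := min w (min x 0)
    have hc0 : c ≤ 0 := (min_le_right _ _).trans (min_le_right _ _)
    have hcx : c ≤ x := (min_le_right _ _).trans (min_le_left _ _)
    rw [kst, if_pos hcx]
    have h1 := wMi_le (neg_nonneg.2 hc0)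
    have h3 := mul_nonneg (neg_nonneg.2 hc0) (Mi_nonneg (-c))
    nlinarith [Qg_nonneg x, Qg_le x]
  · have h := (kst_diff x (a := w) (b := max w (max (x + 1) 0)) (le_max_left _ _)).1
    refine le_trans h ?_
    set c := max w (max (x + 1) 0)
    have hc0 : 0 ≤ c := (le_max_right _ _).trans (le_max_right _ _)
    have hcx : x + 1 ≤ c := (le_max_left _ _).trans (le_max_right _ _)
    rw [kst, if_neg (by linarith)]
    have h1 := wMi_le hc0
    have h3 := mul_nonneg hc0 (Mi_nonneg c)
    nlinarith [Qg_nonneg x, Qg_le x]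

lemma dst_abs (x w : ℝ) : |dst x w| ≤ 3 := by
  have h := abs_le.1 (kst_abs x w)
  have h1 := Qg_nonneg x
  have h2 := Qg_le x
  unfold dst
  rw [abs_le]
  split_ifs <;> constructor <;> linarith [h.1, h.2]

lemma fst_cont (x : ℝ) : Continuous (fst x) := by
  unfold fst
  have := Mi_cont
  refine Continuous.if_le (by fun_prop) (by fun_prop) continuous_id continuous_const ?_
  intro w hw
  subst hw
  exact f_junc w

lemma fst_ftc (x a b : ℝ) : ∫ w in a..b, dst x w = fst x b - fst x a := by
  refine MeasureTheory.integral_eq_of_hasDerivAt_off_countable (fst x) (dst x) (Set.countable_singleton x) (fst_cont x).continuousOn ?_ ?_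
  · intro w hw
    have hne : w ≠ x := by simpa using hw.2
    rcases lt_or_gt_of_ne hne with h | h
    · have h1 : HasDerivAt (fun w => Mi (-w) * Qg x) (-(-w * Mi (-w) - 1) * Qg x) w :=
        (((Mi_der (-w)).comp w (hasDerivAt_neg w)).congr_deriv (by ring)).mul_const _
      refine (h1.congr_of_eventuallyEq ?_).congr_deriv ?_
      · filter_upwards [gt_mem_nhds h] with y hy
        rw [fst, if_pos hy.le]
      · rw [dst, kst, if_pos h.le, if_pos h.le]; ring
    · have h1 : HasDerivAt (fun w => Mi w * (1 - Qg x)) ((w * Mi w - 1) * (1 - Qg x)) w :=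
        (Mi_der w).mul_const _
      refine (h1.congr_of_eventuallyEq ?_).congr_deriv ?_
      · filter_upwards [lt_mem_nhds h] with y hy
        rw [fst, if_neg (not_le.2 hy)]
      · rw [dst, kst, if_neg (not_le.2 h), if_neg (not_le.2 h)]; ring
  · rw [intervalIntegrable_iff]
    have : IsFiniteMeasure ((volume : Measure ℝ).restrict (Set.uIoc a b)) := ⟨by simp [Set.uIoc]⟩
    refine Integrable.of_bound (dst_meas x).aestronglyMeasurable 3 (Filter.Eventually.of_forall fun w => dst_abs x w)

lemma IsSJ.stein (hs : IsSJ κ μ 1 R) (x : ℝ) :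
    Dc μ x = (∫ w, dst x w ∂μ) - ∫ w, dst x w ∂(xi κ μ) := by
  have := hs.pμ
  have := hs.pκ
  have := hs.xi_prob
  have h1 := hs.zb_integral (fun z => (dst x z : ℂ)) (Complex.measurable_ofReal.comp (dst_meas x)) 3 (fun z => by simpa using dst_abs x z)
  rw [hs.zb_eq, integral_smul_measure, ENNReal.toReal_ofReal zero_le_one, integral_complex_ofReal, one_smul] at h1
  have e : ∀ y : ℝ, (y:ℂ) * ∫ z in (0:ℝ)..y, (dst x z : ℂ) = ((kst x y - y * fst x 0 : ℝ) : ℂ) := by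
    intro y
    rw [intervalIntegral.integral_ofReal, fst_ftc, kst_eq]
    push_cast; ring
  simp_rw [e] at h1
  rw [integral_complex_ofReal] at h1
  have h1' : ∫ w, dst x w ∂(xi κ μ) = ∫ y, (kst x y - y * fst x 0) ∂μ := by exact_mod_cast h1
  have hk : Integrable (kst x) μ := Integrable.of_bound (kst_meas x).aestronglyMeasurable 1 (Filter.Eventually.of_forall fun w => kst_abs x w)
  have hid : Integrable (fun y : ℝ => y * fst x 0) μ := hs.int_id.mul_const _
  rw [h1', integral_sub hk hid, integral_mul_const, hs.mean, zero_mul, sub_zero]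
  have hind : Integrable (fun w : ℝ => (if w ≤ x then (1:ℝ) else 0)) μ :=
    Integrable.of_bound (Measurable.ite (measurableSet_le (by fun_prop) (by fun_prop)) (by fun_prop) (by fun_prop)).aestronglyMeasurable 1
      (Filter.Eventually.of_forall fun w => by split_ifs <;> simp)
  have h2 : ∫ w, dst x w ∂μ = (∫ w, kst x w ∂μ) + ((∫ w, (if w ≤ x then (1:ℝ) else 0) ∂μ) - (1 - Qg x)) := by
    unfold dst
    have hc : Integrable (fun w : ℝ => (if w ≤ x then (1:ℝ) else 0) - (1 - Qg x)) μ := hind.sub (integrable_const _)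
    rw [integral_add hk hc, integral_sub hind (integrable_const _)]
    simp
  have h3 : ∫ w, (if w ≤ x then (1:ℝ) else 0) ∂μ = cdf μ x := by
    have : (fun w : ℝ => (if w ≤ x then (1:ℝ) else 0)) = (Set.Iic x).indicator 1 := by
      funext w; simp [Set.indicator]
    rw [this, integral_indicator_one measurableSet_Iic, cdf_eq_real]
  rw [h2, h3, Dc, Qg]; ring

lemma dst_diff (x a b : ℝ) : ENNReal.ofReal |dst x a - dst x b| ≤
    (∫⁻ w, ENNReal.ofReal |stp (a, b) w| * ENNReal.ofReal (Kst x w)) + ENNReal.ofReal |stp (a, b) x| := by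
  have h1 : dst x a - dst x b = (kst x a - kst x b) + stp (a, b) x := by
    unfold dst stp; simp only; ring
  rw [h1]
  refine (ENNReal.ofReal_le_ofReal (abs_add_le _ _)).trans (ENNReal.ofReal_add_le.trans ?_)
  gcongr
  have h2 : (fun w => ENNReal.ofReal |stp (a, b) w| * ENNReal.ofReal (Kst x w)) =
      (Set.Ico (min a b) (max a b)).indicator (fun w => ENNReal.ofReal (Kst x w)) := by
    funext w
    rw [stp_abs]
    by_cases hw : w ∈ Set.Ico (min a b) (max a b)
    · simp only [Set.indicator_of_mem hw]; simp
    · simp only [Set.indicator_of_notMem hw]; simp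
  rw [h2, lintegral_indicator measurableSet_Ico]
  rcases le_total a b with h | h
  · rw [min_eq_left h, max_eq_right h, abs_sub_comm, abs_of_nonneg (sub_nonneg.2 (kst_diff x h).1)]
    exact (kst_diff x h).2
  · rw [min_eq_right h, max_eq_left h, abs_of_nonneg (sub_nonneg.2 (kst_diff x h).1)]
    exact (kst_diff x h).2

end SJ

namespace SJ

/-- the integrated kernel -/
noncomputable def GA (A w : ℝ) : ℝ≥0∞ := ∫⁻ x in outA A, ENNReal.ofReal (Kst x w)

lemma GA_le_one (A w : ℝ) : GA A w ≤ 1 := by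
  have hw1 : ∫⁻ x in Set.Iio w, ENNReal.ofReal (Kst x w) = ENNReal.ofReal (Li w * Jg (-w)) := by
    rw [ENNReal.ofReal_mul (Li_nonneg w), ← Jg_lint', ← lintegral_const_mul' _ _ (by simp)]
    refine setLIntegral_congr_fun measurableSet_Iio fun x hx => ?_
    show ENNReal.ofReal (Kst x w) = _
    rw [Kst, if_neg (not_le.2 hx), ENNReal.ofReal_mul (Li_nonneg w)]
  have hw2 : ∫⁻ x in (Set.Iio w)ᶜ, ENNReal.ofReal (Kst x w) = ENNReal.ofReal (Li (-w) * Jg w) := by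
    rw [ENNReal.ofReal_mul (Li_nonneg _), ← Jg_lint, ← lintegral_const_mul' _ _ (by simp), Set.compl_Iio,
      setLIntegral_congr (Ioi_ae_eq_Ici (a := w)).symm]
    refine setLIntegral_congr_fun measurableSet_Ioi fun x hx => ?_
    show ENNReal.ofReal (Kst x w) = _
    rw [Kst, if_pos (le_of_lt hx), ENNReal.ofReal_mul (Li_nonneg _)]
  unfold GA
  refine (setLIntegral_le_lintegral _ _).trans ?_
  rw [← lintegral_add_compl _ (measurableSet_Iio (a := w)), hw1, hw2, ← ENNReal.ofReal_add
    (mul_nonneg (Li_nonneg _) (Jg_nonneg _)) (mul_nonneg (Li_nonneg _) (Jg_nonneg _)), add_comm, LJ]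
  simp

lemma GA_le {A w : ℝ} (hA : 0 ≤ A) (hw : |w| ≤ A) :
    GA A w ≤ ENNReal.ofReal ((1 + w ^ 2) / (1 + A ^ 2) * Real.exp (-((A ^ 2 - w ^ 2) / 2))) := by
  have hb := abs_le.1 hw
  have hsub : outA A ⊆ Set.Ioi A ∪ Set.Iio (-A) := by
    intro x hx
    have : A < |x| := hx
    rcases lt_abs.1 this with h | h
    · left; exact h
    · right; show x < -A; linarith
  have hw1 : ∫⁻ x in Set.Iio (-A), ENNReal.ofReal (Kst x w) = ENNReal.ofReal (Li w * Jg A) := by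
    have := Jg_lint' (-A)
    rw [neg_neg] at this
    rw [ENNReal.ofReal_mul (Li_nonneg w), ← this, ← lintegral_const_mul' _ _ (by simp)]
    refine setLIntegral_congr_fun measurableSet_Iio fun x hx => ?_
    show ENNReal.ofReal (Kst x w) = _
    rw [Kst, if_neg (not_le.2 (lt_of_lt_of_le hx hb.1)), ENNReal.ofReal_mul (Li_nonneg w)]
  have hw2 : ∫⁻ x in Set.Ioi A, ENNReal.ofReal (Kst x w) = ENNReal.ofReal (Li (-w) * Jg A) := by
    rw [ENNReal.ofReal_mul (Li_nonneg _), ← Jg_lint, ← lintegral_const_mul' _ _ (by simp)]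
    refine setLIntegral_congr_fun measurableSet_Ioi fun x hx => ?_
    show ENNReal.ofReal (Kst x w) = _
    rw [Kst, if_pos (hb.2.trans (le_of_lt hx)), ENNReal.ofReal_mul (Li_nonneg _)]
  unfold GA
  refine (lintegral_mono_set hsub).trans ((lintegral_union_le _ _ _).trans ?_)
  rw [hw1, hw2, ← ENNReal.ofReal_add (mul_nonneg (Li_nonneg _) (Jg_nonneg _)) (mul_nonneg (Li_nonneg _) (Jg_nonneg _)),
    ← add_mul, LL]
  apply ENNReal.ofReal_le_ofReal
  have h1 := Jg_le A hA
  have hp := ph_pos w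
  calc (1 + w ^ 2) / ph w * Jg A ≤ (1 + w ^ 2) / ph w * (ph A / (1 + A ^ 2)) := by gcongr
    _ = (1 + w ^ 2) / (1 + A ^ 2) * (ph A / ph w) := by
      have : 1 + A ^ 2 ≠ 0 := by positivity
      field_simp
    _ = _ := by
      congr 1
      unfold ph
      rw [pdf_eq, pdf_eq, mul_div_mul_left _ _ (by positivity), ← Real.exp_sub]
      congr 1; ring

lemma exp_env : Real.exp (-(4)) ≤ 1 / 54 := by
  rw [Real.exp_neg, inv_le_comm₀ (Real.exp_pos _) (by norm_num)]
  have h := Real.exp_one_gt_d9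
  have e : Real.exp 4 = Real.exp 1 ^ 4 := by rw [← Real.exp_nat_mul]; norm_num
  rw [e]
  have : (2.718:ℝ) ^ 4 ≤ Real.exp 1 ^ 4 := by gcongr; linarith
  norm_num at this ⊢; linarith

/-- polynomial envelope -/
noncomputable def env (w : ℝ) : ℝ := 25 / 10000 + 304 / 10000 * w ^ 4

lemma env_ok (w : ℝ) : GA (57/20) w + (outA (57/20)).indicator 1 w ≤ ENNReal.ofReal (env w) := by
  by_cases hw : w ∈ outA (57/20)
  · rw [Set.indicator_of_mem hw]
    have h1 : (57/20:ℝ) < |w| := hw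
    have h2 : (57/20:ℝ)^4 ≤ w ^ 4 := by
      rw [← Even.pow_abs (by decide : Even 4) w]; gcongr
    calc GA (57/20) w + (1 : ℝ → ℝ≥0∞) w ≤ 1 + 1 := by gcongr; exact GA_le_one _ _; simp
      _ = ENNReal.ofReal 2 := by norm_num
      _ ≤ _ := by
        apply ENNReal.ofReal_le_ofReal
        unfold env; norm_num at h2 ⊢; linarith
  · rw [Set.indicator_of_notMem hw, add_zero]
    have h1 : |w| ≤ 57/20 := not_lt.1 hw
    refine (GA_le (by norm_num) h1).trans (ENNReal.ofReal_le_ofReal ?_)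
    have h2 : w ^ 2 ≤ (57/20:ℝ)^2 := by rw [← sq_abs w]; gcongr
    have h3 : w ^ 4 = (w ^ 2) ^ 2 := by ring
    unfold env
    rw [h3]
    have hs0 : 0 ≤ w ^ 2 := sq_nonneg w
    generalize w ^ 2 = s at *
    norm_num at h2 ⊢
    rcases le_total s 2 with hs | hs
    · have e1 : Real.exp (-((3249 / 400 - s) / 2)) = Real.exp (-4) * Real.exp (-(49/800)) * Real.exp (s / 2) := by
        rw [← Real.exp_add, ← Real.exp_add]; congr 1; ring
      have e2 : Real.exp (s / 2) ≤ 1 + s / 2 + (s / 2) ^ 2 := by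
        have := Real.abs_exp_sub_one_sub_id_le (x := s/2) (by rw [abs_of_nonneg (by linarith)]; linarith)
        have := (abs_le.1 this).2
        linarith
      have e3 : Real.exp (-(49/800)) ≤ 1 := Real.exp_le_one_iff.2 (by norm_num)
      have e4 := exp_env
      have e5 : Real.exp (-((3249 / 400 - s) / 2)) ≤ 1 / 54 * 1 * (1 + s / 2 + (s / 2) ^ 2) := by
        rw [e1]; gcongr
      calc _ ≤ (1 + s) / (3649 / 400) * (1 / 54 * 1 * (1 + s / 2 + (s / 2) ^ 2)) := by gcongr
        _ ≤ _ := by nlinarith [sq_nonneg (s - 1/10), mul_nonneg hs0 (mul_nonneg hs0 (sub_nonneg.2 hs))]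
    · have e1 : Real.exp (-((3249 / 400 - s) / 2)) ≤ 1 / (1 + (3249 / 400 - s) / 2) := by
        rw [Real.exp_neg, one_div]
        apply inv_anti₀ (by linarith)
        linarith [Real.add_one_le_exp ((3249 / 400 - s) / 2)]
      calc _ ≤ (1 + s) / (3649 / 400) * (1 / (1 + (3249 / 400 - s) / 2)) := by gcongr
        _ ≤ _ := by
          rw [mul_one_div, div_le_iff₀ (by linarith), div_le_iff₀ (by norm_num)]
          nlinarith [mul_nonneg (sub_nonneg.2 hs) (sub_nonneg.2 h2), mul_nonneg (mul_nonneg (sub_nonneg.2 hs) (sub_nonneg.2 h2)) hs0]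

lemma env_int (a b : ℝ) : ∫⁻ w, ENNReal.ofReal |stp (a, b) w| * ENNReal.ofReal (env w) ≤
    ENNReal.ofReal (|a - b| * (25 / 10000 + 304 / 10000 * ((a ^ 4 + b ^ 4) / 2))) := by
  have h2 : (fun w => ENNReal.ofReal |stp (a, b) w| * ENNReal.ofReal (env w)) =
      (Set.Ico (min a b) (max a b)).indicator (fun w => ENNReal.ofReal (env w)) := by
    funext w
    rw [stp_abs]
    by_cases hw : w ∈ Set.Ico (min a b) (max a b)
    · simp only [Set.indicator_of_mem hw]; simp
    · simp only [Set.indicator_of_notMem hw]; simp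
  have key : ∀ a b : ℝ, a ≤ b → ∫⁻ w in Set.Ico a b, ENNReal.ofReal (env w) ≤
      ENNReal.ofReal ((b - a) * (25 / 10000 + 304 / 10000 * ((a ^ 4 + b ^ 4) / 2))) := by
    intro a b hab
    rw [piece (F := fun w => 25 / 10000 * w + 304 / 10000 * (w ^ 5 / 5)) (F' := env) (fun w => by
      refine (((hasDerivAt_id w).const_mul _).add ((((hasDerivAt_id w).pow 5).div_const 5).const_mul _)).congr_deriv ?_
      unfold env; simp only [id]; push_cast; ring) (by unfold env; fun_prop) (fun w => by unfold env; positivity) hab]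
    apply ENNReal.ofReal_le_ofReal
    have : (b ^ 5 - a ^ 5) / 5 ≤ (b - a) * ((a ^ 4 + b ^ 4) / 2) := by
      have e : (b - a) * ((a ^ 4 + b ^ 4) / 2) - (b ^ 5 - a ^ 5) / 5 = (b - a) * ((b - a) ^ 2 * (3 * a ^ 2 + 4 * a * b + 3 * b ^ 2) / 10) := by ring
      have : 0 ≤ 3 * a ^ 2 + 4 * a * b + 3 * b ^ 2 := by nlinarith [sq_nonneg (a + b), sq_nonneg a, sq_nonneg b]
      have : 0 ≤ (b - a) * ((b - a) ^ 2 * (3 * a ^ 2 + 4 * a * b + 3 * b ^ 2) / 10) :=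
        mul_nonneg (sub_nonneg.2 hab) (by positivity)
      linarith
    linarith
  rw [h2, lintegral_indicator measurableSet_Ico]
  rcases le_total a b with h | h
  · rw [min_eq_left h, max_eq_right h, abs_sub_comm, abs_of_nonneg (sub_nonneg.2 h)]
    exact key a b h
  · rw [min_eq_right h, max_eq_left h, abs_of_nonneg (sub_nonneg.2 h), add_comm (a ^ 4)]
    exact key b a h

end SJ

namespace SJ

lemma IsSJ.Dc_le (hs : IsSJ κ μ 1 R) (x : ℝ) : ENNReal.ofReal |Dc μ x| ≤
    ∫⁻ z, ENNReal.ofReal |dst x z.1 - dst x (z.1 + z.2.1 * z.2.2)| ∂(μ.prod (unif.prod κ)) := by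
  have := hs.pμ
  have := hs.pκ
  have hPu : IsProbabilityMeasure unif := ⟨by simp [unif]⟩
  have hm1 : Measurable (fun z : ℝ × ℝ × ℝ => dst x z.1) := (dst_meas x).comp measurable_fst
  have hm2 : Measurable (fun z : ℝ × ℝ × ℝ => dst x (z.1 + z.2.1 * z.2.2)) := (dst_meas x).comp (by fun_prop)
  have i1 : Integrable (fun z : ℝ × ℝ × ℝ => dst x z.1) (μ.prod (unif.prod κ)) :=
    Integrable.of_bound hm1.aestronglyMeasurable 3 (Filter.Eventually.of_forall fun w => dst_abs x _)
  have i2 : Integrable (fun z : ℝ × ℝ × ℝ => dst x (z.1 + z.2.1 * z.2.2)) (μ.prod (unif.prod κ)) :=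
    Integrable.of_bound hm2.aestronglyMeasurable 3 (Filter.Eventually.of_forall fun w => dst_abs x _)
  have e : Dc μ x = ∫ z, (dst x z.1 - dst x (z.1 + z.2.1 * z.2.2)) ∂(μ.prod (unif.prod κ)) := by
    rw [integral_sub i1 i2, hs.stein, xi, integral_map (by fun_prop) (dst_meas x).aestronglyMeasurable]
    congr 1
    rw [integral_fun_fst (f := fun w => dst x w)]
    simp
  rw [e]
  have h1 := norm_integral_le_lintegral_norm (fun z : ℝ × ℝ × ℝ => dst x z.1 - dst x (z.1 + z.2.1 * z.2.2)) (μ := μ.prod (unif.prod κ))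
  have h2 := ENNReal.ofReal_le_ofReal h1
  rw [ENNReal.ofReal_toReal] at h2
  · exact h2
  · have := (i1.sub i2).norm.lintegral_lt_top
    exact this.ne

lemma IsSJ.tail_env (hs : IsSJ κ μ 1 R) : ∫⁻ x in outA (57/20), ENNReal.ofReal |Dc μ x| ≤
    ∫⁻ z, (∫⁻ w, ENNReal.ofReal |stp (z.1, z.1 + z.2.1 * z.2.2) w| * ENNReal.ofReal (env w)) ∂(μ.prod (unif.prod κ)) := by
  have := hs.pμ
  have := hs.pκ
  have hPu : IsProbabilityMeasure unif := ⟨by simp [unif]⟩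
  have hst : ∀ {α : Type} [MeasurableSpace α] (f : α → ℝ × ℝ) (g : α → ℝ), Measurable f → Measurable g →
      Measurable fun y => ENNReal.ofReal |stp (f y) (g y)| := by
    intro α _ f g hf hg
    exact (stp_meas.comp (hf.prodMk hg)).abs.ennreal_ofReal
  have h1 : ∫⁻ x in outA (57/20), ENNReal.ofReal |Dc μ x| ≤ ∫⁻ x in outA (57/20), ∫⁻ z, ((∫⁻ w, ENNReal.ofReal |stp (z.1, z.1 + z.2.1 * z.2.2) w| * ENNReal.ofReal (Kst x w)) + ENNReal.ofReal |stp (z.1, z.1 + z.2.1 * z.2.2) x|) ∂(μ.prod (unif.prod κ)) := by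
    refine lintegral_mono fun x => (hs.Dc_le x).trans (lintegral_mono fun z => dst_diff x _ _)
  refine h1.trans ?_
  rw [lintegral_lintegral_swap]
  · refine lintegral_mono fun z => ?_
    have hz : Measurable (fun w => ENNReal.ofReal |stp (z.1, z.1 + z.2.1 * z.2.2) w|) := hst _ (fun w => w) measurable_const measurable_id
    rw [lintegral_add_right _ hz, lintegral_lintegral_swap]
    · have e2 : ∫⁻ x in outA (57/20), ENNReal.ofReal |stp (z.1, z.1 + z.2.1 * z.2.2) x| =
          ∫⁻ w, ENNReal.ofReal |stp (z.1, z.1 + z.2.1 * z.2.2) w| * (outA (57/20)).indicator 1 w := by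
        rw [← lintegral_indicator (outA_meas _)]
        refine lintegral_congr fun w => ?_
        by_cases hw : w ∈ outA (57/20)
        · simp [Set.indicator_of_mem hw]
        · simp [Set.indicator_of_notMem hw]
      have hz2 : Measurable (fun w => ENNReal.ofReal |stp (z.1, z.1 + z.2.1 * z.2.2) w| * (outA (57/20)).indicator 1 w) :=
        hz.mul (measurable_one.indicator (outA_meas _))
      rw [e2, ← lintegral_add_right _ hz2]
      refine lintegral_mono fun w => ?_
      simp only
      rw [lintegral_const_mul' _ _ (by simp), ← mul_add]
      exact mul_le_mul_right (env_ok w) _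
    · refine Measurable.aemeasurable ?_
      refine Measurable.mul (hst _ _ measurable_const measurable_snd) ?_
      exact Kst_meas.ennreal_ofReal
  · refine Measurable.aemeasurable ?_
    refine Measurable.add ?_ ?_
    · refine Measurable.lintegral_prod_right' (f := fun q : (ℝ × ℝ × ℝ × ℝ) × ℝ => ENNReal.ofReal |stp (q.1.2.1, q.1.2.1 + q.1.2.2.1 * q.1.2.2.2) q.2| * ENNReal.ofReal (Kst q.1.1 q.2)) ?_
      refine Measurable.mul (hst _ _ (by fun_prop) (by fun_prop)) ?_
      exact (Kst_meas.comp ((measurable_fst.comp measurable_fst).prodMk measurable_snd)).ennreal_ofReal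
    · exact hst (fun q : ℝ × ℝ × ℝ × ℝ => (q.2.1, q.2.1 + q.2.2.1 * q.2.2.2)) (fun q => q.1) (by fun_prop) (by fun_prop)

lemma poly_bd {x z u τ : ℝ} (hu : 0 ≤ u) (hu1 : u ≤ 1) (hτ : 0 ≤ τ) (hz : |z| ≤ u * τ) :
    |z| * (25 / 10000 + 304 / 10000 * ((x ^ 4 + (x + z) ^ 4) / 2)) ≤
    304 / 10000 * (u * τ + u ^ 2 * τ ^ 2 * (4 / 7)) * x ^ 4 + 304 / 10000 * (u ^ 2 * τ ^ 2 * (7 / 4 + 3 * τ + τ ^ 2)) * x ^ 2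
      + (25 / 10000 * (u * τ) + 304 / 10000 * (u ^ 2 * τ ^ 2 * (τ ^ 2 + τ ^ 3 / 2))) := by
  set y := |z| with hy
  have hy0 : 0 ≤ y := abs_nonneg z
  set t := |x| with ht
  have ht0 : 0 ≤ t := abs_nonneg x
  have h4 : (x + z) ^ 4 ≤ (t + y) ^ 4 := by
    rw [← Even.pow_abs (by decide : Even 4) (x + z)]
    exact pow_le_pow_left₀ (abs_nonneg _) (abs_add_le x z) 4
  have hx4 : x ^ 4 = t ^ 4 := by rw [ht, Even.pow_abs (by decide)]
  have hx2 : x ^ 2 = t ^ 2 := by rw [ht, sq_abs]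
  rw [hx4, hx2]
  have y2 : y ^ 2 ≤ u ^ 2 * τ ^ 2 := by rw [← mul_pow]; exact pow_le_pow_left₀ hy0 hz 2
  have hyτ : y ≤ τ := hz.trans (mul_le_of_le_one_left hτ hu1)
  have y3 : y ^ 3 ≤ u ^ 2 * τ ^ 2 * τ := by
    calc y ^ 3 = y ^ 2 * y := by ring
      _ ≤ _ := by gcongr
  have y4 : y ^ 4 ≤ u ^ 2 * τ ^ 2 * τ ^ 2 := by
    calc y ^ 4 = y ^ 2 * y ^ 2 := by ring
      _ ≤ u ^ 2 * τ ^ 2 * τ ^ 2 := by gcongr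
  have y5 : y ^ 5 ≤ u ^ 2 * τ ^ 2 * τ ^ 3 := by
    calc y ^ 5 = y ^ 2 * y ^ 3 := by ring
      _ ≤ u ^ 2 * τ ^ 2 * τ ^ 3 := by gcongr
  have t3 : 2 * t ^ 3 ≤ 4 / 7 * t ^ 4 + 7 / 4 * t ^ 2 := by nlinarith [mul_nonneg (sq_nonneg t) (sq_nonneg (t - 7/4))]
  have t1 : 2 * t ≤ 1 + t ^ 2 := by nlinarith [sq_nonneg (t - 1)]
  have a1 : y * t ^ 4 ≤ u * τ * t ^ 4 := by gcongr
  have a2 : y ^ 2 * (2 * t ^ 3) ≤ u ^ 2 * τ ^ 2 * (4 / 7 * t ^ 4 + 7 / 4 * t ^ 2) := by gcongr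
  have a3 : y ^ 3 * (3 * t ^ 2) ≤ u ^ 2 * τ ^ 2 * τ * (3 * t ^ 2) := by gcongr
  have a4 : y ^ 4 * (2 * t) ≤ u ^ 2 * τ ^ 2 * τ ^ 2 * (1 + t ^ 2) := by gcongr
  have e : y * ((t ^ 4 + (t + y) ^ 4) / 2) = y * t ^ 4 + y ^ 2 * (2 * t ^ 3) + y ^ 3 * (3 * t ^ 2) + y ^ 4 * (2 * t) + y ^ 5 / 2 := by ring
  have h5 : y * ((t ^ 4 + (x + z) ^ 4) / 2) ≤ y * ((t ^ 4 + (t + y) ^ 4) / 2) := by gcongr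
  linarith

lemma IsSJ.small_tail (hs : IsSJ κ μ 1 τ) (hτ0 : 0 < τ) (hτ : τ ≤ 251 / 1000) :
    ∫⁻ x in outA (57/20), ENNReal.ofReal |Dc μ x| ≤ ENNReal.ofReal (59 / 1000 * τ) := by
  have := hs.pμ
  have := hs.pκ
  have hPu : IsProbabilityMeasure unif := ⟨by simp [unif]⟩
  refine hs.tail_env.trans ?_
  refine (lintegral_mono fun z => env_int _ _).trans ?_
  rw [lintegral_prod_symm _ (by fun_prop)]
  set B1 : ℝ := 304 / 10000 * (τ * (3 + τ ^ 2)) + 25 / 10000 * τ with hB1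
  set B2 : ℝ := 304 / 10000 * (τ ^ 2 * (4 / 7) * (3 + τ ^ 2) + τ ^ 2 * (7 / 4 + 3 * τ + τ ^ 2) + τ ^ 2 * (τ ^ 2 + τ ^ 3 / 2)) with hB2
  have hB1p : 0 ≤ B1 := by positivity
  have hB2p : 0 ≤ B2 := by positivity
  have h1 : ∀ᵐ q ∂(unif.prod κ), ∫⁻ x, ENNReal.ofReal (|x - (x + q.1 * q.2)| * (25 / 10000 + 304 / 10000 * ((x ^ 4 + (x + q.1 * q.2) ^ 4) / 2))) ∂μ
      ≤ ENNReal.ofReal (B1 * q.1 + B2 * q.1 ^ 2) := by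
    filter_upwards [hs.prod_supp] with q hq
    have hu := hq.1.1.le
    have hz : |q.1 * q.2| ≤ q.1 * τ := by rw [abs_mul, abs_of_nonneg hu]; exact mul_le_mul_of_nonneg_left hq.2 hu
    set u := q.1
    set α := 304 / 10000 * (u * τ + u ^ 2 * τ ^ 2 * (4 / 7))
    set β := 304 / 10000 * (u ^ 2 * τ ^ 2 * (7 / 4 + 3 * τ + τ ^ 2))
    set γ := (25 / 10000 * (u * τ) + 304 / 10000 * (u ^ 2 * τ ^ 2 * (τ ^ 2 + τ ^ 3 / 2)))
    have hα : 0 ≤ α := by positivity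
    have hβ : 0 ≤ β := by positivity
    have hγ : 0 ≤ γ := by positivity
    calc _ ≤ ∫⁻ x, (ENNReal.ofReal α * ENNReal.ofReal (x ^ 4) + ENNReal.ofReal β * ENNReal.ofReal (x ^ 2) + ENNReal.ofReal γ) ∂μ := by
          refine lintegral_mono fun x => ?_
          rw [← ENNReal.ofReal_mul hα, ← ENNReal.ofReal_mul hβ, ← ENNReal.ofReal_add (by positivity) (by positivity),
            ← ENNReal.ofReal_add (by positivity) hγ]
          apply ENNReal.ofReal_le_ofReal
          have : |x - (x + u * q.2)| = |u * q.2| := by rw [abs_sub_comm]; congr 1; ring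
          rw [this]
          exact poly_bd hu hq.1.2.le hτ0.le hz
      _ = ENNReal.ofReal α * (∫⁻ x, ENNReal.ofReal (x ^ 4) ∂μ) + ENNReal.ofReal β * (∫⁻ x, ENNReal.ofReal (x ^ 2) ∂μ) + ENNReal.ofReal γ := by
          rw [lintegral_add_right _ measurable_const, lintegral_add_right _ (by fun_prop), lintegral_const_mul' _ _ (by simp),
            lintegral_const_mul' _ _ (by simp)]
          simp
      _ ≤ ENNReal.ofReal α * ENNReal.ofReal (3 + τ ^ 2) + ENNReal.ofReal β * ENNReal.ofReal 1 + ENNReal.ofReal γ := by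
          gcongr
          · exact hs.m4
          · exact hs.sq_lint
      _ = ENNReal.ofReal (α * (3 + τ ^ 2) + β * 1 + γ) := by
          rw [← ENNReal.ofReal_mul hα, ← ENNReal.ofReal_mul hβ, ← ENNReal.ofReal_add (by positivity) (by positivity),
            ← ENNReal.ofReal_add (by positivity) hγ]
      _ = _ := by
          congr 1
          simp only [hB1, hB2, α, β, γ]; ring
  refine (lintegral_mono_ae h1).trans ?_
  rw [lintegral_prod _ (by fun_prop)]
  simp only [lintegral_const, measure_univ, mul_one]
  have hi2 : Integrable (fun u : ℝ => u ^ 2) unif := by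
    refine Integrable.of_bound (C := 1) (by fun_prop) ?_
    filter_upwards [unif_mem] with u hu
    have : u ^ 2 ≤ 1 := pow_le_one₀ hu.1.le hu.2.le
    rwa [Real.norm_of_nonneg (by positivity)]
  have j1 : Integrable (fun u : ℝ => B1 * u) unif := unif_int_id.const_mul _
  have j2 : Integrable (fun u : ℝ => B2 * u ^ 2) unif := hi2.const_mul _
  rw [← ofReal_integral_eq_lintegral_ofReal (f := fun u : ℝ => B1 * u + B2 * u ^ 2) (j1.add j2) (by
    filter_upwards [unif_mem] with u hu
    have := hu.1.le
    show 0 ≤ B1 * u + B2 * u ^ 2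
    positivity)]
  apply ENNReal.ofReal_le_ofReal
  rw [integral_add j1 j2, integral_const_mul, integral_const_mul, unif_mean, unif_sq, hB1, hB2]
  have t2 : τ ^ 2 ≤ (251/1000) ^ 2 := by gcongr
  have t3 : τ ^ 3 ≤ (251/1000) ^ 3 := by gcongr
  have t4 : τ ^ 4 ≤ (251/1000) ^ 4 := by gcongr
  norm_num at t2 t3 t4
  have : 304 / 10000 * ((3 + τ ^ 2) / 2 + (τ * (4 / 7) * 3 + (4/7) * τ ^ 3 + τ * (7/4) + 3 * τ ^ 2 + τ ^ 3 + τ ^ 3 + τ ^ 4 / 2) / 3) + 25 / 20000 ≤ 59 / 1000 := by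
    linarith
  nlinarith

end SJ

namespace SJ

lemma gm_int {c : ℝ} (hc : 0 < c) (n : ℕ) : IntegrableOn (fun w : ℝ => w ^ n * Real.exp (-(c * w ^ 2))) (Set.Ioi 0) := by
  have := (integrable_rpow_mul_exp_neg_mul_sq hc (s := (n:ℝ)) (by have : (0:ℝ) ≤ n := Nat.cast_nonneg n; linarith)).integrableOn (s := Set.Ioi (0:ℝ))
  refine this.congr_fun (fun w hw => ?_) measurableSet_Ioi
  simp only [Real.rpow_natCast, neg_mul]

lemma gm_rec {c : ℝ} (hc : 0 < c) (n : ℕ) : 2 * c * ∫ w in Set.Ioi (0:ℝ), w ^ (n + 2) * Real.exp (-(c * w ^ 2)) =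
    ((n:ℝ) + 1) * ∫ w in Set.Ioi (0:ℝ), w ^ n * Real.exp (-(c * w ^ 2)) := by
  have hd : ∀ w : ℝ, HasDerivAt (fun w : ℝ => w ^ (n + 1) * Real.exp (-(c * w ^ 2)))
      (((n:ℝ) + 1) * (w ^ n * Real.exp (-(c * w ^ 2))) - 2 * c * (w ^ (n + 2) * Real.exp (-(c * w ^ 2)))) w := by
    intro w
    have h1 : HasDerivAt (fun w : ℝ => -(c * w ^ 2)) (-(c * (2 * w))) w := by
      refine (((hasDerivAt_pow 2 w).const_mul c).neg).congr_deriv ?_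
      push_cast; ring
    refine ((hasDerivAt_pow (n + 1) w).mul h1.exp).congr_deriv ?_
    simp only [add_tsub_cancel_right]
    push_cast
    ring
  have i1 := (gm_int hc n).const_mul ((n:ℝ) + 1)
  have i2 := (gm_int hc (n + 2)).const_mul (2 * c)
  have ii : IntegrableOn (fun w : ℝ => ((n:ℝ) + 1) * (w ^ n * Real.exp (-(c * w ^ 2))) - 2 * c * (w ^ (n + 2) * Real.exp (-(c * w ^ 2)))) (Set.Ioi 0) := i1.sub i2
  have ht := tendsto_zero_of_hasDerivAt_of_integrableOn_Ioi (fun w _ => hd w) ii (gm_int hc (n + 1))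
  have h := integral_Ioi_of_hasDerivAt_of_tendsto (hd 0).continuousAt.continuousWithinAt (fun w _ => hd w) ii ht
  rw [integral_sub i1 i2, integral_const_mul, integral_const_mul] at h
  simp at h
  linarith

lemma gm0 {c : ℝ} : ∫ w in Set.Ioi (0:ℝ), w ^ 0 * Real.exp (-(c * w ^ 2)) = √(Real.pi / c) / 2 := by
  rw [← integral_gaussian_Ioi]
  simp

lemma gm_lint {c K : ℝ} (hc : 0 < c) (hK : 0 ≤ K) (n : ℕ) : ∫⁻ w in Set.Ioi (0:ℝ), ENNReal.ofReal (K * (w ^ n * Real.exp (-(c * w ^ 2)))) =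
    ENNReal.ofReal (K * ∫ w in Set.Ioi (0:ℝ), w ^ n * Real.exp (-(c * w ^ 2))) := by
  rw [← integral_const_mul, ofReal_integral_eq_lintegral_ofReal ((gm_int hc n).const_mul K)]
  refine (ae_restrict_iff' measurableSet_Ioi).2 (Filter.Eventually.of_forall fun w hw => ?_)
  have : (0:ℝ) < w := hw
  show 0 ≤ K * _
  positivity

lemma gm2 {c : ℝ} (hc : 0 < c) : ∫ w in Set.Ioi (0:ℝ), w ^ 2 * Real.exp (-(c * w ^ 2)) = √(Real.pi / c) / 2 / (2 * c) := by
  have := gm_rec hc 0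
  rw [gm0] at this
  rw [eq_div_iff (by positivity)]
  push_cast at this; linarith

lemma gm4 {c : ℝ} (hc : 0 < c) : ∫ w in Set.Ioi (0:ℝ), w ^ 4 * Real.exp (-(c * w ^ 2)) = 3 * (√(Real.pi / c) / 2) / (2 * c) ^ 2 := by
  have := gm_rec hc 2
  rw [gm2 hc] at this
  simp only [Nat.reduceAdd] at this
  have h5 : √(Real.pi / c) / 2 / (2 * c) * (2 * c) = √(Real.pi / c) / 2 := div_mul_cancel₀ _ (by positivity)
  rw [eq_div_iff (by positivity)]
  push_cast at this
  linear_combination (2 * c) * this + 3 * h5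

lemma gm6 {c : ℝ} (hc : 0 < c) : ∫ w in Set.Ioi (0:ℝ), w ^ 6 * Real.exp (-(c * w ^ 2)) = 15 * (√(Real.pi / c) / 2) / (2 * c) ^ 3 := by
  have := gm_rec hc 4
  rw [gm4 hc] at this
  simp only [Nat.reduceAdd] at this
  have h5 : 3 * (√(Real.pi / c) / 2) / (2 * c) ^ 2 * (2 * c) ^ 2 = 3 * (√(Real.pi / c) / 2) := div_mul_cancel₀ _ (by positivity)
  rw [eq_div_iff (by positivity)]
  push_cast at this
  linear_combination (2 * c) ^ 2 * this + 5 * h5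

lemma cross_small {τ : ℝ} (h0 : 0 < τ) : ∫⁻ w in Set.Ioc 0 (1 / τ), ENNReal.ofReal (crf τ w) ≤ ENNReal.ofReal (206 / 10000 * τ ^ 2) := by
  have h1 : ∫⁻ w in Set.Ioc 0 (1 / τ), ENNReal.ofReal (crf τ w) ≤
      ∫⁻ w in Set.Ioc 0 (1 / τ), ENNReal.ofReal (τ ^ 2 / 36 * (w ^ 4 * Real.exp (-(23 / 24 * w ^ 2)))) := by
    refine setLIntegral_mono' measurableSet_Ioc fun w hw => ENNReal.ofReal_le_ofReal ?_
    have hw0 := hw.1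
    have hθ : w * τ ≤ 1 := by have := mul_le_mul_of_nonneg_right hw.2 h0.le; rwa [div_mul_cancel₀ _ h0.ne'] at this
    have hr : 11 / 24 ≤ rho (w * τ) := by
      refine le_trans ?_ (rho_anti (by positivity) hθ)
      unfold rho Tp
      have : (23/24:ℝ) ≤ max 0 (1 - (1:ℝ) ^ 2 / 4 / 6 + ((1:ℝ) ^ 2 / 4) ^ 2 / 120 - ((1:ℝ) ^ 2 / 4) ^ 3 / 5040) :=
        le_trans (by norm_num) (le_max_right _ _)
      have := pow_le_pow_left₀ (by norm_num) this 2
      linarith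
    unfold crf
    rw [← Real.exp_add]
    have e1 : Real.exp (-(w ^ 2 * rho (w * τ)) + -w ^ 2 / 2) ≤ Real.exp (-(23 / 24 * w ^ 2)) := by
      apply Real.exp_le_exp.2
      have := mul_le_mul_of_nonneg_left hr (sq_nonneg w)
      linarith
    have e2 : (w * min (w * τ / 6) (1 / 3)) ^ 2 ≤ (w * (w * τ / 6)) ^ 2 := by
      have : 0 ≤ min (w * τ / 6) (1 / 3) := le_min (by positivity) (by norm_num)
      gcongr
      exact min_le_left _ _
    calc _ ≤ Real.exp (-(23 / 24 * w ^ 2)) * (w * (w * τ / 6)) ^ 2 := by gcongr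
      _ = _ := by ring
  refine h1.trans ((lintegral_mono_set Set.Ioc_subset_Ioi_self).trans ?_)
  rw [gm_lint (by norm_num) (by positivity), gm4 (by norm_num)]
  apply ENNReal.ofReal_le_ofReal
  have h2 : √(Real.pi / (23 / 24)) ≤ 1811 / 1000 := by
    rw [Real.sqrt_le_left (by norm_num)]
    have := Real.pi_lt_d4
    norm_num at this ⊢; linarith
  calc _ ≤ τ ^ 2 / 36 * (3 * (1811 / 1000 / 2) / (2 * (23 / 24)) ^ 2) := by gcongr
    _ = (1 / 36 * (3 * (1811 / 1000 / 2) / (2 * (23 / 24)) ^ 2)) * τ ^ 2 := by ring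
    _ ≤ _ := mul_le_mul_of_nonneg_right (by norm_num) (sq_nonneg τ)

lemma low_small {τ : ℝ} (h0 : 0 < τ) : ∫⁻ w in Set.Ioc 0 (Real.pi / τ), ENNReal.ofReal (lowf τ w) ≤ ENNReal.ofReal (715 / 10000 * τ ^ 4) := by
  have h1 : ∫⁻ w in Set.Ioc 0 (Real.pi / τ), ENNReal.ofReal (lowf τ w) ≤
      ∫⁻ w in Set.Ioc 0 (Real.pi / τ), ENNReal.ofReal (τ ^ 4 / 576 * (w ^ 6 * Real.exp (-(2 / 5 * w ^ 2)))) := by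
    refine setLIntegral_mono' measurableSet_Ioc fun w hw => ENNReal.ofReal_le_ofReal ?_
    have hw0 := hw.1
    have hθ : w * τ ≤ Real.pi := by have := mul_le_mul_of_nonneg_right hw.2 h0.le; rwa [div_mul_cancel₀ _ h0.ne'] at this
    have hpi := Real.pi_lt_d2
    have hr : 1 / 5 ≤ rho (w * τ) := by
      refine le_trans ?_ (rho_anti (b := 3.15) (by positivity) (by linarith))
      unfold rho Tp
      have : (634/1000:ℝ) ≤ max 0 (1 - (3.15:ℝ) ^ 2 / 4 / 6 + ((3.15:ℝ) ^ 2 / 4) ^ 2 / 120 - ((3.15:ℝ) ^ 2 / 4) ^ 3 / 5040) :=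
        le_trans (by norm_num) (le_max_right _ _)
      have := pow_le_pow_left₀ (by norm_num) this 2
      linarith
    have hr2 : 1 / 2 - rho (w * τ) ≤ (w * τ) ^ 2 / 24 := by
      have hb : (w * τ) ^ 2 ≤ 10 := by
        have : (w * τ) ^ 2 ≤ 3.15 ^ 2 := by gcongr; linarith
        norm_num at this; linarith
      unfold rho Tp
      set u := (w * τ) ^ 2 / 4 with hu
      have hu0 : 0 ≤ u := by positivity
      have hu1 : u ≤ 5 / 2 := by linarith
      have : 1 - u / 6 ≤ max 0 (1 - u / 6 + u ^ 2 / 120 - u ^ 3 / 5040) := by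
        refine le_trans ?_ (le_max_right _ _)
        nlinarith [mul_nonneg (sq_nonneg u) (sub_nonneg.2 hu1), sq_nonneg u]
      have := pow_le_pow_left₀ (by linarith) this 2
      have e : (w * τ) ^ 2 / 24 = u / 6 := by rw [hu]; ring
      rw [e]
      nlinarith [sq_nonneg u]
    unfold lowf
    have hh := rho_le_half (w * τ)
    rw [mul_pow, ← Real.exp_nat_mul]
    have e1 : Real.exp (((2:ℕ):ℝ) * (-(w ^ 2 * rho (w * τ)))) ≤ Real.exp (-(2 / 5 * w ^ 2)) := by
      apply Real.exp_le_exp.2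
      have := mul_le_mul_of_nonneg_left hr (sq_nonneg w)
      push_cast; linarith
    have e2 : (min (w * (1 / 2 - rho (w * τ))) (1 / w)) ^ 2 ≤ (w * ((w * τ) ^ 2 / 24)) ^ 2 := by
      have : 0 ≤ min (w * (1 / 2 - rho (w * τ))) (1 / w) := le_min (mul_nonneg hw0.le (by linarith)) (by positivity)
      gcongr
      exact (min_le_left _ _).trans (by gcongr)
    calc _ ≤ Real.exp (-(2 / 5 * w ^ 2)) * (w * ((w * τ) ^ 2 / 24)) ^ 2 := by gcongr
      _ = _ := by ring
  refine h1.trans ((lintegral_mono_set Set.Ioc_subset_Ioi_self).trans ?_)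
  rw [gm_lint (by norm_num) (by positivity), gm6 (by norm_num)]
  apply ENNReal.ofReal_le_ofReal
  have h2 : √(Real.pi / (2 / 5)) ≤ 28028 / 10000 := by
    rw [Real.sqrt_le_left (by norm_num)]
    have := Real.pi_lt_d4
    norm_num at this ⊢; linarith
  have h4 : 0 ≤ τ ^ 4 := by positivity
  calc _ ≤ τ ^ 4 / 576 * (15 * (28028 / 10000 / 2) / (2 * (2 / 5)) ^ 3) := by gcongr
    _ = (1 / 576 * (15 * (28028 / 10000 / 2) / (2 * (2 / 5)) ^ 3)) * τ ^ 4 := by ring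
    _ ≤ _ := mul_le_mul_of_nonneg_right (by norm_num) h4

lemma exp_poly {c τ : ℝ} (hc : 0 < c) (h0 : 0 < τ) : Real.exp (-(c / τ ^ 2)) ≤ 720 / c ^ 6 * τ ^ 12 := by
  have h := Real.pow_div_factorial_le_exp (c / τ ^ 2) (by positivity) 6
  rw [Real.exp_neg]
  have h2 := inv_anti₀ (by positivity) h
  refine h2.trans (le_of_eq ?_)
  simp [Nat.factorial]
  field_simp

lemma cos_11 {x : ℝ} (h0 : 0 ≤ x) (h1 : x ≤ 1) : 11 / 24 * x ^ 2 ≤ 1 - Real.cos x := by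
  have h := cos_ub4 h0
  nlinarith [mul_nonneg (sq_nonneg x) (sub_nonneg.2 h1), mul_nonneg (mul_nonneg (sq_nonneg x) h0) (sub_nonneg.2 h1)]

lemma hv_small {τ : ℝ} (h0 : 0 < τ) (hτ : τ ≤ 251 / 1000) : hv τ ≤ ENNReal.ofReal (776 / 10000 * τ ^ 2) := by
  unfold hv
  have hpi := Real.pi_gt_d2
  have hpi2 := Real.pi_lt_d2
  set c : ℝ := 11 / 12 / τ ^ 2 with hcdef
  have hc : 0 < c := by positivity
  have p1 : ∫⁻ x in Set.Ioc 0 1, ENNReal.ofReal (Real.exp (-(2 / τ ^ 2 * (1 - Real.cos x))) * wt x) ≤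
      ENNReal.ofReal (774 / 10000 * τ) := by
    have q1 : ∫⁻ x in Set.Ioc (0:ℝ) 1, ENNReal.ofReal (Real.exp (-(2 / τ ^ 2 * (1 - Real.cos x))) * wt x) ≤
       ∫⁻ x in Set.Ioc (0:ℝ) 1, (ENNReal.ofReal (1 / 12 * (x ^ 0 * Real.exp (-(c * x ^ 2)))) + ENNReal.ofReal (11 / 1620 * (x ^ 2 * Real.exp (-(c * x ^ 2))))) := by
      refine setLIntegral_mono' measurableSet_Ioc fun x hx => ?_
      rw [← ENNReal.ofReal_add (by positivity) (by positivity)]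
      apply ENNReal.ofReal_le_ofReal
      have e1 : Real.exp (-(2 / τ ^ 2 * (1 - Real.cos x))) ≤ Real.exp (-(c * x ^ 2)) := by
        apply Real.exp_le_exp.2
        have := mul_le_mul_of_nonneg_left (cos_11 hx.1.le hx.2) (show 0 ≤ 2 / τ ^ 2 by positivity)
        have e : 2 / τ ^ 2 * (11 / 24 * x ^ 2) = c * x ^ 2 := by rw [hcdef]; ring
        linarith
      calc _ ≤ Real.exp (-(c * x ^ 2)) * wt x := mul_le_mul_of_nonneg_right e1 (wt_nonneg x)
        _ = _ := by unfold wt; ring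
    refine q1.trans ((lintegral_mono_set Set.Ioc_subset_Ioi_self).trans ?_)
    rw [lintegral_add_right _ (by fun_prop), gm_lint hc (by norm_num), gm_lint hc (by norm_num), gm0, gm2 hc,
      ← ENNReal.ofReal_add (by positivity) (by positivity)]
    apply ENNReal.ofReal_le_ofReal
    have h2 : √(Real.pi / c) ≤ 1852 / 1000 * τ := by
      rw [Real.sqrt_le_left (by positivity)]
      have e : Real.pi / c = Real.pi * (12 / 11) * τ ^ 2 := by rw [hcdef]; field_simp
      rw [e, mul_pow]
      refine mul_le_mul_of_nonneg_right ?_ (sq_nonneg τ)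
      have := Real.pi_lt_d4
      norm_num at this ⊢; linarith
    have e3 : √(Real.pi / c) / 2 / (2 * c) = √(Real.pi / c) * (3 / 11 * τ ^ 2) := by
      rw [hcdef]; field_simp; norm_num
    rw [e3]
    have t2 : τ ^ 2 ≤ (251/1000) ^ 2 := by gcongr
    have h3 : √(Real.pi / c) * (3 / 11 * τ ^ 2) ≤ 1852 / 1000 * τ * (3 / 11 * (251/1000)^2) := by gcongr
    norm_num at h3
    linarith
  have p2 : ∫⁻ x in Set.Ioc 1 Real.pi, ENNReal.ofReal (Real.exp (-(2 / τ ^ 2 * (1 - Real.cos x))) * wt x) ≤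
      ENNReal.ofReal (2 / 10000 * τ) := by
    have q1 : ∫⁻ x in Set.Ioc 1 Real.pi, ENNReal.ofReal (Real.exp (-(2 / τ ^ 2 * (1 - Real.cos x))) * wt x) ≤
       ∫⁻ x in Set.Ioc 1 Real.pi, ENNReal.ofReal (Real.exp (-c) * (16 / 100)) := by
      refine setLIntegral_mono' measurableSet_Ioc fun x hx => ?_
      apply ENNReal.ofReal_le_ofReal
      have hcos : 11 / 24 ≤ 1 - Real.cos x := by
        have h1 := Real.cos_le_cos_of_nonneg_of_le_pi (by norm_num) hx.2 hx.1.le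
        have h2 := cos_11 (x := 1) (by norm_num) le_rfl
        linarith
      have e1 : Real.exp (-(2 / τ ^ 2 * (1 - Real.cos x))) ≤ Real.exp (-c) := by
        apply Real.exp_le_exp.2
        have := mul_le_mul_of_nonneg_left hcos (show 0 ≤ 2 / τ ^ 2 by positivity)
        have e : 2 / τ ^ 2 * (11 / 24) = c := by rw [hcdef]; ring
        linarith
      have e2 : wt x ≤ 16 / 100 := by
        unfold wt
        have : x ^ 2 ≤ 3.15 ^ 2 := by
          have := hx.1; have := hx.2
          gcongr; linarith
        norm_num at this ⊢; linarith
      exact mul_le_mul e1 e2 (wt_nonneg x) (Real.exp_nonneg _)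
    refine q1.trans ?_
    rw [setLIntegral_const, Real.volume_Ioc, ← ENNReal.ofReal_mul (by positivity)]
    apply ENNReal.ofReal_le_ofReal
    have h1 := exp_poly (c := 11 / 12) (by norm_num) h0
    have t11 : τ ^ 11 ≤ (251/1000) ^ 11 := by gcongr
    have h2 : τ ^ 12 ≤ (251/1000) ^ 11 * τ := by
      calc τ ^ 12 = τ ^ 11 * τ := by ring
        _ ≤ _ := by gcongr
    have h3 : Real.exp (-c) ≤ 720 / (11/12) ^ 6 * ((251/1000) ^ 11 * τ) := h1.trans (by gcongr)
    calc Real.exp (-c) * (16 / 100) * (Real.pi - 1) ≤ 720 / (11/12) ^ 6 * ((251/1000) ^ 11 * τ) * (16 / 100) * (215 / 100) := by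
          gcongr <;> linarith
      _ ≤ _ := by norm_num; linarith
  rw [← Set.Ioc_union_Ioc_eq_Ioc (show (0:ℝ) ≤ 1 by norm_num) (show (1:ℝ) ≤ Real.pi by linarith)]
  calc _ ≤ ENNReal.ofReal τ * (ENNReal.ofReal (774 / 10000 * τ) + ENNReal.ofReal (2 / 10000 * τ)) := by
        gcongr
        exact (lintegral_union_le _ _ _).trans (add_le_add p1 p2)
    _ = _ := by
        rw [← ENNReal.ofReal_add (by positivity) (by positivity), ← ENNReal.ofReal_mul h0.le]
        congr 1; ring

lemma tail_small {τ : ℝ} (h0 : 0 < τ) (hτ : τ ≤ 251 / 1000) :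
    ∫⁻ w in Set.Ioi (1 / τ), ENNReal.ofReal (4 * Real.exp (-w ^ 2 / 2) / w ^ 2) ≤ ENNReal.ofReal (12 / 10000 * τ ^ 2) := by
  have e : ∀ w : ℝ, ENNReal.ofReal (4 * Real.exp (-w ^ 2 / 2) / w ^ 2) = ENNReal.ofReal 4 * ENNReal.ofReal (Real.exp (-(1 / 2 * w ^ 2)) / w ^ 2) := by
    intro w
    rw [← ENNReal.ofReal_mul (by norm_num)]
    congr 1
    rw [mul_div_assoc]; congr 4; ring
  simp_rw [e]
  rw [lintegral_const_mul' _ _ (by simp)]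
  refine (mul_le_mul_right (ex_bd (c := 1/2) (by norm_num) (show 0 < 1 / τ by positivity)) _).trans ?_
  rw [← ENNReal.ofReal_mul (by norm_num)]
  apply ENNReal.ofReal_le_ofReal
  have h1 : Real.exp (-(1 / 2 * (1 / τ) ^ 2)) ≤ 1 / 1000 := by
    have a : 7 ≤ 1 / 2 * (1 / τ) ^ 2 := by
      have : 1000 / 251 ≤ 1 / τ := by
        rw [le_div_iff₀ h0]; linarith
      have : (1000 / 251) ^ 2 ≤ (1 / τ) ^ 2 := by gcongr
      norm_num at this ⊢; linarith
    have b : Real.exp (-(1 / 2 * (1 / τ) ^ 2)) ≤ Real.exp (-7) := Real.exp_le_exp.2 (by linarith)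
    refine b.trans ?_
    rw [Real.exp_neg, inv_le_comm₀ (Real.exp_pos _) (by norm_num)]
    have h := Real.exp_one_gt_d9
    have e : Real.exp 7 = Real.exp 1 ^ 7 := by rw [← Real.exp_nat_mul]; norm_num
    rw [e]
    have : (2.718:ℝ) ^ 7 ≤ Real.exp 1 ^ 7 := by gcongr; linarith
    norm_num at this ⊢; linarith
  have e2 : Real.exp (-(1 / 2 * (1 / τ) ^ 2)) / (1 / τ * (1 + 2 * (1 / 2) * (1 / τ) ^ 2)) = Real.exp (-(1 / 2 * (1 / τ) ^ 2)) * (τ ^ 3 / (τ ^ 2 + 1)) := by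
    field_simp
  rw [e2]
  have h3 : τ ^ 3 / (τ ^ 2 + 1) ≤ 251 / 1000 * τ ^ 2 := by
    rw [div_le_iff₀ (by positivity)]
    nlinarith [sq_nonneg τ, mul_nonneg (sq_nonneg τ) (sq_nonneg τ), mul_nonneg (sq_nonneg τ) (sub_nonneg.2 hτ)]
  calc _ ≤ 4 * (1 / 1000 * (251 / 1000 * τ ^ 2)) := by gcongr
    _ ≤ _ := by nlinarith [sq_nonneg τ]

lemma H_tiny (hs : IsSJ κ μ 1 τ) (h0 : 0 < τ) (hτ : τ ≤ 251 / 1000) :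
    ∀ᵐ y ∂κ, HH (Real.pi / τ) y ≤ ENNReal.ofReal (778 / 10000 * τ ^ 2) := by
  filter_upwards [H_big hs h0] with y hy
  refine hy.trans (max_le ?_ ?_)
  · calc _ ≤ ENNReal.ofReal (776 / 10000 * τ ^ 2) + ENNReal.ofReal (2 / 10000 * τ ^ 2) := by
          refine add_le_add (hv_small h0 hτ) (ENNReal.ofReal_le_ofReal ?_)
          · have h1 := exp_poly (c := 39 / 10) (by norm_num) h0
            have t11 : τ ^ 11 ≤ (251/1000) ^ 11 := by gcongr
            calc 393 / 10000 * τ * Real.exp (-(39 / 10 / τ ^ 2)) ≤ 393 / 10000 * τ * (720 / (39/10) ^ 6 * τ ^ 12) := by gcongr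
              _ = 393 / 10000 * (720 / (39/10) ^ 6) * τ ^ 11 * τ ^ 2 := by ring
              _ ≤ 393 / 10000 * (720 / (39/10) ^ 6) * (251/1000) ^ 11 * τ ^ 2 := by gcongr
              _ ≤ _ := mul_le_mul_of_nonneg_right (by norm_num) (sq_nonneg τ)
    _ = _ := by
        rw [← ENNReal.ofReal_add (by positivity) (by positivity)]; congr 1; ring
  · calc _ ≤ 1 * ENNReal.ofReal (776 / 10000 * τ ^ 2) + ENNReal.ofReal (2 / 10000 * τ ^ 2) := by
          refine add_le_add (mul_le_mul' (ENNReal.ofReal_le_one.2 (by norm_num)) (hv_small h0 hτ)) (ENNReal.ofReal_le_ofReal ?_)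
          · have h1 := exp_poly (c := 4) (by norm_num) h0
            have t12 : τ ^ 12 ≤ (251/1000) ^ 12 := by gcongr
            have h2 : τ ^ 3 * (3184 / 10000) / (τ ^ 2 + 8) ≤ τ ^ 2 := by
              rw [div_le_iff₀ (by positivity)]
              nlinarith [sq_nonneg τ, mul_nonneg (sq_nonneg τ) (sq_nonneg τ), mul_nonneg (sq_nonneg τ) (sub_nonneg.2 hτ)]
            calc Real.exp (-(4 / τ ^ 2)) * (τ ^ 3 * (3184 / 10000) / (τ ^ 2 + 8)) ≤ (720 / 4 ^ 6 * (251/1000) ^ 12) * τ ^ 2 := by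
                  refine mul_le_mul (h1.trans (by gcongr)) h2 (by positivity) (by positivity)
              _ ≤ _ := mul_le_mul_of_nonneg_right (by norm_num) (sq_nonneg τ)
    _ = _ := by
        rw [one_mul, ← ENNReal.ofReal_add (by positivity) (by positivity)]; congr 1; ring

lemma small_range (κ μ : Measure ℝ) (τ : ℝ) (h0 : 0 < τ) (hs : IsSJ κ μ 1 τ) (hτ : τ ≤ 251 / 1000) :
    ∫ u, |qf μ u - qf gam u| ∂unif ≤ τ / 2 := by
  have := hs.pμ
  have hpi := Real.pi_gt_d4
  have hS : ∫⁻ w in Set.Ioi 0, ENNReal.ofReal (‖charFun μ w - charFun gam w‖ ^ 2 / w ^ 2) ≤ ENNReal.ofReal (107 / 1000 * τ ^ 2) := by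
    refine (hs.S0 (W := Real.pi / τ) (V := 1 / τ) (by positivity) (by positivity) (H_tiny hs h0 hτ)).trans ?_
    calc _ ≤ ENNReal.ofReal (715 / 10000 * τ ^ 4) + ENNReal.ofReal (778 / 10000 * τ ^ 2) + ENNReal.ofReal (206 / 10000 * τ ^ 2)
          + ENNReal.ofReal (12 / 10000 * τ ^ 2) := by
          gcongr
          · exact low_small h0
          · exact cross_small h0
          · exact tail_small h0 hτ
      _ = ENNReal.ofReal (715 / 10000 * τ ^ 4 + 778 / 10000 * τ ^ 2 + 206 / 10000 * τ ^ 2 + 12 / 10000 * τ ^ 2) := by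
          rw [← ENNReal.ofReal_add (by positivity) (by positivity), ← ENNReal.ofReal_add (by positivity) (by positivity),
            ← ENNReal.ofReal_add (by positivity) (by positivity)]
      _ ≤ _ := by
          apply ENNReal.ofReal_le_ofReal
          have t2 : τ ^ 2 ≤ (251/1000) ^ 2 := by gcongr
          have : τ ^ 4 ≤ (251/1000) ^ 2 * τ ^ 2 := by
            calc τ ^ 4 = τ ^ 2 * τ ^ 2 := by ring
              _ ≤ _ := by gcongr
          norm_num at this
          linarith [sq_nonneg τ]
  have hmain := w1_combine (μ := μ) hs.int_id (A := 57 / 20) (d := 441 / 1000 * τ) (T := 59 / 1000 * τ) (s := 107 / 1000 * τ ^ 2) (by norm_num) (by positivity)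
    (by positivity) (by positivity) (hs.S0_full hS) (by
      have h2 := sq_nonneg τ
      have : (441/1000) ^ 2 * τ ^ 2 * 3.1415 ≤ (441/1000) ^ 2 * τ ^ 2 * Real.pi := by gcongr
      norm_num at this
      nlinarith) (hs.small_tail h0 hτ)
  rw [integral_eq_lintegral_of_nonneg_ae (f := fun u => |qf μ u - qf gam u|) (Filter.Eventually.of_forall fun u => abs_nonneg _)
    (((qf_aemeasurable μ).sub (qf_aemeasurable gam)).abs.aestronglyMeasurable)]
  refine ENNReal.toReal_le_of_le_ofReal (by positivity) (hmain.trans (ENNReal.ofReal_le_ofReal ?_))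
  linarith

lemma hhalf_all (κ μ : Measure ℝ) (τ : ℝ) (h0 : 0 < τ) (hs : IsSJ κ μ 1 τ) :
    ∫ u, |qf μ u - qf gam u| ∂unif ≤ τ / 2 := by
  rcases le_or_gt τ (251 / 1000) with h | h
  · exact small_range κ μ τ h0 hs h
  rcases le_or_gt τ 4 with h4 | h4
  · exact mid_range κ μ τ hs h h4
  have := triv_bound hs (p := 1) le_rfl (by norm_num)
  simp only [Real.rpow_one] at this
  linarith

end SJ

/-- Gaussian approximation of the marginal at time `t` of the small-jump
Lévy process with triplet `(0,0,ν)`, `ν` supported in `[-ε,ε]`, in `p`-Wasserstein distance. -/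
theorem statement4 (p : ℝ) (hp1 : 1 ≤ p) (hp2 : p ≤ 2) :
    ∃ C > (0 : ℝ), ∀ (ν : Measure ℝ) (ε t : ℝ), 0 < ε → ε ≤ 1 → 0 < t →
      ν {0} = 0 → ν {x : ℝ | ε < |x|} = 0 →
      (∫⁻ x, ENNReal.ofReal (x ^ 2) ∂ν ≠ ⊤) →
      ∀ s2 : ℝ, s2 = ∫ x, x ^ 2 ∂ν → 0 < s2 →
      ∀ μt : Measure ℝ, IsProbabilityMeasure μt →
      (∀ u : ℝ, charFn μt u = Complex.exp ((t : ℂ) * ∫ x, lkIntegrandC u x ∂ν)) →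
      ((wasserstein p μt (gaussianReal 0 (Real.toNNReal (t * s2)))
          ≤ ENNReal.ofReal (C * min (Real.sqrt t * Real.sqrt s2)
              (((∫ x, |x| ^ (p + 2) ∂ν) / s2) ^ (1 / p)))
        ∧ wasserstein p μt (gaussianReal 0 (Real.toNNReal (t * s2)))
            ≤ ENNReal.ofReal (C * min (Real.sqrt t * Real.sqrt s2) ε))
      ∧ (p = 1 → wasserstein 1 μt (gaussianReal 0 (Real.toNNReal (t * s2)))
            ≤ ENNReal.ofReal (min (2 * Real.sqrt t * Real.sqrt s2) (ε / 2)))) := by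
  exact SJ.assemble SJ.hhalf_all p hp1 hp2
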